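/- Let q be a prime power, let K be a finite separable extension of the rational function field F_q(t), and let O_K be the integral closure of F_q[t] in K. Let S be a finite set of places of K containing all infinite places (the places extending the degree place of F_q(t)), and let A = O_{K,S} = {x ∈ K : v_p(x) ≥ 0 for all places p of K not in S}. Assume the unit group A^× is infinite (equivalently, S contains at least two places). Then SL₂(A)^ab ≅ ⊕_{p ∈ S₂''\S} (ℤ/2 ⊕ ℤ/2) if q = 2, SL₂(A)^ab ≅ ⊕_{p ∈ S₃''\S} ℤ/3 if q = 3, and SL₂(A)^ab = 0 if q ≥ 4, where S₂'' = {nonzero primes p of O_K : p divides (t−a)O_K for some a ∈ F₂ and [O_K/p : F₂] = 1} and S₃'' = {nonzero primes p of O_K : p divides (t−a)O_K for some a ∈ F₃ and [O_K/p : F₃] = 1}. -/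

import Mathlib

set_option linter.unusedSectionVars false

/-- A `k`-algebra with one "place at infinity": `ν` is the pole order and `lc` the leading
coefficient at that place, with values in the residue field `κ`. -/
structure OnePlace (k B κ : Type*) [Field k] [CommRing B] [Algebra k B] [Field κ]
    [Algebra k κ] where
  ν : B → ℕ
  lc : B → κ
  n₀ : ℕ
  ν_zero : ν 0 = 0
  lc_eq_zero : ∀ x, lc x = 0 ↔ x = 0
  lc_mul : ∀ x y, lc (x * y) = lc x * lc y
  ν_mul : ∀ x y, x ≠ 0 → y ≠ 0 → ν (x * y) = ν x + ν y
  ν_algebraMap : ∀ c : k, ν (algebraMap k B c) = 0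
  lc_algebraMap : ∀ c : k, lc (algebraMap k B c) = algebraMap k κ c
  exists_algebraMap : ∀ x, ν x = 0 → ∃ c : k, algebraMap k B c = x
  ν_add : ∀ x y, ν (x + y) ≤ max (ν x) (ν y)
  lc_add : ∀ x y, ν x = ν y → lc x + lc y ≠ 0 → ν (x + y) = ν x ∧ lc (x + y) = lc x + lc y
  ν_sub_lt : ∀ x y, ν x = ν y → lc x = lc y → x ≠ y → ν (x - y) < ν x
  surj : ∀ n, n₀ ≤ n → ∀ c : κ, c ≠ 0 → ∃ x, ν x = n ∧ lc x = c

namespace OnePlace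

variable {k B κ : Type*} [Field k] [CommRing B] [Algebra k B] [Field κ] [Algebra k κ]
  (V : OnePlace k B κ)

include V in
theorem isDomain' : IsDomain B := by
  have : Nontrivial B := ⟨0, 1, fun h => by
    have h1 : V.lc 1 = 1 := by simpa using V.lc_algebraMap 1
    rw [← h, (V.lc_eq_zero 0).2 rfl] at h1
    exact zero_ne_one h1⟩
  have : NoZeroDivisors B := ⟨fun {x y} h => by
    rw [← V.lc_eq_zero, V.lc_mul, mul_eq_zero, V.lc_eq_zero, V.lc_eq_zero] at h
    exact h⟩
  exact NoZeroDivisors.to_isDomain B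

theorem lc_zero : V.lc 0 = 0 := (V.lc_eq_zero 0).2 rfl
theorem lc_one : V.lc 1 = 1 := by simpa using V.lc_algebraMap 1
theorem ν_one : V.ν 1 = 0 := by simpa using V.ν_algebraMap 1
theorem lc_ne_zero {x : B} (h : x ≠ 0) : V.lc x ≠ 0 := fun e => h ((V.lc_eq_zero x).1 e)

theorem lc_smul (c : k) (x : B) : V.lc (c • x) = c • V.lc x := by
  rw [Algebra.smul_def, V.lc_mul, V.lc_algebraMap, Algebra.smul_def]

theorem ν_smul_le (c : k) (x : B) : V.ν (c • x) ≤ V.ν x := by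
  have := V.isDomain'
  rcases eq_or_ne c 0 with rfl | hc
  · simp [V.ν_zero]
  rcases eq_or_ne x 0 with rfl | hx
  · simp
  rw [Algebra.smul_def, V.ν_mul _ _ _ hx, V.ν_algebraMap, zero_add]
  simpa using hc

theorem ν_neg (x : B) : V.ν (-x) = V.ν x := by
  have h1 : ∀ y : B, V.ν (-y) ≤ V.ν y := fun y => by simpa using V.ν_smul_le (-1) y
  exact le_antisymm (h1 x) (by simpa using h1 (-x))

theorem lc_neg (x : B) : V.lc (-x) = - V.lc x := by simpa using V.lc_smul (-1) x

theorem ν_sub (x y : B) : V.ν (x - y) ≤ max (V.ν x) (V.ν y) := by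
  rw [sub_eq_add_neg]; simpa [V.ν_neg] using V.ν_add x (-y)

/-- If the pole order drops, the leading terms agree. -/
theorem of_ν_sub_lt {x y : B} (h : V.ν (x - y) < V.ν x) : V.ν x = V.ν y ∧ V.lc x = V.lc y := by
  have h1 : V.ν x = V.ν y := by
    apply le_antisymm
    · by_contra! h2
      have := V.ν_add (x - y) y
      rw [sub_add_cancel] at this
      have := max_lt h h2; omega
    · have := V.ν_sub x (x - y)
      rw [sub_sub_cancel] at this
      exact this.trans (max_le le_rfl h.le)
  refine ⟨h1, ?_⟩
  by_contra h2
  have := (V.lc_add x (-y) (by rw [V.ν_neg, h1])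
    (by rw [V.lc_neg, ← sub_eq_add_neg]; exact sub_ne_zero.2 h2)).1
  rw [← sub_eq_add_neg] at this
  omega

theorem ν_add_eq {x y : B} (h : V.ν y < V.ν x) : V.ν (x + y) = V.ν x ∧ V.lc (x + y) = V.lc x := by
  have := V.of_ν_sub_lt (x := x) (y := x + y) (by simpa [V.ν_neg] using h)
  exact ⟨this.1.symm, this.2.symm⟩

/-- The space of elements of pole order at most `n`. -/
def L (n : ℕ) : Submodule k B where
  carrier := {x | V.ν x ≤ n}
  zero_mem' := by simp [V.ν_zero]
  add_mem' {x y} hx hy := (V.ν_add x y).trans (max_le hx hy)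
  smul_mem' c x hx := (V.ν_smul_le c x).trans hx

@[simp] theorem mem_L {n : ℕ} {x : B} : x ∈ V.L n ↔ V.ν x ≤ n := Iff.rfl

theorem L_mono {m n : ℕ} (h : m ≤ n) : V.L m ≤ V.L n := fun _ hx => le_trans hx h

open Classical in
/-- The coefficient of order `n + 1`. -/
noncomputable def coef (n : ℕ) : V.L (n + 1) →ₗ[k] κ where
  toFun x := if V.ν (x : B) = n + 1 then V.lc x else 0
  map_add' := by
    rintro ⟨x, hx⟩ ⟨y, hy⟩
    simp only [mem_L] at hx hy
    simp only [AddMemClass.mk_add_mk]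
    by_cases h1 : V.ν x = n + 1 <;> by_cases h2 : V.ν y = n + 1
    · by_cases h3 : V.lc x + V.lc y = 0
      · simp only [h1, h2, if_true, h3]
        split_ifs with h4
        · exfalso
          have hxy : x ≠ -y := by
            rintro rfl
            simp [V.ν_zero] at h4
          have := V.ν_sub_lt x (-y) (by rw [V.ν_neg, h1, h2])
            (by rw [V.lc_neg]; exact eq_neg_of_add_eq_zero_left h3) hxy
          rw [sub_neg_eq_add] at this
          omega
        · rfl
      · have := V.lc_add x y (by omega) h3
        simp [h1, h2, this.1, this.2]
    · have := V.ν_add_eq (x := x) (y := y) (by omega)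
      simp [h1, h2, this.1, this.2]
    · have := V.ν_add_eq (x := y) (y := x) (by omega)
      rw [add_comm x y]
      simp [h1, h2, this.1, this.2]
    · have := V.ν_add x y
      rw [if_neg, if_neg h1, if_neg h2, add_zero]
      have := max_le (show V.ν x ≤ n by omega) (show V.ν y ≤ n by omega)
      omega
  map_smul' := by
    rintro c ⟨x, hx⟩
    rcases eq_or_ne c 0 with rfl | hc
    · simp [V.ν_zero]
    have : V.ν (c • x) = V.ν x := by
      apply le_antisymm (V.ν_smul_le c x)
      simpa [smul_smul, inv_mul_cancel₀ hc] using V.ν_smul_le c⁻¹ (c • x)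
    simp [this, V.lc_smul]

theorem coef_eq_zero {n : ℕ} (x : V.L (n + 1)) : V.coef n x = 0 ↔ V.ν (x : B) ≤ n := by
  have := V.mem_L.1 x.2
  have h2 : V.coef n x = if V.ν (x : B) = n + 1 then V.lc x else 0 := by
    simp [coef]
  rw [h2]
  split_ifs with h
  · rw [V.lc_eq_zero]
    constructor
    · intro h'; rw [h', V.ν_zero] at h; omega
    · intro; omega
  · simp; omega

theorem finite_L [Module.Finite k κ] (n : ℕ) : Module.Finite k (V.L n) := by
  induction n with
  | zero =>
    refine Module.Finite.of_surjective
      ((Algebra.linearMap k B).codRestrict (V.L 0) fun c => by simp [V.ν_algebraMap]) ?_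
    rintro ⟨x, hx⟩
    obtain ⟨c, hc⟩ := V.exists_algebraMap x (by simpa using hx)
    exact ⟨c, Subtype.ext hc⟩
  | succ n ih =>
    have hk : Module.Finite k (LinearMap.ker (V.coef n)) := by
      refine Module.Finite.of_injective ((V.L (n+1)).subtype.comp
        (LinearMap.ker (V.coef n)).subtype |>.codRestrict (V.L n) ?_) ?_
      · intro x
        exact (V.coef_eq_zero x.1).1 x.2
      · intro x y h
        have := congrArg Subtype.val h
        exact Subtype.ext (Subtype.ext this)
    have hq : Module.Finite k (V.L (n + 1) ⧸ LinearMap.ker (V.coef n)) :=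
      Module.Finite.equiv (LinearMap.quotKerEquivRange (V.coef n)).symm
    exact Module.Finite.of_submodule_quotient (LinearMap.ker (V.coef n))

/-- The dimension of `L n`. -/
noncomputable def r (n : ℕ) : ℕ := Module.finrank k (V.L n)

theorem coef_surj {n : ℕ} (h : V.n₀ ≤ n + 1) : Function.Surjective (V.coef n) := by
  intro c
  rcases eq_or_ne c 0 with rfl | hc
  · exact ⟨0, map_zero _⟩
  obtain ⟨x, hx, hxc⟩ := V.surj (n + 1) h c hc
  refine ⟨⟨x, hx.le⟩, ?_⟩
  simp [coef, hx, hxc]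

theorem r_succ [Module.Finite k κ] {n : ℕ} (h : V.n₀ ≤ n + 1) :
    V.r (n + 1) = V.r n + Module.finrank k κ := by
  have := V.finite_L (n + 1)
  have h1 := LinearMap.finrank_range_add_finrank_ker (V.coef n)
  rw [LinearMap.range_eq_top.2 (V.coef_surj h), finrank_top] at h1
  have h2 : Module.finrank k (LinearMap.ker (V.coef n)) = V.r n := by
    refine LinearEquiv.finrank_eq (LinearEquiv.ofBijective
      ((V.L (n+1)).subtype.comp
        (LinearMap.ker (V.coef n)).subtype |>.codRestrict (V.L n) ?_) ⟨?_, ?_⟩)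
    · intro x
      exact (V.coef_eq_zero x.1).1 x.2
    · intro x y h
      have := congrArg Subtype.val h
      exact Subtype.ext (Subtype.ext this)
    · rintro ⟨x, hx⟩
      exact ⟨⟨⟨x, V.L_mono (Nat.le_succ n) hx⟩, (V.coef_eq_zero _).2 hx⟩, rfl⟩
  unfold r at *
  omega

theorem r_add [Module.Finite k κ] {n : ℕ} (h : V.n₀ ≤ n) (m : ℕ) :
    V.r (n + m) = V.r n + m * Module.finrank k κ := by
  induction m with
  | zero => simp
  | succ m ih =>
    rw [← add_assoc, V.r_succ (by omega), ih]; ring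

theorem exists_add_mul {x : B} (hx : x ≠ 0) {n : ℕ} (hn : V.n₀ + V.ν x ≤ n + 1) (y : B) :
    ∃ z, V.ν (y - x * z) ≤ n := by
  have := V.isDomain'
  induction h : V.ν y using Nat.strong_induction_on generalizing y with
  | _ N ih =>
    by_cases hN : N ≤ n
    · exact ⟨0, by simpa [h] using hN⟩
    have hy : y ≠ 0 := by rintro rfl; rw [V.ν_zero] at h; omega
    obtain ⟨z, hz, hzc⟩ := V.surj (N - V.ν x) (by omega) (V.lc y / V.lc x)
      (div_ne_zero (V.lc_ne_zero hy) (V.lc_ne_zero hx))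
    have hz0 : z ≠ 0 := by
      rintro rfl
      rw [V.lc_zero] at hzc
      exact div_ne_zero (V.lc_ne_zero hy) (V.lc_ne_zero hx) hzc.symm
    by_cases hxy : y = x * z
    · exact ⟨z, by simp [hxy, V.ν_zero]⟩
    have := V.ν_sub_lt y (x * z) (by rw [V.ν_mul _ _ hx hz0]; omega)
      (by rw [V.lc_mul, hzc, mul_div_cancel₀ _ (V.lc_ne_zero hx)]) hxy
    obtain ⟨z', hz'⟩ := ih (V.ν (y - x * z)) (by omega) (y - x * z) rfl
    exact ⟨z + z', by rwa [mul_add, ← sub_sub]⟩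

/-- The map `L n → B ⧸ I`. -/
def toQuot (n : ℕ) (I : Ideal B) : V.L n →ₗ[k] B ⧸ I :=
  (Ideal.Quotient.mkₐ k I).toLinearMap.comp (V.L n).subtype

theorem toQuot_surj {x : B} (hx : x ≠ 0) {n : ℕ} (hn : V.n₀ + V.ν x ≤ n + 1) {I : Ideal B}
    (hI : x ∈ I) : Function.Surjective (V.toQuot n I) := by
  intro y
  obtain ⟨y, rfl⟩ := Ideal.Quotient.mk_surjective y
  obtain ⟨z, hz⟩ := V.exists_add_mul hx hn y
  refine ⟨⟨y - x * z, hz⟩, ?_⟩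
  simp only [toQuot, LinearMap.comp_apply, Submodule.subtype_apply, AlgHom.toLinearMap_apply,
    Ideal.Quotient.mkₐ_eq_mk]
  rw [Ideal.Quotient.eq]
  simpa using I.mul_mem_right z hI

include V in
theorem finite_quot [Module.Finite k κ] {I : Ideal B} (hI : I ≠ ⊥) : Module.Finite k (B ⧸ I) := by
  obtain ⟨x, hx, hx0⟩ := Submodule.exists_mem_ne_zero_of_ne_bot hI
  have := V.finite_L (V.n₀ + V.ν x)
  exact Module.Finite.of_surjective _ (V.toQuot_surj hx0 (Nat.le_succ _) hx)

/-- The degree of an ideal. -/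
noncomputable def dg (_ : OnePlace k B κ) (I : Ideal B) : ℕ := Module.finrank k (B ⧸ I)

/-- `L n ∩ I`. -/
def LI (n : ℕ) (I : Ideal B) : Submodule k B := V.L n ⊓ I.restrictScalars k

@[simp] theorem mem_LI {n : ℕ} {I : Ideal B} {x : B} : x ∈ V.LI n I ↔ V.ν x ≤ n ∧ x ∈ I := by
  simp [LI]

theorem finite_LI [Module.Finite k κ] (n : ℕ) (I : Ideal B) : Module.Finite k (V.LI n I) := by
  have := V.finite_L n
  exact Submodule.finiteDimensional_inf_left _ _

theorem finrank_ker_toQuot (n : ℕ) (I : Ideal B) :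
    Module.finrank k (LinearMap.ker (V.toQuot n I)) = Module.finrank k (V.LI n I) := by
  refine LinearEquiv.finrank_eq (LinearEquiv.ofBijective
      ((V.L n).subtype.comp
        (LinearMap.ker (V.toQuot n I)).subtype |>.codRestrict (V.LI n I) ?_) ⟨?_, ?_⟩)
  · intro x
    have := x.2
    simp only [toQuot, LinearMap.mem_ker, LinearMap.comp_apply, AlgHom.toLinearMap_apply,
      Ideal.Quotient.mkₐ_eq_mk, Ideal.Quotient.eq_zero_iff_mem] at this
    exact V.mem_LI.2 ⟨x.1.2, this⟩
  · intro x y h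
    have := congrArg Subtype.val h
    exact Subtype.ext (Subtype.ext this)
  · rintro ⟨x, hx⟩
    refine ⟨⟨⟨x, (V.mem_LI.1 hx).1⟩, ?_⟩, rfl⟩
    simp only [toQuot, LinearMap.mem_ker, LinearMap.comp_apply, AlgHom.toLinearMap_apply,
      Ideal.Quotient.mkₐ_eq_mk, Ideal.Quotient.eq_zero_iff_mem]
    exact (V.mem_LI.1 hx).2

theorem finrank_LI_add [Module.Finite k κ] {n : ℕ} {I : Ideal B}
    (h : Function.Surjective (V.toQuot n I)) :
    Module.finrank k (V.LI n I) + V.dg I = V.r n := by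
  have := V.finite_L n
  have h1 := LinearMap.finrank_range_add_finrank_ker (V.toQuot n I)
  rw [LinearMap.range_eq_top.2 h, finrank_top, V.finrank_ker_toQuot] at h1
  unfold r dg
  omega

theorem finrank_LI_add_ge [Module.Finite k κ] (n : ℕ) {I : Ideal B} (hI : I ≠ ⊥) :
    V.r n ≤ Module.finrank k (V.LI n I) + V.dg I := by
  have := V.finite_L n
  have := V.finite_quot hI
  have h1 := LinearMap.finrank_range_add_finrank_ker (V.toQuot n I)
  rw [V.finrank_ker_toQuot] at h1
  have := Submodule.finrank_le (LinearMap.range (V.toQuot n I))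
  unfold r dg
  omega

/-- `L n ∩ xB = x · L (n - ν x)`. -/
theorem finrank_LI_span [Module.Finite k κ] {x : B} (hx : x ≠ 0) {n m : ℕ} (hn : V.ν x + m = n) :
    Module.finrank k (V.LI n (Ideal.span {x})) = V.r m := by
  have := V.isDomain'
  refine (LinearEquiv.finrank_eq (LinearEquiv.ofBijective
    (((LinearMap.mulLeft k x).comp (V.L m).subtype).codRestrict _ ?_) ⟨?_, ?_⟩)).symm
  · intro y
    simp only [LinearMap.comp_apply, Submodule.subtype_apply, LinearMap.mulLeft_apply, mem_LI]
    refine ⟨?_, Ideal.mem_span_singleton.2 (dvd_mul_right _ _)⟩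
    by_cases hy : (y : B) = 0
    · simp [hy, V.ν_zero]
    rw [V.ν_mul _ _ hx hy]
    have := V.mem_L.1 y.2
    omega
  · intro y z h
    have := congrArg Subtype.val h
    exact Subtype.ext (mul_left_cancel₀ hx this)
  · rintro ⟨y, hy⟩
    obtain ⟨hy1, hy2⟩ := V.mem_LI.1 hy
    obtain ⟨z, rfl⟩ := Ideal.mem_span_singleton.1 hy2
    refine ⟨⟨z, ?_⟩, rfl⟩
    by_cases hz : z = 0
    · simp [hz]
    rw [V.ν_mul _ _ hx hz] at hy1
    simp; omega

theorem dg_span [Module.Finite k κ] {x : B} (hx : x ≠ 0) :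
    V.dg (Ideal.span {x}) = V.ν x * Module.finrank k κ := by
  have h1 := V.finrank_LI_add (V.toQuot_surj hx (n := V.n₀ + V.ν x) (Nat.le_succ _)
    (Ideal.mem_span_singleton_self x))
  rw [V.finrank_LI_span hx (m := V.n₀) (by omega), V.r_add le_rfl] at h1
  omega

/-- Every ideal contains a nonzero element of small pole order. -/
theorem exists_mem_of_dg_lt [Module.Finite k κ] {I : Ideal B} (hI : I ≠ ⊥) {n : ℕ}
    (h : V.dg I < V.r n) : ∃ x ∈ I, x ≠ 0 ∧ V.ν x ≤ n := by
  have h1 := V.finrank_LI_add_ge n hI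
  have := V.finite_LI n I
  have h2 : V.LI n I ≠ ⊥ := by
    intro h2
    rw [h2, finrank_bot] at h1
    omega
  obtain ⟨x, hx, hx0⟩ := Submodule.exists_mem_ne_zero_of_ne_bot h2
  exact ⟨x, (V.mem_LI.1 hx).2, hx0, (V.mem_LI.1 hx).1⟩

/-- Uniform surjectivity of `L n → B ⧸ I`. -/
theorem toQuot_surj' [Module.Finite k κ] {I : Ideal B} (hI : I ≠ ⊥) {n : ℕ}
    (h : V.dg I + 2 * V.n₀ * Module.finrank k κ < n * Module.finrank k κ) :
    Function.Surjective (V.toQuot n I) := by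
  have hn : 2 * V.n₀ < n := by
    by_contra! h'
    have := Nat.mul_le_mul_right (Module.finrank k κ) h'
    omega
  obtain ⟨x, hxI, hx, hxn⟩ := V.exists_mem_of_dg_lt hI (n := n - V.n₀) (by
    have := V.r_add le_rfl (n - 2 * V.n₀)
    rw [show V.n₀ + (n - 2 * V.n₀) = n - V.n₀ by omega] at this
    rw [this, Nat.sub_mul]
    omega)
  exact V.toQuot_surj hx (by omega) hxI

include V in
theorem infinite : Infinite B := by
  have h : ∀ n, ∃ x, V.ν x = V.n₀ + n := fun n => by
    obtain ⟨x, hx, -⟩ := V.surj (V.n₀ + n) (by omega) 1 one_ne_zero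
    exact ⟨x, hx⟩
  choose f hf using h
  refine Infinite.of_injective f fun a b hab => ?_
  have := hf a; rw [hab, hf b] at this; omega

theorem isUnit_iff {x : B} : IsUnit x ↔ x ≠ 0 ∧ V.ν x = 0 := by
  have := V.isDomain'
  constructor
  · intro h
    refine ⟨h.ne_zero, ?_⟩
    obtain ⟨y, hy⟩ := h.exists_right_inv
    have := V.ν_mul x y h.ne_zero (right_ne_zero_of_mul_eq_one hy)
    rw [hy, V.ν_one] at this
    omega
  · rintro ⟨h, h'⟩
    obtain ⟨c, rfl⟩ := V.exists_algebraMap x h'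
    exact (IsUnit.mk0 c (by rintro rfl; simp at h)).map _

end OnePlace

open Ideal in
theorem cardQuot_mul_of_infinite {S : Type*} [CommRing S] [IsDedekindDomain S] [Infinite S]
    (I J : Ideal S) :
    Submodule.cardQuot (I * J) = Submodule.cardQuot I * Submodule.cardQuot J :=
  UniqueFactorizationMonoid.multiplicative_of_coprime Submodule.cardQuot I J
      (Submodule.cardQuot_bot _ _)
      (fun {I J} hI => by simp [Ideal.isUnit_iff.mp hI, Ideal.mul_top])
      (fun {I} i hI =>
        have : Ideal.IsPrime I := Ideal.isPrime_of_prime hI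
        cardQuot_pow_of_prime hI.ne_zero)
      fun {I J} hIJ => cardQuot_mul_of_coprime <| Ideal.isCoprime_iff_sup_eq.mpr
        (Ideal.isUnit_iff.mp
          (hIJ (Ideal.dvd_iff_le.mpr le_sup_left) (Ideal.dvd_iff_le.mpr le_sup_right)))

namespace OnePlace

variable {k B κ : Type*} [Field k] [CommRing B] [Algebra k B] [Field κ] [Algebra k κ]
  (V : OnePlace k B κ)

section
variable [Module.Finite k κ]

theorem exists_leading {I : Ideal B} (hI : I ≠ ⊥) (w : B) {c : κ} (hc : c ≠ 0) {l : ℕ}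
    (hl : V.dg I + (2 * V.n₀ + 1) * Module.finrank k κ < l * Module.finrank k κ) :
    ∃ z, z - w ∈ I ∧ V.ν z = l ∧ V.lc z = c := by
  have hδ : 0 < Module.finrank k κ := Module.finrank_pos
  have hl' : 2 * V.n₀ + 1 < l := by
    by_contra! h'
    have := Nat.mul_le_mul_right (Module.finrank k κ) h'
    omega
  obtain ⟨y, hy, hyc⟩ := V.surj l (by omega) c hc
  have : (2 * V.n₀ + 1) * Module.finrank k κ + (l - (2 * V.n₀ + 1)) * Module.finrank k κ
      = l * Module.finrank k κ := by rw [← add_mul]; congr 1; omega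
  have h2 : (l - 1) * Module.finrank k κ = 
    2 * V.n₀ * Module.finrank k κ + (l - (2 * V.n₀ + 1)) * Module.finrank k κ := by
    rw [← add_mul]; congr 1; omega
  obtain ⟨u, hu⟩ := V.toQuot_surj' hI (n := l - 1) (by omega) (Ideal.Quotient.mk I (w - y))
  have hu' := V.mem_L.1 u.2
  have := V.ν_add_eq (x := y) (y := u) (by omega)
  refine ⟨y + u, ?_, by rw [this.1, hy], by rw [this.2, hyc]⟩
  have h3 : Ideal.Quotient.mk I (u : B) = Ideal.Quotient.mk I (w - y) := hu
  rw [Ideal.Quotient.eq] at h3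
  convert h3 using 1; ring

end

variable [IsDedekindDomain B] [Fintype k] [Module.Finite k κ]

local notation "q" => Fintype.card k

include V in
theorem natCard_quot {I : Ideal B} (hI : I ≠ ⊥) : Nat.card (B ⧸ I) = q ^ V.dg I := by
  have := V.finite_quot hI
  rw [Module.natCard_eq_pow_finrank (K := k), Nat.card_eq_fintype_card, dg]

include V in
theorem dg_mul {I J : Ideal B} (hI : I ≠ ⊥) (hJ : J ≠ ⊥) : V.dg (I * J) = V.dg I + V.dg J := by
  have := V.infinite
  have h := cardQuot_mul_of_infinite I J
  simp only [Submodule.cardQuot_apply] at h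
  have hIJ : I * J ≠ ⊥ := mul_ne_zero hI hJ
  have h1 := V.natCard_quot hI
  have h2 := V.natCard_quot hJ
  have h3 := V.natCard_quot hIJ
  change Nat.card (B ⧸ (I * J)) = Nat.card (B ⧸ I) * Nat.card (B ⧸ J) at h
  rw [h1, h2, h3, ← pow_add] at h
  exact Nat.pow_right_injective Fintype.one_lt_card h

theorem dg_one : V.dg (1 : Ideal B) = 0 := by
  unfold dg
  rw [Ideal.one_eq_top]
  exact Module.finrank_zero_of_subsingleton

theorem dg_pow {I : Ideal B} (hI : I ≠ ⊥) (n : ℕ) : V.dg (I ^ n) = n * V.dg I := by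
  induction n with
  | zero => rw [pow_zero, V.dg_one, zero_mul]
  | succ n ih => rw [pow_succ, V.dg_mul (pow_ne_zero n hI) hI, ih]; ring

theorem dg_eq_zero_iff {I : Ideal B} (hI : I ≠ ⊥) : V.dg I = 0 ↔ I = 1 := by
  constructor
  · intro h
    have h1 := V.natCard_quot hI
    rw [h, pow_zero, Nat.card_eq_one_iff_unique] at h1
    rw [Ideal.one_eq_top]
    exact Ideal.Quotient.subsingleton_iff.1 h1.1
  · rintro rfl; exact V.dg_one

theorem dg_pos {I : Ideal B} (hI : I ≠ ⊥) (h : I ≠ ⊤) : 0 < V.dg I := by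
  rw [Nat.pos_iff_ne_zero, Ne, V.dg_eq_zero_iff hI, Ideal.one_eq_top]; exact h

theorem dg_le_of_dvd {I J : Ideal B} (hJ : J ≠ ⊥) (h : I ∣ J) : V.dg I ≤ V.dg J := by
  obtain ⟨K, rfl⟩ := h
  rw [V.dg_mul (left_ne_zero_of_mul hJ) (right_ne_zero_of_mul hJ)]
  omega

theorem finite_L' (n : ℕ) : Finite (V.L n) := by
  have := V.finite_L n
  exact Module.finite_of_finite k

theorem natCard_L (n : ℕ) : Nat.card (V.L n) = q ^ V.r n := by
  have := V.finite_L n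
  rw [Module.natCard_eq_pow_finrank (K := k), Nat.card_eq_fintype_card, r]

include V in
theorem finite_dvd {I : Ideal B} (hI : I ≠ ⊥) : {J : Ideal B | J ∣ I}.Finite := by
  have := V.finite_quot hI
  have : Finite (B ⧸ I) := Module.finite_of_finite k
  have : Finite (Ideal (B ⧸ I)) := inferInstance
  refine Set.Finite.of_finite_image (f := Ideal.map (Ideal.Quotient.mk I))
    (Set.toFinite _) ?_
  intro J hJ K hK h
  have hJ' : I ≤ J := Ideal.le_of_dvd hJ
  have hK' : I ≤ K := Ideal.le_of_dvd hK
  have := congrArg (Ideal.comap (Ideal.Quotient.mk I)) h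
  rw [Ideal.comap_map_of_surjective' _ Ideal.Quotient.mk_surjective,
    Ideal.comap_map_of_surjective' _ Ideal.Quotient.mk_surjective, Ideal.mk_ker] at this
  simpa [sup_eq_left.2 hJ', sup_eq_left.2 hK'] using this

theorem exists_r_gt (m : ℕ) : m < V.r (V.n₀ + m + 1) := by
  have hδ : 0 < Module.finrank k κ := Module.finrank_pos
  rw [add_assoc, V.r_add le_rfl]
  nlinarith

theorem finite_dg_le (m : ℕ) : {I : Ideal B | I ≠ ⊥ ∧ V.dg I ≤ m}.Finite := by
  have := V.finite_L' (V.n₀ + m + 1)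
  have hf : (⋃ x : {x : V.L (V.n₀ + m + 1) // (x : B) ≠ 0},
      {J : Ideal B | J ∣ Ideal.span {(x.1 : B)}}).Finite :=
    Set.finite_iUnion fun x => V.finite_dvd (by simpa using x.2)
  refine hf.subset ?_
  rintro I ⟨hI, hm⟩
  obtain ⟨x, hx, hx0, hxn⟩ := V.exists_mem_of_dg_lt hI (n := V.n₀ + m + 1)
    (lt_of_le_of_lt hm (V.exists_r_gt m))
  simp only [Set.mem_iUnion]
  refine ⟨⟨⟨x, hxn⟩, hx0⟩, ?_⟩
  simpa [Ideal.dvd_span_singleton] using hx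

theorem exists_card_dg_eq : ∃ C : ℕ, ∀ m : ℕ,
    {I : Ideal B | I ≠ ⊥ ∧ V.dg I = m}.ncard ≤ C * q ^ m := by
  set δ := Module.finrank k κ with hδ
  have hδ0 : 0 < δ := Module.finrank_pos
  set c := (V.n₀ + 1) * δ with hc
  have hF := V.finite_dg_le c
  have : Finite {I : Ideal B // I ≠ ⊥ ∧ V.dg I ≤ c} := hF
  refine ⟨q ^ (V.r V.n₀ + δ) * Nat.card {I : Ideal B // I ≠ ⊥ ∧ V.dg I ≤ c}, fun m => ?_⟩
  set n := V.n₀ + (m / δ + 1) with hn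
  have hrn : V.r n = V.r V.n₀ + (m / δ + 1) * δ := V.r_add le_rfl _
  have hdiv := Nat.div_add_mod' m δ
  have hmod := Nat.mod_lt m hδ0
  have hx : ∀ I : {I : Ideal B | I ≠ ⊥ ∧ V.dg I = m}, ∃ x : V.L n, ∃ J : {J : Ideal B // J ≠ ⊥ ∧
      V.dg J ≤ c}, I.1 * J.1 = Ideal.span {(x : B)} := by
    rintro ⟨I, hI, hm⟩
    obtain ⟨x, hx, hx0, hxn⟩ := V.exists_mem_of_dg_lt hI (n := n) (by
      rw [hm, hrn, add_mul]; omega)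
    obtain ⟨J, hJ⟩ := Ideal.dvd_span_singleton.2 hx
    have hs : Ideal.span {x} ≠ ⊥ := by simpa using hx0
    have hJ0 : J ≠ ⊥ := by
      rintro rfl
      rw [Ideal.mul_bot] at hJ
      exact hs hJ
    refine ⟨⟨x, hxn⟩, ⟨J, hJ0, ?_⟩, hJ.symm⟩
    have h1 := V.dg_span hx0
    rw [hJ, V.dg_mul hI hJ0, hm, ← hδ] at h1
    have h2 : V.ν x * δ ≤ n * δ := Nat.mul_le_mul_right _ hxn
    have h3 : n * δ = (m / δ) * δ + c := by rw [hn, hc]; ring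
    omega
  choose x J hxJ using hx
  have hinj : Function.Injective fun I => (x I, J I) := by
    intro I I' h
    simp only [Prod.mk.injEq] at h
    have h1 := hxJ I
    rw [h.1, h.2, ← hxJ I'] at h1
    exact Subtype.ext (mul_right_cancel₀ (J I').2.1 h1)
  have := V.finite_L' n
  have h1 := Nat.card_le_card_of_injective _ hinj
  rw [Nat.card_prod, V.natCard_L, Nat.card_coe_set_eq] at h1
  refine h1.trans ?_
  rw [mul_right_comm, ← pow_add]
  apply Nat.mul_le_mul_right
  apply Nat.pow_le_pow_right Fintype.card_pos
  rw [hrn, add_mul]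
  omega

/-- The number of ideals of degree at most `m` is `O(q ^ m)`. -/
theorem exists_card_dg_le : ∃ C : ℕ, ∀ m : ℕ,
    {I : Ideal B | I ≠ ⊥ ∧ V.dg I ≤ m}.ncard ≤ C * q ^ m := by
  obtain ⟨C, hC⟩ := V.exists_card_dg_eq
  have hq : 2 ≤ q := Fintype.one_lt_card
  refine ⟨2 * C, fun m => ?_⟩
  induction m with
  | zero =>
    have := hC 0
    simp only [Nat.le_zero]
    nlinarith
  | succ m ih =>
    have h1 : {I : Ideal B | I ≠ ⊥ ∧ V.dg I ≤ m + 1} =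
        {I : Ideal B | I ≠ ⊥ ∧ V.dg I ≤ m} ∪ {I : Ideal B | I ≠ ⊥ ∧ V.dg I = m + 1} := by
      ext I
      simp only [Set.mem_ofPred_eq, Set.mem_union, Nat.le_succ_iff]
      tauto
    rw [h1]
    refine (Set.ncard_union_le _ _).trans ?_
    have h2 := hC (m + 1)
    have h3 : 2 * (C * q ^ m) ≤ C * q ^ (m + 1) := by
      calc 2 * (C * q ^ m) ≤ q * (C * q ^ m) := Nat.mul_le_mul_right _ hq
        _ = C * q ^ (m + 1) := by ring
    nlinarith

end OnePlace

section DetLemmas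

variable {k A E C : Type*} [Field k] [AddCommGroup A] [Module k A] [AddCommGroup E] [Module k E]
  [AddCommGroup C] [Module k C]

theorem LinearMap.det_of_exact [Module.Finite k E] (i : A →ₗ[k] E) (p : E →ₗ[k] C)
    (hi : Function.Injective i) (hp : Function.Surjective p)
    (hip : LinearMap.range i = LinearMap.ker p) (fA : A →ₗ[k] A) (fE : E →ₗ[k] E) (fC : C →ₗ[k] C)
    (h1 : ∀ x, fE (i x) = i (fA x)) (h2 : ∀ x, p (fE x) = fC (p x)) :
    fE.det = fA.det * fC.det := by
  have he : LinearMap.range i ≤ (LinearMap.range i).comap fE := by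
    rintro _ ⟨x, rfl⟩
    exact ⟨fA x, (h1 x).symm⟩
  rw [LinearMap.det_eq_det_mul_det (LinearMap.range i) fE he]
  congr 1
  · rw [← LinearMap.det_conj fA (LinearEquiv.ofInjective i hi)]
    congr 1
    refine LinearMap.ext fun x => ?_
    obtain ⟨y, rfl⟩ := (LinearEquiv.ofInjective i hi).surjective x
    apply Subtype.ext
    simp [h1]
  · rw [← LinearMap.det_conj fC ((Submodule.quotEquivOfEq _ _ hip).trans
      (p.quotKerEquivOfSurjective hp)).symm]
    congr 1
    refine LinearMap.ext fun x => ?_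
    obtain ⟨y, rfl⟩ := Submodule.mkQ_surjective _ x
    simp only [LinearMap.comp_apply, LinearEquiv.coe_coe, LinearEquiv.symm_symm]
    rw [LinearEquiv.eq_symm_apply]
    simp only [Submodule.mkQ_apply, Submodule.mapQ_apply, LinearEquiv.trans_apply,
      Submodule.quotEquivOfEq_mk, LinearMap.quotKerEquivOfSurjective_apply_mk, h2]

theorem LinearMap.det_id_add_comp_comm [Module.Finite k A] [Module.Finite k E]
    (f : A →ₗ[k] E) (g : E →ₗ[k] A) :
    (LinearMap.id + f.comp g).det = (LinearMap.id + g.comp f).det := by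
  classical
  let a := Module.finBasis k A
  let e := Module.finBasis k E
  rw [← LinearMap.det_toMatrix e, ← LinearMap.det_toMatrix a, map_add, map_add,
    LinearMap.toMatrix_id, LinearMap.toMatrix_id, LinearMap.toMatrix_comp e a e,
    LinearMap.toMatrix_comp a e a, Matrix.det_one_add_mul_comm]

/-- Two subspaces of the same dimension have a common complement. -/
theorem Submodule.exists_common_compl [Module.Finite k E] (U U' : Submodule k E)
    (h : Module.finrank k U = Module.finrank k U') : ∃ W, IsCompl U W ∧ IsCompl U' W := by
  induction hn : Module.finrank k E - Module.finrank k U using Nat.strong_induction_on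
    generalizing U U' with
  | _ n ih =>
    by_cases hU : U = ⊤
    · have hU' : U' = ⊤ := by
        apply Submodule.eq_top_of_finrank_eq
        rw [← h, hU, finrank_top]
      exact ⟨⊥, by rw [hU]; exact isCompl_top_bot, by rw [hU']; exact isCompl_top_bot⟩
    have hlt := Submodule.finrank_lt hU
    have hU' : U' ≠ ⊤ := by
      rintro rfl
      rw [finrank_top] at h
      omega
    obtain ⟨v, hv, hv'⟩ : ∃ v, v ∉ U ∧ v ∉ U' := by
      by_contra! hc
      obtain ⟨x, hx⟩ : ∃ x, x ∉ U := by
        by_contra! h'; exact hU (eq_top_iff.2 fun x _ => h' x)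
      obtain ⟨y, hy⟩ : ∃ y, y ∉ U' := by
        by_contra! h'; exact hU' (eq_top_iff.2 fun x _ => h' x)
      have hx' := hc x hx
      have hy' : y ∈ U := by by_contra h'; exact hy (hc y h')
      have h1 : x + y ∉ U := fun h' => hx (by simpa using U.sub_mem h' hy')
      have h2 : x + y ∉ U' := fun h' => hy (by simpa using U'.sub_mem h' hx')
      exact h2 (hc _ h1)
    have hfr : ∀ U : Submodule k E, v ∉ U →
        Module.finrank k ↥(U ⊔ span k {v}) = Module.finrank k U + 1 := by
      intro U hv
      have hv0 : v ≠ 0 := fun h => hv (h ▸ U.zero_mem)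
      have h1 := Submodule.finrank_sup_add_finrank_inf_eq U (span k {v})
      have h2 : U ⊓ span k {v} = ⊥ := by
        rw [← disjoint_iff, Submodule.disjoint_span_singleton' hv0]
        exact hv
      rw [h2, finrank_bot, finrank_span_singleton hv0] at h1
      omega
    obtain ⟨W, hW, hW'⟩ := ih _ (by rw [hfr U hv]; omega) (U ⊔ span k {v}) (U' ⊔ span k {v})
      (by rw [hfr U hv, hfr U' hv', h]) rfl
    have key : ∀ U : Submodule k E, v ∉ U → IsCompl (U ⊔ span k {v}) W →
        IsCompl U (W ⊔ span k {v}) := by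
      intro U hv hW
      have hv0 : v ≠ 0 := fun h => hv (h ▸ U.zero_mem)
      constructor
      · rw [sup_comm]
        refine Disjoint.disjoint_sup_right_of_disjoint_sup_left ?_ hW.1
        rw [Submodule.disjoint_span_singleton' hv0]
        exact hv
      · rw [codisjoint_iff, ← hW.2.eq_top]
        ac_rfl
    exact ⟨_, key U hv hW, key U' hv' hW'⟩

end DetLemmas

namespace OnePlace

variable {k B κ : Type*} [Field k] [CommRing B] [Algebra k B] [Field κ] [Algebra k κ]
  (V : OnePlace k B κ)

/-- The determinant of multiplication by `a` on `B ⧸ (b)`. -/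
noncomputable def D (_ : OnePlace k B κ) (a b : B) : k :=
  Algebra.norm k (Ideal.Quotient.mk (Ideal.span {b}) a)

theorem coef_apply_of_eq {n : ℕ} (x : V.L (n + 1)) (h : V.ν (x : B) = n + 1) :
    V.coef n x = V.lc x := by simp [coef, h]

variable [Module.Finite k κ]

theorem exists_common_compl {b b' : B} (hb : b ≠ 0) (hb' : b' ≠ 0) (h : V.ν b = V.ν b') :
    ∃ (N : ℕ) (W : Submodule k B), W ≤ V.L N ∧
      IsCompl ((Ideal.span {b}).restrictScalars k) W ∧
      IsCompl ((Ideal.span {b'}).restrictScalars k) W := by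
  have := V.finite_L (V.n₀ + V.ν b)
  have hfr : ∀ b : B, b ≠ 0 → Module.finrank k
      ((V.LI (V.n₀ + V.ν b) (Ideal.span {b})).comap (V.L (V.n₀ + V.ν b)).subtype) = V.r V.n₀ := by
    intro b hb
    rw [← V.finrank_LI_span hb (n := V.n₀ + V.ν b) (m := V.n₀) (by omega)]
    refine LinearEquiv.finrank_eq (Submodule.comapSubtypeEquivOfLe ?_)
    exact inf_le_left
  obtain ⟨W, hW, hW'⟩ := Submodule.exists_common_compl
    ((V.LI (V.n₀ + V.ν b) (Ideal.span {b})).comap (V.L (V.n₀ + V.ν b)).subtype)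
    ((V.LI (V.n₀ + V.ν b) (Ideal.span {b'})).comap (V.L (V.n₀ + V.ν b)).subtype)
    (by rw [hfr b hb]; rw [h]; rw [hfr b' hb'])
  have key : ∀ c : B, c ≠ 0 → V.ν b = V.ν c →
      IsCompl ((V.LI (V.n₀ + V.ν b) (Ideal.span {c})).comap (V.L (V.n₀ + V.ν b)).subtype) W →
      IsCompl ((Ideal.span {c}).restrictScalars k) (W.map (V.L (V.n₀ + V.ν b)).subtype) := by
    intro c hc hbc hW
    constructor
    · rw [Submodule.disjoint_def]
      rintro _ hx ⟨x, hxW, rfl⟩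
      have h0 := Submodule.disjoint_def.1 hW.1 x
        (by simpa using ⟨V.mem_L.1 x.2, by simpa using hx⟩) hxW
      rw [h0]; rfl
    · rw [codisjoint_iff, eq_top_iff]
      intro y _
      obtain ⟨z, hz⟩ := V.exists_add_mul hc (n := V.n₀ + V.ν b) (by omega) y
      obtain ⟨u, hu, w, hw, huw⟩ := Submodule.mem_sup.1
        (hW.2.eq_top ▸ Submodule.mem_top (x := (⟨_, hz⟩ : V.L (V.n₀ + V.ν b))))
      refine Submodule.mem_sup.2 ⟨c * z + u, ?_, w, ⟨w, hw, rfl⟩, ?_⟩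
      · have : (u : B) ∈ Ideal.span {c} := (V.mem_LI.1 hu).2
        exact Ideal.add_mem _ (Ideal.mul_mem_right _ _ (Ideal.mem_span_singleton_self c)) this
      · have := congrArg Subtype.val huw
        simp only [Submodule.coe_add] at this
        rw [add_assoc, this]; ring
  refine ⟨V.n₀ + V.ν b, W.map (V.L (V.n₀ + V.ν b)).subtype, ?_, key b hb rfl hW, key b' hb' h hW'⟩
  rintro _ ⟨x, -, rfl⟩
  exact x.2

section Division

variable {b : B} {W : Submodule k B}

include V in
theorem division_bijective (hb : b ≠ 0) (hW : IsCompl ((Ideal.span {b}).restrictScalars k) W) :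
    Function.Bijective (((LinearMap.mulLeft k b).coprod W.subtype : B × W →ₗ[k] B)) := by
  have := V.isDomain'
  constructor
  · rw [injective_iff_map_eq_zero]
    rintro ⟨x, w⟩ h
    simp only [LinearMap.coprod_apply, LinearMap.mulLeft_apply, Submodule.subtype_apply] at h
    have h1 : b * x ∈ (Ideal.span {b}).restrictScalars k :=
      Ideal.mul_mem_right _ _ (Ideal.mem_span_singleton_self b)
    have h2 : b * x ∈ W := by
      rw [eq_neg_of_add_eq_zero_left h]; exact W.neg_mem w.2
    have h3 := Submodule.disjoint_def.1 hW.1 _ h1 h2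
    rw [h3, zero_add] at h
    ext
    · simpa [hb] using h3
    · simpa using h
  · intro y
    obtain ⟨u, hu, w, hw, rfl⟩ := Submodule.mem_sup.1 (hW.2.eq_top ▸ Submodule.mem_top (x := y))
    obtain ⟨x, rfl⟩ := Ideal.mem_span_singleton.1 hu
    exact ⟨(x, ⟨w, hw⟩), rfl⟩

/-- Division with remainder by `b`, the remainder lying in the complement `W`. -/
noncomputable def division (hb : b ≠ 0) (hW : IsCompl ((Ideal.span {b}).restrictScalars k) W) :
    (B × W) ≃ₗ[k] B := LinearEquiv.ofBijective _ (V.division_bijective hb hW)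

theorem division_apply (hb : b ≠ 0) (hW : IsCompl ((Ideal.span {b}).restrictScalars k) W)
    (x : B) (w : W) : V.division hb hW (x, w) = b * x + w := rfl

variable {N : ℕ} (hWN : W ≤ V.L N)
include hWN

theorem ν_division_fst (hb : b ≠ 0) (hW : IsCompl ((Ideal.span {b}).restrictScalars k) W)
    {n : ℕ} (hn : N ≤ n + V.ν b) {y : B} (hy : V.ν y ≤ n + V.ν b) :
    V.ν ((V.division hb hW).symm y).1 ≤ n := by
  have := V.isDomain'
  have h := (V.division hb hW).apply_symm_apply y
  set p := (V.division hb hW).symm y with hp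
  rw [← Prod.mk.eta (p := p), division_apply] at h
  have h1 : b * p.1 = y - p.2 := by rw [← h]; ring
  have h2 := V.ν_sub y p.2
  have h3 : V.ν (p.2 : B) ≤ N := hWN p.2.2
  rw [← h1] at h2
  rcases eq_or_ne p.1 0 with h0 | h0
  · rw [h0, V.ν_zero]; omega
  rw [V.ν_mul _ _ hb h0] at h2
  have := max_le hy (h3.trans hn)
  omega

/-- The endomorphism of `L u × W` induced by a map to `L (u + ν b)` through division by `b`. -/
noncomputable def through (hb : b ≠ 0) (hW : IsCompl ((Ideal.span {b}).restrictScalars k) W)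
    {u : ℕ} (hu : N ≤ u + V.ν b) (f : (V.L u × W) →ₗ[k] B)
    (hf : ∀ x, V.ν (f x) ≤ u + V.ν b) : (V.L u × W) →ₗ[k] (V.L u × W) :=
  (((LinearMap.fst k B W).comp ((V.division hb hW).symm.toLinearMap.comp f)).codRestrict (V.L u)
    (fun x => V.ν_division_fst hWN hb hW hu (hf x))).prod
  ((LinearMap.snd k B W).comp ((V.division hb hW).symm.toLinearMap.comp f))

theorem through_spec (hb : b ≠ 0) (hW : IsCompl ((Ideal.span {b}).restrictScalars k) W)
    {u : ℕ} (hu : N ≤ u + V.ν b) (f : (V.L u × W) →ₗ[k] B)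
    (hf : ∀ x, V.ν (f x) ≤ u + V.ν b) (x) :
    b * ((V.through hWN hb hW hu f hf x).1 : B) + ((V.through hWN hb hW hu f hf x).2 : B) = f x := by
  exact (V.division hb hW).apply_symm_apply (f x)

omit hWN in
theorem ext_division (hb : b ≠ 0) (hW : IsCompl ((Ideal.span {b}).restrictScalars k) W)
    {u : ℕ} {x y : V.L u × W} (h : b * (x.1 : B) + (x.2 : B) = b * (y.1 : B) + (y.2 : B)) :
    x = y := by
  have := (V.division_bijective hb hW).1 (a₁ := ((x.1 : B), x.2)) (a₂ := ((y.1 : B), y.2)) h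
  simp only [Prod.mk.injEq, SetLike.coe_eq_coe] at this
  exact Prod.ext this.1 this.2

/-- The map `(x, w) ↦ c * x + a * w`. -/
def lin (c a : B) (u : ℕ) (W : Submodule k B) : (V.L u × W) →ₗ[k] B :=
  ((LinearMap.mulLeft k c).comp (V.L u).subtype).coprod ((LinearMap.mulLeft k a).comp W.subtype)

omit hWN in
theorem lin_apply (c a : B) (u : ℕ) (x : V.L u × W) : V.lin c a u W x = c * x.1 + a * x.2 := rfl

theorem ν_lin_le {c a : B} {u m : ℕ} (h1 : u + V.ν c ≤ m) (h2 : N + V.ν a ≤ m) (x : V.L u × W) :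
    V.ν (V.lin c a u W x) ≤ m := by
  have := V.isDomain'
  have key : ∀ y z : B, V.ν (y * z) ≤ V.ν y + V.ν z := fun y z => by
    rcases eq_or_ne y 0 with rfl | hy
    · simp [V.ν_zero]
    rcases eq_or_ne z 0 with rfl | hz
    · simp [V.ν_zero]
    exact (V.ν_mul y z hy hz).le
  have hx1 := V.mem_L.1 x.1.2
  have hx2 : V.ν (x.2 : B) ≤ N := hWN x.2.2
  have := key c x.1
  have := key a x.2
  rw [lin_apply]
  exact (V.ν_add _ _).trans (max_le (by omega) (by omega))

theorem det_through_lin_self (hb : b ≠ 0) (hW : IsCompl ((Ideal.span {b}).restrictScalars k) W)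
    {u : ℕ} (hu : N ≤ u + V.ν b) (a : B) (hf : ∀ x, V.ν (V.lin b a u W x) ≤ u + V.ν b) :
    (V.through hWN hb hW hu (V.lin b a u W) hf).det = V.D a b := by
  have := V.finite_L u
  have := V.finite_L N
  have : Module.Finite k W := Submodule.finiteDimensional_of_le hWN
  set T := V.through hWN hb hW hu (V.lin b a u W) hf with hT
  have hs := V.through_spec hWN hb hW hu (V.lin b a u W) hf
  rw [← hT] at hs
  have h0 : ∀ x, T (x, 0) = (x, 0) := fun x => by
    refine V.ext_division hb hW ?_
    rw [hs]
    simp [lin_apply]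
  rw [LinearMap.det_of_exact (LinearMap.inl k _ _) (LinearMap.snd k _ _) LinearMap.inl_injective
    LinearMap.snd_surjective (LinearMap.range_inl _ _ _) LinearMap.id T
    ((LinearMap.snd k _ _).comp (T.comp (LinearMap.inr k _ _)))
    (fun x => by simp [h0]) ?_, LinearMap.det_id, one_mul]
  · let g : W →ₗ[k] (B ⧸ Ideal.span {b}) :=
      (Ideal.Quotient.mkₐ k (Ideal.span {b})).toLinearMap.comp W.subtype
    have hg : Function.Bijective g := by
      constructor
      · rw [injective_iff_map_eq_zero]
        intro w hw
        have : (w : B) ∈ (Ideal.span {b}).restrictScalars k :=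
          Ideal.Quotient.eq_zero_iff_mem.1 hw
        exact Subtype.ext (Submodule.disjoint_def.1 hW.1 _ this w.2)
      · intro y
        obtain ⟨y, rfl⟩ := Ideal.Quotient.mk_surjective y
        obtain ⟨v, hv, w, hw, rfl⟩ := Submodule.mem_sup.1
          (hW.2.eq_top ▸ Submodule.mem_top (x := y))
        refine ⟨⟨w, hw⟩, ?_⟩
        change Ideal.Quotient.mk _ w = Ideal.Quotient.mk _ (v + w)
        rw [map_add, Ideal.Quotient.eq_zero_iff_mem.2 hv, zero_add]
    have hconj := LinearMap.det_conj ((LinearMap.snd k (V.L u) W).comp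
      (T.comp (LinearMap.inr k (V.L u) W))) (LinearEquiv.ofBijective g hg)
    rw [D, Algebra.norm_apply, ← hconj]
    congr 1
    refine LinearMap.ext fun x => ?_
    obtain ⟨w, rfl⟩ := (LinearEquiv.ofBijective g hg).surjective x
    simp only [LinearMap.comp_apply, LinearEquiv.coe_coe, LinearEquiv.symm_apply_apply]
    change Ideal.Quotient.mk _ ((T (0, w)).2 : B) =
      Ideal.Quotient.mk _ a * Ideal.Quotient.mk _ (w : B)
    rw [← map_mul, eq_comm, Ideal.Quotient.eq]
    have := hs (0, w)
    simp only [lin_apply, ZeroMemClass.coe_zero, mul_zero, zero_add] at this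
    rw [← this, add_sub_cancel_right]
    exact Ideal.mul_mem_right _ _ (Ideal.mem_span_singleton_self b)
  · rintro ⟨x, w⟩
    have : (x, w) = ((x, 0) : V.L u × W) + (0, w) := by simp
    rw [this, map_add, h0]
    simp

/-- The endomorphism `x ↦ ⌊b' x / b⌋` of `L u`. -/
noncomputable def Q (hb : b ≠ 0) (hW : IsCompl ((Ideal.span {b}).restrictScalars k) W)
    {u : ℕ} (hu : N ≤ u + V.ν b) {b' : B} (hf : ∀ x, V.ν (V.lin b' 1 u W x) ≤ u + V.ν b) :
    V.L u →ₗ[k] V.L u :=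
  (LinearMap.fst k _ _).comp ((V.through hWN hb hW hu (V.lin b' 1 u W) hf).comp
    (LinearMap.inl k _ _))

theorem Q_spec (hb : b ≠ 0) (hW : IsCompl ((Ideal.span {b}).restrictScalars k) W)
    {u : ℕ} (hu : N ≤ u + V.ν b) {b' : B} (hf : ∀ x, V.ν (V.lin b' 1 u W x) ≤ u + V.ν b)
    (x : V.L u) : b' * (x : B) - b * (V.Q hWN hb hW hu hf x : B) ∈ W := by
  have := V.through_spec hWN hb hW hu (V.lin b' 1 u W) hf (x, 0)
  simp only [lin_apply, ZeroMemClass.coe_zero, mul_zero, add_zero] at this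
  rw [← this]
  simp [Q]

theorem det_through_lin_one (hb : b ≠ 0) (hW : IsCompl ((Ideal.span {b}).restrictScalars k) W)
    {u : ℕ} (hu : N ≤ u + V.ν b) {b' : B} (hf : ∀ x, V.ν (V.lin b' 1 u W x) ≤ u + V.ν b) :
    (V.through hWN hb hW hu (V.lin b' 1 u W) hf).det = (V.Q hWN hb hW hu hf).det := by
  have := V.finite_L u
  have := V.finite_L N
  have : Module.Finite k W := Submodule.finiteDimensional_of_le hWN
  set T := V.through hWN hb hW hu (V.lin b' 1 u W) hf with hT
  have hs := V.through_spec hWN hb hW hu (V.lin b' 1 u W) hf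
  rw [← hT] at hs
  have h0 : ∀ w, T (0, w) = (0, w) := fun x => by
    refine V.ext_division hb hW ?_
    rw [hs]
    simp [lin_apply]
  rw [LinearMap.det_of_exact (LinearMap.inr k _ _) (LinearMap.fst k _ _) LinearMap.inr_injective
    LinearMap.fst_surjective (LinearMap.range_inr _ _ _) LinearMap.id T
    (V.Q hWN hb hW hu hf)
    (fun x => by simp [h0]) ?_, LinearMap.det_id, one_mul]
  rintro ⟨x, w⟩
  have : (x, w) = ((x, 0) : V.L u × W) + (0, w) := by simp
  rw [this, map_add, h0]
  simp [Q, ← hT]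

theorem Q_det_ne_zero (hb : b ≠ 0) (hW : IsCompl ((Ideal.span {b}).restrictScalars k) W)
    {u : ℕ} (hu : N ≤ u + V.ν b) {b' : B} (hf : ∀ x, V.ν (V.lin b' 1 u W x) ≤ u + V.ν b)
    (hb' : b' ≠ 0) (hW' : IsCompl ((Ideal.span {b'}).restrictScalars k) W) :
    (V.Q hWN hb hW hu hf).det ≠ 0 := by
  have := V.isDomain'
  have := V.finite_L u
  have hinj : Function.Injective (V.Q hWN hb hW hu hf) := by
    rw [injective_iff_map_eq_zero]
    intro x hx
    have := V.Q_spec hWN hb hW hu hf x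
    rw [hx] at this
    simp only [ZeroMemClass.coe_zero, mul_zero, sub_zero] at this
    have h0 := Submodule.disjoint_def.1 hW'.1 _
      (Ideal.mul_mem_right _ _ (Ideal.mem_span_singleton_self b')) this
    simpa [hb'] using h0
  have hu := (LinearEquiv.ofInjectiveEndo _ hinj).isUnit_det'
  exact hu.ne_zero

theorem Q_det_succ (hb : b ≠ 0) (hW : IsCompl ((Ideal.span {b}).restrictScalars k) W)
    {u : ℕ} (hu : N ≤ u + V.ν b) (hu' : N ≤ u + 1 + V.ν b) {b' : B} (hb' : b' ≠ 0)
    (h : V.ν b = V.ν b')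
    (hf : ∀ x, V.ν (V.lin b' 1 u W x) ≤ u + V.ν b)
    (hf' : ∀ x, V.ν (V.lin b' 1 (u + 1) W x) ≤ u + 1 + V.ν b) (hn : V.n₀ ≤ u + 1) :
    (V.Q hWN hb hW hu' hf').det =
      (V.Q hWN hb hW hu hf).det * Algebra.norm k (V.lc b' / V.lc b) := by
  have := V.isDomain'
  have := V.finite_L (u + 1)
  rw [Algebra.norm_apply]
  refine LinearMap.det_of_exact (Submodule.inclusion (V.L_mono (Nat.le_succ u))) (V.coef u)
    (Submodule.inclusion_injective _) (V.coef_surj hn) ?_ _ _ _ ?_ ?_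
  · ext x
    rw [LinearMap.mem_ker, V.coef_eq_zero, Submodule.range_inclusion]
    simp
  · intro x
    have h1 := V.Q_spec hWN hb hW hu hf x
    have h2 := V.Q_spec hWN hb hW hu' hf' (Submodule.inclusion (V.L_mono (Nat.le_succ u)) x)
    have h3 := W.sub_mem h1 h2
    simp only [Submodule.coe_inclusion, sub_sub_sub_cancel_left, ← mul_sub] at h3
    have h0 := Submodule.disjoint_def.1 hW.1 _
      (Ideal.mul_mem_right _ _ (Ideal.mem_span_singleton_self b)) h3
    apply Subtype.ext
    simpa [hb, sub_eq_zero] using h0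
  · intro x
    have h1 := V.Q_spec hWN hb hW hu' hf' x
    have h1' : V.ν _ ≤ N := hWN h1
    have hx := V.mem_L.1 x.2
    set y := V.Q hWN hb hW hu' hf' x with hy
    by_cases hxu : V.ν (x : B) = u + 1
    · have hx0 : (x : B) ≠ 0 := by intro h; rw [h, V.ν_zero] at hxu; omega
      have h2 := V.of_ν_sub_lt (x := b' * (x : B)) (y := b * (y : B))
        (lt_of_le_of_lt h1' (by rw [V.ν_mul _ _ hb' hx0]; omega))
      have hy0 : (y : B) ≠ 0 := by
        intro h
        rw [h, mul_zero, V.ν_zero, V.ν_mul _ _ hb' hx0] at h2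
        omega
      rw [V.ν_mul _ _ hb' hx0, V.ν_mul _ _ hb hy0, V.lc_mul, V.lc_mul] at h2
      rw [V.coef_apply_of_eq x hxu, V.coef_apply_of_eq y (by omega)]
      have := V.lc_ne_zero hb
      simp only [Algebra.coe_lmul_eq_mul, LinearMap.mul_apply']
      rw [div_mul_eq_mul_div, h2.2, mul_div_cancel_left₀ _ this]
    · rw [(V.coef_eq_zero x).2 (by omega), map_zero, V.coef_eq_zero]
      rcases eq_or_ne (y : B) 0 with hy0 | hy0
      · rw [hy0, V.ν_zero]; omega
      have h3 : V.ν (b' * (x : B)) ≤ u + V.ν b := by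
        rcases eq_or_ne (x : B) 0 with hx0 | hx0
        · rw [hx0, mul_zero, V.ν_zero]; omega
        rw [V.ν_mul _ _ hb' hx0]; omega
      have h2 := V.ν_sub (b' * (x : B)) (b' * (x : B) - b * (y : B))
      rw [sub_sub_cancel, V.ν_mul _ _ hb hy0] at h2
      have := max_le h3 (h1'.trans hu)
      omega

theorem Q_det_add (hb : b ≠ 0) (hW : IsCompl ((Ideal.span {b}).restrictScalars k) W)
    {u : ℕ} (hu : N ≤ u + V.ν b) {b' : B} (hb' : b' ≠ 0)
    (h : V.ν b = V.ν b')
    (hf : ∀ x, V.ν (V.lin b' 1 u W x) ≤ u + V.ν b) (hn : V.n₀ ≤ u + 1) (j : ℕ)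
    (hu' : N ≤ u + j + V.ν b)
    (hf' : ∀ x, V.ν (V.lin b' 1 (u + j) W x) ≤ u + j + V.ν b) :
    (V.Q hWN hb hW hu' hf').det =
      (V.Q hWN hb hW hu hf).det * Algebra.norm k (V.lc b' / V.lc b) ^ j := by
  induction j with
  | zero => simp
  | succ j ih =>
    have h1 : ∀ x, V.ν (V.lin b' 1 (u + j) W x) ≤ u + j + V.ν b :=
      V.ν_lin_le hWN (by omega) (by rw [V.ν_one]; omega)
    rw [pow_succ, ← mul_assoc, ← ih (by omega) h1]
    have hn' : V.n₀ ≤ u + j + 1 := by omega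
    exact V.Q_det_succ hWN hb hW _ hu' hb' h h1 hf' hn'

end Division

/-- The reciprocity law for `V.D`. -/
theorem reciprocity {a b b' t : B} (ha : a ≠ 0) (hb : b ≠ 0) (hb' : b' ≠ 0) (h : V.ν b = V.ν b')
    (ht : b' = b + a * t) :
    V.D a b = Algebra.norm k (V.lc b' / V.lc b) ^ V.ν a * V.D a b' := by
  have := V.isDomain'
  obtain ⟨N, W, hWN, hW, hW'⟩ := V.exists_common_compl hb hb' h
  set v := N + V.n₀ + V.ν a with hv
  have := V.finite_L v
  have := V.finite_L (v + V.ν a)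
  have := V.finite_L N
  have : Module.Finite k W := Submodule.finiteDimensional_of_le hWN
  have hu : N ≤ v + V.ν b := by omega
  have hu' : N ≤ v + V.ν a + V.ν b := by omega
  have hu'' : N ≤ v + V.ν a + V.ν b' := by omega
  have hf : ∀ x, V.ν (V.lin b' 1 v W x) ≤ v + V.ν b :=
    V.ν_lin_le hWN (by omega) (by rw [V.ν_one]; omega)
  have hR : ∀ x, V.ν (V.lin b' 1 (v + V.ν a) W x) ≤ v + V.ν a + V.ν b :=
    V.ν_lin_le hWN (by omega) (by rw [V.ν_one]; omega)
  have hS : ∀ x, V.ν (V.lin b a (v + V.ν a) W x) ≤ v + V.ν a + V.ν b :=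
    V.ν_lin_le hWN (by omega) (by omega)
  have hS' : ∀ x, V.ν (V.lin b' a (v + V.ν a) W x) ≤ v + V.ν a + V.ν b' :=
    V.ν_lin_le hWN (by omega) (by omega)
  have hat : V.ν (a * t) ≤ V.ν b := by
    have := V.ν_sub b' b
    rw [ht, add_sub_cancel_left, ← ht, ← h, max_self] at this
    exact this
  have htx : ∀ x : V.L (v + V.ν a), V.ν (t * (x : B)) ≤ v + V.ν b := by
    intro x
    have hx := V.mem_L.1 x.2
    rcases eq_or_ne t 0 with h0 | h0
    · simp [h0, V.ν_zero]
    rcases eq_or_ne (x : B) 0 with h1 | h1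
    · simp [h1, V.ν_zero]
    rw [V.ν_mul _ _ ha h0] at hat
    rw [V.ν_mul _ _ h0 h1]
    omega
  let div : V.L (v + V.ν a) →ₗ[k] B × W :=
    (V.division hb hW).symm.toLinearMap.comp
      ((LinearMap.mulLeft k t).comp (V.L (v + V.ν a)).subtype)
  have hdiv : ∀ x, b * (div x).1 + ((div x).2 : B) = t * x := fun x =>
    (V.division hb hW).apply_symm_apply (t * (x : B))
  let G : V.L (v + V.ν a) →ₗ[k] V.L v := ((LinearMap.fst k B W).comp div).codRestrict (V.L v)
    fun x => V.ν_division_fst hWN hb hW hu (htx x)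
  let m : V.L v →ₗ[k] V.L (v + V.ν a) := ((LinearMap.mulLeft k a).comp (V.L v).subtype).codRestrict
    _ fun x => by
      have hx := V.mem_L.1 x.2
      rw [mem_L]
      change V.ν (a * (x : B)) ≤ _
      rcases eq_or_ne (x : B) 0 with h1 | h1
      · simp [h1, V.ν_zero]
      rw [V.ν_mul _ _ ha h1]
      omega
  let T : (V.L (v + V.ν a) × W) →ₗ[k] (V.L (v + V.ν a) × W) :=
    ((LinearMap.id + m.comp G).comp (LinearMap.fst k _ _)).prod
      (((LinearMap.snd k B W).comp div).coprod LinearMap.id)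
  have hT1 : ∀ x, ((T x).1 : B) = x.1 + a * (div x.1).1 := fun x => rfl
  have hT2 : ∀ x, ((T x).2 : B) = ((div x.1).2 : B) + x.2 := fun x => rfl
  have hdetT : T.det = (V.Q hWN hb hW hu hf).det := by
    rw [LinearMap.det_of_exact (LinearMap.inr k _ _) (LinearMap.fst k _ _) LinearMap.inr_injective
      LinearMap.fst_surjective (LinearMap.range_inr _ _ _) LinearMap.id T
      (LinearMap.id + m.comp G) ?_ (fun x => rfl), LinearMap.det_id, one_mul,
      LinearMap.det_id_add_comp_comm]
    · congr 1
      refine LinearMap.ext fun x => ?_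
      have h1 := V.Q_spec hWN hb hW hu hf x
      have h2 := hdiv (m x)
      have h3 : (m x : B) = a * x := rfl
      have h4 : b' * (x : B) - b * ((x : B) + (div (m x)).1) ∈ W := by
        have : b' * (x : B) - b * ((x : B) + (div (m x)).1) = (div (m x)).2 := by
          rw [h3] at h2
          rw [ht]
          linear_combination (norm := ring_nf) -h2
        rw [this]
        exact (div (m x)).2.2
      have h5 := W.sub_mem h1 h4
      rw [sub_sub_sub_cancel_left, ← mul_sub] at h5
      have h0 := Submodule.disjoint_def.1 hW.1 _
        (Ideal.mul_mem_right _ _ (Ideal.mem_span_singleton_self b)) h5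
      rw [mul_eq_zero, or_iff_right hb, sub_eq_zero] at h0
      exact Subtype.ext h0
    · intro w
      refine Prod.ext ?_ ?_
      · simp [T]
      · simp [T]
  have hcomp : (V.through hWN hb hW hu' (V.lin b' 1 _ W) hR).comp
      (V.through hWN hb' hW' hu'' (V.lin b' a _ W) hS') =
      (V.through hWN hb hW hu' (V.lin b a _ W) hS).comp T := by
    refine LinearMap.ext fun x => V.ext_division hb hW ?_
    rw [LinearMap.comp_apply, LinearMap.comp_apply, V.through_spec, V.through_spec, lin_apply,
      one_mul, V.through_spec, lin_apply, lin_apply, hT1, hT2]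
    rw [ht]
    linear_combination (norm := ring_nf) - a * hdiv x.1
  have hdet := congrArg LinearMap.det hcomp
  rw [LinearMap.det_comp, LinearMap.det_comp, V.det_through_lin_one, V.det_through_lin_self,
    V.det_through_lin_self, hdetT,
    V.Q_det_add hWN hb hW hu hb' h hf (by omega) (V.ν a) hu' hR] at hdet
  have h0 := V.Q_det_ne_zero hWN hb hW hu hf hb' hW'
  apply mul_left_cancel₀ h0
  rw [← mul_assoc, hdet, mul_comm]

theorem D_mul_right {a b c : B} (hb : b ≠ 0) (hc : c ≠ 0) :
    V.D a (b * c) = V.D a b * V.D a c := by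
  have := V.isDomain'
  have hle : (Ideal.span {b * c}).restrictScalars k ≤ (Ideal.span {b}).restrictScalars k :=
    Ideal.span_singleton_le_span_singleton.2 (dvd_mul_right b c)
  have := V.finite_quot (I := Ideal.span {b * c}) (by simpa using ⟨hb, hc⟩)
  let i : (B ⧸ Ideal.span {c}) →ₗ[k] (B ⧸ Ideal.span {b * c}) :=
    Submodule.mapQ ((Ideal.span {c}).restrictScalars k) ((Ideal.span {b * c}).restrictScalars k)
      (LinearMap.mulLeft k b) (fun x hx => by
        obtain ⟨y, rfl⟩ := Ideal.mem_span_singleton.1 hx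
        exact Ideal.mem_span_singleton.2 ⟨y, by simp [mul_assoc]⟩)
  have hi : ∀ x, i (Ideal.Quotient.mk _ x) = Ideal.Quotient.mk _ (b * x) := fun x => rfl
  let p : (B ⧸ Ideal.span {b * c}) →ₗ[k] (B ⧸ Ideal.span {b}) :=
    Submodule.mapQ ((Ideal.span {b * c}).restrictScalars k) ((Ideal.span {b}).restrictScalars k)
      LinearMap.id hle
  have hp : ∀ x, p (Ideal.Quotient.mk _ x) = Ideal.Quotient.mk _ x := fun x => rfl
  rw [mul_comm (V.D a b)]
  refine LinearMap.det_of_exact i p ?_ ?_ ?_ (Algebra.lmul k _ _) (Algebra.lmul k _ _)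
    (Algebra.lmul k _ _) ?_ ?_
  · rw [injective_iff_map_eq_zero]
    intro x hx
    obtain ⟨x, rfl⟩ := Ideal.Quotient.mk_surjective x
    rw [hi, Ideal.Quotient.eq_zero_iff_mem, Ideal.mem_span_singleton,
      mul_dvd_mul_iff_left hb] at hx
    rwa [Ideal.Quotient.eq_zero_iff_mem, Ideal.mem_span_singleton]
  · intro x
    obtain ⟨x, rfl⟩ := Ideal.Quotient.mk_surjective x
    exact ⟨_, hp x⟩
  · ext x
    obtain ⟨x, rfl⟩ := Ideal.Quotient.mk_surjective x
    rw [LinearMap.mem_ker, hp, Ideal.Quotient.eq_zero_iff_mem, Ideal.mem_span_singleton]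
    constructor
    · rintro ⟨y, hy⟩
      obtain ⟨y, rfl⟩ := Ideal.Quotient.mk_surjective y
      rw [hi, Ideal.Quotient.eq, Ideal.mem_span_singleton] at hy
      have := (dvd_mul_right b c).trans hy
      exact (dvd_sub_right (dvd_mul_right b y)).1 this
    · rintro ⟨y, rfl⟩
      exact ⟨_, hi y⟩
  · intro x
    obtain ⟨x, rfl⟩ := Ideal.Quotient.mk_surjective x
    simp only [hi, Algebra.coe_lmul_eq_mul, LinearMap.mul_apply', ← map_mul]
    congr 1; ring
  · intro x
    obtain ⟨x, rfl⟩ := Ideal.Quotient.mk_surjective x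
    simp only [hp, Algebra.coe_lmul_eq_mul, LinearMap.mul_apply', ← map_mul]

end OnePlace

/-- The combinatorial data of a family of partial zeta functions, normalised so that the pole of
interest is at `1`: `e κ n` counts effective divisors of class `κ` and degree `n`, and `Λ` is the
von Mangoldt function. -/
structure ZetaData (G : Type*) [AddCommGroup G] [Fintype G] (M : ℕ) where
  deg : G →+ ZMod M
  e : G → ℕ → ℝ
  Λ : G → ℕ → ℝ
  E : G → Polynomial ℝ
  c : ℝ
  bd : ℝ
  c_pos : 0 < c
  M_pos : 0 < M
  deg_eq : ∀ κ n, e κ n ≠ 0 → (n : ZMod M) = deg κ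
  e_nonneg : ∀ κ n, 0 ≤ e κ n
  e_le : ∀ κ n, e κ n ≤ bd
  e_zero : ∀ κ, κ ≠ 0 → e κ 0 = 0
  e_zero_zero : e 0 0 = 1
  E_spec : ∀ κ, (1 - PowerSeries.X ^ M) * PowerSeries.mk (e κ) = (E κ : PowerSeries ℝ)
  E_eval : ∀ κ, (E κ).eval 1 = c
  Λ_nonneg : ∀ κ n, 0 ≤ Λ κ n
  euler : ∀ κ n, n * e κ n = ∑ p ∈ Finset.HasAntidiagonal.antidiagonal n, ∑ g, Λ g p.1 * e (κ - g) p.2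
  infinite_Λ : ∀ N, ∃ n, N < n ∧ 0 < Λ 0 n

namespace ZetaData

open Finset PowerSeries

variable {G : Type*} [AddCommGroup G] [Fintype G] {M : ℕ} (Z : ZetaData G M)

/-- The `L`-series of a character. -/
noncomputable def L (χ : AddChar G ℂ) : ℂ⟦X⟧ := PowerSeries.mk fun n => ∑ κ, χ κ * Z.e κ n

/-- The negative of the logarithmic derivative of the `L`-series. -/
noncomputable def Gs (χ : AddChar G ℂ) : ℂ⟦X⟧ := PowerSeries.mk fun n => ∑ κ, χ κ * Z.Λ κ n

/-- The numerator of the `L`-series. -/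
noncomputable def Q (χ : AddChar G ℂ) : Polynomial ℂ :=
  ∑ κ, Polynomial.C (χ κ) * (Z.E κ).map Complex.ofRealHom

theorem Q_spec (χ : AddChar G ℂ) : (1 - X ^ M) * Z.L χ = (Z.Q χ : ℂ⟦X⟧) := by
  have h : Z.L χ = ∑ κ, C (χ κ) * PowerSeries.map Complex.ofRealHom (PowerSeries.mk (Z.e κ)) := by
    ext n
    simp [L]
  have h2 : ∀ κ, (1 - X ^ M) * PowerSeries.map Complex.ofRealHom (PowerSeries.mk (Z.e κ)) =
      ((Z.E κ).map Complex.ofRealHom : ℂ⟦X⟧) := by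
    intro κ
    rw [Polynomial.polynomial_map_coe, ← Z.E_spec]
    simp
  rw [h, mul_sum, Q]
  rw [← Polynomial.coeToPowerSeries.ringHom_apply, map_sum]
  refine sum_congr rfl fun κ _ => ?_
  rw [map_mul, Polynomial.coeToPowerSeries.ringHom_apply, Polynomial.coeToPowerSeries.ringHom_apply,
    Polynomial.coe_C, ← h2]
  ring

theorem Q_eval_one [DecidableEq (AddChar G ℂ)] (χ : AddChar G ℂ) : (Z.Q χ).eval 1 = if χ = 0 then (Z.c * Fintype.card G : ℂ) else 0 := by
  have h : (Z.Q χ).eval 1 = Z.c * ∑ κ, χ κ := by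
    rw [Q, Polynomial.eval_finsetSum, mul_sum]
    refine sum_congr rfl fun κ _ => ?_
    have := Polynomial.eval_map_apply (Complex.ofRealHom) (1 : ℝ) (p := Z.E κ)
    simp only [map_one] at this
    rw [Polynomial.eval_mul, Polynomial.eval_C, this, Z.E_eval, mul_comm]
    rfl
  rw [h, AddChar.sum_eq_ite]
  split_ifs <;> simp

theorem constantCoeff_L (χ : AddChar G ℂ) : constantCoeff (Z.L χ) = 1 := by
  rw [← coeff_zero_eq_constantCoeff_apply, L, coeff_mk, sum_eq_single 0]
  · simp [Z.e_zero_zero]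
  · intro b _ hb
    simp [Z.e_zero b hb]
  · simp

theorem euler_L (χ : AddChar G ℂ) : X * d⁄dX ℂ (Z.L χ) = Z.Gs χ * Z.L χ := by
  have h1 : ∀ (f : ℂ⟦X⟧) n, coeff n (X * d⁄dX ℂ f) = n * coeff n f := by
    intro f n
    cases n with
    | zero => simp
    | succ n => rw [coeff_succ_X_mul, coeff_derivative]; push_cast; ring
  ext n
  rw [h1, coeff_mul]
  simp only [L, Gs, coeff_mk]
  rw [mul_sum]
  have h2 : ∀ κ, (n : ℂ) * (χ κ * Z.e κ n) =
      ∑ p ∈ HasAntidiagonal.antidiagonal n, ∑ g, χ κ * (Z.Λ g p.1 * Z.e (κ - g) p.2) := by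
    intro κ
    have := congrArg (fun x : ℝ => (x : ℂ)) (Z.euler κ n)
    push_cast at this
    rw [mul_left_comm, this, mul_sum]
    simp only [mul_sum]
  simp only [h2]
  rw [sum_comm]
  refine sum_congr rfl fun p _ => ?_
  rw [sum_comm, sum_mul]
  refine sum_congr rfl fun g _ => ?_
  rw [mul_sum, ← Equiv.sum_comp (Equiv.addRight g)]
  refine sum_congr rfl fun κ _ => ?_
  simp only [Equiv.coe_addRight, add_sub_cancel_right, AddChar.map_add_eq_mul]
  ring

/-- The twist of a character by `ω ^ deg`. -/
noncomputable def twist (ω : ℂ) (hω : ω ^ M = 1) : AddChar G ℂ :=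
  have : NeZero M := ⟨Z.M_pos.ne'⟩
  (AddChar.zmodChar M hω).compAddMonoidHom Z.deg

theorem twist_apply {ω : ℂ} (hω : ω ^ M = 1) {κ : G} {n : ℕ} (h : (n : ZMod M) = Z.deg κ) :
    Z.twist ω hω κ = ω ^ n := by
  have : NeZero M := ⟨Z.M_pos.ne'⟩
  rw [twist, AddChar.compAddMonoidHom_apply, ← h, AddChar.zmodChar_apply']

theorem L_twist (χ : AddChar G ℂ) {ω : ℂ} (hω : ω ^ M = 1) :
    Z.L (χ * Z.twist ω hω) = rescale ω (Z.L χ) := by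
  ext n
  rw [coeff_rescale, L, L, coeff_mk, coeff_mk, mul_sum]
  refine sum_congr rfl fun κ _ => ?_
  by_cases h : Z.e κ n = 0
  · simp [h]
  · rw [AddChar.mul_apply, Z.twist_apply hω (Z.deg_eq _ _ h)]
    ring

theorem Q_twist (χ : AddChar G ℂ) {ω : ℂ} (hω : ω ^ M = 1) :
    Z.Q (χ * Z.twist ω hω) = (Z.Q χ).comp (Polynomial.C ω * Polynomial.X) := by
  apply Polynomial.coe_injective
  rw [← Q_spec, L_twist]
  have h : ∀ p : Polynomial ℂ, ((p.comp (Polynomial.C ω * Polynomial.X) : Polynomial ℂ) : ℂ⟦X⟧) =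
      rescale ω (p : ℂ⟦X⟧) := by
    intro p
    ext n
    rw [Polynomial.coeff_coe, coeff_rescale, Polynomial.coeff_coe, Polynomial.comp_C_mul_X_coeff,
      mul_comm]
  rw [h, ← Q_spec, map_mul, map_sub, map_pow, map_one, rescale_X, mul_pow, ← map_pow, hω, map_one,
    one_mul]

theorem Λ_zero (κ : G) : Z.Λ κ 0 = 0 := by
  have h := Z.euler κ 0
  simp only [Nat.cast_zero, zero_mul, Finset.Nat.antidiagonal_zero, sum_singleton] at h
  rw [sum_eq_single κ] at h
  · simpa [Z.e_zero_zero] using h.symm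
  · intro b _ hb
    rw [Z.e_zero _ (sub_ne_zero.2 hb.symm), mul_zero]
  · simp

theorem euler_prod (s : Finset (AddChar G ℂ)) :
    X * d⁄dX ℂ (∏ χ ∈ s, Z.L χ) = (∑ χ ∈ s, Z.Gs χ) * ∏ χ ∈ s, Z.L χ := by
  classical
  induction s using Finset.induction_on with
  | empty => simp
  | insert a s ha ih =>
    rw [prod_insert ha, sum_insert ha, Derivation.leibniz, smul_eq_mul, smul_eq_mul, mul_add,
      mul_left_comm, ih, mul_left_comm X, Z.euler_L]
    ring

theorem coeff_sum_Gs (n : ℕ) :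
    coeff n (∑ χ, Z.Gs χ) = ((Fintype.card G * Z.Λ 0 n : ℝ) : ℂ) := by
  classical
  simp only [map_sum, Gs, coeff_mk]
  rw [sum_comm]
  simp only [← sum_mul, AddChar.sum_apply_eq_ite, ite_mul, zero_mul]
  simp

theorem pow_dvd_prod_Q (h2 : ∃ χ, (Polynomial.X - Polynomial.C 1) ^ 2 ∣ Z.Q χ) {ω : ℂ}
    (hω : ω ^ M = 1) :
    (Polynomial.X - Polynomial.C ω) ^ Fintype.card G ∣ ∏ χ, Z.Q χ := by
  classical
  obtain ⟨χ, hχ⟩ := h2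
  have hχ0 : χ ≠ 0 := by
    rintro rfl
    have h := Z.Q_eval_one 0
    rw [if_pos rfl] at h
    have h' := Polynomial.dvd_iff_isRoot.1 ((dvd_pow_self _ two_ne_zero).trans hχ)
    rw [Polynomial.IsRoot, h] at h'
    have := Z.c_pos.ne'
    simp [this] at h'
  have h1 : (Polynomial.X - Polynomial.C 1) ^ Fintype.card G ∣ ∏ χ, Z.Q χ := by
    let m : AddChar G ℂ → ℕ := fun χ' => if χ' = 0 then 0 else if χ' = χ then 2 else 1
    have hm : ∑ χ', m χ' = Fintype.card G := by
      have : ∑ χ', (m χ' + if χ' = 0 then 1 else 0) = ∑ χ', (1 + if χ' = χ then 1 else 0) := by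
        refine sum_congr rfl fun χ' _ => ?_
        by_cases h0 : χ' = 0
        · simp [m, h0, hχ0.symm]
        · by_cases h1 : χ' = χ <;> simp [m, h0, h1, hχ0]
      rw [sum_add_distrib, sum_add_distrib] at this
      simpa [AddChar.card_eq] using this
    rw [← hm, ← prod_pow_eq_pow_sum]
    refine prod_dvd_prod_of_dvd _ _ fun χ' _ => ?_
    simp only [m]
    split_ifs with h0 h1
    · simp
    · rwa [h1]
    · rw [pow_one, Polynomial.dvd_iff_isRoot, Polynomial.IsRoot, Z.Q_eval_one, if_neg h0]
  have hω0 : ω ≠ 0 := by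
    rintro rfl
    simp [Z.M_pos.ne'] at hω
  have hω' : ω⁻¹ ^ M = 1 := by rw [inv_pow, hω, inv_one]
  have h2 : ∏ χ, Z.Q χ = (∏ χ, Z.Q χ).comp (Polynomial.C ω⁻¹ * Polynomial.X) := by
    rw [Polynomial.prod_comp, ← Equiv.prod_comp (Equiv.mulRight (Z.twist ω⁻¹ hω'))]
    refine prod_congr rfl fun χ _ => ?_
    rw [Equiv.coe_mulRight, Z.Q_twist]
  rw [h2]
  obtain ⟨R, hR⟩ := h1
  rw [hR, Polynomial.mul_comp, Polynomial.pow_comp]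
  refine Dvd.dvd.mul_right (pow_dvd_pow_of_dvd ⟨Polynomial.C ω⁻¹, ?_⟩ _) _
  rw [Polynomial.sub_comp, Polynomial.X_comp, Polynomial.C_comp, sub_mul, ← Polynomial.C_mul,
    mul_inv_cancel₀ hω0]
  ring

theorem not_sq_dvd_Q (χ : AddChar G ℂ) : ¬ (Polynomial.X - Polynomial.C 1) ^ 2 ∣ Z.Q χ := by
  intro hχ
  set h := Fintype.card G with hh
  have h1 : (Polynomial.X ^ M - 1 : Polynomial ℂ) ^ h ∣ ∏ χ, Z.Q χ := by
    rw [Polynomial.X_pow_sub_one_eq_prod Z.M_pos (Complex.isPrimitiveRoot_exp M Z.M_pos.ne'),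
      ← prod_pow]
    refine Finset.prod_dvd_of_coprime (fun a _ b _ hab => ?_) fun ω hω => ?_
    · exact (Polynomial.isCoprime_X_sub_C_of_isUnit_sub (sub_ne_zero.2 hab).isUnit).pow
    · exact Z.pow_dvd_prod_Q ⟨χ, hχ⟩ ((Polynomial.mem_nthRootsFinset Z.M_pos _).1 hω)
  obtain ⟨R, hR⟩ := h1
  have h2 : ∏ χ, Z.L χ = (((-1) ^ h * R : Polynomial ℂ) : ℂ⟦X⟧) := by
    have h3 : ((1 : ℂ⟦X⟧) - X ^ M) ^ h ≠ 0 := by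
      refine pow_ne_zero _ fun h0 => ?_
      have := congrArg constantCoeff h0
      simp [Z.M_pos.ne'] at this
    apply mul_left_cancel₀ h3
    have h4 : ((1 : ℂ⟦X⟧) - X ^ M) ^ h = ∏ χ : AddChar G ℂ, (1 - X ^ M) := by
      rw [prod_const, card_univ, AddChar.card_eq]
    conv_lhs => rw [h4, ← prod_mul_distrib]
    rw [prod_congr rfl fun χ _ => Z.Q_spec χ]
    have h5 := congrArg (Polynomial.coeToPowerSeries.ringHom (R := ℂ)) hR
    rw [map_prod] at h5
    simp only [Polynomial.coeToPowerSeries.ringHom_apply] at h5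
    rw [h5]
    simp only [Polynomial.coe_mul, Polynomial.coe_pow, Polynomial.coe_sub, Polynomial.coe_X,
      Polynomial.coe_one, Polynomial.coe_neg]
    rw [← mul_assoc, ← mul_pow]
    congr 2
    ring
  have h3 := Z.euler_prod univ
  set P := ∏ χ, Z.L χ with hP
  have h4 : ∀ n : ℕ, (n : ℂ) * coeff n P = ∑ p ∈ HasAntidiagonal.antidiagonal n,
      ((h * Z.Λ 0 p.1 : ℝ) : ℂ) * coeff p.2 P := by
    intro n
    have := congrArg (coeff n) h3
    rw [coeff_mul n (∑ χ, Z.Gs χ)] at this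
    simp only [Z.coeff_sum_Gs] at this
    rw [← this]
    cases n with
    | zero => simp
    | succ n => rw [coeff_succ_X_mul, coeff_derivative]; push_cast; ring
  have h0 : coeff 0 P = 1 := by
    rw [coeff_zero_eq_constantCoeff_apply, hP, map_prod]
    simp [Z.constantCoeff_L]
  have hpos : ∀ n, ∃ r : ℝ, 0 ≤ r ∧ coeff n P = r := by
    intro n
    induction n using Nat.strong_induction_on with
    | _ n ih =>
      rcases Nat.eq_zero_or_pos n with rfl | hn
      · exact ⟨1, zero_le_one, by simp [h0]⟩
      have : ∀ p : ℕ × ℕ, ∃ r : ℝ, 0 ≤ r ∧ (p ∈ HasAntidiagonal.antidiagonal n →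
          ((h * Z.Λ 0 p.1 : ℝ) : ℂ) * coeff p.2 P = r) := by
        intro p
        by_cases hp : p.2 < n
        · obtain ⟨r, hr, hr'⟩ := ih _ hp
          refine ⟨h * Z.Λ 0 p.1 * r, ?_, fun _ => by rw [hr']; push_cast; rfl⟩
          have := Z.Λ_nonneg 0 p.1
          positivity
        · refine ⟨0, le_rfl, fun h' => ?_⟩
          have : p.1 = 0 := by
            have := mem_antidiagonal.1 h'
            omega
          simp [this, Z.Λ_zero]
      choose r hr hr' using this
      refine ⟨(∑ p ∈ HasAntidiagonal.antidiagonal n, r p) / n,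
        div_nonneg (sum_nonneg fun p _ => hr p) (by positivity), ?_⟩
      have hn' : (n : ℂ) ≠ 0 := by exact_mod_cast hn.ne'
      push_cast
      rw [eq_div_iff hn', mul_comm, h4]
      exact sum_congr rfl fun p hp => hr' p hp
  choose r hr hr' using hpos
  obtain ⟨n, hn, hΛ⟩ := Z.infinite_Λ ((-1) ^ h * R : Polynomial ℂ).natDegree
  have h5 := h4 n
  have h6 : coeff n P = 0 := by
    rw [h2, Polynomial.coeff_coe]
    exact Polynomial.coeff_eq_zero_of_natDegree_lt hn
  rw [h6, mul_zero] at h5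
  simp only [hr'] at h5
  have h7 : (0 : ℝ) = ∑ p ∈ HasAntidiagonal.antidiagonal n, (h * Z.Λ 0 p.1) * r p.2 := by
    exact_mod_cast h5
  have h8 := (sum_eq_zero_iff_of_nonneg (fun p _ => by
    have := Z.Λ_nonneg 0 p.1
    have := hr p.2
    positivity)).1 h7.symm (n, 0) (by simp)
  have h9 : r 0 = 1 := by
    have := hr' 0
    rw [h0] at this
    exact_mod_cast this.symm
  have h10 : (h : ℝ) ≠ 0 := by
    rw [hh]; exact_mod_cast Fintype.card_ne_zero
  simp [h9, h10, hΛ.ne'] at h8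

end ZetaData

namespace ZetaData

open Finset PowerSeries Filter Topology

variable {G : Type*} [AddCommGroup G] [Fintype G] {M : ℕ} (Z : ZetaData G M)

theorem Λ_le (κ : G) (n : ℕ) : Z.Λ κ n ≤ n * Z.bd := by
  have h := Z.euler κ n
  have h1 : Z.Λ κ n ≤ n * Z.e κ n := by
    rw [h]
    refine le_trans ?_ (single_le_sum (fun p _ => sum_nonneg fun g _ =>
      mul_nonneg (Z.Λ_nonneg _ _) (Z.e_nonneg _ _))
      (show (n, 0) ∈ HasAntidiagonal.antidiagonal n by simp))
    refine le_trans ?_ (single_le_sum (fun g _ =>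
      mul_nonneg (Z.Λ_nonneg _ _) (Z.e_nonneg _ _)) (mem_univ κ))
    simp [Z.e_zero_zero]
  exact h1.trans (mul_le_mul_of_nonneg_left (Z.e_le κ n) (by positivity))

theorem summable_Λ (κ : G) {z : ℝ} (h0 : 0 ≤ z) (h1 : z < 1) :
    Summable fun n => Z.Λ κ n * z ^ n := by
  have h2 := summable_pow_mul_geometric_of_norm_lt_one 1 (r := z)
    (by rwa [Real.norm_of_nonneg h0])
  refine Summable.of_nonneg_of_le (fun n => ?_) (fun n => ?_) (h2.mul_left Z.bd)
  · have := Z.Λ_nonneg κ n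
    positivity
  · have := mul_le_mul_of_nonneg_right (Z.Λ_le κ n) (pow_nonneg h0 n)
    rw [pow_one]
    linarith

theorem summable_Gs (χ : AddChar G ℂ) {z : ℝ} (h0 : 0 ≤ z) (h1 : z < 1) :
    Summable fun n => ‖coeff n (Z.Gs χ) * (z : ℂ) ^ n‖ := by
  have h2 : Summable fun n => ∑ κ, Z.Λ κ n * z ^ n :=
    summable_sum fun κ _ => Z.summable_Λ κ h0 h1
  refine Summable.of_nonneg_of_le (fun n => norm_nonneg _) (fun n => ?_) h2
  rw [Gs, coeff_mk, sum_mul]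
  refine (norm_sum_le _ _).trans (sum_le_sum fun κ _ => ?_)
  rw [norm_mul, norm_mul, norm_pow, AddChar.norm_apply, one_mul, Complex.norm_real,
    Complex.norm_real, Real.norm_of_nonneg h0, Real.norm_of_nonneg (Z.Λ_nonneg _ _)]

/-- The value of the sum of a power series. -/
noncomputable def ev (f : ℂ⟦X⟧) (z : ℂ) : ℂ := ∑' n, coeff n f * z ^ n

theorem summable_coe (p : Polynomial ℂ) (z : ℂ) :
    Summable fun n => ‖coeff n (p : ℂ⟦X⟧) * z ^ n‖ := by
  refine summable_of_ne_finset_zero (s := range (p.natDegree + 1)) fun n hn => ?_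
  rw [Polynomial.coeff_coe, Polynomial.coeff_eq_zero_of_natDegree_lt (by simpa using hn)]
  simp

theorem ev_coe (p : Polynomial ℂ) (z : ℂ) : ev (p : ℂ⟦X⟧) z = p.eval z := by
  rw [ev, tsum_eq_sum (s := range (p.natDegree + 1)), Polynomial.eval_eq_sum_range]
  · simp
  · intro n hn
    rw [Polynomial.coeff_coe, Polynomial.coeff_eq_zero_of_natDegree_lt (by simpa using hn)]
    simp

theorem ev_mul {f g : ℂ⟦X⟧} {z : ℂ} (hf : Summable fun n => ‖coeff n f * z ^ n‖)
    (hg : Summable fun n => ‖coeff n g * z ^ n‖) : ev (f * g) z = ev f z * ev g z := by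
  rw [ev, ev, ev, tsum_mul_tsum_eq_tsum_sum_antidiagonal_of_summable_norm hf hg]
  refine tsum_congr fun n => ?_
  rw [coeff_mul, sum_mul]
  refine sum_congr rfl fun p hp => ?_
  rw [← HasAntidiagonal.mem_antidiagonal.1 hp, pow_add]
  ring

theorem ev_Gs_mul (χ : AddChar G ℂ) {z : ℝ} (h0 : 0 ≤ z) (h1 : z < 1) :
    ev (Z.Gs χ) z * ((1 - (z : ℂ) ^ M) * (Z.Q χ).eval (z : ℂ)) =
      (1 - (z : ℂ) ^ M) * z * (Polynomial.derivative (Z.Q χ)).eval (z : ℂ) +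
        M * (z : ℂ) ^ M * (Z.Q χ).eval (z : ℂ) := by
  have key : Z.Gs χ * (((1 - Polynomial.X ^ M) * Z.Q χ : Polynomial ℂ) : ℂ⟦X⟧) =
      (((1 - Polynomial.X ^ M) * Polynomial.X * (Polynomial.derivative (Z.Q χ)) +
        (M : Polynomial ℂ) * Polynomial.X ^ M * Z.Q χ : Polynomial ℂ) : ℂ⟦X⟧) := by
    have hd := congrArg (d⁄dX ℂ) (Z.Q_spec χ)
    rw [derivative_coe, Derivation.leibniz, map_sub, derivative_pow] at hd
    simp only [derivative_one, derivative_X, smul_eq_mul] at hd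
    simp only [Polynomial.coe_mul, Polynomial.coe_pow, Polynomial.coe_sub, Polynomial.coe_X,
      Polynomial.coe_one, Polynomial.coe_add, ← hd, ← Z.Q_spec]
    have hM : ((M : Polynomial ℂ) : ℂ⟦X⟧) = (M : ℂ⟦X⟧) := by
      rw [← Polynomial.coeToPowerSeries.ringHom_apply, map_natCast]
    have hX : X * (X : ℂ⟦X⟧) ^ (M - 1) = X ^ M := by
      rw [← pow_succ', Nat.sub_add_cancel Z.M_pos]
    rw [hM]
    linear_combination (-(1 - X ^ M) * (1 - X ^ M)) * Z.euler_L χ +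
      (1 - X ^ M) * Z.L χ * M * hX
  have h := congrArg (fun f => ev f z) key
  change ev _ _ = ev _ _ at h
  rw [ev_coe, ev_mul (Z.summable_Gs χ h0 h1) (summable_coe _ _), ev_coe] at h
  simpa using h

theorem tendsto_Gs [DecidableEq (AddChar G ℂ)] (χ : AddChar G ℂ) :
    Tendsto (fun z : ℝ => (1 - (z : ℂ)) * ev (Z.Gs χ) z) (𝓝[<] 1) (𝓝 (if χ = 0 then 1 else 0)) := by
  have hM : (M : ℂ) ≠ 0 := by exact_mod_cast Z.M_pos.ne'
  have hcont : ∀ p : Polynomial ℂ, ContinuousAt (fun z : ℝ => p.eval (z : ℂ)) 1 := fun p =>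
    (p.continuous.comp Complex.continuous_ofReal).continuousAt
  let S : Polynomial ℂ := ∑ i ∈ range M, Polynomial.X ^ i
  have hS1 : S.eval 1 = M := by simp [S, Polynomial.eval_finsetSum]
  have hS : ∀ z : ℝ, (1 - (z : ℂ) ^ M) = (1 - z) * S.eval (z : ℂ) := by
    intro z
    simp only [S, Polynomial.eval_finsetSum, Polynomial.eval_pow, Polynomial.eval_X]
    rw [mul_neg_geom_sum]
  have hmem : ∀ᶠ z : ℝ in 𝓝[<] 1, 0 ≤ z ∧ z < 1 := by
    filter_upwards [self_mem_nhdsWithin, mem_nhdsWithin_of_mem_nhds (Ici_mem_nhds one_pos)]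
      with z h1 h2 using ⟨h2, h1⟩
  have main : ∀ (R N : Polynomial ℂ), R.eval 1 ≠ 0 → (∀ z : ℝ, 0 ≤ z → z < 1 →
      (1 - (z : ℂ)) * ev (Z.Gs χ) z * (S.eval (z : ℂ) * R.eval (z : ℂ)) = N.eval (z : ℂ)) →
      Tendsto (fun z : ℝ => (1 - (z : ℂ)) * ev (Z.Gs χ) z) (𝓝[<] 1)
        (𝓝 (N.eval 1 / (M * R.eval 1))) := by
    intro R N hR h
    have h1 : ContinuousAt (fun z : ℝ => (S * R).eval (z : ℂ)) 1 := hcont _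
    have h2 : (fun z : ℝ => (S * R).eval (z : ℂ)) 1 ≠ 0 := by
      simpa [hS1, hM] using hR
    have h3 : ∀ᶠ z : ℝ in 𝓝[<] 1, (S * R).eval (z : ℂ) ≠ 0 :=
      (h1.eventually_ne h2).filter_mono nhdsWithin_le_nhds
    have h4 : ContinuousAt (fun z : ℝ => N.eval (z : ℂ) / (S * R).eval (z : ℂ)) 1 :=
      (hcont N).div h1 h2
    have h5 := h4.tendsto.mono_left (nhdsWithin_le_nhds (s := Set.Iio 1))
    simp only [Complex.ofReal_one, Polynomial.eval_mul, hS1] at h5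
    refine h5.congr' ?_
    filter_upwards [hmem, h3] with z hz hz3
    rw [Polynomial.eval_mul] at hz3
    rw [div_eq_iff hz3, h z hz.1 hz.2]
  by_cases hχ : χ = 0
  · rw [if_pos hχ]
    have hQ : (Z.Q χ).eval 1 ≠ 0 := by
      have h1 := Z.c_pos.ne'
      rw [Z.Q_eval_one, if_pos hχ]
      simp [h1]
    convert main (Z.Q χ) ((1 - Polynomial.X) * S * Polynomial.X * Polynomial.derivative (Z.Q χ) +
      (M : Polynomial ℂ) * Polynomial.X ^ M * Z.Q χ) hQ ?_ using 2
    · simp only [Polynomial.eval_add, Polynomial.eval_mul, Polynomial.eval_sub, Polynomial.eval_one,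
        Polynomial.eval_X, sub_self, zero_mul, zero_add, Polynomial.eval_pow, one_pow, mul_one,
        Polynomial.eval_natCast]
      rw [div_self (mul_ne_zero hM hQ)]
    · intro z h0 h1
      have := Z.ev_Gs_mul χ h0 h1
      simp only [hS] at this
      simp only [Polynomial.eval_add, Polynomial.eval_mul, Polynomial.eval_sub, Polynomial.eval_one,
        Polynomial.eval_X, Polynomial.eval_pow, Polynomial.eval_natCast]
      linear_combination this
  · rw [if_neg hχ]
    have hQ : (Z.Q χ).IsRoot 1 := by
      rw [Polynomial.IsRoot, Z.Q_eval_one, if_neg hχ]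
    obtain ⟨R, hR⟩ := Polynomial.dvd_iff_isRoot.2 hQ
    have hR1 : R.eval 1 ≠ 0 := by
      intro h
      obtain ⟨R', hR'⟩ := Polynomial.dvd_iff_isRoot.2 h
      exact Z.not_sq_dvd_Q χ ⟨R', by rw [hR, hR']; ring⟩
    convert main R (-S * Polynomial.X * (R + (Polynomial.X - 1) * Polynomial.derivative R) +
      (M : Polynomial ℂ) * Polynomial.X ^ M * R) hR1 ?_ using 2
    · simp only [Polynomial.eval_add, Polynomial.eval_mul, Polynomial.eval_sub, Polynomial.eval_one,
        Polynomial.eval_X, sub_self, zero_mul, Polynomial.eval_pow, one_pow, mul_one,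
        Polynomial.eval_natCast, Polynomial.eval_neg, hS1]
      simp
    · intro z h0 h1
      have := Z.ev_Gs_mul χ h0 h1
      have hz : (z : ℂ) - 1 ≠ 0 := by
        rw [sub_ne_zero]; exact_mod_cast h1.ne
      simp only [hS, hR, Polynomial.derivative_mul, Polynomial.eval_add, Polynomial.eval_mul,
        Polynomial.eval_sub, Polynomial.eval_one, Polynomial.eval_X, Polynomial.eval_C,
        Polynomial.derivative_sub, Polynomial.derivative_X, Polynomial.derivative_C,
        Polynomial.eval_zero] at this
      simp only [Polynomial.eval_add, Polynomial.eval_mul, Polynomial.eval_sub, Polynomial.eval_one,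
        Polynomial.eval_X, Polynomial.eval_pow, Polynomial.eval_natCast, Polynomial.eval_neg]
      apply mul_left_cancel₀ hz
      linear_combination this

/-- Equidistribution of the von Mangoldt function in the class group. -/
theorem tendsto_Λ (κ : G) :
    Tendsto (fun z : ℝ => (1 - z) * ∑' n, Z.Λ κ n * z ^ n) (𝓝[<] 1) (𝓝 (Fintype.card G : ℝ)⁻¹) := by
  classical
  have hG : (Fintype.card G : ℂ) ≠ 0 := by exact_mod_cast Fintype.card_ne_zero
  have h1 : Tendsto (fun z : ℝ => (Fintype.card G : ℂ)⁻¹ *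
      ∑ χ, χ (-κ) * ((1 - (z : ℂ)) * ev (Z.Gs χ) z)) (𝓝[<] 1)
      (𝓝 ((Fintype.card G : ℂ)⁻¹ * ∑ χ : AddChar G ℂ, χ (-κ) * if χ = 0 then 1 else 0)) :=
    (tendsto_finsetSum _ fun χ _ => (Z.tendsto_Gs χ).const_mul _).const_mul _
  simp only [mul_ite, mul_one, mul_zero, sum_ite_eq', mem_univ, if_true, AddChar.zero_apply] at h1
  have h2 := (Complex.continuous_re.tendsto _).comp h1
  have h3 : ((Fintype.card G : ℂ)⁻¹).re = (Fintype.card G : ℝ)⁻¹ := by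
    rw [← Complex.ofReal_natCast, ← Complex.ofReal_inv, Complex.ofReal_re]
  rw [h3] at h2
  refine h2.congr' ?_
  have hmem : ∀ᶠ z : ℝ in 𝓝[<] 1, 0 ≤ z ∧ z < 1 := by
    filter_upwards [self_mem_nhdsWithin, mem_nhdsWithin_of_mem_nhds (Ici_mem_nhds one_pos)]
      with z h1 h2 using ⟨h2, h1⟩
  filter_upwards [hmem] with z hz
  have h4 : ∑ χ : AddChar G ℂ, χ (-κ) * ev (Z.Gs χ) z =
      Fintype.card G * ((∑' n, Z.Λ κ n * z ^ n : ℝ) : ℂ) := by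
    simp only [ev]
    simp only [← tsum_mul_left]
    rw [← Summable.tsum_finsetSum fun χ _ => ((Z.summable_Gs χ hz.1 hz.2).of_norm).mul_left _,
      Complex.ofReal_tsum, ← tsum_mul_left]
    refine tsum_congr fun n => ?_
    simp only [Gs, coeff_mk, sum_mul, mul_sum]
    rw [sum_comm]
    have : ∀ g, ∑ χ : AddChar G ℂ, χ (-κ) * (χ g * Z.Λ g n * (z : ℂ) ^ n) =
        (if g = κ then (Fintype.card G : ℂ) else 0) * (Z.Λ g n * (z : ℂ) ^ n) := by
      intro g
      have := AddChar.sum_apply_eq_ite (-κ + g)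
      simp only [neg_add_eq_zero, @eq_comm _ κ] at this
      rw [← this, sum_mul]
      refine sum_congr rfl fun χ _ => ?_
      rw [AddChar.map_add_eq_mul]
      ring
    simp only [this, ite_mul, zero_mul, sum_ite_eq', mem_univ, if_true]
    push_cast
    ring
  simp only [Function.comp]
  have h5 : (Fintype.card G : ℂ)⁻¹ * ∑ χ : AddChar G ℂ, χ (-κ) * ((1 - (z : ℂ)) * ev (Z.Gs χ) z) =
      (((1 - z) * ∑' n, Z.Λ κ n * z ^ n : ℝ) : ℂ) := by
    have : ∑ χ : AddChar G ℂ, χ (-κ) * ((1 - (z : ℂ)) * ev (Z.Gs χ) z) =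
        (1 - (z : ℂ)) * ∑ χ : AddChar G ℂ, χ (-κ) * ev (Z.Gs χ) z := by
      rw [mul_sum]
      exact sum_congr rfl fun χ _ => by ring
    rw [this, h4]
    push_cast
    field_simp
  rw [h5, Complex.ofReal_re]

end ZetaData

namespace OnePlace

/-- The nonzero ideals coprime to `a`. -/
def cop {B : Type*} [CommRing B] [IsDomain B] (a : B) : Submonoid (Ideal B) where
  carrier := {I | I ≠ ⊥ ∧ IsCoprime I (Ideal.span {a})}
  one_mem' := ⟨by simp, isCoprime_one_left⟩
  mul_mem' := fun h h' => ⟨by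
    rw [Ne, Ideal.mul_eq_bot]
    exact fun e => e.elim h.1 h'.1, h.2.mul_left h'.2⟩

variable {k B κ : Type*} [Field k] [CommRing B] [Algebra k B] [Field κ] [Algebra k κ]
  (V : OnePlace k B κ)

/-- Ray class equivalence of ideals, with modulus `a` and `M` times the place at infinity. -/
def rel (a : B) (M : ℕ) (I J : Ideal B) : Prop :=
  ∃ x y, x ≠ 0 ∧ y ≠ 0 ∧ IsCoprime x a ∧ a ∣ x - y ∧ V.lc x = V.lc y ∧
    V.ν x ≡ V.ν y [MOD M] ∧ Ideal.span {x} * I = Ideal.span {y} * J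

theorem isCoprime_of_dvd_sub {R : Type*} [CommRing R] {a x y : R} (h : IsCoprime x a) (h' : a ∣ x - y) :
    IsCoprime y a := by
  obtain ⟨t, ht⟩ := h'
  have : y = x + a * (-t) := by linear_combination -ht
  rw [this]
  exact IsCoprime.add_mul_left_left h _

theorem mem_left_of_mem_mul {R : Type*} [CommRing R] (I J : Ideal R) {x : R} (h : x ∈ I * J) :
    x ∈ I :=
  (Ideal.mul_le_left : I * J ≤ I) h

theorem mem_right_of_mem_mul {R : Type*} [CommRing R] (I J : Ideal R) {x : R} (h : x ∈ I * J) :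
    x ∈ J :=
  (Ideal.mul_le_right : I * J ≤ J) h

section

variable [IsDedekindDomain B]

/-- Ray class equivalence as a congruence. -/
def relCon (a : B) (M : ℕ) : Con (cop a) where
  r I J := V.rel a M I J
  iseqv := by
    refine ⟨fun I => ⟨1, 1, one_ne_zero, one_ne_zero, isCoprime_one_left, by simp, rfl, rfl, rfl⟩,
      ?_, ?_⟩
    · rintro I J ⟨x, y, hx, hy, hc, hd, hl, hn, h⟩
      exact ⟨y, x, hy, hx, isCoprime_of_dvd_sub hc hd, dvd_sub_comm.1 hd, hl.symm, hn.symm,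
        h.symm⟩
    · rintro I J K ⟨x, y, hx, hy, hc, hd, hl, hn, h⟩ ⟨x', y', hx', hy', hc', hd', hl', hn', h'⟩
      refine ⟨x * x', y * y', mul_ne_zero hx hx', mul_ne_zero hy hy', hc.mul_left hc', ?_, ?_, ?_,
        ?_⟩
      · have : x * x' - y * y' = (x - y) * x' + y * (x' - y') := by ring
        rw [this]
        exact dvd_add (hd.mul_right _) (hd'.mul_left _)
      · rw [V.lc_mul, V.lc_mul, hl, hl']
      · rw [V.ν_mul _ _ hx hx', V.ν_mul _ _ hy hy']
        exact hn.add hn'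
      · rw [← Ideal.span_singleton_mul_span_singleton, ← Ideal.span_singleton_mul_span_singleton,
          mul_comm (Ideal.span {x}), mul_assoc, h, mul_left_comm, h', mul_assoc]
  mul' := by
    rintro I J I' J' ⟨x, y, hx, hy, hc, hd, hl, hn, h⟩ ⟨x', y', hx', hy', hc', hd', hl', hn', h'⟩
    refine ⟨x * x', y * y', mul_ne_zero hx hx', mul_ne_zero hy hy', hc.mul_left hc', ?_, ?_, ?_,
      ?_⟩
    · have : x * x' - y * y' = (x - y) * x' + y * (x' - y') := by ring
      rw [this]
      exact dvd_add (hd.mul_right _) (hd'.mul_left _)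
    · rw [V.lc_mul, V.lc_mul, hl, hl']
    · rw [V.ν_mul _ _ hx hx', V.ν_mul _ _ hy hy']
      exact hn.add hn'
    · rw [← Ideal.span_singleton_mul_span_singleton, ← Ideal.span_singleton_mul_span_singleton,
        Submonoid.coe_mul, Submonoid.coe_mul, mul_mul_mul_comm, h, h', mul_mul_mul_comm]

variable [Fintype k] [Module.Finite k κ] {a : B} (ha : a ≠ 0) {M : ℕ} (hM : 0 < M)

local notation "δ" => Module.finrank k κ

include ha hM in
/-- Every ideal coprime to `a` divides a principal ideal in the ray with complement of bounded
degree. -/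
theorem exists_inv {I : Ideal B} (hI : I ∈ cop a) :
    ∃ J ∈ cop a, ∃ z, I * J = Ideal.span {z} ∧ a ∣ z - 1 ∧ V.lc z = 1 ∧ M ∣ V.ν z ∧
      0 < V.ν z ∧
      V.dg J ≤ V.dg (Ideal.span {a}) + (2 * V.n₀ + 1) * δ + M * δ := by
  have hδ : 0 < δ := Module.finrank_pos
  obtain ⟨i, hi, t, ht, hit⟩ := Ideal.isCoprime_iff_exists.1 hI.2
  have haI : I * Ideal.span {a} ≠ ⊥ := by
    rw [Ne, Ideal.mul_eq_bot]
    rintro (h | h)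
    · exact hI.1 h
    · exact ha (by simpa using h)
  set T := V.dg (I * Ideal.span {a}) + (2 * V.n₀ + 1) * δ with hT
  have h1 : T < (M * (T / (M * δ) + 1)) * δ := by
    have := Nat.lt_mul_div_succ T (Nat.mul_pos hM hδ)
    calc T < _ := this
      _ = _ := by ring
  have h2 : (M * (T / (M * δ) + 1)) * δ ≤ T + M * δ := by
    have := Nat.mul_div_le T (M * δ)
    calc _ = M * δ * (T / (M * δ)) + M * δ := by ring
      _ ≤ _ := by omega
  obtain ⟨z, hz, hzν, hzl⟩ := V.exists_leading haI i one_ne_zero h1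
  have hz0 : z ≠ 0 := by
    rintro rfl
    simp [V.lc_zero] at hzl
  have hza : a ∣ z - 1 := by
    rw [← Ideal.mem_span_singleton]
    have h3 : z - i ∈ Ideal.span {a} := mem_right_of_mem_mul _ _ hz
    have : z - 1 = (z - i) - t := by rw [← hit]; ring
    rw [this]
    exact sub_mem h3 ht
  have hzI : z ∈ I := by
    have h3 : z - i ∈ I := mem_left_of_mem_mul _ _ hz
    simpa using add_mem h3 hi
  obtain ⟨J, hJ⟩ := Ideal.dvd_span_singleton.2 hzI
  have hJ0 : J ≠ ⊥ := by
    rintro rfl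
    simp [hz0] at hJ
  have hzc : IsCoprime z a := isCoprime_of_dvd_sub isCoprime_one_left (dvd_sub_comm.1 hza)
  refine ⟨J, ⟨hJ0, ?_⟩, z, hJ.symm, hza, hzl, ?_, ?_, ?_⟩
  · have : IsCoprime (Ideal.span {z}) (Ideal.span {a}) :=
      (Ideal.isCoprime_span_singleton_iff _ _).2 hzc
    rw [hJ] at this
    exact this.of_mul_left_right
  · rw [hzν]; exact dvd_mul_right _ _
  · rw [hzν]; positivity
  · have h3 := V.dg_span hz0
    rw [hJ, V.dg_mul hI.1 hJ0, hzν] at h3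
    rw [V.dg_mul hI.1 (by simpa using ha)] at hT
    omega

include ha in
theorem isCoprime_inf {I : Ideal B} (hI : I ∈ cop a) (x : B) :
    x ∈ I * Ideal.span {a} ↔ x ∈ I ∧ a ∣ x := by
  have hI' := hI.2
  rw [Ideal.mul_eq_inf_of_coprime (Ideal.isCoprime_iff_sup_eq.1 hI'), Ideal.mem_inf, Ideal.mem_span_singleton]

theorem rel_one_iff {I : Ideal B} (hI : I ∈ cop a) :
    V.rel a M I 1 ↔ ∃ z, I = Ideal.span {z} ∧ a ∣ z - 1 ∧ V.lc z = 1 ∧ M ∣ V.ν z := by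
  constructor
  · rintro ⟨x, y, hx, hy, hc, hd, hl, hn, h⟩
    rw [mul_one] at h
    have hxy : x ∣ y := by
      rw [← Ideal.span_singleton_le_span_singleton, ← h]
      exact Ideal.mul_le_left
    obtain ⟨z, rfl⟩ := hxy
    have hz : z ≠ 0 := right_ne_zero_of_mul hy
    refine ⟨z, ?_, ?_, ?_, ?_⟩
    · rw [← Ideal.span_singleton_mul_span_singleton] at h
      refine mul_left_cancel₀ ?_ h
      simpa using hx
    · have : x - x * z = x * (1 - z) := by ring
      rw [this] at hd
      exact dvd_sub_comm.1 (hc.symm.dvd_of_dvd_mul_left hd)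
    · rw [V.lc_mul] at hl
      have := V.lc_ne_zero hx
      exact (mul_left_cancel₀ this (by rw [mul_one]; exact hl)).symm
    · rw [V.ν_mul _ _ hx hz] at hn
      have : V.ν x + 0 ≡ V.ν x + V.ν z [MOD M] := by simpa using hn
      exact (Nat.modEq_zero_iff_dvd.1 (Nat.ModEq.add_left_cancel' _ this).symm)
  · rintro ⟨z, rfl, hz, hl, hn⟩
    refine ⟨1, z, one_ne_zero, ?_, isCoprime_one_left, dvd_sub_comm.1 hz, ?_, ?_, ?_⟩
    · rintro rfl
      simp [V.lc_zero] at hl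
    · rw [hl, V.lc_one]
    · rw [V.ν_one]
      exact ((Nat.modEq_zero_iff_dvd).2 hn).symm
    · simp

include ha in
/-- The number of ideals of given large degree in a ray class. -/
theorem card_rel {J : Ideal B} (hJ : J ∈ cop a) {n l : ℕ} (hl : n + V.dg J = l * δ) (hlM : M ∣ l)
    (h : V.dg (J * Ideal.span {a}) + (2 * V.n₀ + 1) * δ < l * δ) :
    Nat.card {I : Ideal B // I ∈ cop a ∧ V.dg I = n ∧ V.rel a M (I * J) 1} *
      Fintype.card k ^ (V.dg (Ideal.span {a}) + (1 + V.n₀) * δ)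
      = Fintype.card k ^ (V.r V.n₀ + n) := by
  have hδ : 0 < δ := Module.finrank_pos
  have ha' : Ideal.span {a} ≠ ⊥ := by simpa using ha
  have haJ : J * Ideal.span {a} ≠ ⊥ := by
    rw [Ne, Ideal.mul_eq_bot]
    exact fun h => h.elim hJ.1 ha'
  have hl2 : 2 * V.n₀ + 1 < l := by
    by_contra! h'
    have := Nat.mul_le_mul_right δ h'
    omega
  obtain ⟨i, hi, t, ht, hit⟩ := Ideal.isCoprime_iff_exists.1 hJ.2
  obtain ⟨z₀, hz, hzν, hzl⟩ := V.exists_leading haJ i one_ne_zero h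
  have hz₀ := (isCoprime_inf ha hJ _).1 hz
  have hz₀J : z₀ ∈ J := by simpa using add_mem hz₀.1 hi
  have hz₀a : a ∣ z₀ - 1 := by
    have : z₀ - 1 = (z₀ - i) - t := by rw [← hit]; ring
    rw [this]
    exact dvd_sub hz₀.2 (Ideal.mem_span_singleton.1 ht)
  have key : ∀ z, (z ∈ J ∧ a ∣ z - 1 ∧ V.ν z = l ∧ V.lc z = 1) ↔
      z - z₀ ∈ V.LI (l - 1) (J * Ideal.span {a}) := by
    intro z
    rw [V.mem_LI, isCoprime_inf ha hJ]
    constructor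
    · rintro ⟨h1, h2, h3, h4⟩
      refine ⟨?_, sub_mem h1 hz₀J, by simpa using dvd_sub h2 hz₀a⟩
      by_cases hzz : z = z₀
      · rw [hzz, sub_self, V.ν_zero]; omega
      · have := V.ν_sub_lt z z₀ (by rw [h3, hzν]) (by rw [h4, hzl]) hzz
        omega
    · rintro ⟨h1, h2, h3⟩
      have h4 := V.ν_add_eq (x := z₀) (y := z - z₀) (by omega)
      rw [add_sub_cancel, hzν, hzl] at h4
      refine ⟨by simpa using add_mem h2 hz₀J, by simpa using dvd_add h3 hz₀a, h4⟩
  have hcard : Nat.card {I : Ideal B // I ∈ cop a ∧ V.dg I = n ∧ V.rel a M (I * J) 1} =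
      Nat.card (V.LI (l - 1) (J * Ideal.span {a})) := by
    symm
    have hex : ∀ w : V.LI (l - 1) (J * Ideal.span {a}),
        ∃ I : Ideal B, Ideal.span {(w : B) + z₀} = J * I := fun w =>
      Ideal.dvd_span_singleton.2 ((key (w + z₀)).2 (by simp [w.2])).1
    choose f hf using hex
    have hfp : ∀ w, f w ∈ cop a ∧ V.dg (f w) = n ∧ V.rel a M (f w * J) 1 := by
      intro w
      obtain ⟨h1, h2, h3, h4⟩ := (key (w + z₀)).2 (by simp [w.2])
      have h0 : (w : B) + z₀ ≠ 0 := by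
        intro h0
        rw [h0, V.lc_zero] at h4
        exact zero_ne_one h4
      have hf0 : f w ≠ ⊥ := by
        intro h
        have := hf w
        rw [h, Ideal.mul_bot] at this
        exact h0 (by simpa using this)
      have hzc : IsCoprime ((w : B) + z₀) a :=
        isCoprime_of_dvd_sub isCoprime_one_left (dvd_sub_comm.1 h2)
      have hc : f w ∈ cop a := by
        refine ⟨hf0, ?_⟩
        have : IsCoprime (Ideal.span {(w : B) + z₀}) (Ideal.span {a}) :=
          (Ideal.isCoprime_span_singleton_iff _ _).2 hzc
        rw [hf w] at this
        exact this.of_mul_left_right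
      refine ⟨hc, ?_, ?_⟩
      · have := V.dg_span h0
        rw [hf w, V.dg_mul hJ.1 hf0, h3] at this
        omega
      · rw [V.rel_one_iff ((cop a).mul_mem hc hJ)]
        exact ⟨_, by rw [mul_comm, ← hf w], h2, h4, by rw [h3]; exact hlM⟩
    refine Nat.card_congr (Equiv.ofBijective (fun w => ⟨f w, hfp w⟩) ⟨?_, ?_⟩)
    · intro w w' hww
      have h1 : f w = f w' := congrArg Subtype.val hww
      have h2 := hf w
      rw [h1, ← hf w', Ideal.span_singleton_eq_span_singleton] at h2
      obtain ⟨u, hu⟩ := h2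
      obtain ⟨c, hc⟩ := V.exists_algebraMap u (V.isUnit_iff.1 u.isUnit).2
      have h3 := ((key (w + z₀)).2 (by simp [w.2])).2.2.2
      have h4 := ((key (w' + z₀)).2 (by simp [w'.2])).2.2.2
      rw [← hu, V.lc_mul, h3, one_mul, ← hc, V.lc_algebraMap] at h4
      have h5 : c = 1 := by
        apply (algebraMap k κ).injective
        rw [h4, map_one]
      rw [← hc, h5, map_one, mul_one] at hu
      exact Subtype.ext (add_right_cancel hu)
    · rintro ⟨I, hI, hIn, hIr⟩
      obtain ⟨z, h1, h2, h3, h4⟩ := (V.rel_one_iff ((cop a).mul_mem hI hJ)).1 hIr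
      have hz0 : z ≠ 0 := by
        rintro rfl
        simp [V.lc_zero] at h3
      have hzJ : z ∈ J := by
        have : z ∈ I * J := by rw [h1]; exact Ideal.mem_span_singleton_self z
        exact mem_right_of_mem_mul _ _ this
      have hzν : V.ν z = l := by
        have h5 := V.dg_span hz0
        rw [← h1, V.dg_mul hI.1 hJ.1, hIn, hl] at h5
        exact (Nat.eq_of_mul_eq_mul_right hδ h5).symm
      refine ⟨⟨z - z₀, (key z).1 ⟨hzJ, h2, hzν, h3⟩⟩, Subtype.ext ?_⟩
      have h5 := hf ⟨z - z₀, (key z).1 ⟨hzJ, h2, hzν, h3⟩⟩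
      simp only [sub_add_cancel] at h5
      rw [← h1, mul_comm] at h5
      exact (mul_left_cancel₀ hJ.1 h5).symm
  have := V.finite_LI (l - 1) (J * Ideal.span {a})
  rw [hcard, Module.natCard_eq_pow_finrank (K := k), Nat.card_eq_fintype_card, ← pow_add]
  congr 1
  have e1 : l * δ = (l - 1 - 2 * V.n₀) * δ + (2 * V.n₀ + 1) * δ := by
    rw [← add_mul]; congr 1; omega
  have e2 : l * δ = (l - 1) * δ + δ := by
    rw [← Nat.succ_mul]; congr 1; omega
  have e3 : (l - 1) * δ = (l - 1 - V.n₀) * δ + V.n₀ * δ := by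
    rw [← add_mul]; congr 1; omega
  have hs := V.toQuot_surj' haJ (n := l - 1) (by
    have : (2 * V.n₀ + 1) * δ = 2 * V.n₀ * δ + δ := by ring
    omega)
  have h6 := V.finrank_LI_add hs
  rw [V.dg_mul hJ.1 ha'] at h6
  have h7 := V.r_add (n := V.n₀) le_rfl (l - 1 - V.n₀)
  rw [show V.n₀ + (l - 1 - V.n₀) = l - 1 by omega] at h7
  have : (1 + V.n₀) * δ = δ + V.n₀ * δ := by ring
  omega

end

end OnePlace

namespace OnePlace

variable {k B κ : Type*} [Field k] [CommRing B] [Algebra k B] [Field κ] [Algebra k κ]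
  (V : OnePlace k B κ)

open Classical in
/-- The von Mangoldt function on ideals. -/
noncomputable def vM (I : Ideal B) : ℕ :=
  if h : ∃ P : Ideal B, Prime P ∧ ∃ m, 0 < m ∧ I = P ^ m then V.dg h.choose else 0

section

variable [IsDedekindDomain B]

theorem vM_pow {P : Ideal B} (hP : Prime P) {m : ℕ} (hm : 0 < m) : V.vM (P ^ m) = V.dg P := by
  have h : ∃ Q : Ideal B, Prime Q ∧ ∃ n, 0 < n ∧ P ^ m = Q ^ n := ⟨P, hP, m, hm, rfl⟩
  rw [vM, dif_pos h]
  obtain ⟨hQ, n, hn, h2⟩ := h.choose_spec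
  congr 1
  have h3 : P ∣ h.choose := hP.dvd_of_dvd_pow (n := n) (by rw [← h2]; exact dvd_pow_self _ hm.ne')
  exact (associated_iff_eq.1 (hP.associated_of_dvd hQ h3)).symm

variable [Fintype k] [Module.Finite k κ]

open Classical in
theorem sum_vM {I : Ideal B} (hI : I ≠ ⊥) : ∑ J ∈ (V.finite_dvd hI).toFinset, V.vM J = V.dg I := by
  induction I using UniqueFactorizationMonoid.induction_on_prime with
  | h₁ => exact absurd rfl hI
  | h₂ I h =>
    have hI1 : I = 1 := by simpa using h
    subst hI1
    rw [V.dg_one]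
    refine Finset.sum_eq_zero fun J hJ => ?_
    rw [Set.Finite.mem_toFinset, Set.mem_ofPred_eq] at hJ
    rw [vM, dif_neg]
    rintro ⟨P, hP, m, hm, rfl⟩
    have : IsUnit (P ^ m) := isUnit_of_dvd_one hJ
    rw [isUnit_pow_iff hm.ne'] at this
    exact hP.not_isUnit this
  | h₃ J P hJ0 hP ih =>
    have hJ0' : J ≠ ⊥ := hJ0
    have ih := ih hJ0'
    obtain ⟨J', hJ', hPJ'⟩ := (FiniteMultiplicity.of_prime_left hP hJ0).exists_eq_pow_mul_and_not_dvd
    set v := multiplicity P J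
    have hnot : ¬ P ^ (v + 1) ∣ J := by
      rw [hJ', pow_succ]
      intro h
      exact hPJ' ((mul_dvd_mul_iff_left (pow_ne_zero v hP.ne_zero)).1 h)
    have hsub : insert (P ^ (v + 1)) (V.finite_dvd hJ0').toFinset ⊆ (V.finite_dvd hI).toFinset := by
      intro K hK
      simp only [Finset.mem_insert, Set.Finite.mem_toFinset, Set.mem_ofPred_eq] at hK ⊢
      rcases hK with rfl | hK
      · rw [pow_succ', hJ']
        exact mul_dvd_mul_left _ (dvd_mul_right _ _)
      · exact hK.mul_left _
    rw [← Finset.sum_subset hsub, Finset.sum_insert, ih, V.vM_pow hP (by omega), V.dg_mul hP.ne_zero hJ0]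
    · simpa using hnot
    · intro K hK hK'
      simp only [Finset.mem_insert, Set.Finite.mem_toFinset, Set.mem_ofPred_eq, not_or] at hK hK'
      rw [vM, dif_neg]
      rintro ⟨Q, hQ, m, hm, rfl⟩
      by_cases hQP : Q ∣ P
      · obtain rfl : Q = P := associated_iff_eq.1 (hQ.associated_of_dvd hP hQP)
        have h1 : Q ^ m ∣ Q ^ (v + 1) := by
          refine hQ.pow_dvd_of_dvd_mul_right m hPJ' ?_
          rw [pow_succ', mul_assoc, ← hJ']
          exact hK
        have h2 : m ≤ v + 1 := (pow_dvd_pow_iff hQ.ne_zero hQ.not_isUnit).1 h1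
        rcases Nat.lt_or_ge m (v + 1) with h3 | h3
        · refine hK'.2 ?_
          rw [hJ']
          exact (pow_dvd_pow Q (by omega : m ≤ v)).mul_right _
        · exact hK'.1 (by rw [show m = v + 1 by omega])
      · exact hK'.2 (hQ.pow_dvd_of_dvd_mul_left m hQP hK)

end

/-- A presentation of the ray class group. -/
structure RayClass [IsDedekindDomain B] (a : B) (M : ℕ) (G : Type*) [AddCommGroup G] where
  cls : Ideal B → G
  cls_mul : ∀ I ∈ cop a, ∀ J ∈ cop a, cls (I * J) = cls I + cls J
  cls_iff : ∀ I ∈ cop a, ∀ J ∈ cop a, cls I = cls J ↔ V.rel a M I J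
  cls_surj : ∀ g, ∃ I ∈ cop a, cls I = g

theorem of_mul_mem_cop [IsDedekindDomain B] {a : B} {I J : Ideal B} (h : I * J ∈ cop a) : J ∈ cop a :=
  ⟨fun e => h.1 (by rw [e, Ideal.mul_bot]), h.2.of_mul_left_right⟩

namespace RayClass

variable [IsDedekindDomain B] [Fintype k] [Module.Finite k κ] {a : B} {M : ℕ}
  {V} {G : Type*} [AddCommGroup G] [Fintype G] [DecidableEq G] (R : V.RayClass a M G)

open Classical in
/-- Ideals coprime to `a` of degree `n`. -/
noncomputable def idl (V : OnePlace k B κ) (a : B) (n : ℕ) : Finset (Ideal B) :=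
  (V.finite_dg_le n).toFinset.filter fun I => I ∈ cop a ∧ V.dg I = n

theorem mem_idl {n : ℕ} {I : Ideal B} : I ∈ idl V a n ↔ I ∈ cop a ∧ V.dg I = n := by
  simp only [idl, Finset.mem_filter, Set.Finite.mem_toFinset, Set.mem_ofPred_eq]
  constructor
  · exact fun h => h.2
  · exact fun h => ⟨⟨h.1.1, h.2.le⟩, h⟩

/-- The number of ideals of given class and degree. -/
noncomputable def cnt (g : G) (n : ℕ) : ℕ := ((idl V a n).filter fun I => R.cls I = g).card

/-- The sum of the von Mangoldt function over ideals of given class and degree. -/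
noncomputable def lam (g : G) (n : ℕ) : ℕ := ∑ I ∈ (idl V a n).filter fun I => R.cls I = g, V.vM I

open Classical in
theorem euler (g : G) (n : ℕ) : n * R.cnt g n =
    ∑ p ∈ Finset.HasAntidiagonal.antidiagonal n, ∑ h, R.lam h p.1 * R.cnt (g - h) p.2 := by
  set S := (idl V a n).filter fun I => R.cls I = g with hS
  set D := (V.finite_dg_le n).toFinset.filter fun I => I ∈ cop a with hD
  have hSm : ∀ I, I ∈ S ↔ (I ∈ cop a ∧ V.dg I = n) ∧ R.cls I = g := by
    intro I; rw [hS, Finset.mem_filter, mem_idl]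
  have hDm : ∀ I, I ∈ D ↔ I ∈ cop a ∧ V.dg I ≤ n := by
    intro I
    simp only [hD, Finset.mem_filter, Set.Finite.mem_toFinset, Set.mem_ofPred_eq]
    exact ⟨fun h => ⟨h.2, h.1.2⟩, fun h => ⟨⟨h.1.1, h.2⟩, h.1⟩⟩
  have h1 : n * R.cnt g n = ∑ I ∈ S, ∑ J ∈ D, if J ∣ I then V.vM J else 0 := by
    have : ∀ I ∈ S, (∑ J ∈ D, if J ∣ I then V.vM J else 0) = n := by
      intro I hI
      obtain ⟨⟨hIc, hIn⟩, -⟩ := (hSm I).1 hI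
      rw [← Finset.sum_filter, ← hIn, ← V.sum_vM hIc.1]
      refine Finset.sum_congr ?_ fun _ _ => rfl
      ext J
      simp only [Finset.mem_filter, Set.Finite.mem_toFinset, Set.mem_ofPred_eq, hDm]
      refine ⟨fun h => h.2, fun h => ⟨⟨?_, ?_⟩, h⟩⟩
      · obtain ⟨K, rfl⟩ := h
        rw [mul_comm] at hIc
        exact of_mul_mem_cop hIc
      · rw [← hIn]
        exact V.dg_le_of_dvd hIc.1 h
    rw [Finset.sum_congr rfl this, Finset.sum_const, smul_eq_mul, mul_comm]
    rfl
  have h2 : ∀ J ∈ D, (∑ I ∈ S, if J ∣ I then V.vM J else 0) =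
      V.vM J * R.cnt (g - R.cls J) (n - V.dg J) := by
    intro J hJ
    obtain ⟨hJc, hJn⟩ := (hDm J).1 hJ
    rw [← Finset.sum_filter, Finset.sum_const, smul_eq_mul, mul_comm]
    congr 1
    symm
    unfold cnt
    refine Finset.card_bij (fun K _ => J * K) ?_ ?_ ?_
    · intro K hK
      obtain ⟨hK1, hK2⟩ := Finset.mem_filter.1 hK
      obtain ⟨hKc, hKn⟩ := mem_idl.1 hK1
      rw [Finset.mem_filter, hSm]
      refine ⟨⟨⟨(cop a).mul_mem hJc hKc, ?_⟩, ?_⟩, dvd_mul_right _ _⟩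
      · rw [V.dg_mul hJc.1 hKc.1, hKn]; omega
      · rw [R.cls_mul _ hJc _ hKc, hK2]; abel
    · intro K _ K' _ h
      exact mul_left_cancel₀ hJc.1 h
    · intro I hI
      obtain ⟨hI1, K, rfl⟩ := Finset.mem_filter.1 hI
      obtain ⟨⟨hIc, hIn⟩, hIg⟩ := (hSm _).1 hI1
      have hKc : K ∈ cop a := of_mul_mem_cop hIc
      refine ⟨K, ?_, rfl⟩
      rw [Finset.mem_filter, mem_idl]
      refine ⟨⟨hKc, ?_⟩, ?_⟩
      · rw [V.dg_mul hJc.1 hKc.1] at hIn; omega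
      · rw [R.cls_mul _ hJc _ hKc] at hIg
        rw [← hIg]; abel
  rw [h1, Finset.sum_comm, Finset.sum_congr rfl h2]
  rw [← Finset.sum_fiberwise_of_maps_to (g := fun J => (V.dg J, n - V.dg J))
    (t := Finset.HasAntidiagonal.antidiagonal n)
    (fun J hJ => by
      rw [Finset.HasAntidiagonal.mem_antidiagonal]
      have := ((hDm J).1 hJ).2
      simp only
      omega)]
  refine Finset.sum_congr rfl fun p hp => ?_
  rw [Finset.HasAntidiagonal.mem_antidiagonal] at hp
  have h3 : (D.filter fun J => (V.dg J, n - V.dg J) = p) = idl V a p.1 := by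
    ext J
    rw [Finset.mem_filter, hDm, mem_idl, Prod.ext_iff]
    constructor
    · rintro ⟨⟨h, -⟩, h', -⟩
      exact ⟨h, h'⟩
    · rintro ⟨h, h'⟩
      simp only [h']
      exact ⟨⟨h, by omega⟩, trivial, by omega⟩
  rw [h3, ← Finset.sum_fiberwise (idl V a p.1) R.cls]
  refine Finset.sum_congr rfl fun h _ => ?_
  rw [lam, Finset.sum_mul]
  refine Finset.sum_congr rfl fun J hJ => ?_
  obtain ⟨hJ1, hJ2⟩ := Finset.mem_filter.1 hJ
  obtain ⟨-, hJ3⟩ := mem_idl.1 hJ1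
  rw [hJ2, hJ3, show n - p.1 = p.2 by omega]

end RayClass

end OnePlace

theorem PowerSeries.exists_polynomial_of_eventually_periodic {M : ℕ} [NeZero M] (f : ℕ → ℝ) (c : ℝ) (d : ZMod M) (N : ℕ)
    (hf : ∀ n, N ≤ n → f n = if (n : ZMod M) = d then c else 0) :
    ∃ E : Polynomial ℝ, (1 - PowerSeries.X ^ M) * PowerSeries.mk f = (E : PowerSeries ℝ) ∧
      E.eval 1 = c := by
  have hM : 0 < M := Nat.pos_of_ne_zero (NeZero.ne M)
  have hco : ∀ n, PowerSeries.coeff n ((1 - PowerSeries.X ^ M) * PowerSeries.mk f) =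
      f n - if M ≤ n then f (n - M) else 0 := by
    intro n
    rw [sub_mul, one_mul, map_sub, PowerSeries.coeff_X_pow_mul', PowerSeries.coeff_mk,
      PowerSeries.coeff_mk]
  refine ⟨PowerSeries.trunc (N + M) ((1 - PowerSeries.X ^ M) * PowerSeries.mk f), ?_, ?_⟩
  · ext n
    rw [Polynomial.coeff_coe, PowerSeries.coeff_trunc]
    split_ifs with h
    · rfl
    · push Not at h
      rw [hco, if_pos (by omega), hf n (by omega), hf (n - M) (by omega), Nat.cast_sub (by omega)]
      simp
  · rw [PowerSeries.trunc_apply, Polynomial.eval_finsetSum]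
    simp only [Polynomial.eval_monomial, one_pow, mul_one, hco]
    rw [Finset.sum_sub_distrib, Nat.Ico_zero_eq_range]
    have h1 : ∑ n ∈ Finset.range (N + M), (if M ≤ n then f (n - M) else 0) =
        ∑ n ∈ Finset.range N, f n := by
      rw [add_comm, Finset.sum_range_add]
      rw [Finset.sum_eq_zero (fun n hn => if_neg (by simpa using hn)), zero_add]
      refine Finset.sum_congr rfl fun n _ => ?_
      simp
    rw [h1, Finset.sum_range_add, add_sub_cancel_left]
    have h2 : ∀ n ∈ Finset.range M, f (N + n) = if n = (d - N : ZMod M).val then c else 0 := by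
      intro n hn
      rw [hf _ (by omega)]
      congr 1
      rw [eq_iff_iff]
      constructor
      · intro h
        rw [← h]
        push_cast
        rw [add_sub_cancel_left, ZMod.val_cast_of_lt (by simpa using hn)]
      · intro h
        rw [h]
        push_cast
        rw [ZMod.natCast_val, ZMod.cast_id]
        ring
    rw [Finset.sum_congr rfl h2, Finset.sum_ite_eq' , if_pos]
    simpa using ZMod.val_lt _

namespace OnePlace

universe u v w
variable {k : Type u} {B : Type v} {κ : Type w} [Field k] [CommRing B] [Algebra k B] [Field κ] [Algebra k κ]
  {V : OnePlace k B κ} [IsDedekindDomain B] [Fintype k] [Module.Finite k κ] {a : B} {M : ℕ}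

local notation "δ" => Module.finrank k κ
local notation "q" => Fintype.card k

theorem mem_cop_of_dvd {I J : Ideal B} (hJ : J ∈ cop a) (h : I ∣ J) : I ∈ cop a := by
  obtain ⟨K, rfl⟩ := h
  rw [mul_comm] at hJ
  exact of_mul_mem_cop hJ

theorem dg_of_rel {I J : Ideal B} (hI : I ≠ ⊥) (hJ : J ≠ ⊥) (h : V.rel a M I J) :
    (V.dg I : ZMod (δ * M)) = V.dg J := by
  obtain ⟨x, y, hx, hy, -, -, -, hn, h⟩ := h
  have h1 := congrArg V.dg h
  rw [V.dg_mul (by simpa using hx) hI, V.dg_mul (by simpa using hy) hJ, V.dg_span hx,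
    V.dg_span hy] at h1
  have h2 := hn.mul_left' δ
  rw [← ZMod.natCast_eq_natCast_iff] at h2
  have h3 := congrArg (Nat.cast : ℕ → ZMod (δ * M)) h1
  rw [mul_comm (V.ν x), mul_comm (V.ν y)] at h3
  rw [Nat.cast_add, Nat.cast_add, h2] at h3
  exact add_left_cancel h3

theorem exists_rayClass (V : OnePlace k B κ) (ha : a ≠ 0) (hM : 0 < M) : ∃ (G : Type v) (_ : AddCommGroup G) (_ : Fintype G),
    Nonempty (V.RayClass a M G) := by
  classical
  have hrel : ∀ I J : cop a, ((I : (V.relCon a M).Quotient) = J) ↔ V.rel a M I J :=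
    fun I J => Con.eq _
  have hinv : ∀ x : (V.relCon a M).Quotient, ∃ J : cop a,
      x * (J : (V.relCon a M).Quotient) = 1 ∧
      V.dg (J : Ideal B) ≤ V.dg (Ideal.span {a}) + (2 * V.n₀ + 1) * δ + M * δ := by
    intro x
    induction x using Con.induction_on with
    | H I =>
      obtain ⟨J, hJ, z, h1, h2, h3, h4, -, h5⟩ := V.exists_inv ha hM I.2
      refine ⟨⟨J, hJ⟩, ?_, h5⟩
      have h6 : V.rel a M ((I * ⟨J, hJ⟩ : cop a) : Ideal B) ((1 : cop a) : Ideal B) :=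
        (V.rel_one_iff ((cop a).mul_mem I.2 hJ)).2 ⟨z, h1, h2, h3, h4⟩
      exact (hrel _ _).2 h6
  let _ : CommGroup (V.relCon a M).Quotient :=
    commGroupOfIsUnit fun x => by
      obtain ⟨J, hJ, -⟩ := hinv x
      exact .of_mul_eq_one _ hJ
  have hfin : Finite (V.relCon a M).Quotient := by
    have hf := V.finite_dg_le (V.dg (Ideal.span {a}) + (2 * V.n₀ + 1) * δ + M * δ)
    set T := {J : cop a | V.dg (J : Ideal B) ≤ V.dg (Ideal.span {a}) + (2 * V.n₀ + 1) * δ + M * δ}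
    have hT : T.Finite := by
      refine Set.Finite.of_finite_image (f := Subtype.val) (hf.subset ?_)
        Subtype.val_injective.injOn
      rintro _ ⟨J, hJ, rfl⟩
      exact ⟨J.2.1, hJ⟩
    have := hT.to_subtype
    refine Finite.of_surjective (fun J : T => ((J : cop a) : (V.relCon a M).Quotient)) fun x => ?_
    obtain ⟨J, hJ, h⟩ := hinv x⁻¹
    exact ⟨⟨J, h⟩, (inv_mul_eq_one.1 hJ).symm⟩
  let _ : Fintype (V.relCon a M).Quotient := Fintype.ofFinite _
  refine ⟨Additive (V.relCon a M).Quotient, inferInstance, inferInstance, ⟨{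
    cls := fun I => if h : I ∈ cop a then Additive.ofMul (((⟨I, h⟩ : cop a) : (V.relCon a M).Quotient)) else 0
    cls_mul := ?_
    cls_iff := ?_
    cls_surj := ?_ }⟩⟩
  · intro I hI J hJ
    rw [dif_pos hI, dif_pos hJ, dif_pos ((cop a).mul_mem hI hJ)]
    rfl
  · intro I hI J hJ
    rw [dif_pos hI, dif_pos hJ]
    exact hrel _ _
  · intro g
    obtain ⟨I, hI⟩ := Con.mk'_surjective (c := V.relCon a M) g.toMul
    refine ⟨I, I.2, ?_⟩
    rw [dif_pos I.2]
    exact congrArg Additive.ofMul hI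

namespace RayClass

variable {G : Type*} [AddCommGroup G] [Fintype G] [DecidableEq G] (R : V.RayClass a M G)

theorem cls_one : R.cls 1 = 0 := by
  have := R.cls_mul 1 (cop a).one_mem 1 (cop a).one_mem
  rw [one_mul] at this
  simpa using this

theorem cls_pow {I : Ideal B} (hI : I ∈ cop a) (n : ℕ) : R.cls (I ^ n) = n • R.cls I := by
  induction n with
  | zero => rw [pow_zero, R.cls_one, zero_smul]
  | succ n ih => rw [pow_succ, R.cls_mul _ ((cop a).pow_mem hI n) _ hI, ih, succ_nsmul]

theorem exists_deg : ∃ deg : G →+ ZMod (δ * M), ∀ I ∈ cop a, deg (R.cls I) = V.dg I := by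
  choose f hf hfc using R.cls_surj
  have h : ∀ I ∈ cop a, (V.dg (f (R.cls I)) : ZMod (δ * M)) = V.dg I := fun I hI =>
    dg_of_rel (hf _).1 hI.1 ((R.cls_iff _ (hf _) _ hI).1 (hfc _))
  refine ⟨AddMonoidHom.mk' (fun g => (V.dg (f g) : ZMod (δ * M))) fun g g' => ?_, h⟩
  have h1 := h _ ((cop a).mul_mem (hf g) (hf g'))
  rw [R.cls_mul _ (hf g) _ (hf g'), hfc, hfc, V.dg_mul (hf g).1 (hf g').1, Nat.cast_add] at h1
  exact h1

theorem cnt_eq (ha : a ≠ 0) {deg : G →+ ZMod (δ * M)} (hdeg : ∀ I ∈ cop a, deg (R.cls I) = V.dg I) (g : G) :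
    ∃ N, ∀ n : ℕ, N ≤ n → (n : ZMod (δ * M)) = deg g →
      R.cnt g n * q ^ (V.dg (Ideal.span {a}) + (1 + V.n₀) * δ) = q ^ (V.r V.n₀ + n) := by
  obtain ⟨J, hJ, hJg⟩ := R.cls_surj (-g)
  refine ⟨V.dg (J * Ideal.span {a}) + (2 * V.n₀ + 1) * δ + 1, fun n hn hng => ?_⟩
  have h1 : ((n + V.dg J : ℕ) : ZMod (δ * M)) = 0 := by
    rw [Nat.cast_add, hng, ← hdeg J hJ, hJg, map_neg, add_neg_cancel]
  rw [ZMod.natCast_eq_zero_iff] at h1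
  obtain ⟨l, hl⟩ := h1
  have hl' : n + V.dg J = (M * l) * δ := by rw [hl]; ring
  have := V.card_rel ha hJ hl' (dvd_mul_right M l) (by rw [← hl']; omega)
  rw [← this]
  congr 1
  rw [cnt, Nat.subtype_card]
  intro I
  rw [Finset.mem_filter, mem_idl]
  have h2 : I ∈ cop a → (R.cls I = g ↔ V.rel a M (I * J) 1) := by
    intro hI
    have h3 : J * 1 ∈ cop a := by rwa [mul_one]
    rw [← R.cls_iff _ ((cop a).mul_mem hI hJ) _ (cop a).one_mem, R.cls_mul _ hI _ hJ, hJg, R.cls_one,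
      ← sub_eq_add_neg, sub_eq_zero]
  tauto

theorem exists_prime_cop (ha : a ≠ 0) (V : OnePlace k B κ) : ∃ P ∈ cop a, Prime P := by
  obtain ⟨J, hJ, z, h1, -, -, -, h2, -⟩ := V.exists_inv ha one_pos (cop a).one_mem
  rw [one_mul] at h1
  have hJ1 : ¬ IsUnit J := by
    rw [h1, Ideal.isUnit_iff, Ideal.span_singleton_eq_top, V.isUnit_iff]
    omega
  obtain ⟨P, hP, hPJ⟩ := WfDvdMonoid.exists_irreducible_factor hJ1 hJ.1
  exact ⟨P, mem_cop_of_dvd hJ hPJ, hP.prime⟩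

theorem exists_zetaData (ha : a ≠ 0) (hM : 0 < M) :
    ∃ Z : ZetaData G (δ * M), Z.Λ = fun g n => (R.lam g n : ℝ) / (q : ℝ) ^ n := by
  have hδ : 0 < δ := Module.finrank_pos
  have hq : (0 : ℝ) < q := by exact_mod_cast Fintype.card_pos
  have : NeZero (δ * M) := ⟨(Nat.mul_pos hδ hM).ne'⟩
  obtain ⟨deg, hdeg⟩ := R.exists_deg
  obtain ⟨C, hC⟩ := V.exists_card_dg_eq
  set c : ℝ := (q : ℝ) ^ V.r V.n₀ / (q : ℝ) ^ (V.dg (Ideal.span {a}) + (1 + V.n₀) * δ) with hc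
  have hdeg' : ∀ g n, R.cnt g n ≠ 0 → (n : ZMod (δ * M)) = deg g := by
    intro g n h
    obtain ⟨I, hI⟩ := Finset.card_ne_zero.1 h
    rw [Finset.mem_filter, mem_idl] at hI
    rw [← hI.2, hdeg I hI.1.1, hI.1.2]
  have hE : ∀ g, ∃ E : Polynomial ℝ, (1 - PowerSeries.X ^ (δ * M)) *
      PowerSeries.mk (fun n => (R.cnt g n : ℝ) / (q : ℝ) ^ n) = (E : PowerSeries ℝ) ∧
      E.eval 1 = c := by
    intro g
    obtain ⟨N, hN⟩ := R.cnt_eq ha hdeg g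
    refine PowerSeries.exists_polynomial_of_eventually_periodic _ c (deg g) N fun n hn => ?_
    split_ifs with h
    · have h1 := congrArg (Nat.cast : ℕ → ℝ) (hN n hn h)
      push_cast at h1
      rw [hc, div_eq_div_iff (by positivity) (by positivity), h1, pow_add]
    · have : R.cnt g n = 0 := by
        by_contra h'
        exact h (hdeg' g n h')
      simp [this]
  choose E hE1 hE2 using hE
  have h0 : ∀ I ∈ idl V a 0, I = 1 := fun I hI =>
    (V.dg_eq_zero_iff (mem_idl.1 hI).1.1).1 (mem_idl.1 hI).2
  refine ⟨{
    deg := deg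
    e := fun g n => (R.cnt g n : ℝ) / (q : ℝ) ^ n
    Λ := fun g n => (R.lam g n : ℝ) / (q : ℝ) ^ n
    E := E
    c := c
    bd := C
    c_pos := by positivity
    M_pos := Nat.mul_pos hδ hM
    deg_eq := fun g n h => hdeg' g n fun h' => h (by simp [h'])
    e_nonneg := fun g n => by positivity
    e_le := ?_
    e_zero := ?_
    e_zero_zero := ?_
    E_spec := hE1
    E_eval := hE2
    Λ_nonneg := fun g n => by positivity
    euler := ?_
    infinite_Λ := ?_ }, rfl⟩
  · intro g n
    rw [div_le_iff₀ (by positivity)]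
    have h1 : R.cnt g n ≤ {I : Ideal B | I ≠ ⊥ ∧ V.dg I = n}.ncard := by
      rw [cnt, ← Set.ncard_coe_finset]
      refine Set.ncard_le_ncard ?_ ((V.finite_dg_le n).subset fun I hI => ⟨hI.1, hI.2.le⟩)
      intro I hI
      have := (mem_idl.1 (Finset.mem_filter.1 (Finset.mem_coe.1 hI)).1)
      exact ⟨this.1.1, this.2⟩
    exact_mod_cast h1.trans (hC n)
  · intro g hg
    have : R.cnt g 0 = 0 := by
      rw [cnt, Finset.card_eq_zero, Finset.filter_eq_empty_iff]
      intro I hI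
      rw [h0 I hI, R.cls_one]
      exact Ne.symm hg
    simp [this]
  · have : R.cnt 0 0 = 1 := by
      rw [cnt, Finset.card_eq_one]
      refine ⟨1, ?_⟩
      ext I
      rw [Finset.mem_filter, Finset.mem_singleton]
      constructor
      · exact fun h => h0 I h.1
      · rintro rfl
        exact ⟨mem_idl.2 ⟨(cop a).one_mem, V.dg_one⟩, R.cls_one⟩
    simp [this]
  · intro g n
    have h1 := congrArg (Nat.cast : ℕ → ℝ) (R.euler g n)
    push_cast at h1
    rw [← mul_div_assoc, h1, Finset.sum_div]
    refine Finset.sum_congr rfl fun p hp => ?_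
    rw [Finset.sum_div]
    refine Finset.sum_congr rfl fun h _ => ?_
    rw [Finset.HasAntidiagonal.mem_antidiagonal] at hp
    rw [← hp, pow_add, mul_div_mul_comm]
  · intro N
    obtain ⟨P, hPc, hP⟩ := exists_prime_cop ha V
    have hP1 : 0 < V.dg P := V.dg_pos hPc.1 fun h => hP.not_isUnit (by simp [h])
    have hG : 0 < Fintype.card G := Fintype.card_pos
    have hm : 0 < Fintype.card G * (N + 1) := by positivity
    have hIc := (cop a).pow_mem hPc (Fintype.card G * (N + 1))
    refine ⟨V.dg (P ^ (Fintype.card G * (N + 1))), ?_, ?_⟩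
    · rw [V.dg_pow hPc.1]
      nlinarith [Nat.mul_le_mul hG hP1, Nat.mul_le_mul_right (N + 1) (Nat.mul_le_mul hG hP1)]
    · refine div_pos ?_ (by positivity)
      rw [Nat.cast_pos, lam]
      refine Finset.sum_pos' (fun _ _ => Nat.zero_le _)
        ⟨P ^ (Fintype.card G * (N + 1)), Finset.mem_filter.2 ⟨mem_idl.2 ⟨hIc, rfl⟩, ?_⟩, ?_⟩
      · rw [R.cls_pow hPc, mul_comm, mul_smul, card_nsmul_eq_zero, smul_zero]
      · rw [V.vM_pow hP hm]
        exact hP1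

end RayClass
end OnePlace

open Filter Topology in
/-- An Abelian comparison of an Abel mean with partial sums. -/
theorem abel_limit_le {f : ℕ → ℝ} (hf : ∀ n, 0 ≤ f n) {c C : ℝ}
    (h : ∀ X : ℕ, ∑ n ∈ Finset.range (X + 1), f n ≤ c * X + C) {l : ℝ}
    (hl : Tendsto (fun z : ℝ => (1 - z) * ∑' n, f n * z ^ n) (𝓝[<] 1) (𝓝 l)) : l ≤ c := by
  have hfn : ∀ n : ℕ, f n ≤ c * n + C := fun n =>
    (Finset.single_le_sum (f := f) (fun i _ => hf i) (Finset.self_mem_range_succ n)).trans (h n)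
  have hg : Tendsto (fun z : ℝ => c * z + C * (1 - z)) (𝓝[<] 1) (𝓝 c) := by
    have : Tendsto (fun z : ℝ => c * z + C * (1 - z)) (𝓝 1) (𝓝 (c * 1 + C * (1 - 1))) :=
      (Continuous.tendsto (by fun_prop) 1)
    simp only [mul_one, sub_self, mul_zero, add_zero] at this
    exact this.mono_left nhdsWithin_le_nhds
  refine le_of_tendsto_of_tendsto hl hg ?_
  filter_upwards [Ioo_mem_nhdsLT (show (0 : ℝ) < 1 by norm_num)] with z hz
  have hz1 : ‖z‖ < 1 := by rw [Real.norm_of_nonneg hz.1.le]; exact hz.2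
  have s0 : HasSum (fun n : ℕ => z ^ n) (1 - z)⁻¹ := hasSum_geometric_of_norm_lt_one hz1
  have s1 : HasSum (fun n : ℕ => (n : ℝ) * z ^ n) (z / (1 - z) ^ 2) :=
    hasSum_coe_mul_geometric_of_norm_lt_one hz1
  have s2 := (s1.mul_left c).add (s0.mul_left C)
  have hsf : Summable fun n => f n * z ^ n := by
    refine Summable.of_nonneg_of_le (fun n => mul_nonneg (hf n) (pow_nonneg hz.1.le _)) ?_ s2.summable
    intro n
    have := mul_le_mul_of_nonneg_right (hfn n) (pow_nonneg hz.1.le n)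
    linarith
  have hprod := tsum_mul_tsum_eq_tsum_sum_range_of_summable_norm (f := fun n => f n * z ^ n) (g := fun n => z ^ n) hsf.norm s0.summable.norm
  have hterm : ∀ n, ∑ i ∈ Finset.range (n + 1), f i * z ^ i * z ^ (n - i) =
      (∑ i ∈ Finset.range (n + 1), f i) * z ^ n := by
    intro n
    rw [Finset.sum_mul]
    refine Finset.sum_congr rfl fun i hi => ?_
    rw [mul_assoc, ← pow_add, Nat.add_sub_cancel' (by simp at hi; omega)]
  simp only [hterm] at hprod
  have hle : ∀ n, (∑ i ∈ Finset.range (n + 1), f i) * z ^ n ≤ c * (n * z ^ n) + C * z ^ n := by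
    intro n
    have := mul_le_mul_of_nonneg_right (h n) (pow_nonneg hz.1.le n)
    linarith
  have hs3 : Summable fun n => (∑ i ∈ Finset.range (n + 1), f i) * z ^ n :=
    Summable.of_nonneg_of_le (fun n => mul_nonneg (Finset.sum_nonneg fun i _ => hf i) (pow_nonneg hz.1.le _)) hle s2.summable
  have h4 := hs3.tsum_le_tsum hle s2.summable
  rw [← hprod, s0.tsum_eq, s2.tsum_eq] at h4
  have h1z : 0 < 1 - z := by linarith [hz.2]
  have h5 : (1 - z) ^ 2 * ((∑' n, f n * z ^ n) * (1 - z)⁻¹) = (1 - z) * ∑' n, f n * z ^ n := by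
    field_simp
  have h6 : (1 - z) ^ 2 * (c * (z / (1 - z) ^ 2) + C * (1 - z)⁻¹) = c * z + C * (1 - z) := by
    field_simp
  rw [← h5, ← h6]
  exact mul_le_mul_of_nonneg_left h4 (by positivity)

namespace OnePlace
namespace RayClass

variable {k B κ : Type*} [Field k] [CommRing B] [Algebra k B] [Field κ] [Algebra k κ]
  {V : OnePlace k B κ} [IsDedekindDomain B] [Fintype k] [Module.Finite k κ] {a : B} {M : ℕ}
  {G : Type*} [AddCommGroup G] [Fintype G] [DecidableEq G] (R : V.RayClass a M G)

local notation "δ" => Module.finrank k κ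
local notation "q" => Fintype.card k

open Classical in
theorem exists_sum_not_prime_le (V : OnePlace k B κ) (a : B) : ∃ C : ℝ, 0 ≤ C ∧ ∀ n,
    ((∑ I ∈ (idl V a n).filter fun I => ¬ Prime I, V.vM I : ℕ) : ℝ) / (q : ℝ) ^ n ≤
      C * (n * (3 / 4) ^ n) := by
  obtain ⟨C, hC⟩ := V.exists_card_dg_le
  refine ⟨C, by positivity, fun n => ?_⟩
  have hq : 2 ≤ q := Fintype.one_lt_card
  rcases Nat.eq_zero_or_pos n with rfl | hn
  · have : ∑ I ∈ (idl V a 0).filter fun I => ¬ Prime I, V.vM I = 0 := by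
      refine Finset.sum_eq_zero fun I hI => ?_
      obtain ⟨h1, h2⟩ := mem_idl.1 (Finset.mem_filter.1 hI).1
      rw [vM, dif_neg]
      rintro ⟨P, hP, m, hm, rfl⟩
      rw [V.dg_pow hP.ne_zero] at h2
      have hP1 : 0 < V.dg P := V.dg_pos hP.ne_zero fun h => hP.not_isUnit (by simp [h])
      have := Nat.mul_pos hm hP1
      omega
    simp [this]
  set S := (idl V a n).filter fun I => ¬ Prime I with hS
  set S' := S.filter fun I => V.vM I ≠ 0 with hS'
  have hprop : ∀ I ∈ S', ∃ P : Ideal B, Prime P ∧ ∃ m, 2 ≤ m ∧ I = P ^ m ∧ m * V.dg P = n := by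
    intro I hI
    rw [hS', Finset.mem_filter, hS, Finset.mem_filter, mem_idl] at hI
    obtain ⟨⟨⟨h1, h2⟩, h3⟩, h4⟩ := hI
    have : ∃ P : Ideal B, Prime P ∧ ∃ m, 0 < m ∧ I = P ^ m := by
      by_contra h
      exact h4 (by rw [vM, dif_neg h])
    obtain ⟨P, hP, m, hm, rfl⟩ := this
    refine ⟨P, hP, m, ?_, rfl, ?_⟩
    · by_contra! h
      obtain rfl : m = 1 := by omega
      exact h3 (by simpa using hP)
    · rw [← h2, V.dg_pow hP.ne_zero]
  choose! f hf m hm hfm hfn using hprop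
  have hcard : S'.card ≤ C * q ^ (n / 2) := by
    refine le_trans ?_ (hC (n / 2))
    rw [← Set.ncard_coe_finset]
    refine Set.ncard_le_ncard_of_injOn f ?_ ?_ (V.finite_dg_le _)
    · intro I hI
      refine ⟨(hf I hI).ne_zero, ?_⟩
      have := Nat.mul_le_mul_right (V.dg (f I)) (hm I hI)
      rw [hfn I hI] at this
      omega
    · intro I hI J hJ h
      have hI := Finset.mem_coe.1 hI
      have hJ := Finset.mem_coe.1 hJ
      have h1 := hfn I hI
      rw [h, ← hfn J hJ] at h1
      have hP1 : 0 < V.dg (f J) := V.dg_pos (hf J hJ).ne_zero fun h => (hf J hJ).not_isUnit (by simp [h])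
      have h2 := Nat.eq_of_mul_eq_mul_right hP1 h1
      rw [hfm I hI, hfm J hJ, h, h2]
  have hsum : ∑ I ∈ S, V.vM I ≤ C * q ^ (n / 2) * n := by
    rw [← Finset.sum_filter_ne_zero]
    calc ∑ I ∈ S', V.vM I ≤ S'.card • n := Finset.sum_le_card_nsmul _ _ _ fun I hI => ?_
      _ ≤ _ := by rw [smul_eq_mul]; exact Nat.mul_le_mul_right _ hcard
    rw [hfm I hI, V.vM_pow (hf I hI) (by have := hm I hI; omega)]
    have := Nat.mul_le_mul_right (V.dg (f I)) (hm I hI)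
    rw [hfn I hI] at this
    omega
  have hq0 : (0 : ℝ) < q := by positivity
  have hq2 : (2 : ℝ) ≤ q := by exact_mod_cast hq
  rw [div_le_iff₀ (by positivity)]
  have hkey : (q : ℝ) ^ (n / 2) ≤ (3 / 4 : ℝ) ^ n * (q : ℝ) ^ n := by
    obtain ⟨h, hh⟩ : ∃ h, n = n / 2 + h := ⟨n - n / 2, by omega⟩
    have h2 : n ≤ 2 * h := by omega
    have e1 : (1 : ℝ) ≤ (3 / 4 : ℝ) ^ n * (q : ℝ) ^ h := by
      calc (1 : ℝ) ≤ (9 / 8) ^ h := one_le_pow₀ (by norm_num)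
        _ = (3 / 4) ^ (2 * h) * 2 ^ h := by rw [pow_mul, ← mul_pow]; norm_num
        _ ≤ _ := mul_le_mul (pow_le_pow_of_le_one (by norm_num) (by norm_num) h2)
            (pow_le_pow_left₀ (by norm_num) hq2 _) (by positivity) (by positivity)
    calc (q : ℝ) ^ (n / 2) = 1 * (q : ℝ) ^ (n / 2) := by ring
      _ ≤ ((3 / 4 : ℝ) ^ n * (q : ℝ) ^ h) * (q : ℝ) ^ (n / 2) :=
        mul_le_mul_of_nonneg_right e1 (by positivity)
      _ = (3 / 4 : ℝ) ^ n * (q : ℝ) ^ (n / 2 + h) := by rw [pow_add]; ring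
      _ = _ := by rw [← hh]
  calc ((∑ I ∈ S, V.vM I : ℕ) : ℝ) ≤ ((C * q ^ (n / 2) * n : ℕ) : ℝ) := by exact_mod_cast hsum
    _ = C * n * (q : ℝ) ^ (n / 2) := by push_cast; ring
    _ ≤ C * n * ((3 / 4 : ℝ) ^ n * (q : ℝ) ^ n) := mul_le_mul_of_nonneg_left hkey (by positivity)
    _ = _ := by ring

theorem exists_sum_le_geom : ∃ D : ℝ, ∀ X : ℕ,
    ∑ n ∈ Finset.range (X + 1), (n * (3 / 4) ^ n : ℝ) ≤ D := by
  have hs : Summable fun n : ℕ => (n * (3 / 4) ^ n : ℝ) :=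
    (hasSum_coe_mul_geometric_of_norm_lt_one (by norm_num)).summable
  exact ⟨_, fun X => hs.sum_le_tsum _ fun i _ => by positivity⟩

/-- Dirichlet's theorem: every ray class contains a prime. -/
theorem exists_prime (ha : a ≠ 0) (hM : 0 < M) (g : G) : ∃ P ∈ cop a, Prime P ∧ R.cls P = g := by
  classical
  obtain ⟨Z, hZ⟩ := R.exists_zetaData ha hM
  obtain ⟨C, hC0, hC⟩ := exists_sum_not_prime_le V a
  obtain ⟨D, hD⟩ := exists_sum_le_geom
  by_contra! hno
  have h1 : ∀ n, Z.Λ g n ≤ C * (n * (3 / 4) ^ n) := by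
    intro n
    rw [hZ]
    refine le_trans ?_ (hC n)
    refine div_le_div_of_nonneg_right ?_ (by positivity)
    rw [Nat.cast_le, lam]
    refine Finset.sum_le_sum_of_subset fun I hI => ?_
    rw [Finset.mem_filter] at hI ⊢
    exact ⟨hI.1, fun h => hno I (mem_idl.1 hI.1).1 h hI.2⟩
  have h2 := abel_limit_le (f := Z.Λ g) (c := 0) (C := C * D) (Z.Λ_nonneg g)
    (fun X => by
      rw [zero_mul, zero_add]
      refine (Finset.sum_le_sum fun n _ => h1 n).trans ?_
      rw [← Finset.mul_sum]
      exact mul_le_mul_of_nonneg_left (hD X) hC0) (Z.tendsto_Λ g)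
  have : (0 : ℝ) < (Fintype.card G : ℝ)⁻¹ := by
    have : 0 < Fintype.card G := Fintype.card_pos
    positivity
  linarith

end RayClass

open RayClass in
open Classical in
/-- A weak form of the prime number theorem. -/
theorem exists_sum_prime_gt {k B κ : Type*} [Field k] [CommRing B] [Algebra k B] [Field κ] [Algebra k κ]
    (V : OnePlace k B κ) [IsDedekindDomain B] [Fintype k] [Module.Finite k κ] {a : B} (ha : a ≠ 0)
    {c : ℝ} (hc : c < 1) (C : ℝ) :
    ∃ X : ℕ, c * X + C < ∑ n ∈ Finset.range (X + 1),
      (n * ((idl V a n).filter fun I => Prime I).card : ℝ) / (Fintype.card k : ℝ) ^ n := by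
  obtain ⟨G, hG1, hG2, ⟨R⟩⟩ := exists_rayClass V ha one_pos
  obtain ⟨Z, hZ⟩ := R.exists_zetaData ha one_pos
  obtain ⟨C', hC0, hC⟩ := exists_sum_not_prime_le V a
  obtain ⟨D, hD⟩ := exists_sum_le_geom
  by_contra! hno
  have h1 : ∀ n, ∑ g, Z.Λ g n ≤
      (n * ((idl V a n).filter fun I => Prime I).card : ℝ) / (Fintype.card k : ℝ) ^ n +
        C' * (n * (3 / 4) ^ n) := by
    intro n
    refine le_trans ?_ (add_le_add_right (hC n) _)
    rw [hZ, ← Finset.sum_div, ← add_div]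
    refine div_le_div_of_nonneg_right ?_ (by positivity)
    rw [← Nat.cast_sum]
    have : ∑ g, R.lam g n = ∑ I ∈ idl V a n, V.vM I :=
      Finset.sum_fiberwise (idl V a n) R.cls V.vM
    rw [this, ← Finset.sum_filter_add_sum_filter_not (idl V a n) (fun I => Prime I)]
    push_cast
    refine add_le_add_left ?_ _
    rw [mul_comm, ← nsmul_eq_mul]
    refine Finset.sum_le_card_nsmul _ _ _ fun I hI => ?_
    rw [Finset.mem_filter, mem_idl] at hI
    have := V.vM_pow hI.2 one_pos
    rw [pow_one] at this
    rw [this, hI.1.2]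
  have h2 := abel_limit_le (f := fun n => ∑ g, Z.Λ g n) (c := c) (C := C + C' * D)
    (fun n => Finset.sum_nonneg fun g _ => Z.Λ_nonneg g n)
    (fun X => by
      refine (Finset.sum_le_sum fun n _ => h1 n).trans ?_
      rw [Finset.sum_add_distrib, ← Finset.mul_sum, ← add_assoc]
      exact add_le_add (hno X) (mul_le_mul_of_nonneg_left (hD X) hC0)) (l := 1) (by
      have h3 := tendsto_finsetSum Finset.univ fun g _ => Z.tendsto_Λ g
      have h4 : ∑ _g : G, (Fintype.card G : ℝ)⁻¹ = 1 := by
        have : (0 : ℝ) < Fintype.card G := by exact_mod_cast Fintype.card_pos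
        simp [this.ne']
      rw [h4] at h3
      refine h3.congr' ?_
      filter_upwards [Ioo_mem_nhdsLT (show (0 : ℝ) < 1 by norm_num)] with z hz
      rw [← Finset.mul_sum]
      congr 1
      rw [← Summable.tsum_finsetSum fun g _ => Z.summable_Λ g hz.1.le hz.2]
      simp [Finset.sum_mul])
  linarith

end OnePlace

open Polynomial in
/-- Over a finite field there is, in each positive degree `g`, an irreducible polynomial with `g`
roots in every finite extension of degree divisible by `g`. -/
theorem FiniteField.exists_irreducible_card_roots {k : Type*} [Field k] [Finite k] {g : ℕ}
    (hg : 0 < g) : ∃ m : k[X], m.Monic ∧ Irreducible m ∧ m.natDegree = g ∧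
      ∀ (L : Type*) [CommRing L] [IsDomain L] [Finite L] [Algebra k L], g ∣ Module.finrank k L →
        ∃ s : Finset L, s.card = g ∧ ∀ θ ∈ s, aeval θ m = 0 := by
  classical
  obtain ⟨p, hp⟩ := CharP.exists k
  have : Fact p.Prime := ⟨CharP.char_is_prime k p⟩
  have : NeZero g := ⟨hg.ne'⟩
  have hfr := FiniteField.finrank_extension k p g
  have : FiniteDimensional k (FiniteField.Extension k p g) :=
    Module.finite_of_finrank_pos (by rw [hfr]; exact hg)
  let pb := Field.powerBasisOfFiniteOfSeparable k (FiniteField.Extension k p g)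
  have h_int : IsIntegral k pb.gen := pb.isIntegral_gen
  refine ⟨minpoly k pb.gen, minpoly.monic h_int, minpoly.irreducible h_int, ?_, ?_⟩
  · rw [pb.natDegree_minpoly, ← pb.finrank, hfr]
  intro L _ _ _ _ hL
  let _ : Field L := (Finite.isField_of_domain L).toField
  have hc := FiniteField.natCard_algHom_of_finrank_dvd (F := k) (K := FiniteField.Extension k p g)
    (L := L) (by rw [hfr]; exact hL)
  rw [hfr] at hc
  have hf : Finite (FiniteField.Extension k p g →ₐ[k] L) :=
    Nat.finite_of_card_ne_zero (by rw [hc]; exact hg.ne')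
  have := Fintype.ofFinite (FiniteField.Extension k p g →ₐ[k] L)
  refine ⟨Finset.univ.image fun σ : FiniteField.Extension k p g →ₐ[k] L => σ pb.gen, ?_, ?_⟩
  · rw [Finset.card_image_of_injective, Finset.card_univ, ← Nat.card_eq_fintype_card, hc]
    exact fun σ τ h => pb.algHom_ext h
  · intro θ hθ
    obtain ⟨σ, -, rfl⟩ := Finset.mem_image.1 hθ
    rw [aeval_algHom_apply, minpoly.aeval, map_zero]

namespace Polynomial

variable {k : Type*} [Field k] (m : k[X])

/-- The homogenization of `m`. -/
noncomputable def homEval {R : Type*} [CommRing R] [Algebra k R] (z w : R) : R :=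
  ∑ i ∈ Finset.range (m.natDegree + 1), m.coeff i • (z ^ i * w ^ (m.natDegree - i))

theorem map_homEval {R S : Type*} [CommRing R] [Algebra k R] [CommRing S] [Algebra k S]
    (f : R →ₐ[k] S) (z w : R) : f (m.homEval z w) = m.homEval (f z) (f w) := by
  simp [homEval]

theorem homEval_mul {R : Type*} [CommRing R] [Algebra k R] (θ w : R) :
    m.homEval (θ * w) w = w ^ m.natDegree * aeval θ m := by
  rw [aeval_eq_sum_range, homEval, Finset.mul_sum]
  refine Finset.sum_congr rfl fun i hi => ?_
  have hi : i ≤ m.natDegree := by simpa [Nat.lt_succ_iff] using hi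
  have h : w ^ m.natDegree = w ^ i * w ^ (m.natDegree - i) := by rw [← pow_add]; congr 1; omega
  rw [h, mul_pow, mul_smul_comm]
  congr 1
  ring

theorem homEval_mem_pow {R : Type*} [CommRing R] [Algebra k R] {P : Ideal R} {z w : R}
    (hz : z ∈ P) (hw : w ∈ P) : m.homEval z w ∈ P ^ m.natDegree := by
  refine Ideal.sum_mem _ fun i hi => ?_
  have hi : i ≤ m.natDegree := by simpa [Nat.lt_succ_iff] using hi
  rw [Algebra.smul_def]
  refine Ideal.mul_mem_left _ _ ?_
  have h : P ^ m.natDegree = P ^ i * P ^ (m.natDegree - i) := by rw [← pow_add]; congr 1; omega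
  rw [h]
  exact Ideal.mul_mem_mul (Ideal.pow_mem_pow hz _) (Ideal.pow_mem_pow hw _)

end Polynomial

namespace OnePlace

variable {k B κ : Type*} [Field k] [CommRing B] [Algebra k B] [Field κ] [Algebra k κ]
  (V : OnePlace k B κ)

open Polynomial

theorem ν_mul_le (y z : B) : V.ν (y * z) ≤ V.ν y + V.ν z := by
  rcases eq_or_ne y 0 with rfl | hy
  · simp [V.ν_zero]
  rcases eq_or_ne z 0 with rfl | hz
  · simp [V.ν_zero]
  exact (V.ν_mul y z hy hz).le

theorem ν_pow_le (y : B) (n : ℕ) : V.ν (y ^ n) ≤ n * V.ν y := by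
  induction n with
  | zero => simp [V.ν_one]
  | succ n ih =>
    rw [pow_succ]
    have := V.ν_mul_le (y ^ n) y
    linarith

theorem homEval_mem_L (m : k[X]) {n : ℕ} {z w : B} (hz : V.ν z ≤ n) (hw : V.ν w ≤ n) :
    V.ν (m.homEval z w) ≤ m.natDegree * n := by
  refine (V.mem_L).1 (Submodule.sum_mem _ fun i hi => Submodule.smul_mem _ _ ?_)
  have hi : i ≤ m.natDegree := by simpa [Nat.lt_succ_iff] using hi
  rw [V.mem_L]
  refine (V.ν_mul_le _ _).trans ?_
  have h1 := (V.ν_pow_le z i).trans (Nat.mul_le_mul_left i hz)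
  have h2 := (V.ν_pow_le w (m.natDegree - i)).trans (Nat.mul_le_mul_left _ hw)
  calc _ ≤ i * n + (m.natDegree - i) * n := add_le_add h1 h2
    _ = m.natDegree * n := by rw [← add_mul]; congr 1; omega

include V in
theorem homEval_ne_zero [IsDedekindDomain B] {m : k[X]} (hm : Irreducible m) (hmo : m.Monic)
    (hd : 2 ≤ m.natDegree) {z w : B} (h : z ≠ 0 ∨ w ≠ 0) : m.homEval z w ≠ 0 := by
  intro h0
  rcases eq_or_ne w 0 with rfl | hw
  · have hz : z ≠ 0 := by simpa using h
    rw [homEval, Finset.sum_range_succ, Finset.sum_eq_zero] at h0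
    · rw [Nat.sub_self, pow_zero, mul_one, zero_add, hmo.coeff_natDegree, one_smul] at h0
      exact hz (pow_eq_zero_iff (by omega) |>.1 h0)
    · intro i hi
      rw [Finset.mem_range] at hi
      rw [zero_pow (by omega), mul_zero, smul_zero]
  have hw' : algebraMap B (FractionRing B) w ≠ 0 := by simpa using hw
  have h1 : m.homEval (algebraMap B (FractionRing B) z) (algebraMap B (FractionRing B) w) = 0 := by
    have := m.map_homEval (IsScalarTower.toAlgHom k B (FractionRing B)) z w
    rw [h0, map_zero] at this
    exact this.symm
  rw [← div_mul_cancel₀ (algebraMap B (FractionRing B) z) hw', homEval_mul] at h1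
  have h2 := (mul_eq_zero.1 h1).resolve_left (pow_ne_zero _ hw')
  have h3 : IsIntegral B (algebraMap B (FractionRing B) z / algebraMap B (FractionRing B) w) :=
    IsIntegral.tower_top (R := k) ⟨m, hmo, by rwa [aeval_def] at h2⟩
  obtain ⟨b, hb⟩ := IsIntegrallyClosed.isIntegral_iff.1 h3
  have h4 : aeval b m = 0 := by
    rw [← hb, aeval_algebraMap_apply] at h2
    exact (FaithfulSMul.algebraMap_injective B (FractionRing B)) (by rw [h2, map_zero])
  have hroot : ∀ c : k, ¬ m.IsRoot c := fun c hc => by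
    have := degree_eq_one_of_irreducible_of_root hm hc
    rw [degree_eq_natDegree hm.ne_zero] at this
    have : m.natDegree = 1 := by exact_mod_cast this
    omega
  have h5 : m.coeff 0 ≠ 0 := fun e => hroot 0 (by rw [IsRoot, ← coeff_zero_eq_eval_zero, e])
  have h6 : b * aeval b m.divX = algebraMap k B (-m.coeff 0) := by
    have := congrArg (aeval b) m.divX_mul_X_add
    rw [h4, map_add, map_mul, aeval_X, aeval_C] at this
    rw [map_neg]
    linear_combination this
  have h7 : IsUnit b := by
    refine isUnit_of_mul_isUnit_left (y := aeval b m.divX) ?_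
    rw [h6]
    exact (IsUnit.mk0 _ (neg_ne_zero.2 h5)).map _
  obtain ⟨c, rfl⟩ := V.exists_algebraMap b ((V.isUnit_iff).1 h7).2
  rw [aeval_algebraMap_apply] at h4
  refine hroot c ?_
  have h8 := (FaithfulSMul.algebraMap_injective k B) (h4.trans (map_zero _).symm)
  simpa [IsRoot, aeval_def] using h8

end OnePlace

namespace OnePlace

variable {k B κ : Type*} [Field k] [CommRing B] [Algebra k B] [Field κ] [Algebra k κ]
  (V : OnePlace k B κ) [IsDedekindDomain B] [Fintype k] [Module.Finite k κ]

open Polynomial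

/-- Pairs in `L n` on a line modulo `P` are frequent. -/
theorem card_line_ge (n : ℕ) {P : Ideal B} (hP : P ≠ ⊥) (θ : B ⧸ P) :
    (Fintype.card k : ℝ) ^ (2 * V.r n) ≤
      Nat.card {x : V.L n × V.L n // Ideal.Quotient.mk P (x.1 : B) = θ * Ideal.Quotient.mk P (x.2 : B)}
        * (Fintype.card k : ℝ) ^ V.dg P := by
  have := V.finite_quot hP
  have := V.finite_L n
  let f : (V.L n × V.L n) →ₗ[k] B ⧸ P :=
    (V.toQuot n P).comp (LinearMap.fst k _ _) -
      (LinearMap.mulLeft k θ).comp ((V.toQuot n P).comp (LinearMap.snd k _ _))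
  have hf : ∀ x, x ∈ LinearMap.ker f ↔
      Ideal.Quotient.mk P (x.1 : B) = θ * Ideal.Quotient.mk P (x.2 : B) := by
    intro x
    rw [LinearMap.mem_ker]
    exact sub_eq_zero (a := Ideal.Quotient.mk P (x.1 : B)) (b := θ * Ideal.Quotient.mk P (x.2 : B))
  have h1 := LinearMap.finrank_range_add_finrank_ker f
  have h2 : Module.finrank k (LinearMap.range f) ≤ V.dg P := Submodule.finrank_le _
  have h3 : Module.finrank k (V.L n × V.L n) = 2 * V.r n := by
    rw [Module.finrank_prod, r]; ring
  have h4 : Nat.card {x : V.L n × V.L n //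
      Ideal.Quotient.mk P (x.1 : B) = θ * Ideal.Quotient.mk P (x.2 : B)} =
      Fintype.card k ^ Module.finrank k (LinearMap.ker f) := by
    rw [← Nat.card_eq_fintype_card]
    exact (Nat.card_congr (Equiv.subtypeEquivRight fun x => (hf x).symm)).trans
      (Module.natCard_eq_pow_finrank (K := k) (V := LinearMap.ker f))
  rw [h4]
  push_cast
  rw [← pow_add]
  exact pow_le_pow_right₀ (by exact_mod_cast Fintype.card_pos) (by omega)

open Classical in
include V in
theorem homEval_mem_pow_card {P : Ideal B} (hP : Prime P) {m : k[X]}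
    {s : Finset (B ⧸ P)} (hs : ∀ θ ∈ s, aeval θ m = 0) (hm : s.card = m.natDegree) (z w : B) :
    m.homEval z w ∈
      P ^ (s.filter fun θ => Ideal.Quotient.mk P z = θ * Ideal.Quotient.mk P w).card := by
  have hPp : P.IsPrime := Ideal.isPrime_of_prime hP
  have key : ∀ θ ∈ s, Ideal.Quotient.mk P z = θ * Ideal.Quotient.mk P w → m.homEval z w ∈ P := by
    intro θ hθ h
    have h1 := m.map_homEval (Ideal.Quotient.mkₐ k P) z w
    simp only [Ideal.Quotient.mkₐ_eq_mk] at h1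
    rw [h, Polynomial.homEval_mul, hs θ hθ, mul_zero] at h1
    exact Ideal.Quotient.eq_zero_iff_mem.1 h1
  by_cases hw : w ∈ P
  · by_cases he : (s.filter fun θ => Ideal.Quotient.mk P z = θ * Ideal.Quotient.mk P w) = ∅
    · rw [he]; simp
    obtain ⟨θ, hθ⟩ := Finset.nonempty_iff_ne_empty.2 he
    have hz : z ∈ P := by
      rw [← Ideal.Quotient.eq_zero_iff_mem, (Finset.mem_filter.1 hθ).2,
        Ideal.Quotient.eq_zero_iff_mem.2 hw, mul_zero]
    refine Ideal.pow_le_pow_right ?_ (m.homEval_mem_pow hz hw)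
    rw [← hm]
    exact Finset.card_filter_le _ _
  · have hle : (s.filter fun θ => Ideal.Quotient.mk P z = θ * Ideal.Quotient.mk P w).card ≤ 1 := by
      rw [Finset.card_le_one]
      intro θ hθ θ' hθ'
      have hw' : Ideal.Quotient.mk P w ≠ 0 := by rwa [Ne, Ideal.Quotient.eq_zero_iff_mem]
      exact mul_right_cancel₀ hw' ((Finset.mem_filter.1 hθ).2.symm.trans (Finset.mem_filter.1 hθ').2)
    rcases Nat.le_one_iff_eq_zero_or_eq_one.1 hle with h | h
    · rw [h]; simp
    · rw [h, pow_one]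
      obtain ⟨θ, hθ⟩ := Finset.card_pos.1 (by rw [h]; exact one_pos)
      exact key θ (Finset.mem_filter.1 hθ).1 (Finset.mem_filter.1 hθ).2

theorem sum_dg_le {S : Finset (Ideal B)} (hS : ∀ P ∈ S, Prime P) (e : Ideal B → ℕ) {v : B}
    (hv : v ≠ 0) (h : ∀ P ∈ S, v ∈ P ^ e P) :
    ∑ P ∈ S, V.dg P * e P ≤ V.ν v * Module.finrank k κ := by
  have h1 : ∏ P ∈ S, P ^ e P ∣ Ideal.span {v} := by
    refine Finset.prod_dvd_of_coprime ?_ fun P hP => ?_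
    · intro P hP Q hQ hne
      have := (Ideal.isPrime_of_prime (hS P hP)).isMaximal (hS P hP).ne_zero
      have := (Ideal.isPrime_of_prime (hS Q hQ)).isMaximal (hS Q hQ).ne_zero
      exact (Ideal.isCoprime_of_isMaximal hne).pow
    · exact Ideal.dvd_span_singleton.2 (h P hP)
  have h2 := V.dg_le_of_dvd (by simpa using hv) h1
  rw [V.dg_span hv] at h2
  refine le_trans (le_of_eq ?_) h2
  clear h1 h2 h
  classical
  induction S using Finset.induction_on with
  | empty => rw [Finset.sum_empty, Finset.prod_empty, V.dg_one]
  | insert P S hP ih =>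
    have hP' : P ^ e P ≠ ⊥ := pow_ne_zero _ (hS P (Finset.mem_insert_self _ _)).ne_zero
    have hS' : ∏ P ∈ S, P ^ e P ≠ ⊥ := Finset.prod_ne_zero_iff.2 fun Q hQ =>
      pow_ne_zero _ (hS Q (Finset.mem_insert_of_mem hQ)).ne_zero
    rw [Finset.sum_insert hP, Finset.prod_insert hP, V.dg_mul hP' hS',
      ih fun Q hQ => hS Q (Finset.mem_insert_of_mem hQ),
      V.dg_pow (hS P (Finset.mem_insert_self _ _)).ne_zero, mul_comm]

/-- If all members of a set of primes have degree divisible by `g ≥ 2`, its density is small. -/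
theorem sum_prime_le {g : ℕ} (hg : 2 ≤ g) {S : Finset (Ideal B)} (hS : ∀ P ∈ S, Prime P)
    (hSg : ∀ P ∈ S, g ∣ V.dg P) (n : ℕ) :
    ∑ P ∈ S, (V.dg P : ℝ) / (Fintype.card k : ℝ) ^ V.dg P ≤ n * Module.finrank k κ +
      (∑ P ∈ S, (V.dg P : ℝ)) / (Fintype.card k : ℝ) ^ (2 * V.r n) := by
  classical
  obtain ⟨m, hmo, hm, hmg, hroots⟩ := FiniteField.exists_irreducible_card_roots (k := k)
    (show 0 < g by omega)
  have hex : ∀ P : Ideal B, ∃ s : Finset (B ⧸ P), P ∈ S → s.card = g ∧ ∀ θ ∈ s, aeval θ m = 0 := by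
    intro P
    by_cases hP : P ∈ S
    · have := V.finite_quot (hS P hP).ne_zero
      have hfin : Finite (B ⧸ P) := Module.finite_of_finite k
      have : P.IsPrime := Ideal.isPrime_of_prime (hS P hP)
      obtain ⟨s, hs⟩ := hroots (B ⧸ P) (hSg P hP)
      exact ⟨s, fun _ => hs⟩
    · exact ⟨∅, fun h => absurd h hP⟩
  choose s hs using hex
  have := V.finite_L' n
  have := Fintype.ofFinite (V.L n)
  set Q : ℝ := ((Fintype.card k : ℕ) : ℝ) with hQ
  have hQ0 : 0 < Q := by rw [hQ]; exact_mod_cast Fintype.card_pos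
  set E : Ideal B → V.L n × V.L n → ℕ := fun P x =>
    ((s P).filter fun θ => Ideal.Quotient.mk P (x.1 : B) = θ * Ideal.Quotient.mk P (x.2 : B)).card with hE
  set W : Finset (V.L n × V.L n) := Finset.univ.erase 0 with hW
  have hcard : (Fintype.card (V.L n × V.L n) : ℝ) = Q ^ (2 * V.r n) := by
    rw [Fintype.card_prod, ← Nat.card_eq_fintype_card, V.natCard_L]
    push_cast
    ring
  have hup : ∀ x ∈ W, ∑ P ∈ S, V.dg P * E P x ≤ g * n * Module.finrank k κ := by
    intro x hx
    have hx0 : x ≠ 0 := Finset.ne_of_mem_erase hx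
    have hx' : (x.1 : B) ≠ 0 ∨ (x.2 : B) ≠ 0 := by
      by_contra! h
      exact hx0 (Prod.ext (Subtype.ext h.1) (Subtype.ext h.2))
    have h1 := V.homEval_ne_zero hm hmo (by omega) hx'
    refine (V.sum_dg_le hS (fun P => E P x) h1 fun P hP => ?_).trans ?_
    · exact V.homEval_mem_pow_card (hS P hP) (hs P hP).2 (by rw [(hs P hP).1, hmg]) _ _
    · refine Nat.mul_le_mul_right _ ?_
      rw [← hmg]
      exact V.homEval_mem_L m x.1.2 x.2.2
  have hlow : ∀ P ∈ S, (g : ℝ) * (Q ^ (2 * V.r n) / Q ^ V.dg P - 1) ≤ ∑ x ∈ W, (E P x : ℝ) := by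
    intro P hP
    have h1 : ∑ x ∈ W, (E P x : ℝ) = ∑ θ ∈ s P, ((W.filter fun x : V.L n × V.L n =>
        Ideal.Quotient.mk P (x.1 : B) = θ * Ideal.Quotient.mk P (x.2 : B)).card : ℝ) := by
      have : ∑ x ∈ W, E P x = ∑ θ ∈ s P, (W.filter fun x : V.L n × V.L n =>
        Ideal.Quotient.mk P (x.1 : B) = θ * Ideal.Quotient.mk P (x.2 : B)).card := by
        simp only [hE, Finset.card_filter]
        exact Finset.sum_comm
      exact_mod_cast this
    rw [h1, ← (hs P hP).1, ← nsmul_eq_mul]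
    refine Finset.card_nsmul_le_sum _ _ _ fun θ _ => ?_
    have h2 := V.card_line_ge n (hS P hP).ne_zero θ
    rw [← hQ, ← div_le_iff₀ (by positivity)] at h2
    have h3 : W.filter (fun x : V.L n × V.L n =>
        Ideal.Quotient.mk P (x.1 : B) = θ * Ideal.Quotient.mk P (x.2 : B)) =
        (Finset.univ.filter fun x : V.L n × V.L n =>
        Ideal.Quotient.mk P (x.1 : B) = θ * Ideal.Quotient.mk P (x.2 : B)).erase 0 := by
      rw [hW, Finset.filter_erase]
    rw [Nat.card_eq_fintype_card, Fintype.card_subtype] at h2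
    rw [h3, Finset.card_erase_of_mem (by simp)]
    have h4 : 1 ≤ (Finset.univ.filter fun x : V.L n × V.L n =>
        Ideal.Quotient.mk P (x.1 : B) = θ * Ideal.Quotient.mk P (x.2 : B)).card :=
      Finset.card_pos.2 ⟨0, by simp⟩
    rw [Nat.cast_sub h4, Nat.cast_one]
    linarith
  have hWc : (W.card : ℝ) ≤ Q ^ (2 * V.r n) := by
    rw [← hcard]
    exact_mod_cast Finset.card_le_univ W
  have hg0 : (0 : ℝ) < g := by exact_mod_cast (show 0 < g by omega)
  have htot : ∑ P ∈ S, (V.dg P : ℝ) * (g * (Q ^ (2 * V.r n) / Q ^ V.dg P - 1)) ≤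
      Q ^ (2 * V.r n) * (g * n * Module.finrank k κ) := by
    calc _ ≤ ∑ P ∈ S, (V.dg P : ℝ) * ∑ x ∈ W, (E P x : ℝ) :=
          Finset.sum_le_sum fun P hP => mul_le_mul_of_nonneg_left (hlow P hP) (Nat.cast_nonneg _)
      _ = ∑ x ∈ W, ∑ P ∈ S, (V.dg P : ℝ) * (E P x : ℝ) := by
          simp only [Finset.mul_sum]
          exact Finset.sum_comm
      _ ≤ ∑ x ∈ W, (g * n * Module.finrank k κ : ℝ) :=
          Finset.sum_le_sum fun x hx => by exact_mod_cast hup x hx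
      _ = W.card * (g * n * Module.finrank k κ : ℝ) := by rw [Finset.sum_const, nsmul_eq_mul]
      _ ≤ _ := mul_le_mul_of_nonneg_right hWc (by positivity)
  have hR : (0 : ℝ) < Q ^ (2 * V.r n) := by positivity
  have hid : ∑ P ∈ S, (V.dg P : ℝ) * (g * (Q ^ (2 * V.r n) / Q ^ V.dg P - 1)) =
      g * Q ^ (2 * V.r n) * (∑ P ∈ S, (V.dg P : ℝ) / Q ^ V.dg P -
        (∑ P ∈ S, (V.dg P : ℝ)) / Q ^ (2 * V.r n)) := by
    rw [Finset.sum_div, ← Finset.sum_sub_distrib, Finset.mul_sum]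
    refine Finset.sum_congr rfl fun P _ => ?_
    field_simp
  rw [hid] at htot
  have h5 : g * Q ^ (2 * V.r n) * (∑ P ∈ S, (V.dg P : ℝ) / Q ^ V.dg P -
        (∑ P ∈ S, (V.dg P : ℝ)) / Q ^ (2 * V.r n)) ≤
      g * Q ^ (2 * V.r n) * (n * Module.finrank k κ) := by
    refine htot.trans (le_of_eq (by ring))
  have h6 := le_of_mul_le_mul_left h5 (by positivity)
  linarith

theorem exists_prime_not_dvd {a : B} (ha : a ≠ 0) {g : ℕ} (hg : 2 ≤ g) :
    ∃ P ∈ cop a, Prime P ∧ ¬ g ∣ V.dg P := by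
  classical
  by_contra! hall
  obtain ⟨C, hC⟩ := V.exists_card_dg_le
  have hδ : 0 < Module.finrank k κ := Module.finrank_pos
  set δ := Module.finrank k κ with hδd
  obtain ⟨X, hX⟩ := V.exists_sum_prime_gt ha (c := 3 / 4) (by norm_num) ((V.n₀ + 1) * δ + 2 * C)
  set S : Finset (Ideal B) := (Finset.range (X + 1)).biUnion fun n =>
    (RayClass.idl V a n).filter fun I => Prime I with hS
  have hSm : ∀ P, P ∈ S ↔ (P ∈ cop a ∧ Prime P) ∧ V.dg P ≤ X := by
    intro P
    simp only [hS, Finset.mem_biUnion, Finset.mem_filter, RayClass.mem_idl, Finset.mem_range]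
    constructor
    · rintro ⟨n, h1, ⟨h2, rfl⟩, h3⟩
      exact ⟨⟨h2, h3⟩, by omega⟩
    · rintro ⟨⟨h1, h2⟩, h3⟩
      exact ⟨V.dg P, by omega, ⟨h1, rfl⟩, h2⟩
  set j := 3 * X / (4 * δ) + 1 with hj
  have hjX : 3 * X ≤ 4 * (j * δ) := by
    have := Nat.lt_div_mul_add (a := 3 * X) (b := 4 * δ) (by omega)
    rw [hj]
    nlinarith
  have hjX' : 4 * (j * δ) ≤ 3 * X + 4 * δ := by
    have := Nat.div_mul_le_self (3 * X) (4 * δ)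
    rw [hj]
    nlinarith
  have h1 := V.sum_prime_le hg (S := S) (fun P hP => ((hSm P).1 hP).1.2)
    (fun P hP => hall P ((hSm P).1 hP).1.1 ((hSm P).1 hP).1.2) (V.n₀ + j)
  set Q : ℝ := ((Fintype.card k : ℕ) : ℝ) with hQ
  have hQ2 : 2 ≤ Q := by rw [hQ]; exact_mod_cast Fintype.one_lt_card (α := k)
  have h2 : ∑ P ∈ S, (V.dg P : ℝ) / Q ^ V.dg P = ∑ n ∈ Finset.range (X + 1),
      (n * ((RayClass.idl V a n).filter fun I => Prime I).card : ℝ) / Q ^ n := by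
    rw [hS, Finset.sum_biUnion]
    · refine Finset.sum_congr rfl fun n _ => ?_
      rw [Finset.sum_congr rfl (g := fun _ => (n : ℝ) / Q ^ n), Finset.sum_const, nsmul_eq_mul]
      · ring
      · intro P hP
        rw [(RayClass.mem_idl.1 (Finset.mem_filter.1 hP).1).2]
    · intro i _ j _ hij
      refine Finset.disjoint_left.2 fun P hP hP' => hij ?_
      rw [← (RayClass.mem_idl.1 (Finset.mem_filter.1 hP).1).2,
        ← (RayClass.mem_idl.1 (Finset.mem_filter.1 hP').1).2]
  have h3 : ∑ P ∈ S, (V.dg P : ℝ) ≤ X * (C * Q ^ X) := by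
    calc _ ≤ ∑ P ∈ S, (X : ℝ) := Finset.sum_le_sum fun P hP => by exact_mod_cast ((hSm P).1 hP).2
      _ = S.card * X := by rw [Finset.sum_const, nsmul_eq_mul]
      _ ≤ (C * Q ^ X) * X := by
        refine mul_le_mul_of_nonneg_right ?_ (Nat.cast_nonneg _)
        have : S.card ≤ C * Fintype.card k ^ X := by
          refine le_trans ?_ (hC X)
          rw [← Set.ncard_coe_finset]
          refine Set.ncard_le_ncard (fun P hP => ?_) (V.finite_dg_le X)
          have := (hSm P).1 hP
          exact ⟨this.1.1.1, this.2⟩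
        rw [hQ]
        exact_mod_cast this
      _ = _ := by ring
  have hr : 3 * X ≤ 2 * (2 * V.r (V.n₀ + j)) := by
    rw [V.r_add le_rfl, ← hδd]; omega
  have h4 : (X : ℝ) * Q ^ X ≤ 2 * Q ^ (2 * V.r (V.n₀ + j)) := by
    have hX2 : (X : ℝ) ^ 2 ≤ 4 * 2 ^ X := by
      have : ∀ n : ℕ, n ^ 2 ≤ 4 * 2 ^ n := by
        intro n
        induction n with
        | zero => simp
        | succ n ih =>
          rcases Nat.lt_or_ge n 3 with h | h
          · interval_cases n <;> norm_num
          · rw [pow_succ 2 n]; nlinarith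
      exact_mod_cast this X
    refine le_of_sq_le_sq ?_ (by positivity)
    calc ((X : ℝ) * Q ^ X) ^ 2 = (X : ℝ) ^ 2 * Q ^ (2 * X) := by rw [mul_pow, ← pow_mul, mul_comm X 2]
      _ ≤ (4 * 2 ^ X) * Q ^ (2 * X) := by gcongr
      _ ≤ (4 * Q ^ X) * Q ^ (2 * X) := by gcongr
      _ = 4 * Q ^ (3 * X) := by rw [mul_assoc, ← pow_add]; congr 2; ring
      _ ≤ 4 * Q ^ (2 * (2 * V.r (V.n₀ + j))) := by
        gcongr
        linarith
      _ = _ := by rw [mul_pow, ← pow_mul, mul_comm (2 * V.r (V.n₀ + j)) 2]; norm_num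
  have h5 : (∑ P ∈ S, (V.dg P : ℝ)) / Q ^ (2 * V.r (V.n₀ + j)) ≤ 2 * C := by
    rw [div_le_iff₀ (by positivity)]
    refine h3.trans ?_
    have hC0 : (0 : ℝ) ≤ C := Nat.cast_nonneg _
    nlinarith
  rw [h2] at h1
  have h6 : ((V.n₀ + j : ℕ) : ℝ) * δ ≤ 3 / 4 * X + (V.n₀ + 1) * δ := by
    have : (4 : ℝ) * (j * δ) ≤ 3 * X + 4 * δ := by exact_mod_cast hjX'
    push_cast
    linarith
  linarith

end OnePlace

namespace OnePlace

universe u v w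
variable {k : Type u} {B : Type v} {κ : Type w} [Field k] [CommRing B] [Algebra k B] [Field κ]
  [Algebra k κ] {V : OnePlace k B κ} [IsDedekindDomain B] [Fintype k] [Module.Finite k κ]
  {a : B} {M : ℕ}

/-- Some prime ideal coprime to `a` has degree one modulo `M` times the degree of the place. -/
theorem RayClass.exists_prime_dg_eq_one {G : Type*} [AddCommGroup G] [Fintype G]
    (R : V.RayClass a M G) (ha : a ≠ 0) (hM : 0 < M) :
    ∃ P ∈ cop a, Prime P ∧ (V.dg P : ZMod (Module.finrank k κ * M)) = 1 := by
  classical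
  obtain ⟨deg, hdeg⟩ := R.exists_deg
  suffices h : ∃ g, deg g = 1 by
    obtain ⟨g, hg⟩ := h
    obtain ⟨P, hP, hP', rfl⟩ := R.exists_prime ha hM g
    exact ⟨P, hP, hP', by rw [← hdeg P hP, hg]⟩
  set H : AddSubgroup ℤ := deg.range.comap (Int.castAddHom (ZMod (Module.finrank k κ * M))) with hH
  obtain ⟨d, hd⟩ := Int.subgroup_cyclic H
  by_cases h1 : d.natAbs = 1
  · have : (1 : ℤ) ∈ H := by
      rw [hd, ← AddSubgroup.zmultiples_eq_closure, Int.mem_zmultiples_iff, ← Int.natAbs_dvd, h1]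
      simp
    simpa [hH] using this
  · obtain ⟨g, hg, hgd⟩ := Nat.exists_prime_and_dvd h1
    obtain ⟨P, hP, hP', hPg⟩ := V.exists_prime_not_dvd ha hg.two_le
    refine absurd ?_ hPg
    have h2 : (V.dg P : ℤ) ∈ H := by
      rw [hH, AddSubgroup.mem_comap]
      exact ⟨R.cls P, by rw [hdeg P hP]; simp⟩
    rw [hd, ← AddSubgroup.zmultiples_eq_closure, Int.mem_zmultiples_iff] at h2
    have := (Int.natAbs_dvd_natAbs.2 h2)
    exact hgd.trans (by simpa using this)

end OnePlace

/-- Degrees `± 1` modulo `ℓ * (ℓ - 1)` give geometric sums prime to `ℓ`. -/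
theorem Nat.not_prime_dvd_geom_sum {l Q d : ℕ} (hl : l.Prime) (hd : 0 < d)
    (h : (l * (l - 1) : ℤ) ∣ d - 1 ∨ (l * (l - 1) : ℤ) ∣ d + 1) :
    ¬ l ∣ ∑ j ∈ Finset.range d, Q ^ j := by
  have : Fact l.Prime := ⟨hl⟩
  rw [← ZMod.natCast_eq_zero_iff]
  push_cast
  have hd1 : (d : ZMod l) = 1 ∨ (d : ZMod l) = -1 := by
    rcases h with h | h
    · left
      have := (ZMod.intCast_zmod_eq_zero_iff_dvd ((d : ℤ) - 1) l).2 ((dvd_mul_right _ _).trans h)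
      push_cast at this
      linear_combination this
    · right
      have := (ZMod.intCast_zmod_eq_zero_iff_dvd ((d : ℤ) + 1) l).2 ((dvd_mul_right _ _).trans h)
      push_cast at this
      linear_combination this
  rcases eq_or_ne (Q : ZMod l) 0 with hQ | hQ
  · rw [hQ, Finset.sum_eq_single 0]
    · simp
    · intro b _ hb; exact zero_pow hb
    · intro h'; exact absurd (Finset.mem_range.2 hd) h'
  rcases eq_or_ne (Q : ZMod l) 1 with hQ1 | hQ1
  · rw [hQ1]
    simp only [one_pow, Finset.sum_const, Finset.card_range, nsmul_eq_mul, mul_one]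
    rcases hd1 with h | h <;> rw [h] <;> simp
  · intro h0
    have h1 := mul_geom_sum (Q : ZMod l) d
    rw [h0, mul_zero] at h1
    have h2 : (Q : ZMod l) ^ (l - 1) = 1 := ZMod.pow_card_sub_one_eq_one hQ
    have hl1 : ((l : ℤ) - 1) = ((l - 1 : ℕ) : ℤ) := by
      rw [Nat.cast_sub hl.one_le]; simp
    rw [hl1] at h
    rcases h with h | h
    · have h3 : l - 1 ∣ d - 1 := by
        have := (dvd_mul_left _ _).trans h
        have e : ((d : ℤ) - 1) = ((d - 1 : ℕ) : ℤ) := by rw [Nat.cast_sub hd]; simp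
        rw [e] at this
        exact_mod_cast this
      obtain ⟨t, ht⟩ := h3
      have : (Q : ZMod l) ^ d = Q := by
        rw [show d = (l - 1) * t + 1 by omega, pow_succ, pow_mul, h2, one_pow, one_mul]
      exact hQ1 (by rw [this] at h1; linear_combination -h1)
    · have h3 : l - 1 ∣ d + 1 := by
        have := (dvd_mul_left _ _).trans h
        exact_mod_cast this
      obtain ⟨t, ht⟩ := h3
      have : (Q : ZMod l) ^ d * Q = 1 := by
        rw [← pow_succ, ht, pow_mul, h2, one_pow]
      exact hQ1 (by linear_combination this + Q * h1)

theorem Algebra.norm_mk_mul {k B : Type*} [Field k] [CommRing B] [Algebra k B] {I J : Ideal B}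
    (hIJ : IsCoprime I J) [Module.Finite k (B ⧸ I)] [Module.Finite k (B ⧸ J)] (a : B) :
    Algebra.norm k (Ideal.Quotient.mk (I * J) a) =
      Algebra.norm k (Ideal.Quotient.mk I a) * Algebra.norm k (Ideal.Quotient.mk J a) := by
  let e : (B ⧸ I * J) ≃ₐ[k] (B ⧸ I) × (B ⧸ J) :=
    AlgEquiv.ofRingEquiv (f := Ideal.quotientMulEquivQuotientProd I J hIJ) (fun c => rfl)
  rw [← Algebra.norm_eq_of_algEquiv e]
  have h : e (Ideal.Quotient.mk (I * J) a) = (Ideal.Quotient.mk I a, Ideal.Quotient.mk J a) := rfl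
  rw [h, Algebra.norm_apply, Algebra.norm_apply, Algebra.norm_apply, ← LinearMap.det_prodMap]
  rfl

namespace OnePlace

universe u v w
variable {k : Type u} {B : Type v} {κ : Type w} [Field k] [CommRing B] [Algebra k B] [Field κ]
  [Algebra k κ] (V : OnePlace k B κ) [IsDedekindDomain B] [Fintype k] [Module.Finite k κ]

local notation "δ" => Module.finrank k κ
local notation "q" => Fintype.card k

include V in
/-- A power of an element is its norm modulo a prime. -/
theorem pow_geom_sum_mem {P : Ideal B} (hP : Prime P) (a : B) :
    a ^ (∑ j ∈ Finset.range (V.dg P), q ^ j) -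
      algebraMap k B (Algebra.norm k (Ideal.Quotient.mk P a)) ∈ P := by
  have := V.finite_quot hP.ne_zero
  have : Finite (B ⧸ P) := Module.finite_of_finite k
  have := (Ideal.isPrime_of_prime hP).isMaximal hP.ne_zero
  let _ : Field (B ⧸ P) := Ideal.Quotient.field P
  have h := FiniteField.algebraMap_norm_eq_pow (K := k) (x := Ideal.Quotient.mk P a)
  rw [V.natCard_quot hP.ne_zero, Nat.card_eq_fintype_card,
    ← Nat.geomSum_eq Fintype.one_lt_card] at h
  rw [← Ideal.Quotient.eq, map_pow, ← h]
  rfl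

theorem D_ne_zero {a z : B} (hz : z ≠ 0) (h : IsCoprime a z) : V.D a z ≠ 0 := by
  have := V.finite_quot (I := Ideal.span {z}) (by simpa using hz)
  obtain ⟨x, y, hxy⟩ := h
  have h1 : Ideal.Quotient.mk (Ideal.span {z}) x * Ideal.Quotient.mk (Ideal.span {z}) a = 1 := by
    rw [← map_mul, ← map_one (Ideal.Quotient.mk _), Ideal.Quotient.eq, Ideal.mem_span_singleton]
    exact ⟨-y, by linear_combination hxy⟩
  have h2 := congrArg (Algebra.norm k) h1
  rw [map_mul, map_one] at h2
  exact right_ne_zero_of_mul (h2 ▸ one_ne_zero)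

theorem D_pow_right {a g : B} (hg : g ≠ 0) (n : ℕ) : V.D a (g ^ n) = V.D a g ^ n := by
  have := V.isDomain'
  induction n with
  | zero =>
    rw [pow_zero, pow_zero, D, show Ideal.Quotient.mk (Ideal.span {(1 : B)}) a = 1 from ?_, map_one]
    rw [← map_one (Ideal.Quotient.mk _), Ideal.Quotient.eq, Ideal.span_singleton_one]
    trivial
  | succ n ih => rw [pow_succ, V.D_mul_right (pow_ne_zero n hg) hg, ih, pow_succ]

theorem ν_pow {x : B} (hx : x ≠ 0) (n : ℕ) : V.ν (x ^ n) = n * V.ν x := by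
  have := V.isDomain'
  induction n with
  | zero => simp [V.ν_one]
  | succ n ih => rw [pow_succ, V.ν_mul _ _ (pow_ne_zero n hx) hx, ih]; ring

theorem lc_pow (x : B) (n : ℕ) : V.lc (x ^ n) = V.lc x ^ n := by
  induction n with
  | zero => simp [V.lc_one]
  | succ n ih => rw [pow_succ, V.lc_mul, ih, pow_succ]

theorem D_eq_of_lc_eq {a b b' : B} (ha : a ≠ 0) (hb : b ≠ 0) (hb' : b' ≠ 0) (h : V.ν b = V.ν b')
    (hl : V.lc b = V.lc b') (ht : a ∣ b' - b) : V.D a b = V.D a b' := by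
  obtain ⟨t, ht⟩ := ht
  rw [V.reciprocity ha hb hb' h (t := t) (by linear_combination ht), hl,
    div_self (V.lc_ne_zero hb'), map_one, one_pow, one_mul]

/-- `V.D a` only depends on the ray class when the modulus at infinity is a multiple of `q - 1` with
large cofactor. -/
theorem D_eq_of_modEq {a b z : B} (ha : a ≠ 0) (hb : b ≠ 0) (hz : z ≠ 0) {M : ℕ}
    (hM' : V.dg (Ideal.span {a}) + (2 * V.n₀ + 1) * δ < M * δ) (hbM : (q - 1) * M ∣ V.ν b)
    (hzM : (q - 1) * M ∣ V.ν z) (hl : V.lc b = V.lc z) (h : a ∣ b - z) : V.D a b = V.D a z := by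
  have := V.isDomain'
  obtain ⟨g, hg, hgν, hgl⟩ := V.exists_leading (I := Ideal.span {a}) (by simpa using ha) 1
    one_ne_zero hM'
  rw [Ideal.mem_span_singleton] at hg
  have hg0 : g ≠ 0 := by
    rintro rfl
    rw [V.lc_zero] at hgl
    exact zero_ne_one hgl
  have hcop : IsCoprime a g := by
    obtain ⟨t, ht⟩ := hg
    exact ⟨-t, 1, by linear_combination ht⟩
  have hDg : V.D a (g ^ (q - 1)) = 1 := by
    rw [V.D_pow_right hg0, FiniteField.pow_card_sub_one_eq_one _ (V.D_ne_zero hg0 hcop)]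
  have hG0 : g ^ (q - 1) ≠ 0 := pow_ne_zero _ hg0
  obtain ⟨i, hi⟩ := hbM
  obtain ⟨j, hj⟩ := hzM
  have hGn : ∀ n, a ∣ (g ^ (q - 1)) ^ n - 1 := fun n => by
    rw [← pow_mul]
    exact hg.trans (sub_one_dvd_pow_sub_one g _)
  have hνG : ∀ n, V.ν ((g ^ (q - 1)) ^ n) = n * ((q - 1) * M) := fun n => by
    rw [V.ν_pow hG0, V.ν_pow hg0, hgν]
  have key := V.D_eq_of_lc_eq (a := a) (b := b * (g ^ (q - 1)) ^ j) (b' := z * (g ^ (q - 1)) ^ i) ha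
    (mul_ne_zero hb (pow_ne_zero _ hG0)) (mul_ne_zero hz (pow_ne_zero _ hG0))
    (by rw [V.ν_mul _ _ hb (pow_ne_zero _ hG0), V.ν_mul _ _ hz (pow_ne_zero _ hG0), hνG, hνG, hi, hj]
        ring)
    (by rw [V.lc_mul, V.lc_mul, hl]
        simp only [V.lc_pow, hgl, one_pow])
    (by
      obtain ⟨t, ht⟩ := h
      obtain ⟨s, hs⟩ := hGn i
      obtain ⟨r, hr⟩ := hGn j
      exact ⟨-t + z * s - b * r, by linear_combination -ht + z * hs - b * hr⟩)
  rwa [V.D_mul_right hb (pow_ne_zero _ hG0), V.D_mul_right hz (pow_ne_zero _ hG0),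
    V.D_pow_right hG0, V.D_pow_right hG0, hDg, one_pow, one_pow, mul_one, mul_one] at key

/-- If the class of `z` is a sum of classes of ideals `I, J`, then `I * J` has a generator in the
class of `z`. -/
theorem exists_generator_of_rel {a z : B} (hz : z ≠ 0) {M : ℕ} {I : Ideal B}
    (h : V.rel a M I (Ideal.span {z})) :
    ∃ b, I = Ideal.span {b} ∧ a ∣ b - z ∧ V.lc b = V.lc z ∧ V.ν b ≡ V.ν z [MOD M] := by
  have := V.isDomain'
  obtain ⟨x, y, hx, hy, hc, hd, hl, hn, h⟩ := h
  have h1 : y * z ∈ Ideal.span {x} * I := by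
    rw [h, Ideal.span_singleton_mul_span_singleton]
    exact Ideal.mem_span_singleton_self _
  obtain ⟨b, hb, hxb⟩ := Ideal.mem_span_singleton_mul.1 h1
  have hb0 : b ≠ 0 := by
    rintro rfl
    rw [mul_zero] at hxb
    exact mul_ne_zero hy hz hxb.symm
  refine ⟨b, ?_, ?_, ?_, ?_⟩
  · rw [Ideal.span_singleton_mul_span_singleton, ← hxb,
      ← Ideal.span_singleton_mul_span_singleton] at h
    exact mul_left_cancel₀ (a := Ideal.span {x}) (by simpa using hx) h
  · refine hc.symm.dvd_of_dvd_mul_left ?_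
    obtain ⟨t, ht⟩ := hd
    exact ⟨-t * z, by linear_combination hxb - z * ht⟩
  · have := congrArg V.lc hxb
    rw [V.lc_mul, V.lc_mul, hl] at this
    exact mul_left_cancel₀ (V.lc_ne_zero hy) this
  · have := congrArg V.ν hxb
    rw [V.ν_mul _ _ hx hb0, V.ν_mul _ _ hy hz] at this
    have h2 : V.ν x + V.ν b ≡ V.ν x + V.ν z [MOD M] := by
      rw [this]
      exact hn.symm.add_right _
    exact Nat.ModEq.add_left_cancel' _ h2

end OnePlace

namespace OnePlace

universe u v w
variable {k : Type u} {B : Type v} {κ : Type w} [Field k] [CommRing B] [Algebra k B] [Field κ]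
  [Algebra k κ] (V : OnePlace k B κ) [IsDedekindDomain B] [Fintype k] [Module.Finite k κ]

local notation "δ" => Module.finrank k κ
local notation "q" => Fintype.card k

/-- If `D a z = 1`, some element of the class of `z` modulo `a` divides `a ^ e - c` for an exponent
`e` prime to `l`. -/
theorem exists_pow_sub_dvd {l : ℕ} (hl : l.Prime) {a z : B} (ha : a ≠ 0) (hz : z ≠ 0)
    (hc : IsCoprime a z) {R : ℕ} (hR : V.dg (Ideal.span {a}) + (2 * V.n₀ + 1) * δ < R * δ)
    (hR3 : 3 ≤ R) (hzR : (q - 1) * (l * (l - 1) * R) ∣ V.ν z) (hD : V.D a z = 1) :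
    ∃ b e, ∃ c : k, a ∣ b - z ∧ ¬ l ∣ e ∧ c ≠ 0 ∧ b ∣ a ^ e - algebraMap k B c := by
  have := V.isDomain'
  have hq : 2 ≤ q := Fintype.one_lt_card
  have hl2 := hl.two_le
  have hδ : 0 < δ := Module.finrank_pos
  have hll : 0 < l * (l - 1) := Nat.mul_pos hl.pos (by omega)
  set M := (q - 1) * (l * (l - 1) * R) with hM
  have hM0 : 0 < M := Nat.mul_pos (by omega) (Nat.mul_pos hll (by omega))
  have hRM : R ≤ l * (l - 1) * R := Nat.le_mul_of_pos_left _ hll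
  have hM3 : 3 ≤ δ * M := by
    have h1 : l * (l - 1) * R ≤ M := Nat.le_mul_of_pos_left _ (by omega)
    have h2 : M ≤ δ * M := Nat.le_mul_of_pos_left _ hδ
    omega
  obtain ⟨G, _, _, ⟨C⟩⟩ := V.exists_rayClass ha hM0
  classical
  obtain ⟨P, hP, hPp, hPd⟩ := C.exists_prime_dg_eq_one ha hM0
  have hzc : Ideal.span {z} ∈ cop a :=
    ⟨by simpa using hz, (Ideal.isCoprime_span_singleton_iff _ _).2 hc.symm⟩
  obtain ⟨Q, hQ, hQp, hQc⟩ := C.exists_prime ha hM0 (C.cls (Ideal.span {z}) - C.cls P)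
  have hPQ : P * Q ∈ cop a := (cop a).mul_mem hP hQ
  have hrel : V.rel a M (P * Q) (Ideal.span {z}) := by
    rw [← C.cls_iff _ hPQ _ hzc, C.cls_mul _ hP _ hQ, hQc]; abel
  have hdg := dg_of_rel hPQ.1 hzc.1 hrel
  have hz0 : (V.dg (Ideal.span {z}) : ZMod (δ * M)) = 0 := by
    rw [V.dg_span hz, ZMod.natCast_eq_zero_iff, mul_comm]
    exact Nat.mul_dvd_mul_right hzR _
  rw [hz0, V.dg_mul hPp.ne_zero hQp.ne_zero] at hdg
  push_cast at hdg
  rw [hPd] at hdg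
  have hP1 : ((δ * M : ℕ) : ℤ) ∣ V.dg P - 1 := by
    rw [← ZMod.intCast_zmod_eq_zero_iff_dvd]; push_cast; rw [hPd, sub_self]
  have hQ1 : ((δ * M : ℕ) : ℤ) ∣ V.dg Q + 1 := by
    rw [← ZMod.intCast_zmod_eq_zero_iff_dvd]; push_cast; rw [add_comm]; exact hdg
  have hne : P ≠ Q := by
    rintro rfl
    have h := dvd_sub hQ1 hP1
    rw [show ((V.dg P : ℤ) + 1) - (V.dg P - 1) = ((2 : ℕ) : ℤ) by push_cast; ring] at h
    have := Nat.le_of_dvd two_pos (Int.natCast_dvd_natCast.1 h)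
    omega
  obtain ⟨b, hb, hbz, hblc, hbν⟩ := V.exists_generator_of_rel hz hrel
  have hb0 : b ≠ 0 := by
    rintro rfl
    rw [V.lc_zero] at hblc
    exact V.lc_ne_zero hz hblc.symm
  have hDb : V.D a b = 1 := by
    rw [← hD]
    refine V.D_eq_of_modEq (M := l * (l - 1) * R) ha hb0 hz ?_ ?_ hzR hblc hbz
    · exact hR.trans_le (Nat.mul_le_mul_right _ hRM)
    · rw [Nat.modEq_zero_iff_dvd.symm]
      exact hbν.trans (Nat.modEq_zero_iff_dvd.2 hzR)
  have hPm := (Ideal.isPrime_of_prime hPp).isMaximal hPp.ne_zero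
  have hQm := (Ideal.isPrime_of_prime hQp).isMaximal hQp.ne_zero
  have hcop : IsCoprime P Q := Ideal.isCoprime_of_isMaximal hne
  have := V.finite_quot hPp.ne_zero
  have := V.finite_quot hQp.ne_zero
  have hnorm : Algebra.norm k (Ideal.Quotient.mk P a) * Algebra.norm k (Ideal.Quotient.mk Q a) = 1 := by
    rw [← Algebra.norm_mk_mul hcop, ← hDb, D]
    have : ∀ I J : Ideal B, I = J → Algebra.norm k (Ideal.Quotient.mk I a) =
      Algebra.norm k (Ideal.Quotient.mk J a) := by rintro I _ rfl; rfl
    exact this _ _ hb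
  set c := Algebra.norm k (Ideal.Quotient.mk P a) with hcd
  set c' := Algebra.norm k (Ideal.Quotient.mk Q a) with hcd'
  have hc0 : c ≠ 0 := left_ne_zero_of_mul (hnorm ▸ one_ne_zero)
  have hc0' : c' ≠ 0 := right_ne_zero_of_mul (hnorm ▸ one_ne_zero)
  set e := ∑ j ∈ Finset.range (V.dg P), q ^ j with he
  set e' := ∑ j ∈ Finset.range (V.dg Q), q ^ j with he'
  have hpow : ∀ (x : k) (d : ℕ), x ≠ 0 → x ^ (∑ j ∈ Finset.range d, q ^ j) = x ^ d := by
    intro x d hx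
    rw [← Finset.prod_pow_eq_pow_sum]
    have : ∀ j : ℕ, x ^ q ^ j = x := fun j => by
      induction j with
      | zero => simp
      | succ j ih => rw [pow_succ, pow_mul, ih, FiniteField.pow_card]
    simp [this]
  have hdvd1 : ((q - 1 : ℕ) : ℤ) ∣ ((δ * M : ℕ) : ℤ) :=
    Int.natCast_dvd_natCast.2 ((dvd_mul_right _ _).trans (dvd_mul_left _ _))
  have hx1 : ∀ x : k, x ≠ 0 → x ^ (q - 1) = 1 := fun x hx => FiniteField.pow_card_sub_one_eq_one x hx
  have hdP : 0 < V.dg P := V.dg_pos hPp.ne_zero hPm.ne_top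
  have hdQ : 0 < V.dg Q := V.dg_pos hQp.ne_zero hQm.ne_top
  have hpP : c' ^ e = c' := by
    rw [he, hpow _ _ hc0']
    have h := hdvd1.trans hP1
    have e1 : ((V.dg P : ℤ) - 1) = ((V.dg P - 1 : ℕ) : ℤ) := by rw [Nat.cast_sub hdP]; simp
    rw [e1] at h
    obtain ⟨t, ht⟩ := Int.natCast_dvd_natCast.1 h
    rw [show V.dg P = (q - 1) * t + 1 by omega, pow_succ, pow_mul, hx1 _ hc0', one_pow, one_mul]
  have hpQ : c ^ e' = c' := by
    rw [he', hpow _ _ hc0]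
    obtain ⟨t, ht⟩ := Int.natCast_dvd_natCast.1 (show ((q - 1 : ℕ) : ℤ) ∣ ((V.dg Q + 1 : ℕ) : ℤ) by
      push_cast [-Nat.cast_sub]; exact hdvd1.trans hQ1)
    have : c ^ (V.dg Q) * c = 1 := by rw [← pow_succ, ht, pow_mul, hx1 _ hc0, one_pow]
    have h2 : c' * c = 1 := by rw [mul_comm]; exact hnorm
    exact mul_right_cancel₀ hc0 (this.trans h2.symm)
  have hll' : ((l : ℤ) * (l - 1)) ∣ ((δ * M : ℕ) : ℤ) := by
    have : ((l : ℤ) * (l - 1)) = ((l * (l - 1) : ℕ) : ℤ) := by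
      push_cast [Nat.cast_sub hl.one_le]; ring
    rw [this]
    exact Int.natCast_dvd_natCast.2
      (((dvd_mul_right _ R).trans (dvd_mul_left _ (q - 1))).trans (dvd_mul_left _ δ))
  refine ⟨b, e * e', c', hbz, ?_, hc0', ?_⟩
  · intro h
    rcases hl.dvd_mul.1 h with h | h
    · exact Nat.not_prime_dvd_geom_sum hl hdP (Or.inl (hll'.trans hP1)) h
    · exact Nat.not_prime_dvd_geom_sum hl hdQ (Or.inr (hll'.trans hQ1)) h
  · rw [← Ideal.mem_span_singleton, ← hb, Ideal.mul_eq_inf_of_coprime hcop.sup_eq, Ideal.mem_inf]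
    have h1 := V.pow_geom_sum_mem hPp a
    have h2 := V.pow_geom_sum_mem hQp a
    constructor
    · have h3 := P.mem_of_dvd (sub_dvd_pow_sub_pow _ _ e') h1
      rw [← map_pow, ← pow_mul] at h3
      rwa [hpQ] at h3
    · have h3 := Q.mem_of_dvd (sub_dvd_pow_sub_pow _ _ e) h2
      rw [← map_pow, ← pow_mul, mul_comm e'] at h3
      rwa [hpP] at h3

include V in
/-- Every coprime pair `(a, b)` can be moved by two elementary operations to a pair `(a', b')` such
that `a' ^ e` is a constant modulo `b'`, with `e` prime to `l`. -/
theorem exists_pow_const {l : ℕ} (hl : l.Prime) {a b : B} (hab : IsCoprime a b) :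
    ∃ t s : B, ∃ e, ∃ c : k, ¬ l ∣ e ∧ c ≠ 0 ∧
      b + (a + b * t) * s ∣ (a + b * t) ^ e - algebraMap k B c := by
  have := V.isDomain'
  have hq : 2 ≤ q := Fintype.one_lt_card
  have hδ : 0 < δ := Module.finrank_pos
  rcases eq_or_ne b 0 with rfl | hb
  · have hu : IsUnit a := isCoprime_zero_right.1 hab
    obtain ⟨h1, h2⟩ := V.isUnit_iff.1 hu
    obtain ⟨c, rfl⟩ := V.exists_algebraMap a h2
    refine ⟨0, 0, 1, c, hl.one_lt.ne' ∘ Nat.dvd_one.1, ?_, by simp⟩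
    rintro rfl
    exact h1 (map_zero _)
  set m := V.dg (Ideal.span {b}) + (2 * V.n₀ + 1) * δ with hm
  obtain ⟨a', ha', haν, halc⟩ := V.exists_leading (I := Ideal.span {b}) (by simpa using hb) a
    (c := 1) one_ne_zero (l := (q - 1) * m + 1) (by
      have h1 : m ≤ (q - 1) * m := Nat.le_mul_of_pos_left _ (by omega)
      have h2 : (q - 1) * m + 1 ≤ ((q - 1) * m + 1) * δ := Nat.le_mul_of_pos_right _ hδ
      omega)
  obtain ⟨t, ht⟩ := Ideal.mem_span_singleton.1 ha'
  have ha't : a' = a + b * t := by linear_combination ht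
  have ha0 : a' ≠ 0 := by
    rintro rfl
    rw [V.lc_zero] at halc
    exact zero_ne_one halc
  have hcop : IsCoprime a' b := by
    rw [ha't]; exact hab.add_mul_left_left t
  set R := V.dg (Ideal.span {a'}) + (2 * V.n₀ + 1) * δ + 3 with hR
  have hRδ : V.dg (Ideal.span {a'}) + (2 * V.n₀ + 1) * δ < R * δ := by
    have : R ≤ R * δ := Nat.le_mul_of_pos_right _ hδ
    omega
  have hR' : V.dg (Ideal.span {a'}) + (2 * V.n₀ + 1) * δ < (q - 1) * (l * (l - 1) * R) * δ := by
    refine hRδ.trans_le (Nat.mul_le_mul_right _ ?_)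
    have h1 := hl.two_le
    exact (Nat.le_mul_of_pos_left R (Nat.mul_pos hl.pos (by omega))).trans
      (Nat.le_mul_of_pos_left _ (by omega))
  have hex : ∀ x : κ, x ≠ 0 → ∃ z, IsCoprime a' z ∧ z ≠ 0 ∧ a' ∣ z - b ∧
      V.ν z = (q - 1) * (l * (l - 1) * R) ∧ V.lc z = x := by
    intro x hx
    obtain ⟨z, h1, h2, h3⟩ := V.exists_leading (I := Ideal.span {a'}) (by simpa using ha0) b hx hR'
    rw [Ideal.mem_span_singleton] at h1
    refine ⟨z, ?_, ?_, h1, h2, h3⟩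
    · obtain ⟨s, hs⟩ := h1
      rw [show z = b + a' * s by linear_combination hs]
      exact hcop.add_mul_left_right s
    · rintro rfl
      rw [V.lc_zero] at h3
      exact hx h3.symm
  obtain ⟨z0, hz0c, hz00, hz0b, hz0ν, hz0l⟩ := hex 1 one_ne_zero
  have : Finite κ := Module.finite_of_finite k
  obtain ⟨x, hx⟩ := FiniteField.norm_surjective k κ (V.D a' z0)
  have hD0 := V.D_ne_zero hz00 hz0c
  have hx0 : x ≠ 0 := by
    rintro rfl
    rw [Algebra.norm_zero] at hx
    exact hD0 hx.symm
  obtain ⟨z, hzc, hz0, hzb, hzν, hzl⟩ := hex x hx0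
  have hDz : V.D a' z = 1 := by
    obtain ⟨s, hs⟩ := dvd_sub hzb hz0b
    have h := V.reciprocity ha0 hz00 hz0 (hz0ν.trans hzν.symm) (t := s) (by linear_combination hs)
    rw [hzl, hz0l, div_one, hx, haν, pow_succ, pow_mul,
      FiniteField.pow_card_sub_one_eq_one _ hD0, one_pow, one_mul] at h
    exact (mul_eq_left₀ hD0).1 h.symm
  obtain ⟨b', e, c, hb', he, hc, hdvd⟩ := V.exists_pow_sub_dvd hl ha0 hz0 hzc hRδ (by omega)
    (by rw [hzν]) hDz
  obtain ⟨s, hs⟩ := dvd_add hb' hzb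
  refine ⟨t, s, e, c, he, hc, ?_⟩
  rw [← ha't, show b + a' * s = b' by linear_combination -hs]
  exact hdvd

end OnePlace

namespace OnePlace

variable {k B κ : Type*} [Field k] [CommRing B] [Algebra k B] [Field κ] [Algebra k κ]
  (V : OnePlace k B κ) [IsDedekindDomain B] [Fintype k] [Module.Finite k κ]

local notation "δ" => Module.finrank k κ
local notation "q" => Fintype.card k

theorem r_succ_le (n : ℕ) : V.r (n + 1) ≤ V.r n + δ := by
  have := V.finite_L (n + 1)
  have := V.finite_L n
  have h1 := LinearMap.finrank_range_add_finrank_ker (V.coef n)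
  have h2 : Module.finrank k (LinearMap.range (V.coef n)) ≤ δ := Submodule.finrank_le _
  have h3 : Module.finrank k (LinearMap.ker (V.coef n)) ≤ V.r n := by
    refine LinearMap.finrank_le_finrank_of_injective
      (f := (LinearMap.codRestrict (V.L n) ((V.L (n + 1)).subtype.comp (LinearMap.ker (V.coef n)).subtype)
        (fun x => (V.coef_eq_zero x.1).1 x.2))) ?_
    intro x y h
    have := congrArg Subtype.val h
    exact Subtype.ext (Subtype.ext this)
  unfold r at *
  omega

theorem r_add_le (n m : ℕ) : V.r (n + m) ≤ V.r n + m * δ := by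
  induction m with
  | zero => simp
  | succ m ih =>
    have := V.r_succ_le (n + m)
    rw [← add_assoc, add_mul]
    omega

theorem finrank_LI_add_dg_le {n : ℕ} {I : Ideal B} (h : V.LI n I ≠ ⊥) :
    Module.finrank k (V.LI n I) + V.dg I ≤ (n + 1) * δ := by
  have hδ : 0 < δ := Module.finrank_pos
  have hm : ∀ m, m * δ < V.dg I → V.LI m I = ⊥ := by
    intro m hm
    rw [eq_bot_iff]
    intro x hx
    rw [mem_LI] at hx
    by_contra hx0
    have h1 := V.dg_le_of_dvd (I := I) (J := Ideal.span {x}) (by simpa using hx0)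
      (Ideal.dvd_span_singleton.2 hx.2)
    rw [V.dg_span hx0] at h1
    have := Nat.mul_le_mul_right δ hx.1
    omega
  have := V.finite_LI n I
  have := V.finite_L n
  rcases Nat.eq_zero_or_pos (V.dg I) with h0 | h0
  · rw [h0, add_zero]
    have h1 := V.r_add_le 0 n
    have h2 : V.r 0 ≤ δ := by
      have : V.r 0 ≤ Module.finrank k k := by
        refine (Submodule.finrank_mono (t := LinearMap.range (Algebra.linearMap k B)) ?_).trans
          (LinearMap.finrank_range_le _)
        intro x hx
        obtain ⟨c, hc⟩ := V.exists_algebraMap x (Nat.le_zero.1 hx)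
        exact ⟨c, hc⟩
      rw [Module.finrank_self] at this
      omega
    have h3 : Module.finrank k (V.LI n I) ≤ V.r n := Submodule.finrank_mono inf_le_left
    rw [zero_add] at h1
    rw [add_mul, one_mul]
    omega
  set m := (V.dg I - 1) / δ with hmd
  have h1 : m * δ < V.dg I := by
    have := Nat.div_mul_le_self (V.dg I - 1) δ
    rw [← hmd] at this
    omega
  have h2 : V.dg I ≤ (m + 1) * δ := by
    have := Nat.lt_div_mul_add (a := V.dg I - 1) hδ
    rw [← hmd] at this
    rw [add_mul, one_mul]
    omega
  have hmn : m < n := by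
    by_contra! hmn
    refine h ?_
    have := hm m h1
    rw [eq_bot_iff] at this ⊢
    exact le_trans (inf_le_inf_right _ (V.L_mono hmn)) this
  have h3 : Module.finrank k (V.LI n I) + V.r m ≤ V.r n := by
    have := V.finite_L m
    have h4 := Submodule.finrank_sup_add_finrank_inf_eq (V.LI n I) (V.L m)
    have h5 : V.LI n I ⊓ V.L m = ⊥ := by
      have := hm m h1
      rw [eq_bot_iff] at this ⊢
      intro x hx
      exact this ⟨hx.2, hx.1.2⟩
    rw [h5, finrank_bot, add_zero] at h4
    have h6 : Module.finrank k ↥(V.LI n I ⊔ V.L m) ≤ V.r n :=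
      Submodule.finrank_mono (sup_le inf_le_left (V.L_mono hmn.le))
    unfold r at *
    omega
  have h4 := V.r_add_le m (n - m)
  rw [Nat.add_sub_cancel' hmn.le] at h4
  have h5 : (n - m) * δ + (m + 1) * δ = (n + 1) * δ := by
    rw [← add_mul]; congr 1; omega
  omega

theorem natCard_LI_le (n : ℕ) {I : Ideal B} (hI : I ≠ ⊥) :
    (Nat.card (V.LI n I) : ℝ) ≤ 1 + (q : ℝ) ^ ((n + 1) * δ) / (q : ℝ) ^ V.dg I := by
  have hq : (0 : ℝ) < q := by exact_mod_cast Fintype.card_pos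
  have hq1 : (1 : ℝ) ≤ q := by exact_mod_cast Fintype.card_pos
  by_cases h : V.LI n I = ⊥
  · rw [h]
    simp only [Nat.card_unique, Nat.cast_one, le_add_iff_nonneg_right]
    positivity
  have := V.finite_LI n I
  have h1 := V.finrank_LI_add_dg_le h
  rw [Module.natCard_eq_pow_finrank (K := k), Nat.card_eq_fintype_card, Nat.cast_pow]
  have : (q : ℝ) ^ Module.finrank k (V.LI n I) ≤ (q : ℝ) ^ ((n + 1) * δ) / (q : ℝ) ^ V.dg I := by
    rw [le_div_iff₀ (by positivity), ← pow_add]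
    exact pow_le_pow_right₀ hq1 h1
  linarith

end OnePlace

namespace OnePlace

variable {k B κ : Type*} [Field k] [CommRing B] [Algebra k B] [Field κ] [Algebra k κ]
  (V : OnePlace k B κ) [IsDedekindDomain B] [Fintype k] [Module.Finite k κ]

local notation "δ" => Module.finrank k κ
local notation "q" => Fintype.card k

theorem ncard_add_mul_mem_le (n : ℕ) {a b : B} (I : Ideal B) (h : ∀ z, b * z ∈ I → z ∈ I) :
    {y : B | y ∈ V.L n ∧ a + b * y ∈ I}.ncard ≤ Nat.card (V.LI n I) := by
  have := V.finite_LI n I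
  have : Finite (V.LI n I) := Module.finite_of_finite k
  rcases Set.eq_empty_or_nonempty {y : B | y ∈ V.L n ∧ a + b * y ∈ I} with h0 | ⟨y0, h1, h2⟩
  · rw [h0]; simp
  rw [← SetLike.coe_sort_coe, Nat.card_coe_set_eq]
  refine Set.ncard_le_ncard_of_injOn (fun y => y - y0) ?_ (fun x _ y _ h => sub_left_injective h)
    (Set.toFinite _)
  rintro y ⟨h3, h4⟩
  refine ⟨(V.L n).sub_mem h3 h1, h _ ?_⟩
  have := I.sub_mem h4 h2
  rwa [show a + b * y - (a + b * y0) = b * (y - y0) by ring] at this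

theorem sum_le_of_ncard_dg_le {C : ℕ} (hC : ∀ m : ℕ, {I : Ideal B | I ≠ ⊥ ∧ V.dg I = m}.ncard ≤ C * q ^ m)
    (S : Finset (Ideal B)) (hS : ∀ I ∈ S, I ≠ ⊥ ∧ I ≠ ⊤) {E : ℕ} (hE : 2 ≤ E) :
    ∑ I ∈ S, (1 : ℝ) / (q : ℝ) ^ (E * V.dg I) ≤ 2 * C / (q : ℝ) ^ (E - 1) := by
  classical
  have hq2 : (2 : ℝ) ≤ q := by exact_mod_cast Fintype.one_lt_card (α := k)
  have hq0 : (0 : ℝ) < q := by linarith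
  set X := S.sup V.dg with hX
  have h1 : ∀ I ∈ S, V.dg I ∈ Finset.Icc 1 X := fun I hI =>
    Finset.mem_Icc.2 ⟨V.dg_pos (hS I hI).1 (hS I hI).2, Finset.le_sup hI⟩
  rw [← Finset.sum_fiberwise_of_maps_to h1]
  have h2 : ∀ m ∈ Finset.Icc 1 X, ∑ I ∈ S with V.dg I = m, (1 : ℝ) / (q : ℝ) ^ (E * V.dg I) ≤
      C * ((1 : ℝ) / q ^ (E - 1)) ^ m := by
    intro m hm
    rw [Finset.sum_congr rfl (g := fun _ => (1 : ℝ) / (q : ℝ) ^ (E * m))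
      (fun I hI => by rw [(Finset.mem_filter.1 hI).2]), Finset.sum_const, nsmul_eq_mul]
    have h3 : (S.filter (fun I => V.dg I = m)).card ≤ C * q ^ m := by
      refine le_trans ?_ (hC m)
      rw [← Set.ncard_coe_finset]
      refine Set.ncard_le_ncard ?_ ((V.finite_dg_le m).subset fun I hI => ⟨hI.1, hI.2.le⟩)
      intro I hI
      have := Finset.mem_filter.1 (Finset.mem_coe.1 hI)
      exact ⟨(hS I this.1).1, this.2⟩
    have h4 : ((S.filter (fun I => V.dg I = m)).card : ℝ) ≤ C * (q : ℝ) ^ m := by exact_mod_cast h3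
    calc _ ≤ C * (q : ℝ) ^ m * (1 / (q : ℝ) ^ (E * m)) := by gcongr
      _ = _ := by
        obtain ⟨e, rfl⟩ : ∃ e, E = e + 1 := ⟨E - 1, by omega⟩
        rw [Nat.add_sub_cancel, div_pow, one_pow, ← pow_mul, add_mul, one_mul, pow_add]
        field_simp
  refine (Finset.sum_le_sum h2).trans ?_
  rw [← Finset.mul_sum]
  have h5 : (1 : ℝ) / q ^ (E - 1) ≤ 1 / 2 := by
    refine one_div_le_one_div_of_le (by norm_num) (hq2.trans ?_)
    exact le_self_pow₀ (by linarith) (by omega)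
  have h6 : ∀ (y : ℝ), 0 ≤ y → y ≤ 1 / 2 → ∑ m ∈ Finset.Icc 1 X, y ^ m ≤ 2 * y := by
    intro y hy0 hy
    have : ∀ X : ℕ, ∑ m ∈ Finset.Icc 1 X, y ^ m ≤ 2 * y - 2 * y ^ (X + 1) := by
      intro X
      induction X with
      | zero => simp
      | succ X ih =>
        rw [Finset.sum_Icc_succ_top (by omega)]
        have : y ^ (X + 1 + 1) = y ^ (X + 1) * y := pow_succ _ _
        have := pow_nonneg hy0 (X + 1)
        nlinarith
    have := this X
    have := pow_nonneg hy0 (X + 1)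
    linarith
  have h7 := h6 _ (by positivity) h5
  calc _ ≤ (C : ℝ) * (2 * (1 / (q : ℝ) ^ (E - 1))) := by gcongr
    _ = _ := by ring

theorem two_mul_ncard_lt : ∃ E0, 2 ≤ E0 ∧ ∀ E ≥ E0, ∀ s a b : B, s ≠ 0 →
    (∀ P : Ideal B, P.IsPrime → s ∉ P → a ∈ P → b ∉ P) → ∃ n1, ∀ n ≥ n1,
      2 * {y : B | y ∈ V.L n ∧ ∃ P : Ideal B, P.IsPrime ∧ s ∉ P ∧ a + b * y ∈ P ^ E}.ncard
        < q ^ V.r n := by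
  classical
  obtain ⟨C, hC⟩ := V.exists_card_dg_eq
  obtain ⟨C', hC'⟩ := V.exists_card_dg_le
  have hδ : 0 < δ := Module.finrank_pos
  have hq2' : 2 ≤ q := Fintype.one_lt_card (α := k)
  have hq2 : (2 : ℝ) ≤ q := by exact_mod_cast hq2'
  have hq0 : (0 : ℝ) < q := by linarith
  have hlarge : ∀ x : ℕ, x ≤ q ^ x := fun x =>
    (Nat.lt_two_pow_self).le.trans (Nat.pow_le_pow_left hq2' x)
  set W := 16 * C * q ^ ((V.n₀ + 1) * δ) with hW
  refine ⟨W + 2, by omega, fun E hE s a b hs hab => ?_⟩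
  rcases eq_or_ne b 0 with rfl | hb
  · refine ⟨0, fun n _ => ?_⟩
    have : {y : B | y ∈ V.L n ∧ ∃ P : Ideal B, P.IsPrime ∧ s ∉ P ∧ a + 0 * y ∈ P ^ E} = ∅ := by
      rw [Set.eq_empty_iff_forall_notMem]
      rintro y ⟨-, P, hP, hsP, hy⟩
      rw [zero_mul, add_zero] at hy
      exact hab P hP hsP (Ideal.pow_le_self (by omega) hy) P.zero_mem
    rw [this, Set.ncard_empty, mul_zero]
    exact pow_pos (by omega) _
  set c := V.ν a + V.ν b with hc
  set D := 8 * (1 + C') with hD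
  refine ⟨2 * V.n₀ + c + 2 * D, fun n hn => ?_⟩
  set X := (n + c) * δ / E with hX
  have hfin : {P : Ideal B | P ≠ ⊥ ∧ V.dg P ≤ X}.Finite := V.finite_dg_le X
  set S := hfin.toFinset.filter (fun P => P.IsPrime ∧ b ∉ P) with hS
  have hSmem : ∀ P ∈ S, (P ≠ ⊥ ∧ V.dg P ≤ X) ∧ P.IsPrime ∧ b ∉ P := by
    intro P hP
    rw [hS, Finset.mem_filter, Set.Finite.mem_toFinset] at hP
    exact hP
  have hbad : {y : B | y ∈ V.L n ∧ ∃ P : Ideal B, P.IsPrime ∧ s ∉ P ∧ a + b * y ∈ P ^ E} ⊆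
      {y : B | y ∈ V.L n ∧ a + b * y ∈ (⊥ : Ideal B)} ∪
        ⋃ P ∈ S, {y : B | y ∈ V.L n ∧ a + b * y ∈ P ^ E} := by
    rintro y ⟨hy, P, hP, hsP, hyP⟩
    by_cases h0 : a + b * y = 0
    · exact Or.inl ⟨hy, h0⟩
    right
    have hP0 : P ≠ ⊥ := by
      rintro rfl
      rw [Ideal.bot_pow (by omega)] at hyP
      exact h0 hyP
    have hy' := V.dg_le_of_dvd (I := P ^ E) (J := Ideal.span {a + b * y}) (by simpa using h0)
      (Ideal.dvd_span_singleton.2 hyP)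
    rw [V.dg_span h0, V.dg_pow hP0] at hy'
    have h1 : V.ν (a + b * y) ≤ n + c := by
      refine (V.ν_add _ _).trans ?_
      have := V.ν_mul_le b y
      have : V.ν y ≤ n := hy
      omega
    refine Set.mem_iUnion₂.2 ⟨P, ?_, hy, hyP⟩
    rw [hS, Finset.mem_filter, Set.Finite.mem_toFinset]
    refine ⟨⟨hP0, ?_⟩, hP, fun hbP => ?_⟩
    · rw [hX, Nat.le_div_iff_mul_le (by omega), mul_comm]
      exact hy'.trans (Nat.mul_le_mul_right _ h1)
    · refine hab P hP hsP ?_ hbP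
      have := Ideal.pow_le_self (by omega) hyP
      simpa using P.sub_mem this (P.mul_mem_right y hbP)
  have hfinL : Finite (V.L n) := V.finite_L' n
  have hfinU : ({y : B | y ∈ V.L n ∧ a + b * y ∈ (⊥ : Ideal B)} ∪
        ⋃ P ∈ S, {y : B | y ∈ V.L n ∧ a + b * y ∈ P ^ E}).Finite := by
    refine Set.Finite.subset (Set.toFinite (V.L n : Set B)) ?_
    rintro y (h | h)
    · exact h.1
    · obtain ⟨P, _, h⟩ := Set.mem_iUnion₂.1 h
      exact h.1
  have hbot : {y : B | y ∈ V.L n ∧ a + b * y ∈ (⊥ : Ideal B)}.ncard ≤ 1 := by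
    refine (V.ncard_add_mul_mem_le n ⊥ (fun z hz => ?_)).trans ?_
    · have := V.isDomain'
      simpa [hb] using hz
    · have : V.LI n ⊥ = ⊥ := by
        rw [eq_bot_iff]
        exact fun x hx => hx.2
      rw [this]
      simp
  have hU : ((⋃ P ∈ S, {y : B | y ∈ V.L n ∧ a + b * y ∈ P ^ E}).ncard : ℝ) ≤
      ∑ P ∈ S, (1 + (q : ℝ) ^ ((n + 1) * δ) * (1 / (q : ℝ) ^ (E * V.dg P))) := by
    have h1 : (⋃ P ∈ S, {y : B | y ∈ V.L n ∧ a + b * y ∈ P ^ E}).ncard ≤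
        ∑ P ∈ S, {y : B | y ∈ V.L n ∧ a + b * y ∈ P ^ E}.ncard := by
      exact Finset.set_ncard_biUnion_le S _
    refine (Nat.cast_le.2 h1).trans ?_
    rw [Nat.cast_sum]
    refine Finset.sum_le_sum fun P hP => ?_
    obtain ⟨⟨hP0, -⟩, hPp, hbP⟩ := hSmem P hP
    refine (Nat.cast_le.2 (V.ncard_add_mul_mem_le n (P ^ E)
      (fun z hz => (hPp.mul_mem_pow P hz).resolve_left hbP))).trans ?_
    refine (V.natCard_LI_le n (pow_ne_zero _ hP0)).trans ?_
    rw [V.dg_pow hP0, mul_one_div]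
  have hScard : (S.card : ℝ) ≤ C' * (q : ℝ) ^ X := by
    have : S.card ≤ C' * q ^ X := by
      refine le_trans ?_ (hC' X)
      rw [← Set.ncard_coe_finset]
      exact Set.ncard_le_ncard (fun P hP => (hSmem P hP).1) hfin
    exact_mod_cast this
  rw [Finset.sum_add_distrib, ← Finset.mul_sum, Finset.sum_const, nsmul_eq_mul, mul_one] at hU
  have hsum := V.sum_le_of_ncard_dg_le hC S
    (fun P hP => ⟨(hSmem P hP).1.1, (hSmem P hP).2.1.ne_top⟩) (E := E) (by omega)
  have htot := (Set.ncard_le_ncard hbad hfinU).trans (Set.ncard_union_le _ _)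
  set bad := {y : B | y ∈ V.L n ∧ ∃ P : Ideal B, P.IsPrime ∧ s ∉ P ∧ a + b * y ∈ P ^ E}.ncard
  have htot' : (bad : ℝ) ≤ 1 + (C' * (q : ℝ) ^ X +
      (q : ℝ) ^ ((n + 1) * δ) * (2 * C / (q : ℝ) ^ (E - 1))) := by
    have h1 := htot.trans (Nat.add_le_add_right hbot _)
    have h2 : (bad : ℝ) ≤ 1 + ((⋃ P ∈ S, {y : B | y ∈ V.L n ∧ a + b * y ∈ P ^ E}).ncard : ℝ) := by
      exact_mod_cast h1
    refine h2.trans ?_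
    have : (q : ℝ) ^ ((n + 1) * δ) * ∑ I ∈ S, (1 : ℝ) / (q : ℝ) ^ (E * V.dg I) ≤
      (q : ℝ) ^ ((n + 1) * δ) * (2 * C / (q : ℝ) ^ (E - 1)) := by gcongr
    linarith
  have hrn : (n - V.n₀) * δ ≤ V.r n := by
    have := V.r_add le_rfl (n - V.n₀)
    rw [Nat.add_sub_cancel' (by omega)] at this
    omega
  have hN1 : (q : ℝ) ^ ((n + 1) * δ) * (2 * C / (q : ℝ) ^ (E - 1)) ≤ (q : ℝ) ^ V.r n / 8 := by
    have h1 : (q : ℝ) ^ ((n + 1) * δ) ≤ (q : ℝ) ^ V.r n * (q : ℝ) ^ ((V.n₀ + 1) * δ) := by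
      rw [← pow_add]
      refine pow_le_pow_right₀ (by linarith) ?_
      have : (n + 1) * δ = (n - V.n₀) * δ + (V.n₀ + 1) * δ := by
        rw [← add_mul]; congr 1; omega
      omega
    have h2 : (W : ℝ) ≤ (q : ℝ) ^ (E - 1) := by
      have := (hlarge W).trans (Nat.pow_le_pow_right (by omega) (show W ≤ E - 1 by omega))
      exact_mod_cast this
    have h3 : (W : ℝ) = 16 * C * (q : ℝ) ^ ((V.n₀ + 1) * δ) := by rw [hW]; push_cast; ring
    rw [h3] at h2
    rw [← mul_div_assoc, div_le_iff₀ (by positivity)]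
    calc (q : ℝ) ^ ((n + 1) * δ) * (2 * C)
        ≤ (q : ℝ) ^ V.r n * (q : ℝ) ^ ((V.n₀ + 1) * δ) * (2 * C) := by gcongr
      _ = (q : ℝ) ^ V.r n / 8 * (16 * C * (q : ℝ) ^ ((V.n₀ + 1) * δ)) := by ring
      _ ≤ _ := by gcongr
  have hN2 : 1 + C' * (q : ℝ) ^ X ≤ (q : ℝ) ^ V.r n / 8 := by
    have h1 : D + X ≤ V.r n := by
      have h2 : 2 * X ≤ (n + c) * δ := by
        have := Nat.div_mul_le_self ((n + c) * δ) E
        rw [← hX] at this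
        nlinarith
      have h3 : D ≤ D * δ := Nat.le_mul_of_pos_right _ hδ
      have h4 : 2 * (D * δ) + (n + c) * δ ≤ 2 * ((n - V.n₀) * δ) := by
        have : (2 * D + (n + c)) * δ ≤ (2 * (n - V.n₀)) * δ := Nat.mul_le_mul_right _ (by omega)
        linarith
      omega
    have h2 : D * q ^ X ≤ q ^ V.r n := by
      refine le_trans ?_ (Nat.pow_le_pow_right (by omega) h1)
      rw [pow_add]
      exact Nat.mul_le_mul_right _ (hlarge D)
    have h3 : (D : ℝ) * (q : ℝ) ^ X ≤ (q : ℝ) ^ V.r n := by exact_mod_cast h2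
    have h4 : (D : ℝ) = 8 * (1 + C') := by rw [hD]; push_cast; ring
    have h5 : (1 : ℝ) ≤ (q : ℝ) ^ X := one_le_pow₀ (by linarith)
    rw [h4] at h3
    linarith
  have hfinal : 2 * (bad : ℝ) < (q : ℝ) ^ V.r n := by
    have : 0 < (q : ℝ) ^ V.r n := by positivity
    linarith
  exact_mod_cast hfinal

include V in
theorem exists_add_mul_notMem_pow : ∃ E0, 2 ≤ E0 ∧ ∀ E ≥ E0, ∀ s : B, s ≠ 0 → ∀ a b a' b' : B,
    (∀ P : Ideal B, P.IsPrime → s ∉ P → a ∈ P → b ∉ P) →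
    (∀ P : Ideal B, P.IsPrime → s ∉ P → a' ∈ P → b' ∉ P) →
    ∃ y : B, ∀ P : Ideal B, P.IsPrime → s ∉ P → a + b * y ∉ P ^ E ∧ a' + b' * y ∉ P ^ E := by
  obtain ⟨E0, hE0, H⟩ := V.two_mul_ncard_lt
  refine ⟨E0, hE0, fun E hE s hs a b a' b' h h' => ?_⟩
  obtain ⟨n1, h1⟩ := H E hE s a b hs h
  obtain ⟨n2, h2⟩ := H E hE s a' b' hs h'
  set n := max n1 n2
  have h1 := h1 n (le_max_left _ _)
  have h2 := h2 n (le_max_right _ _)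
  have : Finite (V.L n) := V.finite_L' n
  by_contra! hcon
  have hsub : (V.L n : Set B) ⊆
      {y : B | y ∈ V.L n ∧ ∃ P : Ideal B, P.IsPrime ∧ s ∉ P ∧ a + b * y ∈ P ^ E} ∪
      {y : B | y ∈ V.L n ∧ ∃ P : Ideal B, P.IsPrime ∧ s ∉ P ∧ a' + b' * y ∈ P ^ E} := by
    intro y hy
    obtain ⟨P, hP, hsP, hyP⟩ := hcon y
    by_cases h : a + b * y ∈ P ^ E
    · exact Or.inl ⟨hy, P, hP, hsP, h⟩
    · exact Or.inr ⟨hy, P, hP, hsP, hyP h⟩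
  have h3 := (Set.ncard_le_ncard hsub (Set.Finite.subset (Set.toFinite (V.L n : Set B)) (by
    rintro y (h | h) <;> exact h.1))).trans (Set.ncard_union_le _ _)
  have h4 := V.natCard_L n
  rw [← SetLike.coe_sort_coe, Nat.card_coe_set_eq] at h4
  omega

end OnePlace

section Criterion

variable {A : Type*} [CommRing A] [IsDedekindDomain A]

open UniqueFactorizationMonoid in
theorem exists_dvd_pow_mul_pow {e s y : A} (he : e ≠ 0) (n : ℕ)
    (h : ∀ P : Ideal A, P.IsPrime → s ∉ P → e ∉ P ^ (n + 1))
    (hy : ∀ P : Ideal A, P.IsPrime → s ∉ P → e ∈ P → y ∈ P) : ∃ L, e ∣ s ^ L * y ^ n := by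
  classical
  have he' : Ideal.span {e} ≠ ⊥ := by simpa using he
  set M := normalizedFactors (Ideal.span {e}) with hM
  refine ⟨M.card, ?_⟩
  have hpr : ∀ P ∈ M, Prime P := fun P hP => prime_of_normalized_factor P hP
  have hprod : ∏ P ∈ M.toFinset, P ^ M.count P = Ideal.span {e} := by
    rw [← Finset.prod_multiset_count]
    exact Ideal.prod_normalizedFactors_eq_self he'
  rw [← Ideal.mem_span_singleton, ← hprod]
  rw [← IsDedekindDomain.inf_pow_eq_prod_of_prime M.toFinset (fun P => P) (fun P => M.count P)
    (fun P hP => hpr P (Multiset.mem_toFinset.1 hP)) (fun i _ j _ hij => hij)]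
  rw [Submodule.mem_finsetInf]
  intro P hP
  have hPM := Multiset.mem_toFinset.1 hP
  have hPp : P.IsPrime := Ideal.isPrime_of_prime (hpr P hPM)
  by_cases hs : s ∈ P
  · refine Ideal.mul_mem_right _ _ ?_
    exact Ideal.pow_le_pow_right (Multiset.count_le_card P M) (Ideal.pow_mem_pow hs _)
  · have hdvd : P ^ M.count P ∣ Ideal.span {e} := by
      rw [← hprod]; exact Finset.dvd_prod_of_mem (fun P => P ^ M.count P) hP
    have hle : M.count P ≤ n := by
      by_contra! hlt
      exact h P hPp hs (Ideal.dvd_span_singleton.1 ((pow_dvd_pow P hlt).trans hdvd))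
    have heP : e ∈ P := Ideal.dvd_span_singleton.1 (dvd_of_mem_normalizedFactors hPM)
    exact Ideal.mul_mem_left _ _
      (Ideal.pow_le_pow_right hle (Ideal.pow_mem_pow (hy P hPp hs heP) _))

theorem Ideal.dvd_natCard_quot {p : ℕ} [Fact p.Prime] [CharP A p] {P : Ideal A} (hP : P ≠ ⊤)
    [Finite (A ⧸ P)] : p ∣ Nat.card (A ⧸ P) := by
  have : Nontrivial (A ⧸ P) := Ideal.Quotient.nontrivial_iff.2 hP
  have : addOrderOf (1 : A ⧸ P) = p := by
    refine addOrderOf_eq_prime ?_ one_ne_zero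
    rw [nsmul_eq_mul, mul_one, ← map_natCast (Ideal.Quotient.mk P), CharP.cast_eq_zero, map_zero]
  rw [← this]
  exact addOrderOf_dvd_natCard _

theorem Units.pow_sub_one_mem {P : Ideal A} [P.IsMaximal] [Finite (A ⧸ P)] (v : Aˣ) {m : ℕ}
    (hm : Nat.card (A ⧸ P) - 1 ∣ m) : (v : A) ^ m - 1 ∈ P := by
  let _ := Ideal.Quotient.field P
  let _ := Fintype.ofFinite (A ⧸ P)
  obtain ⟨c, rfl⟩ := hm
  rw [← Ideal.Quotient.mk_eq_mk_iff_sub_mem, map_pow, map_one, pow_mul, Nat.card_eq_fintype_card,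
    FiniteField.pow_card_sub_one_eq_one, one_pow]
  exact (v.isUnit.map (Ideal.Quotient.mk P)).ne_zero

theorem exists_unit_eq_mul_add (hfin : ∀ I : Ideal A, I ≠ ⊥ → Finite (A ⧸ I)) {p : ℕ}
    [Fact p.Prime] [CharP A p] (v : Aˣ) {θ s t : A} (hv : (v : A) = 1 + θ) (hθ : θ ≠ 0)
    (hst : s * t ∣ θ) (i : ℕ) : ∃ N, ∀ x0 g : A, t * x0 = -θ ^ p ^ i →
      (∀ P : Ideal A, P.IsPrime → s ∉ P → x0 + s ^ N * g ∉ P ^ (p ^ i + 1)) →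
      ∃ n : ℕ, ∃ z, 1 - (v : A) ^ n = (x0 + s ^ N * g) * (t + s * z) := by
  classical
  have hp : p.Prime := Fact.out
  have : ExpChar A p := ExpChar.prime hp
  set Q := p ^ i with hQ
  have hQ0 : Q ≠ 0 := pow_ne_zero _ hp.ne_zero
  obtain ⟨κ', hκ'⟩ := hst
  have hs0 : s ≠ 0 := by rintro rfl; simp at hκ'; exact hθ hκ'
  have ht0 : t ≠ 0 := by rintro rfl; simp at hκ'; exact hθ hκ'
  obtain ⟨N0, h, α, hh0, ⟨h1, hh1⟩, hα⟩ : ∃ N0 : ℕ, ∃ h α : A, h ≠ 0 ∧ s ∣ h - 1 ∧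
      s ^ N0 * h = θ ^ Q * α := by
    have hfin' : Finite (A ⧸ Ideal.span {θ ^ Q}) := hfin _ (by simpa using fun h => absurd h hθ)
    obtain ⟨i, j, hij, heq⟩ : ∃ i j : ℕ, i < j ∧
        (Ideal.Quotient.mk (Ideal.span {θ ^ Q}) s) ^ i =
        (Ideal.Quotient.mk (Ideal.span {θ ^ Q}) s) ^ j := by
      have := not_injective_infinite_finite
        (fun n : ℕ => (Ideal.Quotient.mk (Ideal.span {θ ^ Q}) s) ^ n)
      rw [Function.not_injective_iff] at this
      obtain ⟨a, b, hab, hne⟩ := this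
      rcases lt_or_gt_of_ne hne with h | h
      · exact ⟨a, b, h, hab⟩
      · exact ⟨b, a, h, hab.symm⟩
    rw [← map_pow, ← map_pow, Ideal.Quotient.mk_eq_mk_iff_sub_mem, Ideal.mem_span_singleton] at heq
    obtain ⟨α, hα⟩ := heq
    obtain ⟨d, rfl⟩ : ∃ d, j = i + (d + 1) := ⟨j - i - 1, by omega⟩
    by_cases h0 : 1 - s ^ (d + 1) = 0
    · refine ⟨i, 1 - s ^ (d + 1) + s * θ ^ Q, α + s ^ i * s, ?_, ⟨- s ^ d + θ ^ Q, by ring⟩, ?_⟩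
      · rw [h0, zero_add]
        exact mul_ne_zero hs0 (pow_ne_zero _ hθ)
      · rw [mul_add, mul_add, ← hα]; ring
    · refine ⟨i, 1 - s ^ (d + 1), α, h0, ⟨- s ^ d, by ring⟩, ?_⟩
      rw [← hα]; ring
  refine ⟨N0 + 2, fun x0 g hx0 he => ?_⟩
  set e := x0 + s ^ (N0 + 2) * g with hedef
  have he0 : e ≠ 0 := by
    intro h0
    refine he ⊥ Ideal.isPrime_bot (by simpa using hs0) ?_
    rw [h0]; exact zero_mem _
  have heI : Ideal.span {e} ≠ ⊥ := by simpa using he0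
  have hfact : {P : Ideal A | P.IsPrime ∧ e ∈ P}.Finite := by
    refine ((Ideal.finite_factors heI).image IsDedekindDomain.HeightOneSpectrum.asIdeal).subset ?_
    rintro P ⟨hP, heP⟩
    exact ⟨⟨P, hP, fun h => he0 (by simpa [h] using heP)⟩, Ideal.dvd_span_singleton.2 heP, rfl⟩
  set m := (∏ P ∈ hfact.toFinset, (Nat.card (A ⧸ P) - 1)) ^ 2 with hm
  have hmax : ∀ P : Ideal A, P.IsPrime → e ∈ P → P.IsMaximal ∧ Finite (A ⧸ P) := by
    intro P hP heP
    have hP0 : P ≠ ⊥ := by rintro rfl; exact he0 (by simpa using heP)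
    exact ⟨hP.isMaximal hP0, hfin P hP0⟩
  have hm1 : (m : A) = 1 := by
    rw [hm, Nat.cast_pow, Nat.cast_prod, Finset.prod_congr rfl (g := fun _ => (-1 : A)),
      Finset.prod_const, ← pow_mul, mul_comm, pow_mul, neg_one_sq, one_pow]
    intro P hP
    rw [Set.Finite.mem_toFinset] at hP
    obtain ⟨-, hf⟩ := hmax P hP.1 hP.2
    rw [Nat.cast_sub Nat.card_pos, Nat.cast_one,
      (CharP.cast_eq_zero_iff A p _).2 (Ideal.dvd_natCard_quot hP.1.ne_top), zero_sub]
  obtain ⟨L, E, hE⟩ := exists_dvd_pow_mul_pow (y := (v : A) ^ m - 1) he0 Q he (fun P hP _ heP => by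
    obtain ⟨h1, h2⟩ := hmax P hP heP
    refine v.pow_sub_one_mem ?_
    rw [hm]
    exact (Finset.dvd_prod_of_mem (fun P => Nat.card (A ⧸ P) - 1)
      ((Set.Finite.mem_toFinset hfact).2 ⟨hP, heP⟩)).trans (dvd_pow_self _ two_ne_zero))
  obtain ⟨ρ, hρ⟩ : ∃ ρ, (v : A) ^ m - 1 = θ + θ ^ 2 * ρ := by
    have h1 : ∀ m : ℕ, ∃ ρ, (1 + θ) ^ m = 1 + m * θ + θ ^ 2 * ρ := by
      intro m
      induction m with
      | zero => exact ⟨0, by simp⟩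
      | succ m ih =>
        obtain ⟨ρ, hρ⟩ := ih
        refine ⟨m + ρ + ρ * θ, ?_⟩
        rw [pow_succ, hρ]; push_cast; ring
    obtain ⟨ρ, hρ⟩ := h1 m
    exact ⟨ρ, by rw [hv, hρ, hm1]; ring⟩
  have hw : ((v : A) ^ m - 1) ^ Q = (v : A) ^ (m * Q) - 1 := by
    rw [hQ, sub_pow_expChar_pow, one_pow, pow_mul]
  have hw2 : (v : A) ^ (m * Q) - 1 = θ ^ Q + θ ^ Q * θ ^ Q * ρ ^ Q := by
    rw [← hw, hρ, hQ, add_pow_expChar_pow]; ring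
  obtain ⟨κ, hκ⟩ : s * t ∣ θ ^ Q := (Dvd.intro _ hκ'.symm).trans (dvd_pow_self _ hQ0)
  have hx0' : x0 = - (s * κ) := by
    refine mul_left_cancel₀ ht0 ?_
    rw [hx0, hκ]; ring
  rw [hw] at hE
  set w := (v : A) ^ (m * Q) with hwdef
  set h' := h - s ^ 2 * t * α * g with hh'
  have heh : e * h = - (s * κ * h') := by
    have : s ^ (N0 + 2) * g * h = s ^ 2 * g * (θ ^ Q * α) := by rw [← hα]; ring
    rw [hedef, add_mul, this, hx0', hκ, hh']; ring
  set Y := 1 - w - t * e with hY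
  have hYh : Y * h = - (s ^ 2 * t ^ 2 * κ * (κ * ρ ^ Q * h + s * α * g)) := by
    have h3 : Y = - (θ ^ Q * θ ^ Q * ρ ^ Q) - t * (s ^ (N0 + 2) * g) := by
      rw [hY, hedef, mul_add, hx0]
      linear_combination -hw2
    have : s ^ (N0 + 2) * g * h = s ^ 2 * g * (θ ^ Q * α) := by rw [← hα]; ring
    rw [h3, sub_mul, mul_assoc t, this, hκ]; ring
  have hd1 : s * e ∣ Y * h' := by
    refine ⟨t ^ 2 * (κ * ρ ^ Q * h + s * α * g), mul_right_cancel₀ hh0 ?_⟩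
    linear_combination h' * hYh - s * t ^ 2 * (κ * ρ ^ Q * h + s * α * g) * heh
  have hd2 : s * e ∣ Y * s ^ (L + 1) := by
    refine ⟨-E - t * s ^ L, ?_⟩
    rw [hY]
    linear_combination -s * hE
  have hcop : IsCoprime h' (s ^ (L + 1)) := by
    refine IsCoprime.pow_right ⟨1, -h1 + s * t * α * g, ?_⟩
    rw [hh']
    linear_combination hh1
  obtain ⟨u1, u2, hu⟩ := hcop
  have hd : s * e ∣ Y := by
    have := (hd1.mul_left u1).add (hd2.mul_left u2)
    rwa [show u1 * (Y * h') + u2 * (Y * s ^ (L + 1)) = Y by linear_combination Y * hu] at this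
  obtain ⟨z, hz⟩ := hd
  exact ⟨m * Q, z, by linear_combination hz⟩

end Criterion

namespace SL2

open Matrix

variable {A : Type*} [CommRing A]

/-- The matrix `(a, b; c, d)` of determinant one. -/
def mk (a b c d : A) (h : a * d - b * c = 1) : SpecialLinearGroup (Fin 2) A :=
  ⟨!![a, b; c, d], by rw [Matrix.det_fin_two_of, h]⟩

theorem mk_congr {a b c d a' b' c' d' : A} {h : a * d - b * c = 1} {h' : a' * d' - b' * c' = 1}
    (h1 : a = a') (h2 : b = b') (h3 : c = c') (h4 : d = d') : mk a b c d h = mk a' b' c' d' h' := by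
  subst h1 h2 h3 h4; rfl

theorem exists_mk (g : SpecialLinearGroup (Fin 2) A) : ∃ a b c d h, g = mk a b c d h := by
  refine ⟨g.1 0 0, g.1 0 1, g.1 1 0, g.1 1 1, ?_, ?_⟩
  · rw [← Matrix.det_fin_two]; exact g.2
  · apply Subtype.ext
    exact Matrix.eta_fin_two g.1

theorem det_mul {a b c d a' b' c' d' : A} (h : a * d - b * c = 1) (h' : a' * d' - b' * c' = 1) :
    (a * a' + b * c') * (c * b' + d * d') - (a * b' + b * d') * (c * a' + d * c') = 1 := by
  linear_combination (a' * d' - b' * c') * h + h'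

theorem mk_mul {a b c d a' b' c' d' : A} (h : a * d - b * c = 1) (h' : a' * d' - b' * c' = 1) :
    mk a b c d h * mk a' b' c' d' h' =
      mk (a * a' + b * c') (a * b' + b * d') (c * a' + d * c') (c * b' + d * d') (det_mul h h') := by
  apply Subtype.ext
  exact Matrix.mul_fin_two _ _ _ _ _ _ _ _

theorem mk_one : mk (1 : A) 0 0 1 (by ring) = 1 := by
  apply Subtype.ext
  exact Matrix.one_fin_two.symm

theorem mk_inv {a b c d : A} (h : a * d - b * c = 1) :
    (mk a b c d h)⁻¹ = mk d (-b) (-c) a (by linear_combination h) := by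
  rw [inv_eq_iff_mul_eq_one, mk_mul, ← mk_one]
  exact mk_congr (by linear_combination h) (by ring) (by ring) (by linear_combination h)

/-- The upper elementary matrix. -/
def E12 (x : A) : SpecialLinearGroup (Fin 2) A := mk 1 x 0 1 (by ring)

/-- The lower elementary matrix. -/
def E21 (x : A) : SpecialLinearGroup (Fin 2) A := mk 1 0 x 1 (by ring)

/-- The diagonal matrix attached to a unit. -/
def dia (u : Aˣ) : SpecialLinearGroup (Fin 2) A := mk u 0 0 (↑u⁻¹ : A) (by simp)

/-- The Weyl element. -/
def weyl : SpecialLinearGroup (Fin 2) A := mk 0 1 (-1) 0 (by ring)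

variable {C : Type*} [AddCommGroup C] {f : SpecialLinearGroup (Fin 2) A → C}
  (hf : ∀ g h, f (g * h) = f g + f h)

include hf

theorem f_one : f 1 = 0 := by simpa using hf 1 1

theorem f_inv (g : SpecialLinearGroup (Fin 2) A) : f g⁻¹ = -f g := by
  rw [eq_neg_iff_add_eq_zero, ← hf, inv_mul_cancel, f_one hf]

theorem f_conj (g h : SpecialLinearGroup (Fin 2) A) : f (g * h * g⁻¹) = f h := by
  rw [hf, hf, f_inv hf]; abel

theorem f_eq_of_mul_eq_mul {g h h' : SpecialLinearGroup (Fin 2) A} (e : g * h = h' * g) :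
    f h' = f h := by
  rw [← f_conj hf g h, e, mul_inv_cancel_right]

theorem f_E12_add (x y : A) : f (E12 (x + y)) = f (E12 x) + f (E12 y) := by
  rw [← hf, E12, E12, E12, mk_mul]
  congr 1
  exact mk_congr (by ring) (by ring) (by ring) (by ring)

theorem f_E12_zero : f (E12 0) = 0 := by simpa using f_E12_add hf 0 0

theorem f_E12_neg (x : A) : f (E12 (-x)) = -f (E12 x) := by
  rw [eq_neg_iff_add_eq_zero, ← f_E12_add hf, neg_add_cancel, f_E12_zero hf]

theorem f_E12_sub (x y : A) : f (E12 (x - y)) = f (E12 x) - f (E12 y) := by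
  rw [sub_eq_add_neg, f_E12_add hf, f_E12_neg hf, sub_eq_add_neg]

theorem f_E21 (x : A) : f (E21 x) = -f (E12 x) := by
  rw [← f_E12_neg hf]
  refine f_eq_of_mul_eq_mul hf (g := weyl) ?_
  rw [weyl, E12, E21, mk_mul, mk_mul]
  exact mk_congr (by ring) (by ring) (by ring) (by ring)

theorem f_E12_sq_mul (u : Aˣ) (x : A) : f (E12 ((u : A) ^ 2 * x)) = f (E12 x) := by
  refine f_eq_of_mul_eq_mul hf (g := dia u) ?_
  rw [dia, E12, E12, mk_mul, mk_mul]
  refine mk_congr (by ring) ?_ (by ring) (by ring)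
  linear_combination (-(u : A) * x) * u.mul_inv

theorem f_E12_sq_sub_one_mul (u : Aˣ) (x : A) : f (E12 (((u : A) ^ 2 - 1) * x)) = 0 := by
  rw [sub_mul, one_mul, f_E12_sub hf, f_E12_sq_mul hf, sub_self]

theorem f_weyl : f (weyl (A := A)) = f (E12 1) + f (E12 1) + f (E12 1) := by
  have : (weyl : SpecialLinearGroup (Fin 2) A) = E12 1 * E21 (-1) * E12 1 := by
    rw [weyl, E12, E21, mk_mul, mk_mul]
    exact mk_congr (by ring) (by ring) (by ring) (by ring)
  rw [this, hf, hf, f_E21 hf, f_E12_neg hf, neg_neg]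

theorem f_dia (u : Aˣ) : f (dia u) =
    f (E12 (u - 1 : A)) + f (E12 (u - 1 : A)) + f (E12 (u - 1 : A)) := by
  have : dia u * weyl = E12 (u : A) * E21 (-(↑u⁻¹ : A)) * E12 (u : A) := by
    rw [weyl, E12, E21, dia, mk_mul, mk_mul, mk_mul]
    refine mk_congr ?_ ?_ ?_ ?_
    · linear_combination u.mul_inv
    · linear_combination (u : A) * u.mul_inv
    · ring
    · linear_combination u.inv_mul
  have h1 : f (dia u) + f weyl = _ := (hf _ _).symm.trans (congrArg f this)
  have h2 : f (E12 (↑u⁻¹ : A)) = f (E12 (u : A)) := by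
    rw [← f_E12_sq_mul hf u (↑u⁻¹ : A)]
    congr 2
    linear_combination (u : A) * u.mul_inv
  rw [hf, hf, f_E21 hf, f_E12_neg hf, neg_neg, h2, f_weyl hf] at h1
  rw [f_E12_sub hf, eq_sub_of_add_eq h1]
  abel

theorem f_E12_eq_sq_mul {a c x j : A} (hac : IsCoprime a c) (w : Aˣ) (hw : 1 - (w : A) = a * c * x)
    (hj : ∀ y, f (E12 (j * y)) = 0) (hwj : j ∣ (w : A) - 1) (hcj : j ∣ c) :
    f (E12 x) = f (E12 (a ^ 2 * x)) := by
  obtain ⟨u, v, huv⟩ := hac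
  obtain ⟨c', rfl⟩ := hcj
  obtain ⟨w', hw'⟩ := hwj
  have hj' : ∀ y, f (E21 (j * y)) = 0 := fun y => by rw [f_E21 hf, hj, neg_zero]
  have hdia : f (dia w) = 0 := by rw [f_dia hf, hw', hj]; simp
  have h1 : f (E21 (-(j * c') ^ 2 * x * ↑w⁻¹) * dia w * E12 (a ^ 2 * x * ↑w⁻¹)) = f (E12 x) := by
    refine f_eq_of_mul_eq_mul hf (g := mk a (-v) (j * c') u (by linear_combination huv)) ?_
    have e1 := w.mul_inv
    have h2 : E21 (-(j * c') ^ 2 * x * ↑w⁻¹) * dia w * E12 (a ^ 2 * x * ↑w⁻¹) =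
        mk (1 - a * (j * c') * x) (a ^ 2 * x) (-(j * c') ^ 2 * x) (1 + a * (j * c') * x)
          (by ring) := by
      rw [E21, E12, dia, mk_mul, mk_mul]
      refine mk_congr ?_ ?_ ?_ ?_
      · linear_combination -hw
      · linear_combination (a ^ 2 * x) * e1
      · linear_combination (-(j * c') ^ 2 * x) * e1
      · linear_combination (1 + a * (j * c') * x + (-(j * c') ^ 2 * x) * (a ^ 2 * x * ↑w⁻¹)) * e1
          + (1 + a * (j * c') * x) * ↑w⁻¹ * hw
    rw [h2, E12, mk_mul, mk_mul]
    refine mk_congr ?_ ?_ ?_ ?_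
    · ring
    · linear_combination (-a * x) * huv
    · ring
    · linear_combination (-j * c' * x) * huv
  rw [hf, hf, hdia, add_zero] at h1
  rw [← h1, show -(j * c') ^ 2 * x * (↑w⁻¹ : A) = j * (- c' * (j * c') * x * ↑w⁻¹) by ring, hj',
    zero_add]
  have : a ^ 2 * x * (↑w⁻¹ : A) - a ^ 2 * x = j * (- a ^ 2 * x * ↑w⁻¹ * w') := by
    linear_combination (-a ^ 2 * x * ↑w⁻¹) * hw' + a ^ 2 * x * w.mul_inv
  rw [← sub_eq_zero, ← f_E12_sub hf, this, hj]

end SL2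

/-- The arithmetic properties of a ring of `S`-integers used to study `SL₂`. -/
structure ArithRing (A : Type*) [CommRing A] : Prop where
  finite_quot : ∀ I : Ideal A, I ≠ ⊥ → Finite (A ⧸ I)
  exists_notMem_pow : ∃ E0 : ℕ, ∀ E ≥ E0, ∀ s : A, s ≠ 0 → ∀ a b a' b' : A,
    (∀ P : Ideal A, P.IsPrime → s ∉ P → a ∈ P → b ∉ P) →
    (∀ P : Ideal A, P.IsPrime → s ∉ P → a' ∈ P → b' ∉ P) →
    ∃ y : A, ∀ P : Ideal A, P.IsPrime → s ∉ P → a + b * y ∉ P ^ E ∧ a' + b' * y ∉ P ^ E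
  exists_dvd_pow_sub : ∀ l : ℕ, l.Prime → ∀ a b : A, IsCoprime a b → ∃ u c : Aˣ, ∃ x t s : A,
    ∃ e : ℕ, ¬ l ∣ e ∧ u * b + u * a * x + (u * a + (u * b + u * a * x) * t) * s ∣
      (u * a + (u * b + u * a * x) * t) ^ e - c
  exists_unit : ∃ v : Aˣ, ∀ n : ℕ, n ≠ 0 → v ^ n ≠ 1

section

variable {A : Type*} [CommRing A] [IsDedekindDomain A]

theorem Ideal.IsPrime.mul_notMem_pow_add {P : Ideal A} (hP : P.IsPrime) {x y : A} {m n : ℕ}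
    (hx : x ∉ P ^ m) (hy : y ∉ P ^ n) : x * y ∉ P ^ (m + n) := by
  rcases eq_or_ne P ⊥ with rfl | h0
  · have hm : x ≠ 0 := by rintro rfl; exact hx (zero_mem _)
    have hn : y ≠ 0 := by rintro rfl; exact hy (zero_mem _)
    have : m ≠ 0 := by rintro rfl; simp at hx
    rw [Ideal.bot_pow (by omega)]
    simp [hm, hn]
  rw [← Ideal.dvd_span_singleton, pow_dvd_iff_le_emultiplicity, not_le] at *
  have hp := Ideal.prime_of_isPrime h0 hP
  rw [← Ideal.span_singleton_mul_span_singleton, emultiplicity_mul hp]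
  push_cast
  exact ENat.add_lt_add hx hy

theorem exists_forall_notMem_pow {x : A} (hx : x ≠ 0) :
    ∃ n : ℕ, ∀ P : Ideal A, P.IsPrime → x ∉ P ^ n := by
  have hx' : Ideal.span {x} ≠ ⊥ := by simpa using hx
  refine ⟨(UniqueFactorizationMonoid.normalizedFactors (Ideal.span {x})).card + 1,
    fun P hP hmem => ?_⟩
  rcases eq_or_ne P ⊥ with rfl | h0
  · rw [Ideal.bot_pow (by omega)] at hmem
    exact hx hmem
  rw [← Ideal.dvd_span_singleton, pow_dvd_iff_le_emultiplicity,
    UniqueFactorizationMonoid.le_emultiplicity_iff_replicate_le_normalizedFactors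
      (Ideal.prime_of_isPrime h0 hP).irreducible hx'] at hmem
  have := Multiset.card_le_card hmem
  rw [Multiset.card_replicate] at this
  omega

theorem ArithRing.exists_unit_sub_one_dvd (hA : ArithRing A) {x : A} (hx : x ≠ 0) :
    ∃ v : Aˣ, x ∣ (v : A) - 1 ∧ (v : A) - 1 ≠ 0 := by
  obtain ⟨v, hv⟩ := hA.exists_unit
  have := hA.finite_quot (Ideal.span {x}) (by simpa using hx)
  obtain ⟨n, hn0, hn⟩ := isOfFinOrder_iff_pow_eq_one.1
    (isOfFinOrder_of_finite (Units.map (Ideal.Quotient.mk (Ideal.span {x})).toMonoidHom v))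
  refine ⟨v ^ n, ?_, ?_⟩
  · rw [← Ideal.mem_span_singleton, ← Ideal.Quotient.mk_eq_mk_iff_sub_mem]
    rw [Units.ext_iff] at hn
    simpa using hn
  · intro h
    exact hv n hn0.ne' (Units.ext (sub_eq_zero.1 h))

end

namespace SL2

variable {A : Type*} [CommRing A] [IsDedekindDomain A]
variable {C : Type*} [AddCommGroup C] {f : Matrix.SpecialLinearGroup (Fin 2) A → C}
  (hf : ∀ g h, f (g * h) = f g + f h)

include hf

theorem f_E12_sq_sub_one_mul_of_isCoprime (hA : ArithRing A) (p : ℕ) [Fact p.Prime] [CharP A p]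
    {j : A} (hj0 : j ≠ 0) (hj : ∀ y, f (E12 (j * y)) = 0) {a : A} (ha : IsCoprime a j) (ξ : A) :
    f (E12 ((a ^ 2 - 1) * ξ)) = 0 := by
  have hp : p.Prime := Fact.out
  rcases eq_or_ne ξ 0 with rfl | hξ
  · rw [mul_zero, f_E12_zero hf]
  rcases eq_or_ne a 0 with rfl | ha0
  · obtain ⟨u, v, huv⟩ := ha
    rw [show (((0 : A) ^ 2 - 1) * ξ) = j * (- v * ξ) by linear_combination ξ * huv, hj]
  obtain ⟨v, ⟨θ', hθ'⟩, hθ0⟩ := hA.exists_unit_sub_one_dvd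
    (mul_ne_zero (mul_ne_zero ha0 (mul_ne_zero hj0 hj0)) hξ)
  set θ := (v : A) - 1 with hθ
  obtain ⟨E0, hE0⟩ := hA.exists_notMem_pow
  obtain ⟨n1, hn1⟩ := exists_forall_notMem_pow (mul_ne_zero hj0 hξ)
  set i := n1 + E0 with hi
  have hiQ : n1 + E0 ≤ p ^ i := (Nat.lt_pow_self hp.one_lt).le
  obtain ⟨N, hN⟩ := exists_unit_eq_mul_add hA.finite_quot (p := p) v (s := a) (t := 1) (θ := θ)
    (by rw [hθ]; ring) hθ0 (by rw [mul_one, hθ']; exact ⟨j * j * ξ * θ', by ring⟩) i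
  set Q := p ^ i with hQ
  have hQ0 : Q ≠ 0 := pow_ne_zero _ hp.ne_zero
  obtain ⟨T, hT⟩ : a * (j * j) * ξ ∣ θ ^ Q := (Dvd.intro _ hθ'.symm).trans (dvd_pow_self _ hQ0)
  obtain ⟨h0, h1, h01⟩ : IsCoprime (a ^ N) j := ha.pow_left
  have hsf := hE0 E0 le_rfl a ha0 (-(j * T) + a ^ N * h0) (a ^ N * j) (-(j * T) + a ^ N * h0)
    (a ^ N * j)
  have hgood : ∀ P : Ideal A, P.IsPrime → a ∉ P → -(j * T) + a ^ N * h0 ∈ P → a ^ N * j ∉ P := by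
    intro P hP haP h1P h2P
    have hjP : j ∈ P := (hP.mem_or_mem h2P).resolve_left fun h => haP (hP.mem_of_pow_mem _ h)
    refine hP.ne_top ((Ideal.eq_top_iff_one P).2 ?_)
    rw [show (1 : A) = (-(j * T) + a ^ N * h0) + (T + h1) * j by linear_combination -h01]
    exact P.add_mem h1P (P.mul_mem_left _ hjP)
  obtain ⟨y, hy⟩ := hsf hgood hgood
  set x := -(j * T) + a ^ N * h0 + a ^ N * j * y with hx
  have he : -θ ^ Q + a ^ N * (a * j * ξ * (h0 + j * y)) = a * (j * ξ) * x := by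
    rw [hx, hT]; ring
  obtain ⟨n, z, hz⟩ := hN (-θ ^ Q) (a * j * ξ * (h0 + j * y)) (one_mul _) (by
    intro P hP haP
    rw [he, mul_assoc]
    intro hmem
    have h2 := (hP.mul_mem_pow P hmem).resolve_left haP
    exact hP.mul_notMem_pow_add (hn1 P hP) (hy P hP haP).1
      (Ideal.pow_le_pow_right (by omega) h2))
  rw [he, ← Units.val_pow_eq_pow_val] at hz
  have hjw : j ∣ ((v ^ n : Aˣ) : A) - 1 := by
    rw [Units.val_pow_eq_pow_val]
    exact (Dvd.intro (a * j * ξ * θ') (by rw [← hθ, hθ']; ring)).trans (sub_one_dvd_pow_sub_one _ n)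
  have hcop : IsCoprime a (j * (1 + a * z)) :=
    ha.mul_right ⟨-z, 1, by ring⟩
  have key := f_E12_eq_sq_mul hf (x := ξ * x) hcop (v ^ n) (by rw [hz]; ring) hj hjw ⟨_, rfl⟩
  have : f (E12 ((a ^ 2 - 1) * (ξ * x))) = 0 := by
    rw [sub_mul, one_mul, f_E12_sub hf, ← key, sub_self]
  rw [← this, ← sub_eq_zero, ← f_E12_sub hf,
    show (a ^ 2 - 1) * ξ - (a ^ 2 - 1) * (ξ * x) =
      j * ((a ^ 2 - 1) * ξ * (h1 + T - a ^ N * y)) by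
      rw [hx]; linear_combination (-(a ^ 2 - 1) * ξ) * h01, hj]

end SL2

namespace SL2

open Matrix

section Rel

variable {A : Type*} [CommRing A]

/-- `h'` is the conjugate of `h` by `(1, 0; -1/s, 1)`. -/
def Rel (s : A) (h h' : SpecialLinearGroup (Fin 2) A) : Prop :=
  !![s, 0; -1, s] * h.1 = h'.1 * !![s, 0; -1, s]

theorem Rel.mul {s : A} {g g' h h' : SpecialLinearGroup (Fin 2) A} (hg : Rel s g g')
    (hh : Rel s h h') : Rel s (g * h) (g' * h') := by
  unfold Rel at *
  change _ * (g.1 * h.1) = (g'.1 * h'.1) * _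
  rw [← Matrix.mul_assoc, hg, Matrix.mul_assoc, hh, Matrix.mul_assoc]

theorem rel_mk {s a b c d a' b' c' d' : A} {h : a * d - b * c = 1} {h' : a' * d' - b' * c' = 1} :
    Rel s (mk a b c d h) (mk a' b' c' d' h') ↔ s * a = s * a' - b' ∧ s * b = s * b' ∧
      s * c - a = s * c' - d' ∧ s * d - b = s * d' := by
  unfold Rel mk
  rw [Matrix.mul_fin_two, Matrix.mul_fin_two]
  simp only [zero_mul, add_zero, neg_mul, one_mul, EmbeddingLike.apply_eq_iff_eq, mul_neg, mul_one,
    mul_zero, zero_add, Matrix.vecCons_inj, and_true]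
  constructor
  · rintro ⟨⟨h1, h2⟩, h3, h4⟩
    exact ⟨by linear_combination h1, by linear_combination h2, by linear_combination h3,
      by linear_combination h4⟩
  · rintro ⟨h1, h2, h3, h4⟩
    exact ⟨⟨by linear_combination h1, by linear_combination h2⟩, by linear_combination h3,
      by linear_combination h4⟩

theorem rel_E21 (s x : A) : Rel s (E21 x) (E21 x) := by
  unfold E21
  rw [rel_mk]
  exact ⟨by ring, by ring, by ring, by ring⟩

/-- The conjugate of `(1, s ^ 2 * x; 0, 1)` by `(1, 0; -1/s, 1)`. -/
def U (s x : A) : SpecialLinearGroup (Fin 2) A :=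
  mk (1 + s * x) (s ^ 2 * x) (-x) (1 - s * x) (by ring)

theorem rel_U (s x : A) : Rel s (E12 (s ^ 2 * x)) (U s x) := by
  unfold E12 U
  rw [rel_mk]
  exact ⟨by ring, by ring, by ring, by ring⟩

theorem U_add (s x y : A) : U s (x + y) = U s x * U s y := by
  unfold U
  rw [mk_mul]
  exact mk_congr (by ring) (by ring) (by ring) (by ring)

end Rel

variable {A : Type*} [CommRing A] [IsDomain A]
variable {C : Type*} [AddCommGroup C] {f : SpecialLinearGroup (Fin 2) A → C}
  (hf : ∀ g h, f (g * h) = f g + f h) (hE : ∀ x, f (E12 x) = 0)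

include hf hE

theorem f_E21' (x : A) : f (E21 x) = 0 := by rw [f_E21 hf, hE, neg_zero]

theorem f_dia' (u : Aˣ) : f (dia u) = 0 := by rw [f_dia hf, hE]; simp

theorem f_weyl' : f weyl = 0 := by rw [f_weyl hf, hE]; simp

theorem f_mk_unit (u : Aˣ) {b c d : A} (h : (u : A) * d - b * c = 1) : f (mk (u : A) b c d h) = 0 := by
  have e : mk (u : A) b c d h = E21 (c * ↑u⁻¹) * dia u * E12 (b * ↑u⁻¹) := by
    unfold E21 E12 dia
    rw [mk_mul, mk_mul]
    have := u.mul_inv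
    refine mk_congr ?_ ?_ ?_ ?_
    · ring
    · linear_combination (-b) * this
    · linear_combination (-c) * this
    · linear_combination (↑u⁻¹ : A) * h - (d + c * b * ↑u⁻¹) * this
  rw [e, hf, hf, f_E21' hf hE, f_dia' hf hE, hE]
  simp

theorem f_mk_of_eq_unit (u : Aˣ) {a b c d : A} (hu : a = u) (h : a * d - b * c = 1) :
    f (mk a b c d h) = 0 := by
  subst hu; exact f_mk_unit hf hE u h

theorem f_eq_of_rel_of_unit {s : A} (hs : s ≠ 0) {a b c d : A} {h : a * d - b * c = 1}
    {h' : SpecialLinearGroup (Fin 2) A} (hr : Rel s (mk a b c d h) h') (w : Aˣ) {z : A}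
    (hw : s * (1 - w) = b * d * (s * z - 1)) : f h' = f (mk a b c d h) := by
  obtain ⟨a', b', c', d', h', rfl⟩ := exists_mk h'
  obtain ⟨h1, h2, h3, h4⟩ := rel_mk.1 hr
  have h2 := mul_left_cancel₀ hs h2
  subst h2
  have key : f (E21 z * mk a' b c' d' h' * E21 (-z) * (mk a b c d h)⁻¹) = 0 := by
    rw [mk_inv, E21, E21, mk_mul, mk_mul, mk_mul]
    refine f_mk_of_eq_unit hf hE w (mul_left_cancel₀ hs ?_) _
    linear_combination hw + s * h - d * h1
  rw [hf, hf, hf, f_E21' hf hE, f_E21' hf hE, f_inv hf] at key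
  rw [← sub_eq_zero, ← key]
  abel

end SL2

namespace SL2

variable {A : Type*} [CommRing A] [IsDedekindDomain A]
variable {C : Type*} [AddCommGroup C] {f : Matrix.SpecialLinearGroup (Fin 2) A → C}
  (hf : ∀ g h, f (g * h) = f g + f h) (hE : ∀ x, f (E12 x) = 0)

include hf hE

theorem exists_f_U_eq_zero (hA : ArithRing A) (p : ℕ) [Fact p.Prime] [CharP A p] {s : A}
    (hs : s ≠ 0) : ∃ N : ℕ, ∀ x, f (U s (s ^ N * x)) = 0 := by
  have hp : p.Prime := Fact.out
  obtain ⟨v, hsθ, hθ0⟩ := hA.exists_unit_sub_one_dvd hs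
  set θ := (v : A) - 1 with hθ
  obtain ⟨E0, hE0⟩ := hA.exists_notMem_pow
  have hiQ : E0 < p ^ E0 := Nat.lt_pow_self hp.one_lt
  obtain ⟨N, hN⟩ := exists_unit_eq_mul_add hA.finite_quot (p := p) v (s := s) (t := -1) (θ := θ)
    (by rw [hθ]; ring) hθ0 (by rwa [mul_neg_one, neg_dvd]) E0
  set Q := p ^ E0 with hQ
  obtain ⟨T, hT⟩ : s ∣ θ ^ Q := hsθ.trans (dvd_pow_self _ (pow_ne_zero _ hp.ne_zero))
  have hgood : ∀ c : A, ∀ P : Ideal A, P.IsPrime → s ∉ P → c ∈ P → s ^ (N + 1) ∉ P :=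
    fun c P hP hsP _ h => hsP (hP.mem_of_pow_mem _ h)
  refine ⟨N, fun x => ?_⟩
  obtain ⟨y, hy⟩ := hE0 (Q + 1) (by omega) s hs (θ ^ Q) (s ^ (N + 1))
    (θ ^ Q + s ^ (N + 1) * x) (s ^ (N + 1)) (hgood _) (hgood _)
  have key : ∀ y, (∀ P : Ideal A, P.IsPrime → s ∉ P → θ ^ Q + s ^ (N + 1) * y ∉ P ^ (Q + 1)) →
      f (U s (T + s ^ N * y)) = 0 := by
    intro y hy
    obtain ⟨n, z, hz⟩ := hN (θ ^ Q) (s * y) (by ring) (by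
      intro P hP hsP
      rw [show θ ^ Q + s ^ N * (s * y) = θ ^ Q + s ^ (N + 1) * y by ring]
      exact hy P hP hsP)
    rw [← hE (s ^ 2 * (T + s ^ N * y))]
    refine f_eq_of_rel_of_unit hf hE hs (rel_U _ _) (v ^ n) (z := z) ?_
    rw [Units.val_pow_eq_pow_val, hz, hT]
    ring
  have h1 := key y fun P hP h => (hy P hP h).1
  have h2 := key (y + x) fun P hP h => by
    rw [show θ ^ Q + s ^ (N + 1) * (y + x) = θ ^ Q + s ^ (N + 1) * x + s ^ (N + 1) * y by ring]
    exact (hy P hP h).2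
  rwa [show T + s ^ N * (y + x) = T + s ^ N * y + s ^ N * x by ring, U_add, hf, h1, zero_add] at h2

set_option maxHeartbeats 1600000 in
theorem exists_f_eq_of_rel (hA : ArithRing A) (p : ℕ) [Fact p.Prime] [CharP A p] {s : A}
    (hs : s ≠ 0) : ∃ M : ℕ, ∀ (a b c d : A) (h : a * d - b * c = 1)
      (h' : Matrix.SpecialLinearGroup (Fin 2) A), s ^ M ∣ b → s ^ M ∣ d - 1 →
      Rel s (mk a b c d h) h' → f h' = f (mk a b c d h) := by
  have hp : p.Prime := Fact.out
  obtain ⟨Nb, hNb⟩ := exists_f_U_eq_zero hf hE hA p hs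
  obtain ⟨v, hsθ, hθ0⟩ := hA.exists_unit_sub_one_dvd hs
  set θ := (v : A) - 1 with hθ
  obtain ⟨E0, hE0⟩ := hA.exists_notMem_pow
  have hiQ : 2 * E0 + Nb + 1 < p ^ (2 * E0 + Nb + 1) := Nat.lt_pow_self hp.one_lt
  obtain ⟨N, hN⟩ := exists_unit_eq_mul_add hA.finite_quot (p := p) v (s := s) (t := -1) (θ := θ)
    (by rw [hθ]; ring) hθ0 (by rwa [mul_neg_one, neg_dvd]) (2 * E0 + Nb + 1)
  set Q := p ^ (2 * E0 + Nb + 1) with hQ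
  obtain ⟨T, hT⟩ : s ^ (Nb + 1) ∣ θ ^ Q := (pow_dvd_pow s (by omega)).trans (pow_dvd_pow_of_dvd hsθ Q)
  refine ⟨N + Nb + 2, ?_⟩
  rintro a b c d h h' ⟨b', rfl⟩ ⟨d0, hd0⟩ hr
  obtain rfl : d = 1 + s ^ (N + Nb + 2) * d0 := by linear_combination hd0
  set d := 1 + s ^ (N + Nb + 2) * d0 with hd
  clear_value θ
  have hcop : ∀ P : Ideal A, P.IsPrime → b' ∈ P → d ∉ P := by
    intro P hP hb hdP
    refine hP.ne_top ((Ideal.eq_top_iff_one P).2 ?_)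
    rw [← h]
    exact P.sub_mem (P.mul_mem_left _ hdP) (P.mul_mem_right _ (P.mul_mem_left _ hb))
  have hgood1 : ∀ P : Ideal A, P.IsPrime → s ∉ P →
      s ^ (N + Nb + 1) * b' + θ ^ Q * d ∈ P → s ^ (N + Nb + 1) * d ∉ P := by
    intro P hP hsP h1 h2
    have hdP := (hP.mem_or_mem h2).resolve_left fun h => hsP (hP.mem_of_pow_mem _ h)
    have h3 := (P.add_mem_iff_left (P.mul_mem_left _ hdP)).1 h1
    exact hcop P hP ((hP.mem_or_mem h3).resolve_left fun h => hsP (hP.mem_of_pow_mem _ h)) hdP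
  obtain ⟨y, hy⟩ := hE0 E0 le_rfl s hs _ _ _ _ hgood1 hgood1
  set e1 := s ^ (N + Nb + 1) * b' + θ ^ Q * d + s ^ (N + Nb + 1) * d * y with he1
  have hgood2 : ∀ P : Ideal A, P.IsPrime → s ∉ P → d ∈ P → s ^ (N + Nb + 2) * (s * e1) ∉ P := by
    intro P hP hsP hdP h2
    have h3 := (hP.mem_or_mem h2).resolve_left fun h => hsP (hP.mem_of_pow_mem _ h)
    have h4 := (hP.mem_or_mem h3).resolve_left hsP
    rw [he1] at h4
    have h5 := (P.add_mem_iff_left (P.mul_mem_right _ (P.mul_mem_left _ hdP))).1 h4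
    have h6 := (P.add_mem_iff_left (P.mul_mem_left _ hdP)).1 h5
    exact hcop P hP ((hP.mem_or_mem h6).resolve_left fun h => hsP (hP.mem_of_pow_mem _ h)) hdP
  obtain ⟨y3, hy3⟩ := hE0 E0 le_rfl s hs _ _ _ _ hgood2 hgood2
  set d1 := d + s ^ (N + Nb + 2) * (s * e1) * y3 with hd1
  have hee : θ ^ Q + s ^ N * ((s ^ (Nb + 1) * b' + s ^ (Nb + 1) * y * d +
      θ ^ Q * s * s ^ (Nb + 1) * d0) + e1 * (s * s ^ (Nb + 1) * (d0 + y3 * (s * e1)))) =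
      e1 * d1 := by
    have : e1 = θ ^ Q + s ^ N * (s ^ (Nb + 1) * b' + s ^ (Nb + 1) * y * d +
      θ ^ Q * s * s ^ (Nb + 1) * d0) := by
      rw [he1, hd]; ring
    have h2 : d1 = 1 + s ^ N * (s * s ^ (Nb + 1) * (d0 + y3 * (s * e1))) := by rw [hd1, hd]; ring
    rw [mul_add (s ^ N), ← add_assoc, ← this, h2]
    ring
  clear_value e1 d1
  obtain ⟨n, z, hz⟩ := hN (θ ^ Q) _ (by ring) (by
    intro P hP hsP
    rw [hee]
    intro hmem
    exact hP.mul_notMem_pow_add (hy P hP hsP).1 (hy3 P hP hsP).1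
      (Ideal.pow_le_pow_right (by omega) hmem))
  rw [hee] at hz
  have hs2 : E12 (s ^ 2 * (s ^ Nb * (T + s ^ N * y))) = E12 (s * (θ ^ Q + s ^ (N + Nb + 1) * y)) := by
    congr 1
    rw [hT]; ring
  have hr1 := (rel_E21 s (s ^ (N + Nb + 2) * y3)).mul ((rel_U s (s ^ Nb * (T + s ^ N * y))).mul hr)
  rw [hs2] at hr1
  have hmk : E21 (s ^ (N + Nb + 2) * y3) * (E12 (s * (θ ^ Q + s ^ (N + Nb + 1) * y)) *
      mk a (s ^ (N + Nb + 2) * b') c d h) = mk (a + s * (θ ^ Q + s ^ (N + Nb + 1) * y) * c) (s * e1)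
      (s ^ (N + Nb + 2) * y3 * (a + s * (θ ^ Q + s ^ (N + Nb + 1) * y) * c) + c) d1 (by
        rw [hd1, he1]; linear_combination h) := by
    unfold E21 E12
    rw [mk_mul, mk_mul]
    refine mk_congr (by ring) ?_ (by ring) ?_
    · rw [he1]; ring
    · rw [hd1, he1]; ring
  have hv := hf (E21 (s ^ (N + Nb + 2) * y3)) (E12 (s * (θ ^ Q + s ^ (N + Nb + 1) * y)) *
      mk a (s ^ (N + Nb + 2) * b') c d h)
  rw [hf (E12 _), hE, f_E21' hf hE, zero_add, zero_add] at hv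
  rw [← hv]
  rw [hmk] at hr1 ⊢
  have := f_eq_of_rel_of_unit hf hE hs hr1 (v ^ n) (z := z) (by
    rw [Units.val_pow_eq_pow_val, hz]; ring)
  rwa [hf, hf, hNb, f_E21' hf hE, zero_add, zero_add] at this

end SL2

namespace SL2

variable {A : Type*} [CommRing A] [IsDedekindDomain A]
variable {C : Type*} [AddCommGroup C] {f : Matrix.SpecialLinearGroup (Fin 2) A → C}

open Classical in
/-- The value of `f` on any matrix with top row `(a, b)`. -/
noncomputable def sym (f : Matrix.SpecialLinearGroup (Fin 2) A → C) (a b : A) : C :=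
  if h : ∃ c d, a * d - b * c = 1 then f (mk a b _ _ h.choose_spec.choose_spec) else 0

variable (hf : ∀ g h, f (g * h) = f g + f h) (hE : ∀ x, f (E12 x) = 0)

include hf hE

theorem exists_f_sq_eq (hA : ArithRing A) (p : ℕ) [Fact p.Prime] [CharP A p] {s : A}
    (hs : s ≠ 0) : ∃ M : ℕ, ∀ (a b c d : A) (h : a * d - b * (s ^ 2 * c) = 1)
      (h' : a * d - s ^ 2 * b * c = 1), s ^ M ∣ a - 1 → s ^ M ∣ b → s ^ M ∣ s ^ 2 * c →
      s ^ M ∣ d - 1 → f (mk a (s ^ 2 * b) c d h') = f (mk a b (s ^ 2 * c) d h) := by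
  obtain ⟨M, hM⟩ := exists_f_eq_of_rel hf hE hA p hs
  refine ⟨M, fun a b c d h h' ha hb hc hd => ?_⟩
  have hr : Rel s (mk (d - s * b) (s * a - s ^ 2 * c + s ^ 2 * b - s * d) (-b) (a + s * b)
      (by linear_combination h)) (mk (a - s * c) (s * a - s ^ 2 * c + s ^ 2 * b - s * d) c (d + s * c)
      (by linear_combination h)) := by
    rw [rel_mk]
    exact ⟨by ring, by ring, by ring, by ring⟩
  have key := hM _ _ _ _ _ _ (by
      rw [show s * a - s ^ 2 * c + s ^ 2 * b - s * d =
        s * (a - 1) - s ^ 2 * c + s ^ 2 * b - s * (d - 1) by ring]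
      exact dvd_sub (dvd_add (dvd_sub (ha.mul_left _) hc) (hb.mul_left _)) (hd.mul_left _)) (by
      rw [show a + s * b - 1 = (a - 1) + s * b by ring]
      exact dvd_add ha (hb.mul_left _)) hr
  have h1 : f (mk a (s ^ 2 * b) c d h') = _ := f_eq_of_mul_eq_mul hf (g := E12 s)
    (h := mk (a - s * c) (s * a - s ^ 2 * c + s ^ 2 * b - s * d) c (d + s * c)
      (by linear_combination h)) (by
      rw [E12, mk_mul, mk_mul]
      exact mk_congr (by ring) (by ring) (by ring) (by ring))
  rw [h1, key]
  refine f_eq_of_mul_eq_mul hf (g := mk s (-1) 1 0 (by ring)) ?_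
  rw [mk_mul, mk_mul]
  exact mk_congr (by ring) (by ring) (by ring) (by ring)

theorem f_mk_eq_sym {a b c d : A} (h : a * d - b * c = 1) : f (mk a b c d h) = sym f a b := by
  have h0 : ∃ c d, a * d - b * c = 1 := ⟨c, d, h⟩
  rw [sym, dif_pos h0]
  suffices ∀ (c' d' : A) (h1 : a * d' - b * c' = 1), f (mk a b c d h) = f (mk a b c' d' h1) from
    this _ _ _
  intro c' d' h1
  have : mk a b c d h = E21 (c * d' - d * c') * mk a b c' d' h1 := by
    rw [E21, mk_mul]
    refine mk_congr (by ring) (by ring) ?_ ?_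
    · linear_combination (-c) * h1 + c' * h
    · linear_combination (-d) * h1 + d' * h
  rw [this, hf, f_E21' hf hE, zero_add]

theorem sym_add_mul_left {a b : A} (h : IsCoprime a b) (t : A) : sym f (a + b * t) b = sym f a b := by
  obtain ⟨u, v, huv⟩ := h
  rw [← f_mk_eq_sym hf hE (a := a) (b := b) (c := -v) (d := u) (by linear_combination huv),
    ← f_mk_eq_sym hf hE (a := a + b * t) (b := b) (c := -v + u * t) (d := u)
      (by linear_combination huv)]
  have : mk (a + b * t) b (-v + u * t) u (by linear_combination huv) =
      mk a b (-v) u (by linear_combination huv) * E21 t := by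
    rw [E21, mk_mul]
    exact mk_congr (by ring) (by ring) (by ring) (by ring)
  rw [this, hf, f_E21' hf hE, add_zero]

theorem sym_neg_swap {a b : A} (h : IsCoprime a b) : sym f (-b) a = sym f a b := by
  obtain ⟨u, v, huv⟩ := h
  rw [← f_mk_eq_sym hf hE (a := a) (b := b) (c := -v) (d := u) (by linear_combination huv),
    ← f_mk_eq_sym hf hE (a := -b) (b := a) (c := -u) (d := -v) (by linear_combination huv)]
  have : mk (-b) a (-u) (-v) (by linear_combination huv) =
      mk a b (-v) u (by linear_combination huv) * weyl := by
    rw [weyl, mk_mul]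
    exact mk_congr (by ring) (by ring) (by ring) (by ring)
  rw [this, hf, f_weyl' hf hE, add_zero]

theorem sym_add_mul_right {a b : A} (h : IsCoprime a b) (t : A) :
    sym f a (b + a * t) = sym f a b := by
  rw [← sym_neg_swap hf hE h, ← sym_neg_swap hf hE (h.add_mul_left_right t),
    ← sym_add_mul_left hf hE (a := -b) (b := a) h.symm.neg_left (-t)]
  congr 1; ring

theorem sym_units_mul (u : Aˣ) {a b : A} (h : IsCoprime a b) :
    sym f (u * a) (u * b) = sym f a b := by
  obtain ⟨x, y, hxy⟩ := h
  have h1 : (u : A) * a * (x * ↑u⁻¹) - u * b * (-y * ↑u⁻¹) = 1 := by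
    linear_combination hxy + (a * x + b * y) * u.mul_inv
  rw [← f_mk_eq_sym hf hE (a := a) (b := b) (c := -y) (d := x) (by linear_combination hxy),
    ← f_mk_eq_sym hf hE h1]
  have : mk _ _ _ _ h1 = dia u * mk a b (-y) x (by linear_combination hxy) := by
    rw [dia, mk_mul]
    exact mk_congr (by ring) (by ring) (by ring) (by ring)
  rw [this, hf, f_dia' hf hE, zero_add]

theorem sym_of_isUnit_left {a : A} (ha : IsUnit a) (b : A) : sym f a b = 0 := by
  obtain ⟨u, rfl⟩ := ha
  rw [← f_mk_eq_sym hf hE (a := (u : A)) (b := b) (c := 0) (d := ↑u⁻¹) (by simp)]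
  exact f_mk_unit hf hE u _

theorem sym_of_isUnit_right (a : A) {b : A} (hb : IsUnit b) : sym f a b = 0 := by
  rw [← sym_neg_swap hf hE (isCoprime_one_right.of_isCoprime_of_dvd_right (isUnit_iff_dvd_one.1 hb)), sym_of_isUnit_left hf hE hb.neg]

omit hf hE in
theorem exists_completion {s a b : A} (h : IsCoprime a (s * b)) (M : ℕ) :
    ∃ t c d : A, a * d - (b + a * t) * (s ^ 2 * c) = 1 ∧ s ^ M ∣ b + a * t ∧ s ^ M ∣ c := by
  obtain ⟨u, w, huw⟩ : IsCoprime a (s ^ M) := h.of_mul_right_left.pow_right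
  obtain ⟨x, y, hxy⟩ : IsCoprime a ((b + a * (-u * b)) * s ^ (M + 2)) :=
    (h.of_mul_right_right.add_mul_left_right _).mul_right h.of_mul_right_left.pow_right
  refine ⟨-u * b, -y * s ^ M, x, by linear_combination hxy, ⟨b * w, ?_⟩, ⟨-y, by ring⟩⟩
  linear_combination -b * huw

theorem exists_sym_sub_congr (hA : ArithRing A) (p : ℕ) [Fact p.Prime] [CharP A p] {s : A}
    (hs : s ≠ 0) : ∃ M : ℕ, ∀ a₁ b₁ a₂ b₂ : A, IsCoprime a₁ (s * b₁) → IsCoprime a₂ (s * b₂) →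
      s ^ M ∣ a₁ - a₂ →
      sym f a₁ (s ^ 2 * b₁) - sym f a₁ b₁ = sym f a₂ (s ^ 2 * b₂) - sym f a₂ b₂ := by
  obtain ⟨M, hM⟩ := exists_f_sq_eq hf hE hA p hs
  refine ⟨M, fun a₁ b₁ a₂ b₂ h₁ h₂ h12 => ?_⟩
  obtain ⟨t₁, c₁, d₁, k₁, hb₁, hc₁⟩ := exists_completion h₁ M
  obtain ⟨t₂, c₂, d₂, k₂, hb₂, hc₂⟩ := exists_completion h₂ M
  have hsq : ∀ a b t : A, IsCoprime a (s * b) →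
      sym f a (s ^ 2 * b) - sym f a b = sym f a (s ^ 2 * (b + a * t)) - sym f a (b + a * t) := by
    intro a b t h
    rw [sym_add_mul_right hf hE h.of_mul_right_right,
      show s ^ 2 * (b + a * t) = s ^ 2 * b + a * (s ^ 2 * t) by ring,
      sym_add_mul_right hf hE (h.of_mul_right_left.pow_right.mul_right h.of_mul_right_right)]
  rw [hsq _ _ t₁ h₁, hsq _ _ t₂ h₂]
  generalize b₁ + a₁ * t₁ = b₁ at *
  generalize b₂ + a₂ * t₂ = b₂ at *
  rw [← f_mk_eq_sym hf hE k₁, ← f_mk_eq_sym hf hE k₂,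
    ← f_mk_eq_sym hf hE (a := a₁) (b := s ^ 2 * b₁) (c := c₁) (d := d₁) (by linear_combination k₁),
    ← f_mk_eq_sym hf hE (a := a₂) (b := s ^ 2 * b₂) (c := c₂) (d := d₂) (by linear_combination k₂),
    sub_eq_sub_iff_sub_eq_sub]
  simp only [sub_eq_add_neg, ← f_inv hf, ← hf, mk_inv, mk_mul]
  have k₁' : s ^ M ∣ a₁ * d₁ - 1 := by
    rw [show a₁ * d₁ - 1 = b₁ * (s ^ 2 * c₁) by linear_combination k₁]; exact hb₁.mul_right _
  have k₂' : s ^ M ∣ a₂ * d₂ - 1 := by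
    rw [show a₂ * d₂ - 1 = b₂ * (s ^ 2 * c₂) by linear_combination k₂]; exact hb₂.mul_right _
  convert hM (a₁ * d₂ - b₁ * (s ^ 2 * c₂)) (-a₁ * b₂ + b₁ * a₂) (c₁ * d₂ - d₁ * c₂)
    (-(s ^ 2 * c₁) * b₂ + d₁ * a₂) (by linear_combination (a₂ * d₂ - b₂ * (s ^ 2 * c₂)) * k₁ + k₂)
    (by linear_combination (a₂ * d₂ - b₂ * (s ^ 2 * c₂)) * k₁ + k₂) ?_ ?_ ?_ ?_ using 2
  · exact mk_congr (by ring) (by ring) (by ring) (by ring)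
  · exact mk_congr (by ring) (by ring) (by ring) (by ring)
  · rw [show a₁ * d₂ - b₁ * (s ^ 2 * c₂) - 1 =
      (a₁ - a₂) * d₂ + (a₂ * d₂ - 1) - b₁ * (s ^ 2 * c₂) by ring]
    exact dvd_sub (dvd_add (h12.mul_right _) k₂') (hb₁.mul_right _)
  · exact dvd_add (hb₂.mul_left _) (hb₁.mul_right _)
  · exact (dvd_sub (hc₁.mul_right _) (hc₂.mul_left _)).mul_left _
  · rw [show -(s ^ 2 * c₁) * b₂ + d₁ * a₂ - 1 =
      (a₁ * d₁ - 1) - (a₁ - a₂) * d₁ - (s ^ 2 * c₁) * b₂ by ring]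
    exact dvd_sub (dvd_sub k₁' (h12.mul_right _)) (hb₂.mul_left _)

end SL2

namespace SL2

variable {A : Type*} [CommRing A] [IsDedekindDomain A]
variable {C : Type*} [AddCommGroup C] {f : Matrix.SpecialLinearGroup (Fin 2) A → C}
variable (hf : ∀ g h, f (g * h) = f g + f h) (hE : ∀ x, f (E12 x) = 0)
  (hA : ArithRing A) (p : ℕ) [Fact p.Prime] [CharP A p]

include hf hE

include hA p in
theorem sym_sq_mul {a b s : A} (h : IsCoprime a (s * b)) :
    sym f a (s ^ 2 * b) = sym f a (s ^ 2) + sym f a b := by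
  rcases eq_or_ne s 0 with rfl | hs
  · rw [zero_mul, isCoprime_zero_right] at h
    simp [sym_of_isUnit_left hf hE h]
  obtain ⟨M, hM⟩ := exists_sym_sub_congr hf hE hA p hs
  have := hM a b a 1 h (by simpa using h.of_mul_right_left) (by simp)
  rw [mul_one, sym_of_isUnit_right hf hE a isUnit_one, sub_zero] at this
  exact sub_eq_iff_eq_add.1 this

include hA p in
theorem sym_mul_sq {a₁ a₂ s : A} (h₁ : IsCoprime a₁ s) (h₂ : IsCoprime a₂ s) :
    sym f (a₁ * a₂) (s ^ 2) = sym f a₁ (s ^ 2) + sym f a₂ (s ^ 2) := by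
  rcases eq_or_ne s 0 with rfl | hs
  · rw [isCoprime_zero_right] at h₁ h₂
    simp [sym_of_isUnit_left hf hE, h₁, h₂, h₁.mul h₂]
  obtain ⟨M, hM⟩ := exists_sym_sub_congr hf hE hA p hs
  obtain ⟨u₁, v₁, k₁⟩ : IsCoprime a₁ (s ^ (M + 2)) := h₁.pow_right
  obtain ⟨u₂, v₂, k₂⟩ : IsCoprime a₂ (s ^ (M + 2)) := h₂.pow_right
  have e₁ : a₁ * u₁ - 1 * (s ^ 2 * (-(s ^ M * v₁))) = 1 := by linear_combination k₁
  have e₂ : a₂ * u₂ - 1 * (s ^ 2 * (-(s ^ M * v₂))) = 1 := by linear_combination k₂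
  have e₁' : a₁ * u₁ - s ^ 2 * (-(s ^ M * v₁)) = 1 := by linear_combination k₁
  have e₂' : a₂ * u₂ - s ^ 2 * (-(s ^ M * v₂)) = 1 := by linear_combination k₂
  have m := congrArg f (mk_mul e₁ e₂)
  have m' := congrArg f (mk_mul e₁' e₂')
  rw [hf] at m m'
  simp only [f_mk_eq_sym hf hE] at m m'
  set a' := a₁ * a₂ + 1 * (s ^ 2 * (-(s ^ M * v₂))) with ha'
  set b' := a₁ * 1 + 1 * u₂ with hb'
  have hc : IsCoprime a' (s * b') := by
    refine ⟨s ^ 2 * (-(s ^ M * v₁)) * 1 + u₁ * u₂,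
      -(s * (-(s ^ M * v₁)) * a₂ + u₁ * (s * (-(s ^ M * v₂)))), ?_⟩
    linear_combination det_mul e₁ e₂
  have hc2 : IsCoprime (a₁ * a₂) (s * 1) := by simpa using h₁.mul_left h₂
  have := hM a' b' (a₁ * a₂) 1 hc hc2 ⟨-(s ^ 2 * v₂), by rw [ha']; ring⟩
  rw [show a₁ * a₂ + s ^ 2 * (-(s ^ M * v₂)) = a' by rw [ha']; ring,
    show a₁ * s ^ 2 + s ^ 2 * u₂ = s ^ 2 * b' by rw [hb']; ring] at m'
  rw [mul_one, sym_of_isUnit_right hf hE (a₁ * a₂) isUnit_one, sub_zero, ← m', ← m,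
    sym_of_isUnit_right hf hE a₁ isUnit_one, sym_of_isUnit_right hf hE a₂ isUnit_one] at this
  simpa using this.symm

include hA p in
theorem sym_one_sub_sq (s x : A) : sym f (1 - s * x) (s ^ 2) = 0 := by
  have h1 : (1 - s * x) * (1 + s * x) - s ^ 2 * x * (-x) = 1 := by ring
  have h2 : f (mk (1 - s * x) (s ^ 2 * x) (-x) (1 + s * x) h1) = 0 := by
    rw [← hE x]
    refine f_eq_of_mul_eq_mul hf (g := mk s (-1) 1 0 (by ring)) ?_
    rw [E12, mk_mul, mk_mul]
    exact mk_congr (by ring) (by ring) (by ring) (by ring)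
  rw [f_mk_eq_sym hf hE, sym_sq_mul hf hE hA p ⟨1, 1, by ring⟩] at h2
  have := sym_add_mul_left hf hE (isCoprime_one_left (x := x)) (-s)
  rw [sym_of_isUnit_left hf hE isUnit_one, show 1 + x * -s = 1 - s * x by ring] at this
  rwa [this, add_zero] at h2

include hA p in
theorem sym_sq_congr {a₁ a₂ s : A} (h₁ : IsCoprime a₁ s) (h : s ∣ a₁ - a₂) :
    sym f a₁ (s ^ 2) = sym f a₂ (s ^ 2) := by
  obtain ⟨u, v, huv⟩ := h₁
  obtain ⟨t, ht⟩ := h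
  have h₁ : IsCoprime a₁ s := ⟨u, v, huv⟩
  have h₂ : IsCoprime a₂ s := ⟨u, v + u * t, by linear_combination huv - u * ht⟩
  have hu : IsCoprime u s := ⟨a₁, v, by linear_combination huv⟩
  have e1 := sym_mul_sq hf hE hA p hu h₁
  have e2 := sym_mul_sq hf hE hA p hu h₂
  rw [show u * a₁ = 1 - s * v by linear_combination huv, sym_one_sub_sq hf hE hA p] at e1
  rw [show u * a₂ = 1 - s * (v + u * t) by linear_combination huv - u * ht,
    sym_one_sub_sq hf hE hA p, e1] at e2
  exact add_left_cancel e2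

include hA p in
theorem sym_pow_sq {a s : A} (h : IsCoprime a s) (n : ℕ) :
    sym f (a ^ n) (s ^ 2) = n • sym f a (s ^ 2) := by
  induction n with
  | zero => simp [sym_of_isUnit_left hf hE isUnit_one]
  | succ n ih => rw [pow_succ, sym_mul_sq hf hE hA p h.pow_left h, ih, succ_nsmul]

include hA p in
theorem sym_sq_eq_zero {a s : A} (h : IsCoprime a s) : sym f a (s ^ 2) = 0 := by
  by_contra hne
  have hl : (addOrderOf (sym f a (s ^ 2))).minFac.Prime := Nat.minFac_prime (by
    rwa [Ne, AddMonoid.addOrderOf_eq_one_iff])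
  obtain ⟨u, c, x, t, s', e, he, hdvd⟩ := hA.exists_dvd_pow_sub _ hl a s h
  refine he ((Nat.minFac_dvd _).trans (addOrderOf_dvd_of_nsmul_eq_zero ?_))
  have hu : IsCoprime (u : A) s := isCoprime_one_left.of_isCoprime_of_dvd_left
    (isUnit_iff_dvd_one.1 u.isUnit)
  have hua : IsCoprime (u * a) s := hu.mul_left h
  have huau : IsCoprime (u * a : A) u := (isCoprime_one_left.of_isCoprime_of_dvd_left
    (isUnit_iff_dvd_one.1 u.isUnit)).symm
  have e1 : sym f a (s ^ 2) = sym f (u * a) (s ^ 2) := by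
    rw [sym_mul_sq hf hE hA p hu h, sym_of_isUnit_left hf hE u.isUnit, zero_add]
  have e2 : sym f (u * a) (s ^ 2) = sym f (u * a) ((u * s) ^ 2) := by
    rw [mul_pow, sym_sq_mul hf hE hA p (b := s ^ 2) (huau.mul_right hua.pow_right),
      sym_of_isUnit_right hf hE _ (u.isUnit.pow 2), zero_add]
  have e3 : sym f (u * a) ((u * s) ^ 2) = sym f (u * a) ((u * s + u * a * x) ^ 2) := by
    rw [show (u * s + u * a * x) ^ 2 = (u * s) ^ 2 + u * a * (2 * (u * s) * x + u * a * x ^ 2) by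
      ring, sym_add_mul_right hf hE (huau.mul_right hua).pow_right]
  have hc : IsCoprime (u * a : A) (u * s + u * a * x) := (huau.mul_right hua).add_mul_left_right x
  rw [e1, e2, e3]
  generalize (u * s + u * a * x : A) = b at *
  have hc' : IsCoprime (u * a + b * t) b := hc.add_mul_left_left t
  rw [← sym_sq_congr hf hE hA p hc' ⟨t, by ring⟩]
  generalize (u * a + b * t : A) = a at *
  have hc'' : IsCoprime a (b + a * s') := hc'.add_mul_left_right s'
  have e5 : sym f a (b ^ 2) = sym f a ((b + a * s') ^ 2) := by
    rw [show (b + a * s') ^ 2 = b ^ 2 + a * (2 * b * s' + a * s' ^ 2) by ring,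
      sym_add_mul_right hf hE hc'.pow_right]
  rw [e5, ← sym_pow_sq hf hE hA p hc'', sym_sq_congr hf hE hA p hc''.pow_left hdvd,
    sym_of_isUnit_left hf hE c.isUnit]

include hA p in
theorem sym_eq_zero {a b : A} (h : IsCoprime a b) : sym f a b = 0 := by
  obtain ⟨u, c, x, t, s', e, he, hdvd⟩ := hA.exists_dvd_pow_sub 2 Nat.prime_two a b h
  have huau : IsCoprime (u * a : A) u := (isCoprime_one_left.of_isCoprime_of_dvd_left
    (isUnit_iff_dvd_one.1 u.isUnit)).symm
  have hua : IsCoprime (u * a) b := (isCoprime_one_left.of_isCoprime_of_dvd_left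
    (isUnit_iff_dvd_one.1 u.isUnit)).mul_left h
  rw [← sym_units_mul hf hE u h, ← sym_add_mul_right hf hE (huau.mul_right hua) x]
  have hc : IsCoprime (u * a : A) (u * b + u * a * x) := (huau.mul_right hua).add_mul_left_right x
  generalize (u * b + u * a * x : A) = b at *
  rw [← sym_add_mul_left hf hE hc t]
  have hc' : IsCoprime (u * a + b * t) b := hc.add_mul_left_left t
  generalize (u * a + b * t : A) = a at *
  rw [← sym_add_mul_right hf hE hc' s']
  have hc'' : IsCoprime a (b + a * s') := hc'.add_mul_left_right s'
  generalize b + a * s' = b at *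
  obtain ⟨k, rfl⟩ : Odd e := by rwa [← Nat.not_even_iff_odd, even_iff_two_dvd]
  obtain ⟨m, hm⟩ := hdvd
  have e1 : sym f (c + b * m) b = 0 := by
    rw [sym_add_mul_left hf hE (isCoprime_one_left.of_isCoprime_of_dvd_left
      (isUnit_iff_dvd_one.1 c.isUnit)), sym_of_isUnit_left hf hE c.isUnit]
  rw [show (c : A) + b * m = (a ^ k) ^ 2 * a by linear_combination -hm] at e1
  have hc3 : IsCoprime (-b) a := hc''.symm.neg_left
  rw [← sym_neg_swap hf hE (hc''.pow_left.pow_left.mul_left hc''),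
    sym_sq_mul hf hE hA p (hc3.pow_right.mul_right hc3), sym_sq_eq_zero hf hE hA p hc3.pow_right,
    zero_add, sym_neg_swap hf hE hc''] at e1
  exact e1

include hA p in
theorem f_eq_zero (g : Matrix.SpecialLinearGroup (Fin 2) A) : f g = 0 := by
  obtain ⟨a, b, c, d, h, rfl⟩ := exists_mk g
  rw [f_mk_eq_sym hf hE]
  exact sym_eq_zero hf hE hA p ⟨d, -c, by linear_combination h⟩

end SL2

section

variable {A : Type*} [CommRing A] [IsDedekindDomain A]

theorem Ideal.le_of_forall_prime_pow {K M : Ideal A} (hK : K ≠ ⊥)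
    (h : ∀ P : Ideal A, P.IsPrime → P ≠ ⊥ → ∀ n, K ≤ P ^ n → M ≤ P ^ n) : M ≤ K := by
  classical
  rcases eq_or_ne M ⊥ with rfl | hM
  · exact bot_le
  rw [← Ideal.dvd_iff_le,
    UniqueFactorizationMonoid.dvd_iff_normalizedFactors_le_normalizedFactors hK hM,
    Multiset.le_iff_count]
  intro P
  by_cases hP : P ∈ UniqueFactorizationMonoid.normalizedFactors K
  · have hp := UniqueFactorizationMonoid.prime_of_normalized_factor P hP
    have e := fun {I : Ideal A} (hI : I ≠ ⊥) =>
      UniqueFactorizationMonoid.emultiplicity_eq_count_normalizedFactors hp.irreducible hI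
    simp only [normalize_eq] at e
    rw [← Nat.cast_le (α := ℕ∞), ← e hM, ← pow_dvd_iff_le_emultiplicity, Ideal.dvd_iff_le]
    refine h P (Ideal.isPrime_of_prime hp) hp.ne_zero _ ?_
    rw [← Ideal.dvd_iff_le, pow_dvd_iff_le_emultiplicity, e hK]
  · rw [Multiset.count_eq_zero_of_notMem hP]
    exact Nat.zero_le _

theorem Ideal.exists_sub_mem_pow_isCoprime {P : Ideal A} (hP : P.IsPrime) (hP0 : P ≠ ⊥) {j a₀ : A}
    (hj : j ≠ 0) (ha₀ : a₀ ∉ P) (n : ℕ) : ∃ a, a - a₀ ∈ P ^ (n + 1) ∧ IsCoprime a j := by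
  have hp := Ideal.prime_of_isPrime hP0 hP
  have hmax := hP.isMaximal hP0
  obtain ⟨J, hJ, hPJ⟩ := (FiniteMultiplicity.of_prime_left hp
    (b := Ideal.span {j}) (by simpa using hj)).exists_eq_pow_mul_and_not_dvd
  have hcop : IsCoprime P J := by
    rw [Ideal.isCoprime_iff_sup_eq]
    exact hmax.out.2 _ (left_lt_sup.2 (by rwa [Ideal.dvd_iff_le] at hPJ))
  obtain ⟨x, hx, y, hy, hxy⟩ := Ideal.isCoprime_iff_exists.1 (hcop.pow_left (m := n + 1))
  refine ⟨x + a₀ * y, ?_, ?_⟩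
  · rw [show x + a₀ * y - a₀ = (1 - a₀) * x by linear_combination a₀ * hxy]
    exact Ideal.mul_mem_left _ _ hx
  · rw [← Ideal.isCoprime_span_singleton_iff, hJ]
    refine IsCoprime.mul_right (IsCoprime.pow_right ?_) ?_
    · rw [Ideal.isCoprime_iff_sup_eq, sup_comm]
      refine hmax.out.2 _ (left_lt_sup.2 fun h => ha₀ ?_)
      have h1 := h (Ideal.mem_span_singleton_self _)
      have h2 := Ideal.pow_le_self (Nat.succ_ne_zero n) hx
      rw [show a₀ = x + a₀ * y - (1 - a₀) * x by linear_combination -a₀ * hxy]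
      exact P.sub_mem h1 (P.mul_mem_left _ h2)
    · rw [Ideal.isCoprime_iff_exists]
      refine ⟨x + a₀ * y, Ideal.mem_span_singleton_self _, (1 - a₀) * y, J.mul_mem_left _ hy, ?_⟩
      linear_combination hxy

end

namespace SL2

variable {A : Type*} [CommRing A] [IsDedekindDomain A]
variable {C : Type*} [AddCommGroup C] {f : Matrix.SpecialLinearGroup (Fin 2) A → C}
  (hf : ∀ g h, f (g * h) = f g + f h)

/-- The largest ideal on which `x ↦ f (1, x; 0, 1)` vanishes. -/
def kerIdeal : Ideal A where
  carrier := {y | ∀ x, f (E12 (y * x)) = 0}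
  add_mem' := by
    intro a b ha hb x
    rw [add_mul, f_E12_add hf, ha, hb, add_zero]
  zero_mem' x := by rw [zero_mul, f_E12_zero hf]
  smul_mem' := by
    intro c y hy x
    rw [smul_eq_mul, show c * y * x = y * (c * x) by ring, hy]

variable (hA : ArithRing A) (p : ℕ) [Fact p.Prime] [CharP A p]

include hA

theorem exists_mem_kerIdeal : ∃ j ∈ kerIdeal hf, j ≠ 0 := by
  obtain ⟨v, hv⟩ := hA.exists_unit
  refine ⟨(v : A) ^ 2 - 1, f_E12_sq_sub_one_mul hf v, fun h => hv 2 two_ne_zero (Units.ext ?_)⟩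
  simpa using sub_eq_zero.1 h

theorem kerIdeal_ne_bot : kerIdeal hf ≠ ⊥ := by
  obtain ⟨j, hj, hj0⟩ := exists_mem_kerIdeal hf hA
  rintro h
  rw [h] at hj
  exact hj0 hj

include p

theorem exists_sq_sub_one_mem_kerIdeal {P : Ideal A} (hP : P.IsPrime) (hP0 : P ≠ ⊥) {a₀ : A}
    (ha₀ : a₀ ∉ P) (n : ℕ) : ∃ a, a - a₀ ∈ P ^ (n + 1) ∧ a ^ 2 - 1 ∈ kerIdeal hf := by
  obtain ⟨j, hj, hj0⟩ := exists_mem_kerIdeal hf hA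
  obtain ⟨a, ha, haj⟩ := Ideal.exists_sub_mem_pow_isCoprime hP hP0 hj0 ha₀ n
  exact ⟨a, ha, fun x => f_E12_sq_sub_one_mul_of_isCoprime hf hA p hj0 hj haj x⟩

theorem sq_sub_one_mem_of_kerIdeal_le {P : Ideal A} (hP : P.IsPrime) (hP0 : P ≠ ⊥) {n : ℕ}
    (h : kerIdeal hf ≤ P ^ (n + 1)) {a₀ : A} (ha₀ : a₀ ∉ P) : a₀ ^ 2 - 1 ∈ P ^ (n + 1) := by
  obtain ⟨a, ha, hK⟩ := exists_sq_sub_one_mem_kerIdeal hf hA p hP hP0 ha₀ n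
  rw [show a₀ ^ 2 - 1 = (a ^ 2 - 1) - (a + a₀) * (a - a₀) by ring]
  exact Ideal.sub_mem _ (h hK) (Ideal.mul_mem_left _ _ ha)

theorem natCard_le_three_of_kerIdeal_le {P : Ideal A} (hP : P.IsPrime) (hP0 : P ≠ ⊥)
    (h : kerIdeal hf ≤ P) : Nat.card (A ⧸ P) ≤ 3 := by
  classical
  have := hA.finite_quot P hP0
  have := Fintype.ofFinite (A ⧸ P)
  have hsub : (Finset.univ : Finset (A ⧸ P)) ⊆ {0, 1, -1} := by
    intro x _
    obtain ⟨a, rfl⟩ := Ideal.Quotient.mk_surjective x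
    by_cases ha : a ∈ P
    · simp [Ideal.Quotient.eq_zero_iff_mem.2 ha]
    · have h1 := sq_sub_one_mem_of_kerIdeal_le hf hA p hP hP0 (n := 0) (by simpa using h) ha
      rw [zero_add, pow_one, ← Ideal.Quotient.eq_zero_iff_mem] at h1
      have h2 : Ideal.Quotient.mk P a * Ideal.Quotient.mk P a = 1 := by
        simpa [sub_eq_zero, sq] using h1
      rcases mul_self_eq_one_iff.1 h2 with h | h <;> simp [h]
  rw [Nat.card_eq_fintype_card]
  exact (Finset.card_le_card hsub).trans Finset.card_le_three

theorem le_two_of_kerIdeal_le (h20 : (2 : A) = 0) {P : Ideal A} (hP : P.IsPrime) (hP0 : P ≠ ⊥) {n : ℕ}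
    (h : kerIdeal hf ≤ P ^ n) : n ≤ 2 := by
  by_contra hn
  obtain ⟨π, hπ, hπ2⟩ := Ideal.exists_mem_pow_notMem_pow_succ P hP0 hP.ne_top 1
  have h1 : 1 + π ∉ P := fun h1 => hP.ne_top ((Ideal.eq_top_iff_one P).2
    ((P.add_mem_iff_left (by simpa using hπ)).1 h1))
  have h3 := sq_sub_one_mem_of_kerIdeal_le hf hA p hP hP0 (n := 2)
    (h.trans (Ideal.pow_le_pow_right (by omega))) h1
  rw [show (1 + π) ^ 2 - 1 = π * π by linear_combination π * h20] at h3
  have hp := Ideal.prime_of_isPrime hP0 hP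
  rw [← Ideal.dvd_span_singleton, pow_dvd_iff_le_emultiplicity,
    ← Ideal.span_singleton_mul_span_singleton, emultiplicity_mul hp] at h3
  rw [← Ideal.dvd_span_singleton, pow_dvd_iff_le_emultiplicity, not_le] at hπ2
  have h4 : emultiplicity P (Ideal.span {π}) ≤ 1 := by
    simpa using hπ2
  have := h3.trans (add_le_add h4 h4)
  norm_num at this

theorem le_one_of_kerIdeal_le (h2 : IsUnit (2 : A)) {P : Ideal A} (hP : P.IsPrime) (hP0 : P ≠ ⊥)
    {n : ℕ} (h : kerIdeal hf ≤ P ^ n) : n ≤ 1 := by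
  by_contra hn
  obtain ⟨π, hπ, hπ2⟩ := Ideal.exists_mem_pow_notMem_pow_succ P hP0 hP.ne_top 1
  have h1 : 1 + π ∉ P := fun h1 => hP.ne_top ((Ideal.eq_top_iff_one P).2
    ((P.add_mem_iff_left (by simpa using hπ)).1 h1))
  have h3 := sq_sub_one_mem_of_kerIdeal_le hf hA p hP hP0 (n := 1)
    (h.trans (Ideal.pow_le_pow_right (by omega))) h1
  rw [pow_one] at hπ
  have h4 : π ^ 2 ∈ P ^ 2 := Ideal.pow_mem_pow hπ 2
  obtain ⟨u, hu⟩ := h2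
  refine hπ2 ?_
  have e : π = ↑u⁻¹ * (((1 + π) ^ 2 - 1) - π ^ 2) := by
    have := u.inv_mul
    rw [hu] at this
    linear_combination -π * this
  rw [e]
  exact Ideal.mul_mem_left _ _ (Ideal.sub_mem _ h3 h4)

end SL2

namespace SL2

section models

/-- The additive character of `SL₂(ℤ/3)` sending `(1, x; 0, 1)` to `x`. -/
def chi3 (a b c d : ZMod 3) : ZMod 3 := a * c + b * d + c * d - b * c ^ 2 * d

theorem chi3_mul : ∀ a b c d : ZMod 3, a * d - b * c = 1 → ∀ a' b' c' d' : ZMod 3,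
    a' * d' - b' * c' = 1 → chi3 (a * a' + b * c') (a * b' + b * d') (c * a' + d * c')
      (c * b' + d * d') = chi3 a b c d + chi3 a' b' c' d' := by
  decide

/-- The additive character of `SL₂(ℤ/2)` sending `(1, x; 0, 1)` to `x`. -/
def chi2 (a b c d : ZMod 2) : ZMod 2 := b + c + (1 + a) * (1 + d)

theorem chi2_mul : ∀ a b c d : ZMod 2, a * d - b * c = 1 → ∀ a' b' c' d' : ZMod 2,
    a' * d' - b' * c' = 1 → chi2 (a * a' + b * c') (a * b' + b * d') (c * a' + d * c')
      (c * b' + d * d') = chi2 a b c d + chi2 a' b' c' d' := by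
  decide

theorem sum_conj_eq : ∀ a b c d : ZMod 2, a * d - b * c = 1 → ∀ x y z w : ZMod 2, x + w = 0 →
    ((a * x + b * z) * d - (a * y + b * w) * c) + (-(a * x + b * z) * b + (a * y + b * w) * a) +
      ((c * x + d * z) * d - (c * y + d * w) * c) = x + y + z := by
  decide

/-- The additive character of `SL₂((ℤ/2)[ε])` sending `(1, x₀ + x₁ε; 0, 1)` to `x₁`. -/
def chiEps (a b c d : DualNumber (ZMod 2)) : ZMod 2 :=
  (a.snd * d.fst - b.snd * c.fst) + (-a.snd * b.fst + b.snd * a.fst) +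
    (c.snd * d.fst - d.snd * c.fst)

theorem chiEps_mul {a b c d a' b' c' d' : DualNumber (ZMod 2)} (h : a * d - b * c = 1)
    (h' : a' * d' - b' * c' = 1) : chiEps (a * a' + b * c') (a * b' + b * d') (c * a' + d * c')
      (c * b' + d * d') = chiEps a b c d + chiEps a' b' c' d' := by
  have h0 := congrArg TrivSqZeroExt.fst h
  have h0' := congrArg TrivSqZeroExt.fst h'
  have h1' := congrArg TrivSqZeroExt.snd h'
  simp only [TrivSqZeroExt.fst_sub, TrivSqZeroExt.fst_mul, TrivSqZeroExt.fst_one] at h0 h0'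
  simp only [TrivSqZeroExt.snd_sub, TrivSqZeroExt.snd_mul, TrivSqZeroExt.snd_one, smul_eq_mul,
    MulOpposite.smul_eq_mul_unop, MulOpposite.unop_op] at h1'
  have key := sum_conj_eq _ _ _ _ h0 (a'.snd * d'.fst - b'.snd * c'.fst)
    (-a'.snd * b'.fst + b'.snd * a'.fst) (c'.snd * d'.fst - d'.snd * c'.fst)
    (-c'.snd * b'.fst + d'.snd * a'.fst) (by linear_combination h1')
  unfold chiEps
  simp only [TrivSqZeroExt.fst_add, TrivSqZeroExt.fst_mul, TrivSqZeroExt.snd_add,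
    TrivSqZeroExt.snd_mul, smul_eq_mul, MulOpposite.smul_eq_mul_unop, MulOpposite.unop_op]
  linear_combination h0' * (a.snd * d.fst - b.snd * c.fst + (-a.snd * b.fst + b.snd * a.fst) +
    (c.snd * d.fst - d.snd * c.fst)) + key

/-- A model of the abelianization of `SL₂(R)`, detected on elementary matrices. -/
structure Model (R W : Type*) [CommRing R] [AddCommGroup W] where
  toFun : Matrix.SpecialLinearGroup (Fin 2) R → W
  map_mul : ∀ g h, toFun (g * h) = toFun g + toFun h
  bijective : Function.Bijective fun x => toFun (E12 x)

/-- The abelianization of `SL₂(ℤ/3)`. -/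
def model3 : Model (ZMod 3) (ZMod 3) where
  toFun g := chi3 (g.1 0 0) (g.1 0 1) (g.1 1 0) (g.1 1 1)
  map_mul g h := by
    obtain ⟨a, b, c, d, hg, rfl⟩ := exists_mk g
    obtain ⟨a', b', c', d', hh, rfl⟩ := exists_mk h
    rw [mk_mul]
    exact chi3_mul a b c d hg a' b' c' d' hh
  bijective := by
    convert Function.bijective_id with x
    simp [E12, mk, chi3]

/-- The abelianization of `SL₂((ℤ/2)[ε])`. -/
def model2 : Model (DualNumber (ZMod 2)) (ZMod 2 × ZMod 2) where
  toFun g := (chi2 (g.1 0 0).fst (g.1 0 1).fst (g.1 1 0).fst (g.1 1 1).fst,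
    chiEps (g.1 0 0) (g.1 0 1) (g.1 1 0) (g.1 1 1))
  map_mul g h := by
    obtain ⟨a, b, c, d, hg, rfl⟩ := exists_mk g
    obtain ⟨a', b', c', d', hh, rfl⟩ := exists_mk h
    rw [mk_mul]
    refine Prod.ext ?_ (chiEps_mul hg hh)
    have h0 := congrArg TrivSqZeroExt.fst hg
    have h0' := congrArg TrivSqZeroExt.fst hh
    simp only [TrivSqZeroExt.fst_sub, TrivSqZeroExt.fst_mul, TrivSqZeroExt.fst_one] at h0 h0'
    have := chi2_mul _ _ _ _ h0 _ _ _ _ h0'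
    simpa [mk] using this
  bijective := by
    have : (fun x : DualNumber (ZMod 2) => (x.fst, x.snd)).Bijective :=
      ⟨fun x y h => TrivSqZeroExt.ext (congrArg Prod.fst h) (congrArg Prod.snd h),
        fun x => ⟨(TrivSqZeroExt.inl x.1 + TrivSqZeroExt.inr x.2), by simp⟩⟩
    convert this with x
    · simp [E12, mk, chi2, CharTwo.add_self_eq_zero]
    · simp [E12, mk, chiEps]

end models

end SL2

namespace SL2

universe u

variable {A : Type u} [CommRing A] [IsDedekindDomain A] (hA : ArithRing A)

include hA

theorem f_eq_zero_of_four_le {C : Type*} [AddCommGroup C]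
    {f : Matrix.SpecialLinearGroup (Fin 2) A → C} (hf : ∀ g h, f (g * h) = f g + f h) (p : ℕ)
    [Fact p.Prime] [CharP A p]
    (h4 : ∀ P : Ideal A, P.IsPrime → P ≠ ⊥ → 4 ≤ Nat.card (A ⧸ P))
    (g : Matrix.SpecialLinearGroup (Fin 2) A) : f g = 0 := by
  refine f_eq_zero hf (fun x => ?_) hA p g
  have : (⊤ : Ideal A) ≤ kerIdeal hf := by
    refine Ideal.le_of_forall_prime_pow (kerIdeal_ne_bot hf hA) fun P hP hP0 n hn => ?_
    rcases n with _ | n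
    · simp
    have h1 := natCard_le_three_of_kerIdeal_le hf hA p hP hP0
      (hn.trans (Ideal.pow_le_self (Nat.succ_ne_zero n)))
    have h2 := h4 P hP hP0
    omega
  simpa using this (Submodule.mem_top (x := (1 : A))) x

theorem abelianization_eq_one_of_four_le (p : ℕ) [Fact p.Prime] [CharP A p]
    (h4 : ∀ P : Ideal A, P.IsPrime → P ≠ ⊥ → 4 ≤ Nat.card (A ⧸ P))
    (x : Abelianization (Matrix.SpecialLinearGroup (Fin 2) A)) : x = 1 := by
  obtain ⟨g, rfl⟩ := QuotientGroup.mk_surjective x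
  exact f_eq_zero_of_four_le hA (C := Additive (Abelianization _))
    (f := fun g => Additive.ofMul (Abelianization.of g)) (fun g h => by rw [map_mul]; rfl) p h4 g

theorem nonempty_addEquiv {R W : Type*} [CommRing R] [AddCommGroup W] (m : Model R W) (p : ℕ)
    [Fact p.Prime] [CharP A p] {ι : Type*} [Finite ι] (ρ : ι → A →+* R)
    (hρ : ∀ i, Function.Surjective (ρ i))
    (hcop : Pairwise fun i j => IsCoprime (RingHom.ker (ρ i)) (RingHom.ker (ρ j)))
    (hK : ∀ {C : Type u} [AddCommGroup C] {f : Matrix.SpecialLinearGroup (Fin 2) A → C}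
      (hf : ∀ g h, f (g * h) = f g + f h), ⨅ i, RingHom.ker (ρ i) ≤ kerIdeal hf) :
    Nonempty (Additive (Abelianization (Matrix.SpecialLinearGroup (Fin 2) A)) ≃+ (ι → W)) := by
  set G := Matrix.SpecialLinearGroup (Fin 2) A with hG
  set fU : G → Additive (Abelianization G) := fun g => Additive.ofMul (Abelianization.of g) with hfU
  have hfU' : ∀ g h, fU (g * h) = fU g + fU h := fun g h => by rw [hfU]; simp
  have hsurj : ∀ c, ∃ x : A, fU (E12 x) = c := by
    intro c
    obtain ⟨g, rfl⟩ : ∃ g, fU g = c := QuotientGroup.mk_surjective c.toMul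
    let ε : A →+ Additive (Abelianization G) :=
      { toFun := fun x => fU (E12 x), map_zero' := f_E12_zero hfU', map_add' := f_E12_add hfU' }
    have h0 := f_eq_zero (f := fun g => QuotientAddGroup.mk' ε.range (fU g))
      (fun g h => by rw [hfU', map_add])
      (fun x => (QuotientAddGroup.eq_zero_iff _).2 ⟨x, rfl⟩) hA p g
    obtain ⟨x, hx⟩ := (QuotientAddGroup.eq_zero_iff _).1 h0
    exact ⟨x, hx⟩
  let Φ : G →* Multiplicative (ι → W) :=
    { toFun := fun g => Multiplicative.ofAdd fun i =>
        m.toFun (Matrix.SpecialLinearGroup.map (ρ i) g)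
      map_one' := by
        ext i
        exact congrArg m.toFun (_root_.map_one _) |>.trans (f_one m.map_mul)
      map_mul' := fun g h => by
        ext i
        exact congrArg m.toFun (_root_.map_mul _ _ _) |>.trans (m.map_mul _ _) }
  let Λ : Additive (Abelianization G) →+ (ι → W) :=
    MonoidHom.toAdditiveLeft (Abelianization.lift Φ)
  have hΛ : ∀ x i, Λ (fU (E12 x)) i = m.toFun (E12 (ρ i x)) := by
    intro x i
    have e : Matrix.SpecialLinearGroup.map (ρ i) (E12 x) = E12 (ρ i x) := by
      apply Subtype.ext
      ext a b
      fin_cases a <;> fin_cases b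
      · exact _root_.map_one (ρ i)
      · rfl
      · exact _root_.map_zero (ρ i)
      · exact _root_.map_one (ρ i)
    rw [← e]
    rfl
  have h0 : m.toFun (E12 0) = 0 := f_E12_zero m.map_mul
  refine ⟨AddEquiv.ofBijective Λ ⟨(injective_iff_map_eq_zero Λ).2 fun c hc => ?_, fun w => ?_⟩⟩
  · obtain ⟨x, rfl⟩ := hsurj c
    have hx : x ∈ ⨅ i, RingHom.ker (ρ i) := by
      rw [Ideal.mem_iInf]
      intro i
      have h1 := hΛ x i
      rw [hc, Pi.zero_apply, ← h0] at h1
      exact (m.bijective.1 h1).symm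
    simpa using hK hfU' hx 1
  · choose r hr using fun i => m.bijective.2 (w i)
    choose a ha using fun i => hρ i (r i)
    obtain ⟨x, hx⟩ := Ideal.quotientInfToPiQuotient_surj hcop
      (fun i => Ideal.Quotient.mk (RingHom.ker (ρ i)) (a i))
    obtain ⟨x, rfl⟩ := Ideal.Quotient.mk_surjective x
    refine ⟨fU (E12 x), funext fun i => ?_⟩
    rw [hΛ, ← hr i, ← ha i]
    have h1 := congrFun hx i
    rw [Ideal.quotientInfToPiQuotient_mk', Ideal.Quotient.mk_eq_mk_iff_sub_mem,
      RingHom.mem_ker, map_sub, sub_eq_zero] at h1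
    rw [h1]

end SL2

section ringEquiv

variable {A : Type*} [CommRing A] [IsDedekindDomain A]

theorem exists_ringHom_dualNumber [CharP A 2] {P : Ideal A} (hP : P.IsPrime) (hP0 : P ≠ ⊥)
    (hcard : Nat.card (A ⧸ P) = 2) :
    ∃ ρ : A →+* DualNumber (ZMod 2), Function.Surjective ρ ∧ RingHom.ker ρ = P ^ 2 := by
  let _ : Algebra (ZMod 2) A := ZMod.algebra A 2
  obtain ⟨π, hπ, hπ2⟩ := Ideal.exists_mem_pow_notMem_pow_succ P hP0 hP.ne_top 1
  rw [pow_one] at hπ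
  let ψ : DualNumber (ZMod 2) →ₐ[ZMod 2] A ⧸ P ^ 2 :=
    DualNumber.lift ⟨(Algebra.ofId _ _, Ideal.Quotient.mk _ π), by
      rw [← map_mul, Ideal.Quotient.eq_zero_iff_mem, ← sq]
      exact Ideal.pow_mem_pow hπ 2, fun a => Commute.all _ _⟩
  have hψ : ∀ x, ψ x = Ideal.Quotient.mk _ (algebraMap (ZMod 2) A x.fst +
      algebraMap (ZMod 2) A x.snd * π) := by
    intro x
    simp [ψ, DualNumber.lift_apply_apply, Algebra.ofId_apply]
  have hinj : Function.Injective ψ := by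
    rw [injective_iff_map_eq_zero]
    intro x hx
    rw [hψ, Ideal.Quotient.eq_zero_iff_mem] at hx
    have h2 : ∀ z : ZMod 2, z = 0 ∨ z = 1 := by decide
    rcases h2 x.fst with h | h
    · rcases h2 x.snd with h' | h'
      · exact TrivSqZeroExt.ext h h'
      · rw [h, h', map_zero, map_one, zero_add, one_mul] at hx
        exact absurd hx hπ2
    · refine absurd ((Ideal.eq_top_iff_one P).2 ?_) hP.ne_top
      rw [h, map_one] at hx
      exact (P.add_mem_iff_left (P.mul_mem_left _ hπ)).1 (Ideal.pow_le_self two_ne_zero hx)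
  have hc : Nat.card (A ⧸ P ^ 2) = 4 := by
    have := cardQuot_pow_of_prime (P := P) hP0 (i := 2)
    rw [Submodule.cardQuot_apply, Submodule.cardQuot_apply, hcard] at this
    exact this
  have hc' : Nat.card (DualNumber (ZMod 2)) = 4 := by
    change Nat.card (ZMod 2 × ZMod 2) = 4
    simp
  have : Finite (A ⧸ P ^ 2) := Nat.finite_of_card_ne_zero (by omega)
  let e := RingEquiv.ofBijective ψ (hinj.bijective_of_nat_card_le (by omega))
  refine ⟨e.symm.toRingHom.comp (Ideal.Quotient.mk (P ^ 2)),
    e.symm.surjective.comp Ideal.Quotient.mk_surjective, ?_⟩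
  rw [RingHom.ker_equiv_comp, Ideal.mk_ker]

theorem exists_ringHom_zmod {P : Ideal A} {p : ℕ} (hp : p.Prime)
    (hcard : Nat.card (A ⧸ P) = p) :
    ∃ ρ : A →+* ZMod p, Function.Surjective ρ ∧ RingHom.ker ρ = P := by
  have : Finite (A ⧸ P) := Nat.finite_of_card_ne_zero (by rw [hcard]; exact hp.ne_zero)
  have := Fintype.ofFinite (A ⧸ P)
  let e := ZMod.ringEquivOfPrime (A ⧸ P) hp (by rw [← Nat.card_eq_fintype_card, hcard])
  refine ⟨e.symm.toRingHom.comp (Ideal.Quotient.mk P),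
    e.symm.surjective.comp Ideal.Quotient.mk_surjective, ?_⟩
  rw [RingHom.ker_equiv_comp, Ideal.mk_ker]

end ringEquiv

namespace SL2

universe u

variable {A : Type u} [CommRing A] [IsDedekindDomain A]

theorem finite_of_natCard_quot_eq (hA : ArithRing A) {q : ℕ} (hq : 1 < q) {ι : Type*}
    {P : ι → Ideal A} (hP : ∀ i, (P i).IsPrime) (hP0 : ∀ i, P i ≠ ⊥)
    (hinj : Function.Injective P) (hcard : ∀ i, Nat.card (A ⧸ P i) = q) : Finite ι := by
  obtain ⟨v, hv⟩ := hA.exists_unit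
  have hne : (v : A) ^ (q - 1) - 1 ≠ 0 := fun h =>
    hv (q - 1) (by omega) (Units.ext (sub_eq_zero.1 h))
  have hfin := Ideal.finite_factors (I := Ideal.span {(v : A) ^ (q - 1) - 1}) (by simpa using hne)
  let g : ι → IsDedekindDomain.HeightOneSpectrum A := fun i => ⟨P i, hP i, hP0 i⟩
  have hg : Function.Injective g := fun i j h =>
    hinj (congrArg IsDedekindDomain.HeightOneSpectrum.asIdeal h)
  have hmem : ∀ i, g i ∈ {v' : IsDedekindDomain.HeightOneSpectrum A |
      v'.asIdeal ∣ Ideal.span {(v : A) ^ (q - 1) - 1}} := by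
    intro i
    have := (hP i).isMaximal (hP0 i)
    have := hA.finite_quot _ (hP0 i)
    exact Ideal.dvd_span_singleton.2 (v.pow_sub_one_mem (by rw [hcard i]))
  have := hfin.to_subtype
  exact Finite.of_injective (fun i => (⟨g i, hmem i⟩ : {v' : IsDedekindDomain.HeightOneSpectrum A |
      v'.asIdeal ∣ Ideal.span {(v : A) ^ (q - 1) - 1}}))
    fun i j h => hg (congrArg Subtype.val h)

theorem nonempty_addEquiv_directSum {R W : Type*} [CommRing R] [AddCommGroup W] (m : Model R W)
    (hA : ArithRing A) (p : ℕ) [Fact p.Prime] [CharP A p] (hp : 4 ≤ 2 * p) (N : ℕ)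
    {ι : Type*} {P : ι → Ideal A} (hP : ∀ i, (P i).IsPrime) (hP0 : ∀ i, P i ≠ ⊥)
    (hinj : Function.Injective P) (hcard : ∀ i, Nat.card (A ⧸ P i) = p)
    (hall : ∀ Q : Ideal A, Q.IsPrime → Q ≠ ⊥ → Nat.card (A ⧸ Q) = p → ∃ i, P i = Q)
    (hρ : ∀ i, ∃ ρ : A →+* R, Function.Surjective ρ ∧ RingHom.ker ρ = P i ^ N)
    (hN : ∀ {C : Type u} [AddCommGroup C] {f : Matrix.SpecialLinearGroup (Fin 2) A → C}
      (hf : ∀ g h, f (g * h) = f g + f h) (Q : Ideal A), Q.IsPrime → Q ≠ ⊥ → ∀ n,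
      kerIdeal hf ≤ Q ^ n → n ≤ N) :
    Nonempty (Additive (Abelianization (Matrix.SpecialLinearGroup (Fin 2) A)) ≃+
      DirectSum ι fun _ => W) := by
  have : Finite ι := finite_of_natCard_quot_eq hA (Fact.out : p.Prime).one_lt hP hP0 hinj hcard
  have := Fintype.ofFinite ι
  choose ρ hsurj hker using hρ
  have hmax : ∀ i, (P i).IsMaximal := fun i => (hP i).isMaximal (hP0 i)
  obtain ⟨e⟩ := nonempty_addEquiv hA m p ρ hsurj (fun i j hij => by
    change IsCoprime (RingHom.ker (ρ i)) (RingHom.ker (ρ j))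
    rw [hker, hker]
    exact IsCoprime.pow (Ideal.isCoprime_iff_sup_eq.2
      (Ideal.IsMaximal.coprime_of_ne (hmax i) (hmax j) fun h => hij (hinj h)))) (fun {C} _ f hf => by
    refine Ideal.le_of_forall_prime_pow (kerIdeal_ne_bot hf hA) fun Q hQ hQ0 n hn => ?_
    rcases Nat.eq_zero_or_pos n with rfl | hn0
    · simp
    have hQ1 := natCard_le_three_of_kerIdeal_le hf hA p hQ hQ0
      (hn.trans (Ideal.pow_le_self hn0.ne'))
    have := hA.finite_quot Q hQ0
    obtain ⟨c, hc⟩ := Ideal.dvd_natCard_quot (p := p) hQ.ne_top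
    have hc0 : Nat.card (A ⧸ Q) ≠ 0 := Nat.card_pos.ne'
    have hc1 : c = 1 := by
      rcases c with _ | _ | c
      · simp [hc] at hc0
      · rfl
      · rw [hc] at hQ1
        nlinarith
    rw [hc1, mul_one] at hc
    obtain ⟨i, rfl⟩ := hall Q hQ hQ0 hc
    exact (iInf_le _ i).trans ((hker i).le.trans (Ideal.pow_le_pow_right (hN hf _ hQ hQ0 n hn))))
  exact ⟨e.trans (DirectSum.addEquivProd fun _ => W).symm⟩

variable (hA : ArithRing A) {ι : Type*} {P : ι → Ideal A} (hP : ∀ i, (P i).IsPrime)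
  (hP0 : ∀ i, P i ≠ ⊥) (hinj : Function.Injective P)

include hA hP hP0 hinj

theorem nonempty_addEquiv_of_two [CharP A 2] (hcard : ∀ i, Nat.card (A ⧸ P i) = 2)
    (hall : ∀ Q : Ideal A, Q.IsPrime → Q ≠ ⊥ → Nat.card (A ⧸ Q) = 2 → ∃ i, P i = Q) :
    Nonempty (Additive (Abelianization (Matrix.SpecialLinearGroup (Fin 2) A)) ≃+
      DirectSum ι fun _ => ZMod 2 × ZMod 2) :=
  nonempty_addEquiv_directSum model2 hA 2 (by norm_num) 2 hP hP0 hinj hcard hall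
    (fun i => exists_ringHom_dualNumber (hP i) (hP0 i) (hcard i))
    fun hf _ hQ hQ0 _ h => le_two_of_kerIdeal_le hf hA 2
      (by exact_mod_cast CharP.cast_eq_zero A 2) hQ hQ0 h

theorem nonempty_addEquiv_of_three [CharP A 3] (hcard : ∀ i, Nat.card (A ⧸ P i) = 3)
    (hall : ∀ Q : Ideal A, Q.IsPrime → Q ≠ ⊥ → Nat.card (A ⧸ Q) = 3 → ∃ i, P i = Q) :
    Nonempty (Additive (Abelianization (Matrix.SpecialLinearGroup (Fin 2) A)) ≃+
      DirectSum ι fun _ => ZMod 3) := by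
  have : Fact (Nat.Prime 3) := ⟨Nat.prime_three⟩
  have h3 : (3 : A) = 0 := by exact_mod_cast CharP.cast_eq_zero A 3
  have h2 : IsUnit (2 : A) := .of_mul_eq_one 2 (by linear_combination h3)
  exact nonempty_addEquiv_directSum model3 hA 3 (by norm_num) 1 hP hP0 hinj hcard hall
    (fun i => by
      rw [pow_one]
      exact exists_ringHom_zmod Nat.prime_three (hcard i))
    fun hf _ hQ hQ0 _ h => le_one_of_kerIdeal_le hf hA 3 h2 hQ hQ0 h

end SL2

namespace OnePlace

variable {k B κ : Type*} [Field k] [CommRing B] [Algebra k B] [Field κ] [Algebra k κ]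
  (V : OnePlace k B κ) [IsDedekindDomain B] [Fintype k] [Module.Finite k κ]
  {d : B} (hd : d ≠ 0) (A : Type*) [CommRing A] [Algebra B A] [IsLocalization.Away d A]

include V in
theorem finite_quotient {I : Ideal B} (hI : I ≠ ⊥) : Finite (B ⧸ I) := by
  have := V.finite_quot hI
  exact Module.finite_of_finite k

variable (d) in
theorem exists_unit_mul_eq (z : A) : ∃ n : ℕ, ∀ m ≥ n, ∃ b, (algebraMap B A d) ^ m * z = algebraMap B A b := by
  obtain ⟨n, b, hb⟩ := IsLocalization.Away.surj d z
  refine ⟨n, fun m hm => ⟨d ^ (m - n) * b, ?_⟩⟩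
  rw [map_mul, map_pow, ← hb, mul_comm z, ← mul_assoc, ← pow_add]
  congr 2
  omega

variable (d) in
theorem exists_unit_mul_eq₂ (z w : A) : ∃ u : Aˣ, (∃ n : ℕ, (u : A) = algebraMap B A d ^ n) ∧
    ∃ a b, u * z = algebraMap B A a ∧ u * w = algebraMap B A b := by
  obtain ⟨n, hn⟩ := exists_unit_mul_eq d A z
  obtain ⟨m, hm⟩ := exists_unit_mul_eq d A w
  obtain ⟨a, ha⟩ := hn (n + m) (by omega)
  obtain ⟨b, hb⟩ := hm (n + m) (by omega)
  refine ⟨(IsLocalization.Away.algebraMap_isUnit (S := A) d).unit ^ (n + m), ⟨n + m, by simp⟩, a, b, ?_, ?_⟩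
  · simpa using ha
  · simpa using hb

include hd in
theorem away_algebraMap_injective : Function.Injective (algebraMap B A) :=
  IsLocalization.injective A (powers_le_nonZeroDivisors_of_noZeroDivisors hd)

include V hd in
theorem finite_quot_away (I : Ideal A) (hI : I ≠ ⊥) : Finite (A ⧸ I) := by
  set J := I.comap (algebraMap B A) with hJ
  have hJ0 : J ≠ ⊥ := by
    obtain ⟨x, hx, hx0⟩ := Submodule.exists_mem_ne_zero_of_ne_bot hI
    obtain ⟨u, -, a, -, ha, -⟩ := exists_unit_mul_eq₂ d A x x
    intro h
    have : a ∈ J := by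
      rw [hJ, Ideal.mem_comap, ← ha]
      exact I.mul_mem_left _ hx
    rw [h, Ideal.mem_bot] at this
    rw [this, map_zero, Units.mul_right_eq_zero] at ha
    exact hx0 ha
  have := V.finite_quotient hJ0
  have hdu : IsUnit (Ideal.Quotient.mk J d) := by
    rw [isUnit_iff_mem_nonZeroDivisors_of_finite, mem_nonZeroDivisors_iff_right]
    intro x hx
    obtain ⟨x, rfl⟩ := Ideal.Quotient.mk_surjective x
    rw [← map_mul, Ideal.Quotient.eq_zero_iff_mem, hJ, Ideal.mem_comap, map_mul] at hx
    rw [Ideal.Quotient.eq_zero_iff_mem]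
    exact (Ideal.mul_unit_mem_iff_mem _ (IsLocalization.Away.algebraMap_isUnit (S := A) d)).1 hx
  obtain ⟨d', hd'⟩ := hdu.exists_right_inv
  obtain ⟨d', rfl⟩ := Ideal.Quotient.mk_surjective d'
  have h1 : Ideal.Quotient.mk I (algebraMap B A d) * Ideal.Quotient.mk I (algebraMap B A d') = 1 := by
    rw [← map_mul, ← map_mul, ← map_one (Ideal.Quotient.mk I), Ideal.Quotient.mk_eq_mk_iff_sub_mem]
    rw [← map_mul, ← map_one (Ideal.Quotient.mk J), Ideal.Quotient.mk_eq_mk_iff_sub_mem, hJ,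
      Ideal.mem_comap] at hd'
    simpa using hd'
  refine Finite.of_surjective (Ideal.quotientMap I (algebraMap B A) le_rfl) fun z => ?_
  obtain ⟨z, rfl⟩ := Ideal.Quotient.mk_surjective z
  obtain ⟨n, b, hb⟩ := IsLocalization.Away.surj d z
  refine ⟨Ideal.Quotient.mk J (b * d' ^ n), ?_⟩
  rw [Ideal.quotientMap_mk, map_mul, ← hb, map_mul, map_mul, map_pow, map_pow, map_pow, mul_assoc,
    ← mul_pow, h1, one_pow, mul_one]

include hd in
theorem comap_pow_le {P : Ideal A} (hP : P.IsPrime) {x : B} {E : ℕ}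
    (h : algebraMap B A x ∈ P ^ E) : x ∈ P.comap (algebraMap B A) ^ E := by
  have hP' : (P.comap (algebraMap B A)).IsPrime := hP.comap _
  have h1 : (P.comap (algebraMap B A)).map (algebraMap B A) = P :=
    IsLocalization.map_under (Submonoid.powers d) A P
  rw [← h1, ← Ideal.map_pow, IsLocalization.mem_map_algebraMap_iff (Submonoid.powers d)] at h
  obtain ⟨⟨⟨y, hy⟩, ⟨_, n, rfl⟩⟩, e⟩ := h
  rw [← map_mul] at e
  have e' := away_algebraMap_injective hd A e
  simp only at e'
  rw [← e', mul_comm] at hy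
  refine (hP'.mul_mem_pow _ hy).resolve_left fun h => hP.ne_top ?_
  rw [Ideal.mem_comap] at h
  exact P.eq_top_of_isUnit_mem h (by
    rw [map_pow]
    exact (IsLocalization.Away.algebraMap_isUnit (S := A) d).pow n)

include hd in
theorem notMem_of_away {s a b : A} {u w : Aˣ} {s' a' b' : B} (hs : w * s = algebraMap B A s')
    (ha : u * a = algebraMap B A a') (hb : u * b = algebraMap B A b')
    (h : ∀ P : Ideal A, P.IsPrime → s ∉ P → a ∈ P → b ∉ P) (P : Ideal B) (hP : P.IsPrime)
    (hsP : s' * d ∉ P) (haP : a' ∈ P) : b' ∉ P := by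
  intro hbP
  have hdis : Disjoint (Submonoid.powers d : Set B) (P : Set B) :=
    (Ideal.disjoint_powers_iff_notMem d hP.isRadical).2 fun h => hsP (P.mul_mem_left _ h)
  have h1 := IsLocalization.isPrime_of_isPrime_disjoint (Submonoid.powers d) A P hP hdis
  have h2 : (P.map (algebraMap B A)).comap (algebraMap B A) = P :=
    IsLocalization.under_map_of_isPrime_disjoint (Submonoid.powers d) A hP hdis
  refine h _ h1 (fun hh => hsP (P.mul_mem_right _ ?_)) ?_ ?_
  · rw [← h2, Ideal.mem_comap, ← hs]
    exact Ideal.mul_mem_left _ _ hh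
  · rw [← Ideal.unit_mul_mem_iff_mem _ u.isUnit, ha]
    exact Ideal.mem_map_of_mem _ haP
  · rw [← Ideal.unit_mul_mem_iff_mem _ u.isUnit, hb]
    exact Ideal.mem_map_of_mem _ hbP

include V hd in
theorem exists_notMem_pow_away : ∃ E0 : ℕ, ∀ E ≥ E0, ∀ s : A, s ≠ 0 → ∀ a b a' b' : A,
    (∀ P : Ideal A, P.IsPrime → s ∉ P → a ∈ P → b ∉ P) →
    (∀ P : Ideal A, P.IsPrime → s ∉ P → a' ∈ P → b' ∉ P) →
    ∃ y : A, ∀ P : Ideal A, P.IsPrime → s ∉ P → a + b * y ∉ P ^ E ∧ a' + b' * y ∉ P ^ E := by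
  obtain ⟨E0, -, hE0⟩ := V.exists_add_mul_notMem_pow
  refine ⟨E0, fun E hE s hs a b a' b' h h' => ?_⟩
  obtain ⟨w, -, s₁, -, hs₁, -⟩ := exists_unit_mul_eq₂ d A s s
  obtain ⟨u, -, a₁, b₁, ha₁, hb₁⟩ := exists_unit_mul_eq₂ d A a b
  obtain ⟨u', -, a₁', b₁', ha₁', hb₁'⟩ := exists_unit_mul_eq₂ d A a' b'
  have hs0 : s₁ * d ≠ 0 := by
    refine mul_ne_zero (fun h0 => hs ?_) hd
    rwa [h0, map_zero, Units.mul_right_eq_zero] at hs₁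
  obtain ⟨y, hy⟩ := hE0 E hE (s₁ * d) hs0 a₁ b₁ a₁' b₁'
    (notMem_of_away hd A hs₁ ha₁ hb₁ h) (notMem_of_away hd A hs₁ ha₁' hb₁' h')
  refine ⟨algebraMap B A y, fun P hP hsP => ?_⟩
  have hP' : (P.comap (algebraMap B A)).IsPrime := hP.comap _
  have hP1 : s₁ * d ∉ P.comap (algebraMap B A) := by
    intro h0
    rw [Ideal.mem_comap, map_mul, Ideal.mul_unit_mem_iff_mem _
      (IsLocalization.Away.algebraMap_isUnit (S := A) d), ← hs₁,
      Ideal.unit_mul_mem_iff_mem _ w.isUnit] at h0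
    exact hsP h0
  have key : ∀ {u : Aˣ} {a b : A} {a₁ b₁ : B}, u * a = algebraMap B A a₁ →
      u * b = algebraMap B A b₁ → a + b * algebraMap B A y ∈ P ^ E →
      a₁ + b₁ * y ∈ P.comap (algebraMap B A) ^ E := by
    intro u a b a₁ b₁ ha hb hm
    refine comap_pow_le hd A hP ?_
    rw [map_add, map_mul, ← ha, ← hb, mul_assoc, ← mul_add]
    exact Ideal.mul_mem_left _ _ hm
  exact ⟨fun hm => (hy _ hP' hP1).1 (key ha₁ hb₁ hm), fun hm => (hy _ hP' hP1).2 (key ha₁' hb₁' hm)⟩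

include V in
theorem exists_pow_eq_mul_add (d : B) {a : B} (ha : a ≠ 0) :
    ∃ n : ℕ, ∃ x y, d ^ n = a * x + d ^ (n + 1) * y := by
  have := V.finite_quotient (I := Ideal.span {a}) (by simpa using ha)
  obtain ⟨i, j, hij, h⟩ := Finite.exists_ne_map_eq_of_infinite
    (fun n : ℕ => Ideal.Quotient.mk (Ideal.span {a}) (d ^ n))
  wlog hlt : i < j generalizing i j
  · exact this j i hij.symm h.symm (by omega)
  obtain ⟨x, hx⟩ := Ideal.mem_span_singleton.1 (Ideal.Quotient.mk_eq_mk_iff_sub_mem _ _|>.1 h)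
  refine ⟨i, x, d ^ (j - i - 1), ?_⟩
  rw [← hx, ← pow_add, show i + 1 + (j - i - 1) = j by omega, sub_add_cancel]

include hd in
theorem isCoprime_of_away {a b : B} (h : IsCoprime (algebraMap B A a) (algebraMap B A b))
    (hb : IsCoprime b d) : IsCoprime a b := by
  obtain ⟨x, y, hxy⟩ := h
  obtain ⟨u, ⟨n, hu⟩, x', y', hx, hy⟩ := exists_unit_mul_eq₂ d A x y
  have h1 : x' * a + y' * b = d ^ n := by
    apply away_algebraMap_injective hd A
    rw [map_add, map_mul, map_mul, ← hx, ← hy, map_pow, ← hu]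
    linear_combination (u : A) * hxy
  obtain ⟨r, t, hrt⟩ := hb.pow_right (n := n)
  exact ⟨t * x', r + t * y', by linear_combination hrt + t * h1⟩

include V hd in
theorem exists_dvd_pow_sub_away (l : ℕ) (hl : l.Prime) (a b : A) (hab : IsCoprime a b) :
    ∃ u c : Aˣ, ∃ x t s : A, ∃ e : ℕ, ¬ l ∣ e ∧
      u * b + u * a * x + (u * a + (u * b + u * a * x) * t) * s ∣
      (u * a + (u * b + u * a * x) * t) ^ e - c := by
  obtain ⟨u, x, a₁, b₁, ha, hb, hc⟩ : ∃ u : Aˣ, ∃ x, ∃ a₁ b₁ : B, u * a = algebraMap B A a₁ ∧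
      u * b + u * a * x = algebraMap B A b₁ ∧ IsCoprime a₁ b₁ := by
    rcases eq_or_ne a 0 with rfl | ha0
    · obtain ⟨u, rfl⟩ := isCoprime_zero_left.1 hab
      exact ⟨u⁻¹, 0, 0, 1, by simp, by simp, isCoprime_one_right⟩
    · obtain ⟨u, -, a₁, b₁, ha, hb⟩ := exists_unit_mul_eq₂ d A a b
      have ha1 : a₁ ≠ 0 := by
        rintro rfl
        rw [map_zero, Units.mul_right_eq_zero] at ha
        exact ha0 ha
      obtain ⟨n, x, y, h⟩ := V.exists_pow_eq_mul_add d ha1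
      obtain ⟨w, hw⟩ := IsLocalization.Away.algebraMap_isUnit (S := A) d
      have h' := congrArg (algebraMap B A) h
      simp only [map_add, map_mul, map_pow, ← hw] at h'
      have hwi : (w : A) ^ n * ((w⁻¹ ^ n : Aˣ) : A) = 1 := by
        rw [← Units.val_pow_eq_pow_val, ← Units.val_mul]; simp
      have hb1 : u * b + u * a * ((1 - u * b) * algebraMap B A x * ((w⁻¹ ^ n : Aˣ) : A)) =
          algebraMap B A (1 - (1 - b₁) * d * y) := by
        rw [ha, hb]
        simp only [map_sub, map_mul, map_one, ← hw]
        linear_combination (-(1 - algebraMap B A b₁) * ((w⁻¹ ^ n : Aˣ) : A)) * h' +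
          ((1 - algebraMap B A b₁) * (1 - w * algebraMap B A y)) * hwi
      refine ⟨u, _, a₁, _, ha, hb1, isCoprime_of_away hd A ?_ ⟨1, (1 - b₁) * y, by ring⟩⟩
      rw [← ha, ← hb1]
      refine IsCoprime.add_mul_left_right ?_ _
      rwa [isCoprime_mul_unit_left_left u.isUnit, isCoprime_mul_unit_left_right u.isUnit]
  obtain ⟨t, s, e, c, he, hc0, hdvd⟩ := V.exists_pow_const hl hc
  refine ⟨u, (Units.mk0 c hc0).map ((algebraMap B A).comp (algebraMap k B)).toMonoidHom, x,
    algebraMap B A t, algebraMap B A s, e, he, ?_⟩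
  rw [hb, ha]
  simpa using map_dvd (algebraMap B A) hdvd

include V hd in
theorem arithRing (hA : ∃ v : Aˣ, ∀ n : ℕ, n ≠ 0 → v ^ n ≠ 1) : ArithRing A where
  finite_quot := V.finite_quot_away hd A
  exists_notMem_pow := V.exists_notMem_pow_away hd A
  exists_dvd_pow_sub := V.exists_dvd_pow_sub_away hd A
  exists_unit := hA

end OnePlace

/-- A field `F` covered by two rings: `O`, the functions regular at the finite places, and `C`, the
functions regular at the infinite places, one of which is the place of the prime element `π`; the
element `ρ` vanishes exactly at the other infinite places. -/
structure Chart (F : Type*) [Field F] where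
  O : Subring F
  C : Subring F
  K : Subfield F
  π : C
  ρ : C
  a : ℕ
  c : ℕ
  prime : Prime π
  coprime : IsCoprime π ρ
  ρ_ne_zero : ρ ≠ 0
  mem_K : ∀ z, z ∈ K ↔ z ∈ O ∧ z ∈ C
  finite_π : Finite (C ⧸ Ideal.span {π})
  finite_ρ : ∀ n : ℕ, Finite (C ⧸ Ideal.span {ρ ^ n})
  decomp : ∀ z : F, ∃ b ∈ O, ∃ m : C, (π : F) ^ a * ρ ^ c * (z - b) = m
  integral_O : ∀ z : F, IsIntegral O z → z ∈ O
  integral_C : ∀ z : F, IsIntegral C z → z ∈ C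
  frac_O : ∀ z : F, ∃ u ∈ O, ∃ w ∈ O, w ≠ 0 ∧ z * w = u
  exists_mul_mem : ∀ z : F, ∃ n : ℕ, ((π : F) * ρ) ^ n * z ∈ C

namespace Chart

variable {F : Type*} [Field F] (X : Chart F)

theorem π_ne_zero : (X.π : F) ≠ 0 := fun h => X.prime.ne_zero (Subtype.ext h)

theorem ρ_ne_zero' : (X.ρ : F) ≠ 0 := fun h => X.ρ_ne_zero (Subtype.ext h)

/-- The functions regular away from the place of `π`. -/
def B : Subring F where
  carrier := {z | z ∈ X.O ∧ ∃ n : ℕ, (X.π : F) ^ n * z ∈ X.C}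
  zero_mem' := ⟨zero_mem _, 0, by simp⟩
  one_mem' := ⟨one_mem _, 0, by simp⟩
  neg_mem' := fun {z} ⟨h, n, hn⟩ => ⟨neg_mem h, n, by rw [mul_neg]; exact neg_mem hn⟩
  add_mem' := fun {z w} ⟨h, n, hn⟩ ⟨h', m, hm⟩ => ⟨add_mem h h', n + m, by
    have := add_mem (mul_mem (pow_mem X.π.2 m) hn) (mul_mem (pow_mem X.π.2 n) hm)
    convert this using 1
    ring⟩
  mul_mem' := fun {z w} ⟨h, n, hn⟩ ⟨h', m, hm⟩ => ⟨mul_mem h h', n + m, by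
    convert mul_mem hn hm using 1
    ring⟩

theorem K_le_C : X.K.toSubring ≤ X.C := fun z hz => ((X.mem_K z).1 hz).2

theorem K_le_B : X.K.toSubring ≤ X.B := fun z hz =>
  ⟨((X.mem_K z).1 hz).1, 0, by simpa using ((X.mem_K z).1 hz).2⟩

/-- The residue field at the place of `π`. -/
abbrev κ := X.C ⧸ Ideal.span {X.π}

instance : (Ideal.span {X.π}).IsMaximal := by
  have := X.finite_π
  have := (Ideal.span_singleton_prime X.prime.ne_zero).2 X.prime
  exact Ideal.Quotient.maximal_of_isField _ (Finite.isField_of_domain _)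

noncomputable instance : Field X.κ := Ideal.Quotient.field _

instance : Finite X.κ := X.finite_π

noncomputable instance : Algebra X.K X.B := (Subring.inclusion X.K_le_B).toAlgebra

noncomputable instance : Algebra X.K X.κ :=
  ((Ideal.Quotient.mk _).comp (Subring.inclusion X.K_le_C)).toAlgebra

instance : Finite X.K := Finite.of_injective _ (algebraMap X.K X.κ).injective

noncomputable instance : Fintype X.K := Fintype.ofFinite _

instance : Module.Finite X.K X.κ := Module.Finite.of_finite

theorem not_dvd_of_mem_K {m : X.C} (hm : (m : F) ∈ X.K) (hm0 : m ≠ 0) : ¬ X.π ∣ m := by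
  rintro h
  have h1 : (m : F)⁻¹ ∈ X.C := X.K_le_C (X.K.inv_mem hm)
  refine X.prime.not_isUnit (isUnit_of_dvd_unit h (.of_mul_eq_one ⟨_, h1⟩ (Subtype.ext ?_)))
  exact mul_inv_cancel₀ fun h => hm0 (Subtype.ext h)

open Classical in
/-- The order of the pole at the place of `π`. -/
noncomputable def ν (b : X.B) : ℕ := Nat.find b.2.2

/-- The function `π ^ ν b * b`. -/
noncomputable def lead (b : X.B) : X.C := ⟨(X.π : F) ^ X.ν b * b, by
  classical exact Nat.find_spec b.2.2⟩

theorem coe_lead (b : X.B) : (X.lead b : F) = (X.π : F) ^ X.ν b * b := rfl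

theorem ν_le {b : X.B} {n : ℕ} (h : (X.π : F) ^ n * b ∈ X.C) : X.ν b ≤ n := by
  classical exact Nat.find_min' b.2.2 h

theorem lead_ne_zero {b : X.B} (hb : b ≠ 0) : X.lead b ≠ 0 := fun h => by
  have h1 := congrArg Subtype.val h
  rw [coe_lead] at h1
  exact (mul_ne_zero (pow_ne_zero _ X.π_ne_zero) fun h => hb (Subtype.ext h)) h1

theorem not_dvd_lead {b : X.B} (hb : b ≠ 0) : ¬ X.π ∣ X.lead b := by
  rintro ⟨m, hm⟩
  have h1 : (X.π : F) ^ X.ν b * b = X.π * m := congrArg Subtype.val hm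
  rcases h : X.ν b with _ | n
  · rw [h, pow_zero, one_mul] at h1
    refine X.not_dvd_of_mem_K (m := X.lead b) ?_ (X.lead_ne_zero hb) ⟨m, hm⟩
    rw [X.mem_K, coe_lead, h, pow_zero, one_mul]
    refine ⟨b.2.1, ?_⟩
    rw [h1]
    exact mul_mem X.π.2 m.2
  · have h2 : (X.π : F) ^ n * b = m := by
      apply mul_left_cancel₀ X.π_ne_zero
      rw [← h1, h]
      ring
    have := X.ν_le (b := b) (n := n) (by rw [h2]; exact m.2)
    omega

theorem eq_of_not_dvd {b : X.B} {n : ℕ} {m : X.C} (h : (m : F) = (X.π : F) ^ n * b)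
    (hm : ¬ X.π ∣ m) : X.ν b = n ∧ X.lead b = m := by
  have h1 : X.ν b ≤ n := X.ν_le (by rw [← h]; exact m.2)
  have h2 : m = X.π ^ (n - X.ν b) * X.lead b := by
    apply Subtype.ext
    push_cast
    rw [h, coe_lead, ← mul_assoc, ← pow_add]
    congr 2
    omega
  have h3 : X.ν b = n := by
    by_contra h4
    exact hm (h2 ▸ (dvd_pow_self _ (by omega)).mul_right _)
  refine ⟨h3, ?_⟩
  rw [h2, h3, Nat.sub_self, pow_zero, one_mul]

/-- The leading coefficient at the place of `π`. -/
noncomputable def lc (b : X.B) : X.κ := Ideal.Quotient.mk _ (X.lead b)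

theorem mk_eq_zero {m : X.C} : (Ideal.Quotient.mk _ m : X.κ) = 0 ↔ X.π ∣ m := by
  rw [Ideal.Quotient.eq_zero_iff_mem, Ideal.mem_span_singleton]

theorem ν_zero : X.ν 0 = 0 := Nat.le_zero.1 (X.ν_le (by simp))

theorem lead_zero : X.lead 0 = 0 := Subtype.ext (by rw [coe_lead]; simp)

theorem lc_eq_zero (b : X.B) : X.lc b = 0 ↔ b = 0 := by
  constructor
  · intro h
    by_contra hb
    exact X.not_dvd_lead hb (X.mk_eq_zero.1 h)
  · rintro rfl
    rw [lc, lead_zero, map_zero]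

theorem ν_lead_mul {x y : X.B} (hx : x ≠ 0) (hy : y ≠ 0) :
    X.ν (x * y) = X.ν x + X.ν y ∧ X.lead (x * y) = X.lead x * X.lead y := by
  refine X.eq_of_not_dvd ?_ (X.prime.not_dvd_mul (X.not_dvd_lead hx) (X.not_dvd_lead hy))
  push_cast
  rw [coe_lead, coe_lead]
  ring

theorem ν_lead_algebraMap (z : X.K) : X.ν (algebraMap X.K X.B z) = 0 ∧
    X.lead (algebraMap X.K X.B z) = ⟨z, X.K_le_C z.2⟩ := by
  rcases eq_or_ne z 0 with rfl | hz
  · rw [map_zero, ν_zero, lead_zero]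
    exact ⟨rfl, rfl⟩
  refine X.eq_of_not_dvd ?_ (X.not_dvd_of_mem_K z.2 fun h => hz ?_)
  · rw [pow_zero, one_mul]
    rfl
  · have h1 : (z : F) = 0 := congrArg Subtype.val h
    exact_mod_cast h1

theorem ν_add (x y : X.B) : X.ν (x + y) ≤ max (X.ν x) (X.ν y) := by
  apply X.ν_le
  rw [Subring.coe_add, mul_add]
  have : ∀ {b : X.B} {n : ℕ}, X.ν b ≤ n → (X.π : F) ^ n * b ∈ X.C := by
    intro b n h
    obtain ⟨m, rfl⟩ := Nat.exists_eq_add_of_le' h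
    rw [pow_add, mul_assoc, ← coe_lead]
    exact mul_mem (pow_mem X.π.2 _) (X.lead b).2
  exact add_mem (this (le_max_left _ _)) (this (le_max_right _ _))

theorem lc_add (x y : X.B) (h : X.ν x = X.ν y) (h0 : X.lc x + X.lc y ≠ 0) :
    X.ν (x + y) = X.ν x ∧ X.lc (x + y) = X.lc x + X.lc y := by
  rw [lc, lc, ← map_add, Ne, mk_eq_zero] at h0
  have := X.eq_of_not_dvd (b := x + y) (n := X.ν x) (m := X.lead x + X.lead y) (by
    push_cast
    rw [coe_lead, coe_lead, ← h]
    ring) h0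
  exact ⟨this.1, by rw [lc, lc, lc, this.2, map_add]⟩

theorem ν_sub_lt (x y : X.B) (h : X.ν x = X.ν y) (hl : X.lc x = X.lc y) (hxy : x ≠ y) :
    X.ν (x - y) < X.ν x := by
  have h1 : X.π ∣ X.lead x - X.lead y := by
    rw [← mk_eq_zero, map_sub, sub_eq_zero]
    exact hl
  have h2 : ((X.lead x - X.lead y : X.C) : F) = (X.π : F) ^ X.ν x * (x - y : X.B) := by
    push_cast
    rw [coe_lead, coe_lead, ← h]
    ring
  refine lt_of_le_of_ne (X.ν_le (by rw [← h2]; exact Subtype.prop _)) fun h3 => ?_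
  have h4 : X.lead (x - y) = X.lead x - X.lead y := Subtype.ext (by rw [coe_lead, h2, h3])
  exact X.not_dvd_lead (sub_ne_zero.2 hxy) (h4 ▸ h1)

end Chart

namespace Chart

variable {F : Type*} [Field F] (X : Chart F)

theorem dvd_of_dvd_π_pow_mul {n m : ℕ} {z : X.C} (h : X.ρ ^ n ∣ X.π ^ m * z) : X.ρ ^ n ∣ z :=
  (X.coprime.symm.pow).dvd_of_dvd_mul_left h

theorem exists_mem_O : ∃ y ∈ X.O, y ≠ 0 ∧ ∃ N : ℕ, ∃ h : X.C, (X.π : F) ^ N * y = X.ρ * h := by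
  have hπ := X.π_ne_zero
  have hρ := X.ρ_ne_zero'
  have := X.finite_ρ (X.c + 1)
  choose b hb m hm using fun n : ℕ => X.decomp ((X.π : F) ^ n)⁻¹
  obtain ⟨i, j, hij, he⟩ := Finite.exists_ne_map_eq_of_infinite (fun n : ℕ =>
    ((Ideal.Quotient.mk (Ideal.span {X.ρ ^ (X.c + 1)}) (X.π ^ (X.a + 1 + n)),
      Ideal.Quotient.mk (Ideal.span {X.ρ ^ (X.c + 1)}) (m (X.a + 1 + n))) :
      (X.C ⧸ Ideal.span {X.ρ ^ (X.c + 1)}) × (X.C ⧸ Ideal.span {X.ρ ^ (X.c + 1)})))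
  wlog hlt : i < j generalizing i j
  · exact this j i hij.symm he.symm (by omega)
  rw [Prod.mk.injEq, Ideal.Quotient.mk_eq_mk_iff_sub_mem, Ideal.Quotient.mk_eq_mk_iff_sub_mem,
    Ideal.mem_span_singleton, Ideal.mem_span_singleton] at he
  obtain ⟨l, hl⟩ := Nat.exists_eq_add_of_lt hlt
  obtain ⟨h1, h, hh⟩ := he
  have h1' : X.ρ ^ (X.c + 1) ∣ X.π ^ (l + 1) - 1 := by
    apply X.dvd_of_dvd_π_pow_mul (m := X.a + 1 + i)
    rw [← dvd_neg]
    convert h1 using 1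
    rw [hl]
    ring
  obtain ⟨g, hg⟩ := h1'
  have hg' : (X.π : F) ^ (l + 1) - 1 = X.ρ ^ (X.c + 1) * g := congrArg Subtype.val hg
  have hh' : (m (X.a + 1 + i) : F) - m (X.a + 1 + j) = X.ρ ^ (X.c + 1) * h := congrArg Subtype.val hh
  have hi := hm (X.a + 1 + i)
  have hj := hm (X.a + 1 + j)
  have hI : (X.π : F) ^ (X.a + 1 + j) * ((X.π : F) ^ (X.a + 1 + i))⁻¹ = X.π ^ (l + 1) := by
    rw [mul_inv_eq_iff_eq_mul₀ (pow_ne_zero _ hπ), ← pow_add]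
    congr 1
    omega
  have hJ : (X.π : F) ^ (X.a + 1 + j) * ((X.π : F) ^ (X.a + 1 + j))⁻¹ = 1 :=
    mul_inv_cancel₀ (pow_ne_zero _ hπ)
  have key : (X.π : F) ^ (X.a + (X.a + 1 + j)) * (b (X.a + 1 + i) - b (X.a + 1 + j)) =
      X.ρ * (X.π ^ X.a * X.ρ ^ X.c * g - X.π ^ (X.a + 1 + j) * h) := by
    apply mul_left_cancel₀ (pow_ne_zero X.c hρ)
    rw [pow_add]
    linear_combination (-(X.π : F) ^ (X.a + 1 + j)) * (hi - hj) + X.π ^ X.a * X.ρ ^ X.c * (hI - hJ)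
      + X.π ^ (X.a + 1 + j) * (-hh') + X.π ^ X.a * X.ρ ^ X.c * hg'
  refine ⟨_, sub_mem (hb (X.a + 1 + i)) (hb (X.a + 1 + j)), fun h0 => ?_, _,
    X.π ^ X.a * X.ρ ^ X.c * g - X.π ^ (X.a + 1 + j) * h, by push_cast; exact key⟩
  rw [h0, mul_zero, eq_comm, mul_eq_zero, or_iff_right hρ] at key
  have h2 : X.ρ ^ X.c * g = X.π ^ (j + 1) * h := by
    apply mul_left_cancel₀ (pow_ne_zero X.a X.prime.ne_zero)
    apply Subtype.ext
    push_cast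
    rw [sub_eq_zero] at key
    rw [← mul_assoc, key]
    ring
  have h3 : X.π ∣ X.π ^ (l + 1) - 1 := by
    rw [hg, pow_succ, mul_right_comm, h2]
    exact ((dvd_pow_self _ (by omega)).mul_right _).mul_right _
  have h4 : X.π ∣ 1 := (dvd_sub_right (dvd_pow_self _ (by omega))).1 h3
  exact X.prime.not_isUnit (isUnit_of_dvd_one h4)

/-- Strong approximation at the places where `ρ` vanishes. -/
theorem exists_approx (z : F) (M : ℕ) :
    ∃ b ∈ X.O, ∃ N : ℕ, ∃ h : X.C, (X.π : F) ^ N * (z - b) = X.ρ ^ M * h := by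
  obtain ⟨y, hy, hy0, N, h, hN⟩ := X.exists_mem_O
  obtain ⟨b, hb, m, hm⟩ := X.decomp (z * (y ^ (M + X.c))⁻¹)
  have h1 : (y ^ (M + X.c))⁻¹ * y ^ (M + X.c) = 1 := inv_mul_cancel₀ (pow_ne_zero _ hy0)
  refine ⟨b * y ^ (M + X.c), mul_mem hb (pow_mem hy _), X.a + N * (M + X.c), h ^ (M + X.c) * m, ?_⟩
  apply mul_left_cancel₀ (pow_ne_zero X.c X.ρ_ne_zero')
  have h2 := congrArg (· ^ (M + X.c)) hN
  simp only [mul_pow] at h2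
  push_cast
  rw [← hm, pow_add _ X.a, pow_mul]
  linear_combination (X.π ^ X.a * X.ρ ^ X.c * (z * (y ^ (M + X.c))⁻¹ - b)) * h2 -
    X.π ^ X.a * (X.π ^ N) ^ (M + X.c) * X.ρ ^ X.c * z * h1

theorem exists_surj : ∃ n₀ : ℕ, ∀ n ≥ n₀, ∀ r : X.C, ∃ b : X.B, ∃ w : X.C,
    (X.π : F) ^ n * b = r - X.π * w := by
  have hπ := X.π_ne_zero
  have hρ := X.ρ_ne_zero'
  have := X.finite_ρ X.c
  have := Fintype.ofFinite (X.C ⧸ Ideal.span {X.ρ ^ X.c})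
  choose b hb N h hN using fun g : X.C ⧸ Ideal.span {X.ρ ^ X.c} =>
    X.exists_approx (((X.π : F) ^ X.a * X.ρ ^ X.c)⁻¹ * (Quotient.out g : X.C)) 0
  obtain ⟨N₀, hN₀⟩ : ∃ N₀, ∀ g, N g ≤ N₀ := ⟨∑ g, N g, fun g =>
    Finset.single_le_sum (fun _ _ => Nat.zero_le _) (Finset.mem_univ g)⟩
  refine ⟨N₀ + X.a + 1, fun n hn r => ?_⟩
  obtain ⟨b', hb', m, hm⟩ := X.decomp (((X.π : F) ^ n)⁻¹ * r)
  set g := Ideal.Quotient.mk (Ideal.span {X.ρ ^ X.c}) m with hg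
  obtain ⟨h', hh'⟩ : X.ρ ^ X.c ∣ m - Quotient.out g := by
    rw [← Ideal.mem_span_singleton, ← Ideal.Quotient.mk_eq_mk_iff_sub_mem, ← hg]
    exact (Quotient.out_eq g).symm
  have hh : (m : F) - (Quotient.out g : X.C) = X.ρ ^ X.c * h' := congrArg Subtype.val hh'
  have hNg := hN g
  obtain ⟨l, rfl⟩ : ∃ l, n = l + 1 + (N g + X.a) := ⟨n - 1 - (N g + X.a), by have := hN₀ g; omega⟩
  have e1 : ((X.π : F) ^ (l + 1 + (N g + X.a))) * ((X.π : F) ^ (l + 1 + (N g + X.a)))⁻¹ = 1 :=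
    mul_inv_cancel₀ (pow_ne_zero _ hπ)
  have e2 : ((X.π : F) ^ X.a * X.ρ ^ X.c) * ((X.π : F) ^ X.a * X.ρ ^ X.c)⁻¹ = 1 :=
    mul_inv_cancel₀ (mul_ne_zero (pow_ne_zero _ hπ) (pow_ne_zero _ hρ))
  have key : (X.π : F) ^ (l + 1 + (N g + X.a)) * (b' + b g) =
      r - X.π * ((X.π ^ l * (X.π ^ X.a * h g + X.π ^ N g * h') : X.C) : F) := by
    push_cast
    apply mul_left_cancel₀ (pow_ne_zero X.c hρ)
    linear_combination (-(X.π : F) ^ (l + 1) * X.π ^ N g) * hm + X.ρ ^ X.c * r * e1 -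
      X.π ^ (l + 1) * X.π ^ X.a * X.ρ ^ X.c * hNg +
      X.π ^ (l + 1) * X.π ^ N g * (Quotient.out g : X.C) * e2 - X.π ^ (l + 1) * X.π ^ N g * hh
  refine ⟨⟨b' + b g, add_mem hb' (hb g), l + 1 + (N g + X.a), ?_⟩, _, key⟩
  rw [key]
  exact sub_mem r.2 (mul_mem X.π.2 (Subtype.prop _))

theorem surj : ∃ n₀ : ℕ, ∀ n, n₀ ≤ n → ∀ c : X.κ, c ≠ 0 → ∃ b : X.B, X.ν b = n ∧ X.lc b = c := by
  obtain ⟨n₀, h⟩ := X.exists_surj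
  refine ⟨n₀, fun n hn c hc => ?_⟩
  obtain ⟨r, rfl⟩ := Ideal.Quotient.mk_surjective c
  obtain ⟨b, w, hb⟩ := h n hn r
  rw [Ne, mk_eq_zero] at hc
  have h1 := X.eq_of_not_dvd (b := b) (n := n) (m := r - X.π * w) (by rw [hb]; push_cast; rfl)
    fun h => hc ((dvd_sub_left (dvd_mul_right _ _)).1 h)
  refine ⟨b, h1.1, ?_⟩
  rw [lc, h1.2, map_sub, (X.mk_eq_zero).2 (dvd_mul_right _ _), sub_zero]

/-- The one-place structure of the ring of functions regular away from the place of `π`. -/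
noncomputable def onePlace : OnePlace X.K X.B X.κ where
  ν := X.ν
  lc := X.lc
  n₀ := X.surj.choose
  ν_zero := X.ν_zero
  lc_eq_zero := X.lc_eq_zero
  lc_mul x y := by
    rcases eq_or_ne x 0 with rfl | hx
    · simp [(X.lc_eq_zero 0).2]
    rcases eq_or_ne y 0 with rfl | hy
    · simp [(X.lc_eq_zero 0).2]
    rw [lc, (X.ν_lead_mul hx hy).2, map_mul, lc, lc]
  ν_mul x y hx hy := (X.ν_lead_mul hx hy).1
  ν_algebraMap z := (X.ν_lead_algebraMap z).1
  lc_algebraMap z := by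
    rw [lc, (X.ν_lead_algebraMap z).2]
    rfl
  exists_algebraMap x hx := by
    refine ⟨⟨x, (X.mem_K x).2 ⟨x.2.1, ?_⟩⟩, rfl⟩
    have := (X.lead x).2
    rwa [coe_lead, hx, pow_zero, one_mul] at this
  ν_add := X.ν_add
  lc_add := X.lc_add
  ν_sub_lt := X.ν_sub_lt
  surj := X.surj.choose_spec

end Chart

namespace Chart

variable {F : Type*} [Field F] (X : Chart F)

theorem exists_pow_mul_mem_B {y : F} (hy : y ∈ X.O) {N : ℕ} {h : X.C}
    (hN : (X.π : F) ^ N * y = X.ρ * h) {u : F} (hu : u ∈ X.O) : ∃ n : ℕ, ∀ m ≥ n, y ^ m * u ∈ X.B := by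
  obtain ⟨n, hn⟩ := X.exists_mul_mem u
  refine ⟨n, fun m hm => ⟨mul_mem (pow_mem hy _) hu, n + N * m, ?_⟩⟩
  obtain ⟨l, rfl⟩ := Nat.exists_eq_add_of_le hm
  have h2 := congrArg (· ^ (n + l)) hN
  simp only [mul_pow] at h2
  have : (X.π : F) ^ (n + N * (n + l)) * (y ^ (n + l) * u) =
      (X.π * X.ρ) ^ n * u * (X.ρ ^ l * h ^ (n + l)) := by
    rw [pow_add, pow_mul, mul_pow]
    linear_combination X.π ^ n * u * h2
  rw [this]
  exact mul_mem hn (mul_mem (pow_mem X.ρ.2 _) (pow_mem h.2 _))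

instance : IsFractionRing X.B F := by
  refine IsFractionRing.of_field X.B F fun z => ?_
  obtain ⟨u, hu, w, hw, hw0, h⟩ := X.frac_O z
  obtain ⟨y, hy, hy0, N, h', hN⟩ := X.exists_mem_O
  obtain ⟨n, hn⟩ := X.exists_pow_mul_mem_B hy hN hu
  obtain ⟨m, hm⟩ := X.exists_pow_mul_mem_B hy hN hw
  refine ⟨⟨_, hn (max n m) (le_max_left _ _)⟩, ⟨_, hm (max n m) (le_max_right _ _)⟩, ?_⟩
  change z = (_ * u) / (_ * w)
  rw [mul_div_mul_left _ _ (pow_ne_zero _ hy0), eq_div_iff hw0, h]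

theorem B_le_O : X.B ≤ X.O := fun _ hz => hz.1

theorem isIntegral_O {z : F} (hz : IsIntegral X.B z) : z ∈ X.O := by
  refine X.integral_O z (hz.map_of_comp_eq (Subring.inclusion X.B_le_O) (RingHom.id F) ?_)
  ext
  rfl

open Polynomial in
theorem exists_pow_mul_mem_C {z : F} (hz : IsIntegral X.B z) : ∃ n : ℕ, (X.π : F) ^ n * z ∈ X.C := by
  obtain ⟨p, hp, hpz⟩ := hz
  choose n hn using fun i : ℕ => (p.coeff i).2.2
  set N := ∑ i ∈ Finset.range p.natDegree, n i
  refine ⟨N, X.integral_C _ ?_⟩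
  set r := (p.map (algebraMap X.B F)).scaleRoots ((X.π : F) ^ N) with hr
  have hdeg : (p.map (algebraMap X.B F)).natDegree = p.natDegree := hp.natDegree_map _
  have hrm : r.Monic := by
    rw [hr, monic_scaleRoots_iff]
    exact hp.map _
  have hcoef : ∀ i, r.coeff i ∈ X.C := by
    intro i
    rcases lt_trichotomy i p.natDegree with h | h | h
    · rw [hr, coeff_scaleRoots, hdeg, coeff_map]
      obtain ⟨l, hl⟩ : ∃ l, N = n i + l := Nat.exists_eq_add_of_le
        (Finset.single_le_sum (fun _ _ => Nat.zero_le _) (Finset.mem_range.2 h))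
      obtain ⟨e, he⟩ : ∃ e, p.natDegree - i = e + 1 := ⟨p.natDegree - i - 1, by omega⟩
      have := mul_mem (hn i) (mul_mem (pow_mem X.π.2 l) (pow_mem X.π.2 (N * e)))
      convert this using 1
      rw [he, pow_succ, ← pow_mul, hl]
      change (p.coeff i : F) * _ = _
      ring
    · rw [h, ← hdeg, ← natDegree_scaleRoots _ ((X.π : F) ^ N), ← hr, hrm.coeff_natDegree]
      exact one_mem _
    · rw [coeff_eq_zero_of_natDegree_lt (by rwa [hr, natDegree_scaleRoots, hdeg])]
      exact zero_mem _
  have hsub : (↑r.coeffs : Set F) ⊆ X.C := by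
    intro x hx
    obtain ⟨i, -, rfl⟩ := mem_coeffs_iff.1 hx
    exact hcoef i
  refine ⟨r.toSubring X.C hsub, (monic_toSubring _ _ _).2 hrm, ?_⟩
  rw [eval₂_eq_eval_map]
  have : (r.toSubring X.C hsub).map (algebraMap X.C F) = r := by
    ext i
    rw [coeff_map]
    exact coeff_toSubring _ _ _
  rw [this]
  have := scaleRoots_aeval_eq_zero (p := p.map (algebraMap X.B F)) (r := (X.π : F) ^ N) (a := z) (A := F) (by
    rw [aeval_map_algebraMap]
    exact hpz)
  simpa [coe_aeval_eq_eval] using this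

instance : IsDedekindDomain X.B := by
  have hfin : ∀ I : Ideal X.B, I ≠ ⊥ → Finite (X.B ⧸ I) := fun I hI => by
    have := X.onePlace.finite_quot hI
    exact Module.finite_of_finite X.K
  have h1 : IsNoetherianRing X.B := by
    rw [isNoetherianRing_iff_ideal_fg]
    intro I
    rcases eq_or_ne I ⊥ with rfl | hI
    · exact Submodule.fg_bot
    obtain ⟨x, hx, hx0⟩ := Submodule.exists_mem_ne_zero_of_ne_bot hI
    have := hfin (Ideal.span {x}) (by simpa using hx0)
    have h2 : Module.Finite X.B (X.B ⧸ Ideal.span {x}) := Module.Finite.of_finite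
    have := Fintype.ofFinite (X.B ⧸ Ideal.span {x})
    have h3 : IsNoetherian X.B (X.B ⧸ Ideal.span {x}) := inferInstance
    refine Submodule.fg_of_fg_map_of_fg_inf_ker (Submodule.mkQ (Ideal.span {x})) 
      (IsNoetherian.noetherian _) ?_
    rw [Submodule.ker_mkQ, inf_eq_right.2 ((Ideal.span_singleton_le_iff_mem _).2 hx)]
    exact ⟨{x}, by simp⟩
  have h2 : Ring.DimensionLEOne X.B := ⟨fun {p} hp hpp => by
    have := hfin p hp
    exact Ideal.Quotient.maximal_of_isField _ (Finite.isField_of_domain _)⟩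
  have h3 : IsIntegrallyClosed X.B := (isIntegrallyClosed_iff F).2 fun {z} hz =>
    ⟨⟨z, X.isIntegral_O hz, X.exists_pow_mul_mem_C hz⟩, rfl⟩
  exact { }

end Chart

namespace OnePlace

variable {k B κ : Type*} [Field k] [CommRing B] [Algebra k B] [Field κ] [Algebra k κ]
  (V : OnePlace k B κ) [IsDedekindDomain B] [Fintype k] [Module.Finite k κ]

/-- Every ideal multiplies an ideal of bounded degree to a principal ideal. -/
theorem exists_mul_eq_span {I : Ideal B} (hI : I ≠ ⊥) : ∃ x : B, x ≠ 0 ∧ ∃ J : Ideal B, J ≠ ⊥ ∧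
    V.dg J ≤ (V.n₀ + 1) * Module.finrank k κ ∧ I * J = Ideal.span {x} := by
  set δ := Module.finrank k κ with hδ
  have hδ0 : 0 < δ := Module.finrank_pos
  set m := V.dg I
  set n := V.n₀ + (m / δ + 1) with hn
  have hrn : V.r n = V.r V.n₀ + (m / δ + 1) * δ := V.r_add le_rfl _
  have hdiv := Nat.div_add_mod' m δ
  have hmod := Nat.mod_lt m hδ0
  obtain ⟨x, hx, hx0, hxn⟩ := V.exists_mem_of_dg_lt hI (n := n) (by
    rw [hrn, add_mul]; omega)
  obtain ⟨J, hJ⟩ := Ideal.dvd_span_singleton.2 hx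
  have hs : Ideal.span {x} ≠ ⊥ := by simpa using hx0
  have hJ0 : J ≠ ⊥ := by
    rintro rfl
    rw [Ideal.mul_bot] at hJ
    exact hs hJ
  refine ⟨x, hx0, J, hJ0, ?_, hJ.symm⟩
  have h1 := V.dg_span hx0
  rw [hJ, V.dg_mul hI hJ0, ← hδ] at h1
  have h2 : V.ν x * δ ≤ n * δ := Nat.mul_le_mul_right _ hxn
  have h3 : n * δ = (m / δ) * δ + (V.n₀ + 1) * δ := by rw [hn]; ring
  omega

include V in
theorem exists_pow_eq_span {I : Ideal B} (hI : I ≠ ⊥) :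
    ∃ n : ℕ, n ≠ 0 ∧ ∃ d : B, d ≠ 0 ∧ I ^ n = Ideal.span {d} := by
  have hfin := V.finite_dg_le ((V.n₀ + 1) * Module.finrank k κ)
  have : Finite {J : Ideal B // J ≠ ⊥ ∧ V.dg J ≤ (V.n₀ + 1) * Module.finrank k κ} := hfin
  choose x hx J hJ hd hxJ using fun m : ℕ => V.exists_mul_eq_span (I := I ^ m) (pow_ne_zero m hI)
  obtain ⟨i, j, hij, he⟩ := Finite.exists_ne_map_eq_of_infinite fun m : ℕ =>
    (⟨J m, hJ m, hd m⟩ : {J : Ideal B // J ≠ ⊥ ∧ V.dg J ≤ (V.n₀ + 1) * Module.finrank k κ})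
  wlog hlt : i < j generalizing i j
  · exact this j i hij.symm he.symm (by omega)
  have he' : J i = J j := congrArg Subtype.val he
  obtain ⟨l, rfl⟩ := Nat.exists_eq_add_of_lt hlt
  have h1 : I ^ (l + 1) * Ideal.span {x i} = Ideal.span {x (i + l + 1)} := by
    rw [← hxJ, ← hxJ, ← he']
    ring
  have h2 : x (i + l + 1) ∈ Ideal.span {x i} := by
    rw [← Ideal.span_singleton_le_iff_mem, ← h1]
    exact Ideal.mul_le_right
  obtain ⟨d, hd⟩ := Ideal.mem_span_singleton'.1 h2
  refine ⟨l + 1, by omega, d, ?_, ?_⟩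
  · rintro rfl
    exact hx _ (by rw [← hd, zero_mul])
  · have hs : Ideal.span {x i} ≠ 0 := by simpa using hx i
    apply mul_right_cancel₀ hs
    rw [h1, Ideal.span_singleton_mul_span_singleton, hd]

end OnePlace

open IsDedekindDomain

theorem IsLocalization.away_of_injective {R A : Type*} [CommRing R] [CommRing A]
    [Algebra R A] (hinj : Function.Injective (algebraMap R A)) {d : R}
    (hd : IsUnit (algebraMap R A d))
    (h : ∀ z : A, ∃ n : ℕ, ∃ r : R, algebraMap R A r = algebraMap R A d ^ n * z) :
    IsLocalization.Away d A where
  map_units := by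
    rintro ⟨_, n, rfl⟩
    rw [map_pow]
    exact hd.pow n
  surj z := by
    obtain ⟨n, r, hr⟩ := h z
    refine ⟨(r, ⟨d ^ n, n, rfl⟩), ?_⟩
    rw [hr, map_pow, mul_comm]
  exists_of_eq {x y} hxy := ⟨1, by rw [hinj hxy]⟩

namespace Chart

variable {F : Type*} [Field F] (X : Chart F) {R : Type*} [CommRing R] 
  [Algebra R F] [IsFractionRing R F]

/-- The inclusion of `X.B` in a ring whose image in `F` is `X.O`. -/
noncomputable def toO (hO : ∀ z, z ∈ X.O ↔ ∃ a : R, algebraMap R F a = z) : X.B →+* R where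
  toFun b := ((hO b).1 b.2.1).choose
  map_zero' := IsFractionRing.injective R F (by
    rw [((hO (0 : X.B)).1 (0 : X.B).2.1).choose_spec, map_zero]; rfl)
  map_one' := IsFractionRing.injective R F (by
    rw [((hO (1 : X.B)).1 (1 : X.B).2.1).choose_spec, map_one]; rfl)
  map_add' x y := IsFractionRing.injective R F (by
    rw [((hO (x + y : X.B)).1 (x + y).2.1).choose_spec, map_add, ((hO x).1 x.2.1).choose_spec,
      ((hO y).1 y.2.1).choose_spec]; rfl)
  map_mul' x y := IsFractionRing.injective R F (by
    rw [((hO (x * y : X.B)).1 (x * y).2.1).choose_spec, map_mul, ((hO x).1 x.2.1).choose_spec,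
      ((hO y).1 y.2.1).choose_spec]; rfl)

variable (hO : ∀ z, z ∈ X.O ↔ ∃ a : R, algebraMap R F a = z)

theorem algebraMap_toO (b : X.B) : algebraMap R F (X.toO hO b) = b :=
  ((hO b).1 b.2.1).choose_spec

include hO in
theorem algebraMap_mem_O (a : R) : algebraMap R F a ∈ X.O := (hO _).2 ⟨a, rfl⟩

/-- The functions vanishing at the zeros of `ρ`. -/
def 𝔯 : Ideal X.B where
  carrier := {b | ∃ N : ℕ, ∃ h : X.C, (X.π : F) ^ N * b = X.ρ * h}
  zero_mem' := ⟨0, 0, by simp⟩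
  add_mem' := fun {x y} ⟨N, h, e⟩ ⟨N', h', e'⟩ => ⟨N + N', X.π ^ N' * h + X.π ^ N * h', by
    push_cast
    linear_combination X.π ^ N' * e + X.π ^ N * e'⟩
  smul_mem' := fun x y ⟨N, h, e⟩ => by
    obtain ⟨n, hn⟩ := x.2.2
    refine ⟨N + n, h * ⟨_, hn⟩, ?_⟩
    push_cast
    rw [smul_eq_mul, Subring.coe_mul]
    linear_combination X.π ^ n * x * e

theorem 𝔯_ne_bot : X.𝔯 ≠ ⊥ := by
  obtain ⟨y, hy, hy0, N, h, hN⟩ := X.exists_mem_O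
  refine Submodule.ne_bot_iff _ |>.2 ⟨⟨y, hy, N, ?_⟩, ⟨N, h, hN⟩, fun h => hy0 (congrArg Subtype.val h)⟩
  rw [hN]
  exact mul_mem X.ρ.2 h.2

theorem exists_pow_mul_mem {y : X.B} (hy : y ∈ X.𝔯) (u : R) :
    ∃ n : ℕ, ∀ m ≥ n, ∃ b : X.B, X.toO hO b = X.toO hO y ^ m * u := by
  obtain ⟨N, h, hN⟩ := hy
  obtain ⟨n, hn⟩ := X.exists_pow_mul_mem_B y.2.1 hN (X.algebraMap_mem_O hO u)
  refine ⟨n, fun m hm => ⟨⟨_, hn m hm⟩, IsFractionRing.injective R F ?_⟩⟩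
  rw [algebraMap_toO, map_mul, map_pow, algebraMap_toO]

theorem exists_mem_𝔯_notMem {P : Ideal R} (hP : P ≠ ⊤) (hP0 : P ≠ ⊥) :
    ∃ y ∈ X.𝔯, X.toO hO y ∉ P := by
  obtain ⟨a, ha, ha0⟩ := Submodule.exists_mem_ne_zero_of_ne_bot hP0
  set α := algebraMap R F a with hα
  have hα0 : α ≠ 0 := by rwa [Ne, hα, IsFractionRing.to_map_eq_zero_iff]
  obtain ⟨n, hn⟩ := X.exists_mul_mem α
  obtain ⟨b, hb, N, h, e⟩ := X.exists_approx (-α⁻¹) (n + 1)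
  have hi : α⁻¹ * α = 1 := inv_mul_cancel₀ hα0
  have e1 : (X.π : F) ^ (N + n) * (1 + α * b) = X.ρ * (-h * ⟨_, hn⟩ : X.C) := by
    push_cast
    rw [mul_pow]
    linear_combination (-(X.π : F) ^ n * α) * e - X.π ^ (N + n) * hi
  have hm : 1 + α * b ∈ X.B := ⟨add_mem (one_mem _) (mul_mem (X.algebraMap_mem_O hO a) hb), N + n, by
    rw [e1]
    exact mul_mem X.ρ.2 (Subtype.prop _)⟩
  refine ⟨⟨_, hm⟩, ⟨_, _, e1⟩, fun h1 => hP ?_⟩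
  obtain ⟨b', rfl⟩ := (hO b).1 hb
  have : X.toO hO ⟨_, hm⟩ = 1 + a * b' := IsFractionRing.injective R F (by
    rw [algebraMap_toO, map_add, map_mul, map_one])
  rw [this, add_comm, Ideal.add_mem_iff_right _ (P.mul_mem_right _ ha)] at h1
  exact (Ideal.eq_top_iff_one _).2 h1

theorem exists_mem_comap_notMem {P Q : Ideal R} (hP : P.IsPrime) (hP0 : P ≠ ⊥) {u : R} (hu : u ∈ Q)
    (hu' : u ∉ P) : ∃ b ∈ Q.comap (X.toO hO), b ∉ P.comap (X.toO hO) := by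
  obtain ⟨y, hy, hyP⟩ := X.exists_mem_𝔯_notMem hO hP.ne_top hP0
  obtain ⟨n, hn⟩ := X.exists_pow_mul_mem hO hy u
  obtain ⟨b, hb⟩ := hn n le_rfl
  refine ⟨b, ?_, ?_⟩
  · rw [Ideal.mem_comap, hb]
    exact Q.mul_mem_left _ hu
  · rw [Ideal.mem_comap, hb]
    exact fun h => (hP.mem_or_mem h).elim (fun h => hyP (hP.mem_of_pow_mem _ h)) hu'

variable [IsDedekindDomain R] (T : Finset (HeightOneSpectrum R))

theorem exists_toO_mem_iff : ∃ d ∈ X.𝔯, d ≠ 0 ∧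
    ∀ p : HeightOneSpectrum R, X.toO hO d ∈ p.asIdeal ↔ p ∈ T := by
  classical
  have hne : ∀ p : HeightOneSpectrum R, p.asIdeal.comap (X.toO hO) ≠ ⊥ := fun p => by
    obtain ⟨a, ha, ha0⟩ := Submodule.exists_mem_ne_zero_of_ne_bot p.ne_bot
    obtain ⟨y, hy, hyP⟩ := X.exists_mem_𝔯_notMem hO p.isPrime.ne_top p.ne_bot
    obtain ⟨n, hn⟩ := X.exists_pow_mul_mem hO hy a
    obtain ⟨b, hb⟩ := hn n le_rfl
    refine Submodule.ne_bot_iff _ |>.2 ⟨b, ?_, ?_⟩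
    · rw [Ideal.mem_comap, hb]
      exact p.asIdeal.mul_mem_left _ ha
    · rintro rfl
      rw [map_zero, eq_comm, mul_eq_zero, or_iff_left ha0] at hb
      exact hyP (by rw [(IsReduced.eq_zero _ ⟨n, hb⟩ : X.toO hO y = 0)]; exact zero_mem _)
  set I := X.𝔯 * ∏ p ∈ T, p.asIdeal.comap (X.toO hO) with hI
  have hI0 : I ≠ ⊥ := mul_ne_zero X.𝔯_ne_bot (Finset.prod_ne_zero_iff.2 fun p _ => hne p)
  obtain ⟨n, hn, d, hd0, hd⟩ := X.onePlace.exists_pow_eq_span hI0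
  have hdI : d ∈ I := Ideal.pow_le_self hn (hd ▸ Ideal.mem_span_singleton_self d)
  refine ⟨d, Ideal.mul_le_left hdI, hd0, fun p => ⟨fun h => ?_, fun h => ?_⟩⟩
  · by_contra hp
    have := p.isPrime
    have hpp : (p.asIdeal.comap (X.toO hO)).IsPrime := inferInstance
    have h1 : I ≤ p.asIdeal.comap (X.toO hO) := hpp.le_of_pow_le (n := n) (by
      rw [hd, Ideal.span_singleton_le_iff_mem]
      exact h)
    rcases hpp.mul_le.1 h1 with h2 | h2
    · obtain ⟨y, hy, hy'⟩ := X.exists_mem_𝔯_notMem hO p.isPrime.ne_top p.ne_bot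
      exact hy' (h2 hy)
    · obtain ⟨p', hp', h3⟩ := (hpp.prod_le).1 h2
      have : ¬ p'.asIdeal ≤ p.asIdeal := fun h4 => hp (by
        rwa [← HeightOneSpectrum.ext (p'.isMaximal.eq_of_le p.isPrime.ne_top h4)])
      obtain ⟨u, hu, hu'⟩ := Set.not_subset.1 this
      obtain ⟨b, hb, hb'⟩ := X.exists_mem_comap_notMem hO p.isPrime p.ne_bot hu hu'
      exact hb' (h3 hb)
  · have h1 : I ≤ p.asIdeal.comap (X.toO hO) := Ideal.mul_le_right.trans (Ideal.prod_le_inf.trans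
      (Finset.inf_le h))
    exact h1 hdI

theorem exists_away (A : Subalgebra R F) (hA : A = (T : Set (HeightOneSpectrum R)).integer F) :
    ∃ d : X.B, d ≠ 0 ∧ (∀ p : HeightOneSpectrum R, X.toO hO d ∈ p.asIdeal ↔ p ∈ T) ∧
    IsLocalization.Away (X.toO hO d) A ∧
    @IsLocalization.Away X.B _ d A _ ((algebraMap R A).comp (X.toO hO)).toAlgebra := by
  obtain ⟨d, hd𝔯, hd0, hdT⟩ := X.exists_toO_mem_iff hO T
  have hmem : ∀ z : F, z ∈ A ↔ ∀ p ∉ T, p.valuation F z ≤ 1 := fun z => by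
    subst hA
    rfl
  have hd0' : (d : F) ≠ 0 := fun h => hd0 (Subtype.ext h)
  have hinj : Function.Injective (algebraMap R A) := fun x y h =>
    IsFractionRing.injective R F (congrArg Subtype.val h)
  have hu : IsUnit (algebraMap R A (X.toO hO d)) := by
    refine .of_mul_eq_one ⟨(d : F)⁻¹, (hmem _).2 fun p hp => ?_⟩ (Subtype.ext ?_)
    · rw [map_inv₀, ← X.algebraMap_toO hO]
      have h1 := p.valuation_lt_one_iff_mem (K := F) (X.toO hO d)
      rw [hdT p, ← not_le] at h1
      exact inv_le_one_of_one_le₀ (by tauto)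
    · change algebraMap R F (X.toO hO d) * _ = 1
      exact (congrArg (· * (d : F)⁻¹) (X.algebraMap_toO hO d)).trans (mul_inv_cancel₀ hd0')
  have hs : ∀ z : A, ∃ n : ℕ, ∃ r : R, algebraMap R A r = algebraMap R A (X.toO hO d) ^ n * z := by
    intro z
    have h1 : ∀ p ∈ T, ∃ n : ℕ, p.valuation F ((d : F) ^ n * z) ≤ 1 := by
      intro p hp
      have h2 : p.valuation F (d : F) < 1 := by
        rw [← X.algebraMap_toO hO, p.valuation_lt_one_iff_mem, hdT]
        exact hp
      rcases eq_or_ne (z : F) 0 with h0 | h0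
      · exact ⟨0, by simp [h0]⟩
      have h3 : p.valuation F (z : F) ≠ 0 := by simpa using h0
      obtain ⟨n, hn⟩ := exists_pow_lt₀ h2 (Units.mk0 _ h3)⁻¹
      refine ⟨n, ?_⟩
      rw [map_mul, map_pow]
      calc _ ≤ (p.valuation F (z : F))⁻¹ * p.valuation F (z : F) := by
            gcongr
            exact hn.le
        _ = 1 := inv_mul_cancel₀ h3
    choose! n hn using h1
    refine ⟨∑ p ∈ T, n p, ?_⟩
    obtain ⟨r, hr⟩ := HeightOneSpectrum.mem_integers_of_valuation_le_one (R := R) F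
      ((d : F) ^ (∑ p ∈ T, n p) * z) fun p => by
        have hd1 : p.valuation F (d : F) ≤ 1 := by
          rw [← X.algebraMap_toO hO]
          exact p.valuation_le_one _
        by_cases hp : p ∈ T
        · obtain ⟨l, hl⟩ := Nat.exists_eq_add_of_le
            (Finset.single_le_sum (f := n) (fun _ _ => Nat.zero_le _) hp)
          rw [hl, add_comm, pow_add, mul_assoc, map_mul, map_pow]
          exact mul_le_one' (pow_le_one' hd1 _) (hn p hp)
        · rw [map_mul, map_pow]
          exact mul_le_one' (pow_le_one' hd1 _) ((hmem _).1 z.2 p hp)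
    refine ⟨r, Subtype.ext ?_⟩
    change algebraMap R F r = algebraMap R F (X.toO hO d) ^ _ * _
    rw [hr, algebraMap_toO]
  refine ⟨d, hd0, hdT, IsLocalization.away_of_injective hinj hu hs, ?_⟩
  let _ := ((algebraMap R A).comp (X.toO hO)).toAlgebra
  refine IsLocalization.away_of_injective (hinj.comp (f := X.toO hO) fun x y h => Subtype.ext ?_) hu fun z => ?_
  · rw [← X.algebraMap_toO hO, h, X.algebraMap_toO hO]
  · obtain ⟨n, r, hr⟩ := hs z
    obtain ⟨m, hm⟩ := X.exists_pow_mul_mem hO hd𝔯 r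
    obtain ⟨b, hb⟩ := hm m le_rfl
    refine ⟨m + n, b, ?_⟩
    change algebraMap R A (X.toO hO b) = algebraMap R A (X.toO hO d) ^ _ * _
    rw [hb, map_mul, map_pow, hr]
    ring

end Chart

namespace Chart

variable {F : Type*} [Field F]

/-- A chart is determined by its two rings once the ring of functions regular at infinity is a
Dedekind domain all of whose nonzero primes contain a given function `x`. -/
theorem exists_of_isDedekindDomain (O C : Subring F) (K : Subfield F) [IsDedekindDomain C]
    (mem_K : ∀ z, z ∈ K ↔ z ∈ O ∧ z ∈ C) (x : C) (hx0 : x ≠ 0) (hx : ¬ IsUnit x)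
    (hfin : Finite (C ⧸ Ideal.span {x})) (hpow : ∀ z : F, ∃ n : ℕ, (x : F) ^ n * z ∈ C) (c : ℕ)
    (hdec : ∀ z : F, ∃ b ∈ O, (x : F) ^ c * (z - b) ∈ C)
    (integral_O : ∀ z : F, IsIntegral O z → z ∈ O) (integral_C : ∀ z : F, IsIntegral C z → z ∈ C)
    (frac_O : ∀ z : F, ∃ u ∈ O, ∃ w ∈ O, w ≠ 0 ∧ z * w = u) : ∃ X : Chart F, X.O = O := by
  have hmem : ∀ P : Ideal C, P.IsPrime → P ≠ ⊥ → x ∈ P := fun P hP hP0 => by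
    obtain ⟨a, ha, ha0⟩ := Submodule.exists_mem_ne_zero_of_ne_bot hP0
    obtain ⟨n, hn⟩ := hpow (a : F)⁻¹
    have : x ^ n = ⟨_, hn⟩ * a := Subtype.ext (by
      push_cast
      rw [mul_assoc, inv_mul_cancel₀ fun h => ha0 (Subtype.ext h), mul_one])
    exact hP.mem_of_pow_mem n (this ▸ P.mul_mem_left _ ha)
  have hpid : IsPrincipalIdealRing C := by
    apply IsPrincipalIdealRing.of_finite_primes
    have h1 := Ideal.finite_factors (I := Ideal.span {x}) (by simpa using hx0)
    refine ((h1.image fun v => v.asIdeal).insert ⊥).subset fun P hP => ?_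
    rcases eq_or_ne P ⊥ with rfl | hP0
    · exact Set.mem_insert _ _
    · exact Set.mem_insert_of_mem _ ⟨⟨P, hP, hP0⟩, Ideal.dvd_span_singleton.2 (hmem P hP hP0), rfl⟩
  obtain ⟨π, hπ, hπx⟩ := WfDvdMonoid.exists_irreducible_factor hx hx0
  have hf : FiniteMultiplicity π x := FiniteMultiplicity.of_not_isUnit hπ.not_isUnit hx0
  obtain ⟨ρ, hρ, hρπ⟩ := hf.exists_eq_pow_mul_and_not_dvd
  set e := multiplicity π x
  have hfp : ∀ n, Finite (C ⧸ Ideal.span {x ^ n}) := fun n => by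
    rw [← Ideal.span_singleton_pow]
    exact Ideal.finite_quotient_pow ⟨{x}, by simp⟩ n
  have hfd : ∀ {y : C} {n : ℕ}, y ∣ x ^ n → Finite (C ⧸ Ideal.span {y}) := fun {y n} h => by
    have := hfp n
    exact Finite.of_surjective _ (Ideal.Quotient.factor_surjective
      (Ideal.span_singleton_le_span_singleton.2 h))
  have he : 1 ≤ e := Nat.one_le_iff_ne_zero.2 fun h => by
    rw [h, pow_zero, one_mul] at hρ
    exact hρπ (hρ ▸ hπx)
  have hxF : (x : F) = (π : F) ^ e * ρ := congrArg Subtype.val hρ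
  refine ⟨⟨O, C, K, π, ρ, e * c, c, hπ.prime, hπ.coprime_iff_not_dvd.2 hρπ, ?_, mem_K,
    hfd (n := 1) (by rwa [pow_one]), fun n => hfd (n := n) (pow_dvd_pow_of_dvd (Dvd.intro_left _ hρ.symm) n),
    fun z => ?_, integral_O, integral_C, frac_O, fun z => ?_⟩, rfl⟩
  · rintro rfl
    exact hρπ (dvd_zero _)
  · obtain ⟨b, hb, h⟩ := hdec z
    refine ⟨b, hb, ⟨_, h⟩, ?_⟩
    change _ = (x : F) ^ c * (z - b)
    rw [hxF, mul_pow, ← pow_mul]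
  · obtain ⟨n, hn⟩ := hpow z
    refine ⟨e * n, ?_⟩
    obtain ⟨l, hl⟩ := Nat.exists_eq_add_of_le (Nat.mul_le_mul_right n he)
    rw [one_mul] at hl
    convert mul_mem hn (pow_mem ρ.2 l) using 1
    rw [hxF, mul_pow, mul_pow, ← pow_mul, hl, pow_add, pow_add]
    ring

end Chart

namespace RatFunc

open Polynomial WithZero

section
variable {k : Type*} [Field k] [DecidableEq (RatFunc k)]

local notation "v" => RatFunc.inftyValuation k

theorem inftyValuation_algebraMap {f : k[X]} (hf : f ≠ 0) :
    v (algebraMap k[X] (RatFunc k) f) = exp (f.natDegree : ℤ) :=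
  inftyValuation.polynomial k hf

theorem inftyValuation_algebraMap_div_lt {f g : k[X]} (hg : g ≠ 0) (h : f.degree < g.degree) :
    v (algebraMap k[X] (RatFunc k) f / algebraMap k[X] (RatFunc k) g) < 1 := by
  rcases eq_or_ne f 0 with rfl | hf
  · simp
  rw [map_div₀, inftyValuation_algebraMap hf, inftyValuation_algebraMap hg, ← exp_sub, ← exp_zero,
    exp_lt_exp]
  have := Polynomial.natDegree_lt_natDegree hf h
  omega

theorem exists_inftyValuation_sub_lt (r : RatFunc k) :
    ∃ f : k[X], v (r - algebraMap k[X] (RatFunc k) f) < 1 := by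
  have hg := r.denom_ne_zero
  have hg' : algebraMap k[X] (RatFunc k) r.denom ≠ 0 := by simpa using hg
  refine ⟨r.num / r.denom, ?_⟩
  have : r - algebraMap k[X] (RatFunc k) (r.num / r.denom) =
      algebraMap k[X] (RatFunc k) (r.num % r.denom) / algebraMap k[X] (RatFunc k) r.denom := by
    rw [eq_div_iff hg']
    nth_rw 1 [← num_div_denom r]
    rw [sub_mul, div_mul_cancel₀ _ hg', ← map_mul, ← map_sub, mul_comm]
    congr 1
    exact sub_eq_of_eq_add' (EuclideanDomain.div_add_mod r.num r.denom).symm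
  rw [this]
  exact inftyValuation_algebraMap_div_lt hg (EuclideanDomain.mod_lt _ hg)

theorem exists_eq_C_of_inftyValuation_le {f : k[X]} (hf : v (algebraMap k[X] (RatFunc k) f) ≤ 1) :
    ∃ a, f = Polynomial.C a := by
  rcases eq_or_ne f 0 with rfl | h0
  · exact ⟨0, by simp⟩
  rw [inftyValuation_algebraMap h0, ← exp_zero, exp_le_exp] at hf
  exact ⟨_, Polynomial.eq_C_of_natDegree_eq_zero (by omega)⟩

theorem inftyValuation_X_mul_le {r : RatFunc k} (hr : v r < 1) : v (RatFunc.X * r) ≤ 1 := by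
  rcases eq_or_ne r 0 with rfl | h0
  · simp
  rw [map_mul, inftyValuation.X]
  rw [inftyValuation_apply, inftyValuation_of_nonzero _ h0] at hr ⊢
  rw [← exp_zero, exp_lt_exp] at hr
  rw [← exp_add, ← exp_zero, exp_le_exp]
  omega

theorem exists_inftyValuation_pow_mul_le (r : RatFunc k) : ∃ n : ℕ, v (RatFunc.X⁻¹ ^ n * r) ≤ 1 := by
  rcases eq_or_ne r 0 with rfl | h0
  · exact ⟨0, by simp⟩
  refine ⟨r.intDegree.toNat, ?_⟩
  rw [map_mul, map_pow, map_inv₀, inftyValuation.X, inftyValuation_apply,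
    inftyValuation_of_nonzero _ h0, ← exp_neg, ← exp_nsmul, ← exp_add, ← exp_zero, exp_le_exp]
  simp

theorem inftyValuation_C_le (a : k) : v (RatFunc.C a) ≤ 1 := by
  rcases eq_or_ne a 0 with rfl | h0
  · simp
  · rw [inftyValuation.C k h0]

theorem exists_eq_C_add_mul (r : RatFunc k) (hr : v r ≤ 1) :
    ∃ a, ∃ s, v s ≤ 1 ∧ r = RatFunc.C a + RatFunc.X⁻¹ * s := by
  obtain ⟨f, hf⟩ := exists_inftyValuation_sub_lt r
  obtain ⟨a, rfl⟩ := exists_eq_C_of_inftyValuation_le (f := f) (by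
    have := (v).map_sub_le hr hf.le
    rwa [sub_sub_cancel] at this)
  refine ⟨a, _, inftyValuation_X_mul_le hf, ?_⟩
  rw [← mul_assoc, inv_mul_cancel₀ RatFunc.X_ne_zero, one_mul, algebraMap_C, add_sub_cancel]

end

end RatFunc

namespace FunctionField

open Polynomial

open Classical in
/-- The valuation ring of the infinite place of the rational function field. -/
noncomputable abbrev inftyInteger (k : Type*) [Field k] : Subring (RatFunc k) :=
  (RatFunc.inftyValuation k).integer

variable (k : Type*) [Field k]

instance : IsDiscreteValuationRing (inftyInteger k) := by
  classical
  exact inferInstanceAs (IsDiscreteValuationRing (RatFunc.inftyValuation k).valuationSubring)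

/-- The inverse of the variable, a uniformizer at the infinite place. -/
noncomputable def inftyUniformizer : inftyInteger k := ⟨RatFunc.X⁻¹, by
  classical
  rw [Valuation.mem_integer_iff, map_inv₀, RatFunc.inftyValuation.X, ← WithZero.exp_neg,
    ← WithZero.exp_zero, WithZero.exp_le_exp]
  omega⟩

variable {k} in
theorem C_mem_inftyInteger (a : k) : RatFunc.C a ∈ inftyInteger k := by
  classical exact RatFunc.inftyValuation_C_le a

variable (F : Type*) [Field F] [Algebra (RatFunc k) F] [FunctionField k F]

/-- The functions regular at the infinite places. -/
noncomputable abbrev inftyIntegers : Subalgebra (inftyInteger k) F :=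
  integralClosure (inftyInteger k) F

instance [Algebra.IsSeparable (RatFunc k) F] : IsDedekindDomain (inftyIntegers k F) :=
  integralClosure.isDedekindDomain (inftyInteger k) (RatFunc k) F

instance [Algebra.IsSeparable (RatFunc k) F] :
    Module.Finite (inftyInteger k) (inftyIntegers k F) :=
  IsIntegralClosure.finite (inftyInteger k) (RatFunc k) F (inftyIntegers k F)

variable {k F} in
theorem algebraMap_mem {r : RatFunc k} (hr : r ∈ inftyInteger k) :
    algebraMap (RatFunc k) F r ∈ inftyIntegers k F :=
  (inftyIntegers k F).algebraMap_mem ⟨r, hr⟩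

theorem algebraMap_inv_X_mem : algebraMap (RatFunc k) F RatFunc.X⁻¹ ∈ inftyIntegers k F :=
  algebraMap_mem (inftyUniformizer k).2

theorem exists_pow_mul_mem (z : F) :
    ∃ n : ℕ, algebraMap (RatFunc k) F RatFunc.X⁻¹ ^ n * z ∈ inftyIntegers k F := by
  classical
  obtain ⟨y, hy0, hy⟩ := exists_integral_multiples (inftyInteger k) (RatFunc k) {z}
  have hy0' : (y : RatFunc k) ≠ 0 := fun h => hy0 (Subtype.ext h)
  obtain ⟨n, hn⟩ := RatFunc.exists_inftyValuation_pow_mul_le (y : RatFunc k)⁻¹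
  refine ⟨n, ?_⟩
  have := mul_mem (algebraMap_mem (F := F) hn) (hy z (by simp))
  convert this using 1
  rw [Subring.smul_def, Algebra.smul_def]
  have hy1 : algebraMap (RatFunc k) F y ≠ 0 := by simpa using hy0'
  rw [map_mul, map_pow, map_inv₀ _ (y : RatFunc k)]
  field_simp

theorem not_isUnit_inv_X : ¬ IsUnit (⟨_, algebraMap_inv_X_mem k F⟩ : inftyIntegers k F) := by
  classical
  rintro h
  obtain ⟨y, hy⟩ := h.exists_right_inv
  have h1 : algebraMap (RatFunc k) F RatFunc.X⁻¹ * y = 1 := congrArg Subtype.val hy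
  have h2 : (y : F) = algebraMap (RatFunc k) F RatFunc.X := by
    rw [map_inv₀, inv_mul_eq_one₀ (by simp [RatFunc.X_ne_zero])] at h1
    exact h1.symm
  have h3 : IsIntegral (inftyInteger k) (algebraMap (RatFunc k) F RatFunc.X) := h2 ▸ y.2
  rw [isIntegral_algebraMap_iff (algebraMap (RatFunc k) F).injective] at h3
  obtain ⟨z, hz⟩ := IsIntegrallyClosed.isIntegral_iff.1 h3
  have h4 : RatFunc.inftyValuation k RatFunc.X ≤ 1 := hz ▸ z.2
  rw [RatFunc.inftyValuation.X, ← WithZero.exp_zero, WithZero.exp_le_exp] at h4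
  omega

theorem finite_quotient_inv_X [Finite k] [Algebra.IsSeparable (RatFunc k) F] :
    Finite (inftyIntegers k F ⧸
      Ideal.span {(⟨_, algebraMap_inv_X_mem k F⟩ : inftyIntegers k F)}) := by
  classical
  obtain ⟨n, f, hf⟩ := Module.Finite.exists_fin' (inftyInteger k) (inftyIntegers k F)
  refine Finite.of_surjective (fun a : Fin n → k => Ideal.Quotient.mk _
    (f fun i => ⟨RatFunc.C (a i), C_mem_inftyInteger _⟩)) fun y => ?_
  obtain ⟨y, rfl⟩ := Ideal.Quotient.mk_surjective y
  obtain ⟨w, rfl⟩ := hf y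
  choose a s hs ha using fun i => RatFunc.exists_eq_C_add_mul (w i : RatFunc k) (w i).2
  refine ⟨a, Eq.symm ?_⟩
  rw [Ideal.Quotient.mk_eq_mk_iff_sub_mem, ← map_sub, Ideal.mem_span_singleton']
  refine ⟨f fun i => ⟨s i, hs i⟩, ?_⟩
  have : (w - fun i => ⟨RatFunc.C (a i), C_mem_inftyInteger _⟩) =
      inftyUniformizer k • fun i => ⟨s i, hs i⟩ := by
    funext i
    apply Subtype.ext
    change (w i : RatFunc k) - RatFunc.C (a i) = RatFunc.X⁻¹ * s i
    rw [ha i, add_sub_cancel_left]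
  rw [this, map_smul, Algebra.smul_def, mul_comm]
  rfl

variable [Algebra k[X] F] [IsScalarTower k[X] (RatFunc k) F]

theorem exists_pow_mul_sub_mem : ∃ c : ℕ, ∀ z : F, ∃ b ∈ ringOfIntegers k F,
    algebraMap (RatFunc k) F RatFunc.X⁻¹ ^ c * (z - b) ∈ inftyIntegers k F := by
  classical
  obtain ⟨s, b, hb⟩ := FiniteDimensional.exists_is_basis_integral k[X] (RatFunc k) F
  choose n hn using fun i => exists_pow_mul_mem k F (b i)
  refine ⟨∑ i, n i, fun z => ?_⟩
  choose f hf using fun i => RatFunc.exists_inftyValuation_sub_lt (b.repr z i)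
  refine ⟨∑ i, f i • b i, sum_mem fun i _ => Subalgebra.smul_mem _ (hb i) _, ?_⟩
  have : z - ∑ i, f i • b i =
      ∑ i, algebraMap (RatFunc k) F (b.repr z i - algebraMap k[X] (RatFunc k) (f i)) * b i := by
    conv_lhs => rw [← b.sum_repr z]
    rw [← Finset.sum_sub_distrib]
    refine Finset.sum_congr rfl fun i _ => ?_
    rw [map_sub, sub_mul, Algebra.smul_def, Algebra.smul_def, ← IsScalarTower.algebraMap_apply]
  rw [this, Finset.mul_sum]
  refine sum_mem fun i hi => ?_
  obtain ⟨l, hl⟩ := Nat.exists_eq_add_of_le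
    (Finset.single_le_sum (f := n) (fun _ _ => Nat.zero_le _) hi)
  have h1 := algebraMap_mem (F := F) (hf i).le
  have := mul_mem (mul_mem h1 (pow_mem (algebraMap_inv_X_mem k F) l)) (hn i)
  convert this using 1
  rw [hl, pow_add]
  ring

end FunctionField

namespace FunctionField

open Polynomial

variable (k F : Type*) [Field k] [Field F] [Algebra (RatFunc k) F] [FunctionField k F]
  [Algebra k[X] F] [IsScalarTower k[X] (RatFunc k) F]

/-- The functions without poles are the constants. -/
theorem isIntegral_constants_iff [Algebra k F] [IsScalarTower k k[X] F] (z : F) :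
    IsIntegral k z ↔ z ∈ ringOfIntegers k F ∧ z ∈ inftyIntegers k F := by
  classical
  have hC : ∀ a : k, algebraMap (RatFunc k) F (RatFunc.C a) = algebraMap k F a := fun a => by
    rw [← RatFunc.algebraMap_C, ← IsScalarTower.algebraMap_apply, IsScalarTower.algebraMap_apply k k[X] F]
    rfl
  refine ⟨fun h => ⟨h.tower_top, h.map_of_comp_eq
    (RatFunc.C.codRestrict (inftyInteger k) C_mem_inftyInteger) (RingHom.id F) ?_⟩, fun ⟨h1, h2⟩ => ?_⟩
  · ext a
    exact hC a
  have e1 := minpoly.isIntegrallyClosed_eq_field_fractions' (RatFunc k) h1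
  have e2 := minpoly.isIntegrallyClosed_eq_field_fractions' (RatFunc k) h2
  have hl : minpoly (RatFunc k) z ∈ lifts (RatFunc.C : k →+* RatFunc k) := by
    rw [lifts_iff_coeff_lifts]
    intro i
    have hi : RatFunc.inftyValuation k ((minpoly (RatFunc k) z).coeff i) ≤ 1 := by
      rw [e2, coeff_map]
      exact ((minpoly (inftyInteger k) z).coeff i).2
    rw [e1, coeff_map] at hi ⊢
    obtain ⟨a, ha⟩ := RatFunc.exists_eq_C_of_inftyValuation_le hi
    rw [ha]
    exact ⟨a, (RatFunc.algebraMap_C a).symm⟩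
  have hz : IsIntegral (RatFunc k) z := Algebra.IsIntegral.isIntegral z
  obtain ⟨p, hp, -, hpm⟩ := lifts_and_natDegree_eq_and_monic hl (minpoly.monic hz)
  refine ⟨p, hpm, ?_⟩
  have h3 := minpoly.aeval (RatFunc k) z
  rw [← hp, aeval_def, eval₂_map] at h3
  rw [← h3]
  congr 1
  ext a
  exact (hC a).symm

theorem exists_chart [Finite k] [Algebra.IsSeparable (RatFunc k) F] :
    ∃ X : Chart F, ∀ z, z ∈ X.O ↔ ∃ a : ringOfIntegers k F, algebraMap (ringOfIntegers k F) F a = z := by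
  let _ : Algebra k F := ((algebraMap k[X] F).comp C).toAlgebra
  have : IsScalarTower k k[X] F := .of_algebraMap_eq fun _ => rfl
  obtain ⟨c, hc⟩ := exists_pow_mul_sub_mem k F
  have : IsDedekindDomain (inftyIntegers k F).toSubring := inferInstanceAs
    (IsDedekindDomain (inftyIntegers k F))
  obtain ⟨X, hX⟩ := Chart.exists_of_isDedekindDomain (ringOfIntegers k F).toSubring
    (inftyIntegers k F).toSubring
    { (integralClosure k F).toSubring with inv_mem' := fun _ h => IsIntegral.inv h }
    (isIntegral_constants_iff k F) ⟨_, algebraMap_inv_X_mem k F⟩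
    (fun h => by
      have h1 : algebraMap (RatFunc k) F RatFunc.X⁻¹ = 0 := congrArg Subtype.val h
      simp [RatFunc.X_ne_zero] at h1)
    (not_isUnit_inv_X k F) (finite_quotient_inv_X k F) (exists_pow_mul_mem k F) c hc
    (fun z hz => isIntegral_trans (R := k[X]) (A := ringOfIntegers k F) z hz)
    (fun z hz => isIntegral_trans (R := inftyInteger k) (A := inftyIntegers k F) z hz)
    (fun z => by
      obtain ⟨u, w, hw, h⟩ := IsFractionRing.div_surjective (ringOfIntegers k F) z
      have hw0 : (w : F) ≠ 0 := fun h => nonZeroDivisors.ne_zero hw (Subtype.ext h)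
      exact ⟨u, u.2, w, w.2, hw0, by rw [← h]; exact div_mul_cancel₀ _ hw0⟩)
  refine ⟨X, fun z => ?_⟩
  rw [hX]
  exact ⟨fun h => ⟨⟨z, h⟩, rfl⟩, by rintro ⟨a, rfl⟩; exact a.2⟩

end FunctionField

open IsDedekindDomain

namespace IsLocalization.Away

variable {R A : Type*} [CommRing R] [IsDedekindDomain R] [CommRing A] [Algebra R A]
  (d : R) [IsLocalization.Away d A]

include d in
theorem under_ne_bot {Q : Ideal A} (hQ : Q ≠ ⊥) : Q.under R ≠ ⊥ := fun h => hQ (by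
  rw [← map_under (Submonoid.powers d) A Q, h, Ideal.map_bot])

theorem notMem_under (Q : Ideal A) [hQ : Q.IsPrime] : d ∉ Q.under R := fun h =>
  hQ.ne_top (Ideal.eq_top_of_isUnit_mem _ h (algebraMap_isUnit d))

include d in
theorem natCard_quotient_under {Q : Ideal A} [hQ : Q.IsPrime] (hQ0 : Q ≠ ⊥) :
    Nat.card (R ⧸ Q.under R) = Nat.card (A ⧸ Q) := by
  have h0 := under_ne_bot d hQ0
  exact Nat.card_congr (Equiv.ofBijective _
    ⟨Ideal.quotientMap_injective, surjective_quotientMap_of_maximal_of_localization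
      (Submonoid.powers d) _ (H := le_rfl) ((Ideal.IsPrime.under R Q).isMaximal h0)⟩)

theorem exists_primes {T S : Set (HeightOneSpectrum R)}
    (hT : ∀ p : HeightOneSpectrum R, d ∈ p.asIdeal ↔ p ∈ T) {n : ℕ}
    (hS : ∀ p, p ∈ S ↔ Nat.card (R ⧸ p.asIdeal) = n) :
    ∃ P : ↥(S \ T) → Ideal A, (∀ i, (P i).IsPrime) ∧ (∀ i, P i ≠ ⊥) ∧ Function.Injective P ∧
      (∀ i, Nat.card (A ⧸ P i) = n) ∧
      ∀ Q : Ideal A, Q.IsPrime → Q ≠ ⊥ → Nat.card (A ⧸ Q) = n → ∃ i, P i = Q := by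
  have hdisj (i : ↥(S \ T)) : Disjoint (Submonoid.powers d : Set R) i.1.asIdeal := by
    rw [Set.disjoint_left]
    rintro _ ⟨m, rfl⟩ hm
    exact i.2.2 ((hT _).1 (i.1.isPrime.mem_of_pow_mem m hm))
  have hunder (i : ↥(S \ T)) : (i.1.asIdeal.map (algebraMap R A)).under R = i.1.asIdeal :=
    under_map_of_isPrime_disjoint (Submonoid.powers d) A i.1.isPrime (hdisj i)
  have hprime (i : ↥(S \ T)) : (i.1.asIdeal.map (algebraMap R A)).IsPrime :=
    isPrime_of_isPrime_disjoint (Submonoid.powers d) A _ i.1.isPrime (hdisj i)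
  have hbot (i : ↥(S \ T)) : i.1.asIdeal.map (algebraMap R A) ≠ ⊥ := fun h => by
    obtain ⟨x, hx, hx0⟩ := Submodule.exists_mem_ne_zero_of_ne_bot i.1.ne_bot
    have hx' : algebraMap R A x = 0 := by
      simpa [h] using Ideal.mem_map_of_mem (algebraMap R A) hx
    obtain ⟨⟨_, m, rfl⟩, hm⟩ := (IsLocalization.map_eq_zero_iff (Submonoid.powers d) A x).1 hx'
    rcases mul_eq_zero.1 hm with h | h
    · exact Set.disjoint_left.1 (hdisj i) ⟨m, rfl⟩ 
        (h.symm ▸ zero_mem i.1.asIdeal : ((⟨_, m, rfl⟩ : Submonoid.powers d) : R) ∈ i.1.asIdeal)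
    · exact hx0 h
  refine ⟨fun i => i.1.asIdeal.map (algebraMap R A), hprime, hbot, fun i j h => ?_, fun i => ?_,
    fun Q hQ hQ0 hn => ?_⟩
  · refine Subtype.ext (HeightOneSpectrum.ext ?_)
    rw [← hunder i, ← hunder j]
    exact congrArg (Ideal.under R) h
  · have := hprime i
    rw [← natCard_quotient_under d (hbot i), hunder]
    exact (hS _).1 i.2.1
  · refine ⟨⟨⟨Q.under R, .under R Q, under_ne_bot d hQ0⟩, (hS _).2 ?_, fun h => ?_⟩,
      map_under (Submonoid.powers d) A Q⟩
    · rw [natCard_quotient_under d hQ0, hn]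
    · exact notMem_under d Q ((hT _).2 h)

end IsLocalization.Away

theorem Chart.exists_unit {F : Type*} [Field F] (X : Chart F) [Finite X.K] (A : Subring F) [Infinite Aˣ] :
    ∃ v : Aˣ, ∀ n : ℕ, n ≠ 0 → v ^ n ≠ 1 := by
  by_contra! h
  have hK (v : Aˣ) : ((v : A) : F) ∈ X.K := by
    obtain ⟨n, hn, hv⟩ := h v
    have hv : ((v : A) : F) ^ n = 1 := by simpa using congrArg (fun w : Aˣ => ((w : A) : F)) hv
    rw [X.mem_K]
    constructor
    · exact X.integral_O _ (.of_pow (Nat.pos_of_ne_zero hn) (hv ▸ isIntegral_one))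
    · exact X.integral_C _ (.of_pow (Nat.pos_of_ne_zero hn) (hv ▸ isIntegral_one))
  have : Finite Aˣ := Finite.of_injective (fun v => (⟨_, hK v⟩ : X.K)) fun v w h =>
    Units.ext (Subtype.ext (by simpa using h))
  exact not_finite Aˣ

theorem exists_sub_mem_of_natCard_quotient {k R : Type*} [Field k] [Finite k] [CommRing R]
    (f : Polynomial k →+* R) {P : Ideal R} (hP : P ≠ ⊤) (h : Nat.card (R ⧸ P) = Nat.card k) :
    ∃ a : k, f (.X - .C a) ∈ P := by
  have := Ideal.Quotient.nontrivial_iff.2 hP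
  let g := ((Ideal.Quotient.mk P).comp f).comp Polynomial.C
  have : Finite (R ⧸ P) := Nat.finite_of_card_ne_zero (h ▸ Nat.card_pos.ne')
  obtain ⟨a, ha⟩ := (Nat.bijective_iff_injective_and_card g).2 ⟨g.injective, h.symm⟩ |>.2
    (Ideal.Quotient.mk P (f .X))
  refine ⟨a, ?_⟩
  rw [map_sub]
  exact Ideal.Quotient.eq.1 ha.symm

theorem natCard_le_natCard_quotient {k A : Type*} [Field k] [CommRing A] (f : k →+* A) {P : Ideal A}
    (hP : P ≠ ⊤) [Finite (A ⧸ P)] : Nat.card k ≤ Nat.card (A ⧸ P) := by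
  have := Ideal.Quotient.nontrivial_iff.2 hP
  exact Nat.card_le_card_of_injective _ ((Ideal.Quotient.mk P).comp f).injective

open IsDedekindDomain DirectSum Polynomial

theorem sl2_abelianization_of_S_integers_function_field
    (Fq F : Type) [Field Fq] [Fintype Fq] [Field F]
    [Algebra Fq[X] F] [Algebra (RatFunc Fq) F] [IsScalarTower Fq[X] (RatFunc Fq) F]
    [FunctionField Fq F] [Algebra.IsSeparable (RatFunc Fq) F]
    -- `T` is the set of finite places in `S`; since `S` contains all the infinite places,
    -- the ring of `S`-integers is exactly the ring of `T`-integers of the Dedekind domain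
    -- `O_F` (the integral closure of `Fq[t]` in `F`).
    (T : Finset (HeightOneSpectrum (FunctionField.ringOfIntegers Fq F)))
    (A : Subalgebra (FunctionField.ringOfIntegers Fq F) F)
    (hA : A = (T : Set (HeightOneSpectrum (FunctionField.ringOfIntegers Fq F))).integer F)
    (hU : Infinite (↥A)ˣ)
    (S₂'' S₃'' : Set (HeightOneSpectrum (FunctionField.ringOfIntegers Fq F)))
    (hS₂'' : S₂'' = {p | (∃ a : Fq,
        algebraMap Fq[X] (FunctionField.ringOfIntegers Fq F) (X - C a) ∈ p.asIdeal) ∧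
        Nat.card ((FunctionField.ringOfIntegers Fq F) ⧸ p.asIdeal) = 2})
    (hS₃'' : S₃'' = {p | (∃ a : Fq,
        algebraMap Fq[X] (FunctionField.ringOfIntegers Fq F) (X - C a) ∈ p.asIdeal) ∧
        Nat.card ((FunctionField.ringOfIntegers Fq F) ⧸ p.asIdeal) = 3}) :
    (Fintype.card Fq = 2 →
      Nonempty (Additive (Abelianization (Matrix.SpecialLinearGroup (Fin 2) ↥A)) ≃+
        ⨁ _p : ↥(S₂'' \ (T : Set (HeightOneSpectrum (FunctionField.ringOfIntegers Fq F)))),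
          (ZMod 2 × ZMod 2))) ∧
    (Fintype.card Fq = 3 →
      Nonempty (Additive (Abelianization (Matrix.SpecialLinearGroup (Fin 2) ↥A)) ≃+
        ⨁ _p : ↥(S₃'' \ (T : Set (HeightOneSpectrum (FunctionField.ringOfIntegers Fq F)))),
          ZMod 3)) ∧
    (4 ≤ Fintype.card Fq →
      ∀ x : Abelianization (Matrix.SpecialLinearGroup (Fin 2) ↥A), x = 1) := by
  obtain ⟨Y, hO⟩ := FunctionField.exists_chart Fq F
  obtain ⟨d, hd, hdT, hRA, hBA⟩ := Y.exists_away hO T A hA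
  have hd' : Y.toO hO d ≠ 0 := fun h => hd (Subtype.ext (by
    rw [← Y.algebraMap_toO hO d, h, map_zero]; rfl))
  have : IsDedekindDomain A := IsLocalization.isDedekindDomain _
    (powers_le_nonZeroDivisors_of_noZeroDivisors hd') A
  have : Infinite A.toSubringˣ := hU
  have hR : ArithRing A := by
    let _ := ((algebraMap _ A).comp (Y.toO hO)).toAlgebra
    exact Y.onePlace.arithRing hd A (Y.exists_unit A.toSubring)
  let f : Fq →+* A := (algebraMap (FunctionField.ringOfIntegers Fq F) A).comp
    ((algebraMap Fq[X] _).comp C)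
  have hS {n : ℕ} (h : Fintype.card Fq = n) (p : HeightOneSpectrum (FunctionField.ringOfIntegers Fq F))
      (hp : Nat.card ((FunctionField.ringOfIntegers Fq F) ⧸ p.asIdeal) = n) :=
    exists_sub_mem_of_natCard_quotient (algebraMap Fq[X] _) p.isPrime.ne_top
      (hp.trans (h.symm.trans Nat.card_eq_fintype_card.symm))
  have hcharP {p : ℕ} (hp : p.Prime) (h : Fintype.card Fq = p) : CharP A p := by
    have : Fact p.Prime := ⟨hp⟩
    have := charP_of_card_eq_prime h
    exact charP_of_injective_ringHom f.injective _
  refine ⟨fun h => ?_, fun h => ?_, fun h => ?_⟩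
  · have := hcharP Nat.prime_two h
    obtain ⟨P, hP, hP0, hinj, hcard, hall⟩ := IsLocalization.Away.exists_primes (A := A) _ hdT
      (S := S₂'') (n := 2) (fun p => by rw [hS₂'']; exact ⟨And.right, fun hp => ⟨hS h p hp, hp⟩⟩)
    exact SL2.nonempty_addEquiv_of_two hR hP hP0 hinj hcard hall
  · have := hcharP Nat.prime_three h
    obtain ⟨P, hP, hP0, hinj, hcard, hall⟩ := IsLocalization.Away.exists_primes (A := A) _ hdT
      (S := S₃'') (n := 3) (fun p => by rw [hS₃'']; exact ⟨And.right, fun hp => ⟨hS h p hp, hp⟩⟩)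
    exact SL2.nonempty_addEquiv_of_three hR hP hP0 hinj hcard hall
  · have : Fact (ringChar Fq).Prime := ⟨CharP.char_is_prime Fq _⟩
    have : CharP A (ringChar Fq) := charP_of_injective_ringHom f.injective _
    refine SL2.abelianization_eq_one_of_four_le hR (ringChar Fq) fun P hP hP0 => ?_
    have := hR.finite_quot P hP0
    rw [← Nat.card_eq_fintype_card] at h
    exact h.trans (natCard_le_natCard_quotient f hP.ne_top)
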